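/- Let $\mathscr{P}_1 = \{Y_1(Y_2-Y_3),\ Y_2(Y_1-Y_3),\ Y_1(Y_1-Y_2),\ Y_2(Y_1-Y_2)\}$. For $B \ge 3$, let $S(B)$ be the set of triples $(x_1, x_2, x_3) \in \mathbb{Z}^3$ such that: (a) $\gcd(x_1, x_2, x_3) = 1$; (b) $x_1 x_2 x_3 (x_1 - x_2)(x_1 - x_3)(x_2 - x_3) \ne 0$; (c) for every prime $p$, $v_p(x_3) \le \max\{v_p(x_1), v_p(x_2)\}$; (d) $\max_{P \in \mathscr{P}_1} |P(x_1, x_2, x_3)| \le B \cdot \gcd(x_1, x_2) \cdot \gcd(x_1 - x_2, x_1 - x_3)$. Then $\frac{1}{2}|S(B)| = c\, B (\log B)^4 + O\Big(\frac{B (\log B)^4}{\log \log B}\Big)$, where $c = \frac{17}{576} \cdot 2\operatorname{vol}\big\{(y_1, y_2) \in \mathbb{R}^2 : \max(|y_1 y_2|,\ |y_1(y_1 - y_2)|,\ |y_2(y_1 - y_2)|) \le 1\big\} \cdot \prod_{p} \Big(1 - \frac{1}{p}\Big)^4 \Big(1 + \frac{4}{p}\Big)$, the product running over all primes and being convergent.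 -/

import Mathlib

open MeasureTheory

/-- The leading constant `c = α(X) ω_{H,∞}(X) ∏_p ω_{H,p}(X)` for `K = ℚ` and `𝒫 = 𝒫₁`. -/
noncomputable def dP5Const : ℝ :=
  (17 / 576) *
    (2 * (volume {y : ℝ × ℝ |
      max |y.1 * y.2| (max |y.1 * (y.1 - y.2)| |y.2 * (y.1 - y.2)|) ≤ 1}).toReal) *
    ∏' p : Nat.Primes, (1 - 1 / ((p : ℕ) : ℝ)) ^ 4 * (1 + 4 / ((p : ℕ) : ℝ))

/-- The set `S(B)` of coprime integral triples off the lines, integral with respect to the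
boundary `A₁₂`, of log-anticanonical height at most `B` (height via `𝒫₁`). -/
def dP5Set (B : ℝ) : Set (ℤ × ℤ × ℤ) :=
  {x | Int.gcd x.1 (Int.gcd x.2.1 x.2.2) = 1 ∧
    x.1 * x.2.1 * x.2.2 * (x.1 - x.2.1) * (x.1 - x.2.2) * (x.2.1 - x.2.2) ≠ 0 ∧
    (∀ p : ℕ, p.Prime →
      padicValInt p x.2.2 ≤ max (padicValInt p x.1) (padicValInt p x.2.1)) ∧
    ((max |x.1 * (x.2.1 - x.2.2)|
        (max |x.2.1 * (x.1 - x.2.2)|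
          (max |x.1 * (x.1 - x.2.1)| |x.2.1 * (x.1 - x.2.1)|)) : ℤ) : ℝ) ≤
      B * (Int.gcd x.1 x.2.1 : ℝ) * (Int.gcd (x.1 - x.2.1) (x.1 - x.2.2) : ℝ)}

namespace DP5

/-- mean of a function on `ZMod W`. -/
noncomputable def mean (W : ℕ) [NeZero W] (G : ZMod W → ℝ) : ℝ := (∑ r, G r) / W

lemma sum_range_W (W : ℕ) [NeZero W] (G : ZMod W → ℝ) :
    ∑ n ∈ Finset.range W, G (n : ZMod W) = ∑ r, G r := by
  refine Finset.sum_bij (fun n _ => (n : ZMod W)) (by simp) ?_ ?_ (by simp)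
  · intro a ha b hb h
    rw [ZMod.natCast_eq_natCast_iff'] at h
    rwa [Nat.mod_eq_of_lt (Finset.mem_range.1 ha), Nat.mod_eq_of_lt (Finset.mem_range.1 hb)] at h
  · intro b _
    exact ⟨b.val, Finset.mem_range.2 (ZMod.val_lt b), by simp⟩

lemma mean_mem (W : ℕ) [NeZero W] (G : ZMod W → ℝ) (h0 : ∀ r, 0 ≤ G r) (h1 : ∀ r, G r ≤ 1) :
    0 ≤ mean W G ∧ mean W G ≤ 1 := by
  have hW : (0:ℝ) < W := by exact_mod_cast Nat.pos_of_ne_zero (NeZero.ne W)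
  unfold mean
  constructor
  · exact div_nonneg (Finset.sum_nonneg fun r _ => h0 r) hW.le
  · rw [div_le_one hW]
    calc ∑ r, G r ≤ ∑ r : ZMod W, (1:ℝ) := Finset.sum_le_sum fun r _ => h1 r
      _ = W := by simp [ZMod.card]

/-- partial sums of a periodic function, starting anywhere. -/
lemma abs_sum_range_sub_mean (W : ℕ) [NeZero W] (G : ZMod W → ℝ) (h0 : ∀ r, 0 ≤ G r)
    (h1 : ∀ r, G r ≤ 1) (N : ℕ) :
    |∑ n ∈ Finset.range N, G (n : ZMod W) - N * mean W G| ≤ W := by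
  have hW : (0:ℝ) < W := by exact_mod_cast Nat.pos_of_ne_zero (NeZero.ne W)
  induction N using Nat.strong_induction_on with
  | _ N ih =>
    rcases lt_or_ge N W with h | h
    · have hm := mean_mem W G h0 h1
      have ha : ∑ n ∈ Finset.range N, G (n : ZMod W) ≤ N := by
        calc _ ≤ ∑ n ∈ Finset.range N, (1:ℝ) := Finset.sum_le_sum fun r _ => h1 r
          _ = N := by simp
      have hb : 0 ≤ ∑ n ∈ Finset.range N, G (n : ZMod W) := Finset.sum_nonneg fun r _ => h0 r
      have hN : (N:ℝ) ≤ W := by exact_mod_cast h.le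
      have hN0 : (0:ℝ) ≤ N := by positivity
      rw [abs_le]; constructor <;> nlinarith
    · have h2 := ih (N - W) (by have := Nat.pos_of_ne_zero (NeZero.ne W); omega)
      obtain ⟨k, rfl⟩ := Nat.exists_eq_add_of_le h
      rw [Nat.add_sub_cancel_left] at h2
      rw [Finset.sum_range_add, sum_range_W]
      have : ∀ x ∈ Finset.range k, G ((W + x : ℕ) : ZMod W) = G (x : ZMod W) := by
        intro x _; simp
      rw [Finset.sum_congr rfl this]
      have e : (∑ r, G r) = W * mean W G := by unfold mean; field_simp
      rw [e]; push_cast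
      convert h2 using 2; ring

/-- shift version -/
lemma mean_shift (W : ℕ) [NeZero W] (G : ZMod W → ℝ) (c : ZMod W) :
    mean W (fun r => G (r + c)) = mean W G := by
  unfold mean
  rw [Fintype.sum_equiv (Equiv.addRight c) (fun r => G (r + c)) G (fun _ => rfl)]

/-- Abel summation against an antitone weight. -/
lemma abel_antitone (f δ : ℕ → ℝ) (K : ℝ) (N : ℕ)
    (hf : ∀ n, n + 1 < N → f (n+1) ≤ f n) (hf0 : ∀ n, n < N → 0 ≤ f n)
    (hδ : ∀ n, |∑ i ∈ Finset.range n, δ i| ≤ K) (hN : 0 < N) :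
    |∑ n ∈ Finset.range N, f n * δ n| ≤ K * f 0 := by
  have key : ∀ M, M < N → |∑ n ∈ Finset.range (M+1), f n * δ n
      - f M * ∑ i ∈ Finset.range (M+1), δ i| ≤ K * (f 0 - f M) := by
    intro M
    induction M with
    | zero => intro _; simp
    | succ M ih =>
      intro hM
      have h1 := ih (by omega)
      have h2 := hδ (M+1)
      have h3 := hf M hM
      rw [Finset.sum_range_succ _ (M+1), Finset.sum_range_succ δ (M+1)]
      set A := ∑ n ∈ Finset.range (M+1), f n * δ n
      set Δ := ∑ n ∈ Finset.range (M+1), δ n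
      have e : A + f (M+1) * δ (M+1) - f (M+1) * (Δ + δ (M+1))
        = (A - f M * Δ) + (f M - f (M+1)) * Δ := by ring
      rw [e]
      calc _ ≤ |A - f M * Δ| + |(f M - f (M+1)) * Δ| := abs_add_le _ _
        _ ≤ K * (f 0 - f M) + (f M - f (M+1)) * K := by
          gcongr
          rw [abs_mul, abs_of_nonneg (by linarith : 0 ≤ f M - f (M+1))]
          exact mul_le_mul_of_nonneg_left h2 (by linarith)
        _ = _ := by ring
  obtain ⟨M, rfl⟩ : ∃ M, N = M + 1 := ⟨N - 1, by omega⟩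
  have h1 := key M (by omega)
  have h2 := hδ (M+1)
  have h3 := hf0 M (by omega)
  have h4 : |f M * ∑ i ∈ Finset.range (M+1), δ i| ≤ f M * K := by
    rw [abs_mul, abs_of_nonneg h3]; exact mul_le_mul_of_nonneg_left h2 h3
  rw [abs_le] at *
  constructor <;> nlinarith

/-- periodic weight against antitone function -/
lemma periodic_antitone (W : ℕ) [NeZero W] (G : ZMod W → ℝ) (h0 : ∀ r, 0 ≤ G r)
    (h1 : ∀ r, G r ≤ 1) (f : ℕ → ℝ) (N : ℕ)
    (hf : ∀ n, 1 ≤ n → n + 1 ≤ N → f (n+1) ≤ f n) (hf0 : ∀ n, 1 ≤ n → n ≤ N → 0 ≤ f n)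
    (hN : 1 ≤ N) :
    |∑ n ∈ Finset.Icc 1 N, f n * G (n : ZMod W) - mean W G * ∑ n ∈ Finset.Icc 1 N, f n|
      ≤ W * f 1 := by
  have e : ∀ g : ℕ → ℝ, ∑ n ∈ Finset.Icc 1 N, g n = ∑ n ∈ Finset.range N, g (n+1) := by
    intro g
    rw [Finset.range_eq_Ico, Finset.sum_Ico_add' g 0 N 1]
    rfl
  rw [e, e, Finset.mul_sum, ← Finset.sum_sub_distrib]
  have := abel_antitone (fun n => f (n+1)) (fun n => G ((n:ZMod W) + 1) - mean W G) W N
    (fun n hn => hf (n+1) (by omega) (by omega)) (fun n hn => hf0 (n+1) (by omega) (by omega))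
    (fun n => by
      have h := abs_sum_range_sub_mean W (fun r => G (r+1)) (fun r => h0 _) (fun r => h1 _) n
      rw [mean_shift] at h
      rw [Finset.sum_sub_distrib]; simpa using h) hN
  convert this using 3
  push_cast; ring

end DP5

namespace DP5

lemma logpow_antitone (Z : ℝ) (k : ℕ) {x y : ℝ} (hx : 1 ≤ x) (hxy : x ≤ y) (hy : y ≤ Z) :
    (Real.log (Z / y)) ^ k / y ≤ (Real.log (Z / x)) ^ k / x := by
  have h1 : 0 < x := by linarith
  have h2 : 0 < y := by linarith
  have h3 : 0 ≤ Real.log (Z / y) := Real.log_nonneg (by rw [le_div_iff₀ h2]; linarith)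
  have h4 : Real.log (Z / y) ≤ Real.log (Z / x) := by
    apply Real.log_le_log
    · apply div_pos <;> linarith
    · gcongr; linarith
  have h5 : 0 ≤ Real.log (Z / x) ^ k := pow_nonneg (h3.trans h4) k
  gcongr

lemma logpow_integral (Z : ℝ) (k : ℕ) (N : ℕ) (hN : 1 ≤ N) (hZ : (N:ℝ) ≤ Z) :
    ∫ x in (1:ℝ)..N, (Real.log (Z / x)) ^ k / x =
      (Real.log Z) ^ (k+1) / (k+1) - (Real.log (Z / N)) ^ (k+1) / (k+1) := by
  have hN' : (1:ℝ) ≤ N := by exact_mod_cast hN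
  have hZ0 : 0 < Z := by linarith
  have := intervalIntegral.integral_eq_sub_of_hasDerivAt (a := (1:ℝ)) (b := N)
    (f := fun x => - ((Real.log (Z / x)) ^ (k+1) / (k+1))) (f' := fun x => (Real.log (Z / x)) ^ k / x)
    ?_ ?_
  · rw [this]; simp; ring
  · intro x hx
    rw [Set.uIcc_of_le hN'] at hx
    have hx0 : x ≠ 0 := by have := hx.1; intro h; linarith
    have h1 : HasDerivAt (fun x : ℝ => Z / x) (-Z / x^2) x := by
      have := (hasDerivAt_inv hx0).const_mul Z
      simpa [div_eq_mul_inv] using this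
    have h2 := ((h1.log (by positivity)).pow (k+1)).div_const ((k:ℝ)+1) |>.neg
    have h3 : (k:ℝ)+1 ≠ 0 := by positivity
    have h4 : Real.log (Z / x) ^ k / x = -(((k + 1 : ℕ) : ℝ) * Real.log (Z / x) ^ (k + 1 - 1) *
        (-Z / x ^ 2 / (Z / x)) / ((k:ℝ) + 1)) := by
      rw [Nat.add_sub_cancel]
      push_cast
      field_simp
    rw [h4]
    exact h2
  · apply ContinuousOn.intervalIntegrable
    rw [Set.uIcc_of_le hN']
    intro x hx
    have hx0 : x ≠ 0 := by have := hx.1; intro h; linarith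
    apply ContinuousAt.continuousWithinAt
    have : Z / x ≠ 0 := by positivity
    fun_prop (disch := assumption)

lemma sum_antitone_integral (f : ℝ → ℝ) (N : ℕ) (hN : 1 ≤ N) (hf : AntitoneOn f (Set.Icc 1 N))
    (hf0 : 0 ≤ f N) :
    ∫ x in (1:ℝ)..N, f x ≤ ∑ n ∈ Finset.Icc 1 N, f n ∧
    ∑ n ∈ Finset.Icc 1 N, f n ≤ f 1 + ∫ x in (1:ℝ)..N, f x := by
  have e1 : ∑ n ∈ Finset.Icc 1 N, f n = ∑ n ∈ Finset.Ico 1 N, f n + f N := by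
    rw [← Finset.sum_Ico_succ_top hN]; rfl
  have e2 : ∑ n ∈ Finset.Icc 1 N, f n = f 1 + ∑ n ∈ Finset.Ico 1 N, f ((n+1 : ℕ):ℝ) := by
    have : ∑ n ∈ Finset.Icc 1 N, f n = ∑ n ∈ Finset.Ico 1 (N+1), f n := rfl
    rw [this, Finset.sum_eq_sum_Ico_succ_bot (by omega)]
    rw [← Finset.sum_Ico_add' (fun n : ℕ => f n) 1 N 1]
    simp
  have h1 := AntitoneOn.integral_le_sum_Ico (f := f) hN (by simpa using hf)
  have h2 := AntitoneOn.sum_le_integral_Ico (f := f) hN (by simpa using hf)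
  simp only [Nat.cast_one] at h1 h2
  constructor
  · rw [e1]; linarith
  · rw [e2]; linarith

/-- log-power sums with periodic weights -/
lemma log_sum (W : ℕ) [NeZero W] (G : ZMod W → ℝ) (h0 : ∀ r, 0 ≤ G r) (h1 : ∀ r, G r ≤ 1)
    (k : ℕ) (Z : ℝ) (hZ : 1 ≤ Z) :
    |∑ c ∈ Finset.Icc 1 ⌊Z⌋₊, (Real.log (Z / c)) ^ k / c * G (c : ZMod W)
      - mean W G * ((Real.log Z) ^ (k+1) / (k+1))| ≤ 4 * W * (1 + Real.log Z) ^ k := by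
  have hW : (1:ℝ) ≤ W := by exact_mod_cast Nat.pos_of_ne_zero (NeZero.ne W)
  set N := ⌊Z⌋₊
  have hN : 1 ≤ N := by rw [Nat.le_floor_iff (by linarith)]; simpa using hZ
  have hNZ : (N:ℝ) ≤ Z := Nat.floor_le (by linarith)
  have hN1 : (1:ℝ) ≤ N := by exact_mod_cast hN
  have hl : 0 ≤ Real.log Z := Real.log_nonneg hZ
  have a := periodic_antitone W G h0 h1 (fun c => (Real.log (Z / c)) ^ k / c) N
    (fun n hn hn' => logpow_antitone Z k (by exact_mod_cast hn) (by simp)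
      (by refine le_trans ?_ hNZ; exact_mod_cast hn'))
    (fun n hn hn' => by
      have : (1:ℝ) ≤ n := by exact_mod_cast hn
      have h2 : (n:ℝ) ≤ N := by exact_mod_cast hn'
      have : 0 ≤ Real.log (Z / n) := Real.log_nonneg (by rw [le_div_iff₀ (by linarith)]; linarith)
      positivity) hN
  have hZN0 : 0 ≤ Real.log (Z / N) := Real.log_nonneg (by rw [le_div_iff₀ (by linarith)]; linarith)
  obtain ⟨b1, b2⟩ := sum_antitone_integral (fun c => (Real.log (Z / c)) ^ k / c) N hN
    (fun x hx y hy hxy => logpow_antitone Z k hx.1 hxy (hy.2.trans hNZ)) (by positivity)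
  rw [logpow_integral Z k N hN hNZ] at b1 b2
  have hZN1 : Real.log (Z / N) ≤ 1 := by
    have : Z / N ≤ 2 := by
      rw [div_le_iff₀ (by linarith)]
      have := Nat.lt_floor_add_one Z
      linarith
    have h2 := Real.log_le_sub_one_of_pos (x := Z / N) (by apply div_pos <;> linarith)
    linarith
  have hc : (Real.log (Z / N)) ^ (k+1) / (k+1) ≤ 1 := by
    rw [div_le_one (by positivity)]
    have := pow_le_one₀ (n := k+1) hZN0 hZN1
    have : (0:ℝ) ≤ k := by positivity
    linarith
  have hc0 : 0 ≤ (Real.log (Z / N)) ^ (k+1) / (k+1) := by positivity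
  have hm := mean_mem W G h0 h1
  simp only [Nat.cast_one, div_one] at a b2
  have hp : (Real.log Z) ^ k ≤ (1 + Real.log Z) ^ k := by gcongr; linarith
  have hp1 : 1 ≤ (1 + Real.log Z) ^ k := one_le_pow₀ (by linarith)
  have hp0 : 0 ≤ (Real.log Z) ^ k := by positivity
  set S := ∑ n ∈ Finset.Icc 1 N, (Real.log (Z / n)) ^ k / n
  set I := (Real.log Z) ^ (k+1) / (k+1)
  set P := (1 + Real.log Z) ^ k
  set p := (Real.log Z) ^ k
  have h3 : |mean W G * S - mean W G * I| ≤ P + 1 := by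
    rw [← mul_sub, abs_mul, abs_of_nonneg hm.1]
    have : |S - I| ≤ P + 1 := by rw [abs_le]; constructor <;> linarith
    nlinarith [abs_nonneg (S - I)]
  have h4 : P + 1 + W * p ≤ 4 * W * P := by nlinarith
  rw [abs_le] at *
  constructor <;> linarith

/-- harmonic sums -/
lemma harm_le (N : ℕ) : ∑ c ∈ Finset.Icc 1 N, (1:ℝ) / c ≤ 1 + Real.log N := by
  have := harmonic_le_one_add_log N
  rw [harmonic_eq_sum_Icc] at this
  push_cast at this
  simpa using this

lemma harm_window (A B : ℝ) (hA : 0 < A) (hAB : A ≤ B) (s : Finset ℕ)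
    (hs : ∀ c ∈ s, 1 ≤ c ∧ A ≤ c ∧ (c:ℝ) ≤ B) :
    ∑ c ∈ s, (1:ℝ) / c ≤ 2 + Real.log (B / A) := by
  by_cases hB : B < 1
  · have : s = ∅ := by
      rw [Finset.eq_empty_iff_forall_notMem]
      intro c hc
      obtain ⟨h1, h2, h3⟩ := hs c hc
      have : (1:ℝ) ≤ c := by exact_mod_cast h1
      linarith
    rw [this]; simp
    have := Real.log_nonneg (x := B / A) (by rw [le_div_iff₀ hA]; linarith)
    linarith
  push Not at hB
  set n := max 1 ⌈A⌉₊
  have hn1 : 1 ≤ n := le_max_left _ _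
  by_cases hnN : n ≤ ⌊B⌋₊
  swap
  · have : s = ∅ := by
      rw [Finset.eq_empty_iff_forall_notMem]
      intro c hc
      obtain ⟨h1, h2, h3⟩ := hs c hc
      apply hnN
      calc n ≤ c := max_le h1 (Nat.ceil_le.2 h2)
        _ ≤ _ := Nat.le_floor h3
    rw [this]; simp
    have := Real.log_nonneg (x := B / A) (by rw [le_div_iff₀ hA]; linarith)
    linarith
  have hsub : s ⊆ Finset.Icc n ⌊B⌋₊ := by
    intro c hc
    obtain ⟨h1, h2, h3⟩ := hs c hc
    exact Finset.mem_Icc.2 ⟨max_le h1 (Nat.ceil_le.2 h2), Nat.le_floor h3⟩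
  have hn0 : (1:ℝ) ≤ n := by exact_mod_cast hn1
  have hAn : A ≤ n := (Nat.le_ceil A).trans (by exact_mod_cast le_max_right _ _)
  calc ∑ c ∈ s, (1:ℝ) / c ≤ ∑ c ∈ Finset.Icc n ⌊B⌋₊, (1:ℝ) / c :=
        Finset.sum_le_sum_of_subset_of_nonneg hsub (fun _ _ _ => by positivity)
    _ = 1 / n + ∑ c ∈ Finset.Ico n ⌊B⌋₊, (1:ℝ) / ((c+1 : ℕ):ℝ) := by
        have : ∑ c ∈ Finset.Icc n ⌊B⌋₊, (1:ℝ) / c = ∑ c ∈ Finset.Ico n (⌊B⌋₊+1), (1:ℝ) / c := rfl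
        rw [this, Finset.sum_eq_sum_Ico_succ_bot (by omega)]
        rw [← Finset.sum_Ico_add' (fun n : ℕ => (1:ℝ) / n) n ⌊B⌋₊ 1]
    _ ≤ 1 / n + ∫ x in (n:ℝ)..(⌊B⌋₊:ℝ), 1 / x := by
        gcongr
        apply AntitoneOn.sum_le_integral_Ico (f := fun x : ℝ => 1 / x) hnN
        intro x hx y hy hxy
        have := hx.1
        simp only
        gcongr
        linarith
    _ = 1 / n + Real.log (⌊B⌋₊ / n) := by
        rw [integral_one_div_of_pos (by linarith)]
        have : (n:ℝ) ≤ ⌊B⌋₊ := by exact_mod_cast hnN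
        linarith
    _ ≤ 2 + Real.log (B / A) := by
        have h1 : (1:ℝ) / n ≤ 1 := by rw [div_le_one (by linarith)]; exact hn0
        have h2 : Real.log (⌊B⌋₊ / n) ≤ Real.log (B / A) := by
          apply Real.log_le_log
          · have : (n:ℝ) ≤ ⌊B⌋₊ := by exact_mod_cast hnN
            apply div_pos <;> linarith
          · have := Nat.floor_le (a := B) (by linarith)
            gcongr
        linarith

end DP5

namespace DP5

/-- primes up to `w` -/
def PS (w : ℕ) : Finset ℕ := (Finset.range (w+1)).filter Nat.Prime

lemma PS_prime {w : ℕ} (i : PS w) : (i:ℕ).Prime := (Finset.mem_filter.1 i.2).2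

instance {w : ℕ} (i : PS w) : Fact (i:ℕ).Prime := ⟨PS_prime i⟩
instance {w : ℕ} (i : PS w) : NeZero (i:ℕ) := ⟨(PS_prime i).ne_zero⟩

/-- the modulus -/
def WW (w : ℕ) : ℕ := ∏ i : PS w, (i:ℕ)

lemma WW_pos (w : ℕ) : 0 < WW w := Finset.prod_pos fun i _ => (PS_prime i).pos

instance (w : ℕ) : NeZero (WW w) := ⟨(WW_pos w).ne'⟩

lemma WW_le (w : ℕ) : WW w ≤ 4 ^ w := by
  have h : WW w = primorial w := by
    exact Finset.prod_coe_sort (PS w) (fun p => p)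
  rw [h]; exact primorial_le_four_pow w

/-- CRT isomorphism -/
noncomputable def crt (w : ℕ) : ZMod (WW w) ≃+* ((i : PS w) → ZMod (i:ℕ)) :=
  ZMod.prodEquivPi (fun i : PS w => (i:ℕ)) (by
    intro i j hij
    exact (Nat.coprime_primes (PS_prime i) (PS_prime j)).2 (fun h => hij (Subtype.ext h)))

lemma crt_nat (w n : ℕ) (i : PS w) : crt w (n : ZMod (WW w)) i = (n : ZMod (i:ℕ)) := by
  rw [map_natCast]; rfl

lemma crt_sum (w : ℕ) (f : (i : PS w) → ZMod (i:ℕ) → ℝ) :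
    ∑ x, ∏ i, f i (crt w x i) = ∏ i, ∑ y, f i y := by
  rw [Finset.prod_univ_sum]
  rw [Fintype.piFinset_univ]
  exact Fintype.sum_equiv (crt w).toEquiv _ _ (fun x => rfl)

noncomputable def wt (p : ℕ) (d : ZMod p) : ℝ := if d = 0 then 1 - 1 / (p:ℝ) else 1

def pick {α : Type} (s : Bool) (c a : α) : α := bif s then a else c

lemma wt_mem (p : ℕ) [Fact p.Prime] (d : ZMod p) : 0 ≤ wt p d ∧ wt p d ≤ 1 := by
  have hp : (2:ℝ) ≤ p := by exact_mod_cast (Fact.out : p.Prime).two_le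
  have h : (1:ℝ) / p ≤ 1 := by rw [div_le_one (by linarith)]; linarith
  have h' : (0:ℝ) ≤ 1 / p := by positivity
  unfold wt; split_ifs <;> constructor <;> linarith

noncomputable def loc (p : ℕ) (s : Bool × Bool × Bool) (c1 c2 c3 a1 a2 a3 : ZMod p) : ℝ :=
  if c1 * a1 = 0 ∧ c2 * a2 = 0 then 0
  else wt p (pick s.1 c1 a1) * wt p (pick s.2.1 c2 a2) * wt p (pick s.2.2 c3 a3)

lemma loc_mem (p : ℕ) [Fact p.Prime] (s : Bool × Bool × Bool) (c1 c2 c3 a1 a2 a3 : ZMod p) :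
    0 ≤ loc p s c1 c2 c3 a1 a2 a3 ∧ loc p s c1 c2 c3 a1 a2 a3 ≤ 1 := by
  unfold loc
  split_ifs
  · simp
  · have h1 := wt_mem p (pick s.1 c1 a1)
    have h2 := wt_mem p (pick s.2.1 c2 a2)
    have h3 := wt_mem p (pick s.2.2 c3 a3)
    constructor
    · exact mul_nonneg (mul_nonneg h1.1 h2.1) h3.1
    · exact mul_le_one₀ (mul_le_one₀ h1.2 h2.1 h2.2) h3.1 h3.2

noncomputable def Th (w : ℕ) (s : Bool × Bool × Bool) (c1 c2 c3 a1 a2 a3 : ZMod (WW w)) : ℝ :=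
  ∏ i : PS w, loc i s (crt w c1 i) (crt w c2 i) (crt w c3 i) (crt w a1 i) (crt w a2 i) (crt w a3 i)

lemma Th_mem (w : ℕ) (s : Bool × Bool × Bool) (c1 c2 c3 a1 a2 a3 : ZMod (WW w)) :
    0 ≤ Th w s c1 c2 c3 a1 a2 a3 ∧ Th w s c1 c2 c3 a1 a2 a3 ≤ 1 :=
  ⟨Finset.prod_nonneg fun _ _ => (loc_mem _ _ _ _ _ _ _ _).1,
   Finset.prod_le_one (fun _ _ => (loc_mem _ _ _ _ _ _ _ _).1)
    (fun _ _ => (loc_mem _ _ _ _ _ _ _ _).2)⟩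

/-- inner average -/
noncomputable def Gf (w : ℕ) (s : Bool × Bool × Bool) (c1 c2 c3 a1 : ZMod (WW w)) : ℝ :=
  (∑ a2, ∑ a3, if c3 * a3 = c1 * a1 + c2 * a2 then Th w s c1 c2 c3 a1 a2 a3 else 0) / WW w

noncomputable def gf (w : ℕ) (s : Bool × Bool × Bool) (c1 c2 c3 : ZMod (WW w)) : ℝ :=
  mean (WW w) (fun a1 => Gf w s c1 c2 c3 a1)

/-- parametrisation of the solutions of `c3 a3 = m + c2 a2`. -/
lemma param_sum {R : Type} [CommRing R] [Fintype R] [DecidableEq R] (c2 c3 u v m A2 A3 : R)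
    (huv : u * c2 + v * c3 = 1) (hA : c3 * A3 = m + c2 * A2) (f : R → R → ℝ) :
    ∑ a2, ∑ a3, (if c3 * a3 = m + c2 * a2 then f a2 a3 else 0)
      = ∑ t, f (A2 + c3 * t) (A3 + c2 * t) := by
  rw [← Finset.sum_product', ← Finset.sum_filter]
  symm
  refine Finset.sum_bij (fun t _ => (A2 + c3 * t, A3 + c2 * t)) ?_ ?_ ?_ ?_
  · intro t _
    simp only [Finset.mem_filter, Finset.mem_product, Finset.mem_univ, true_and]
    linear_combination hA
  · intro t _ t' _ h
    simp only [Prod.mk.injEq] at h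
    linear_combination (-t + t') * huv + v * h.1 + u * h.2
  · rintro ⟨a2, a3⟩ h
    simp only [Finset.mem_filter, Finset.mem_product, Finset.mem_univ, true_and] at h
    refine ⟨v * (a2 - A2) + u * (a3 - A3), Finset.mem_univ _, ?_⟩
    simp only [Prod.mk.injEq]
    constructor
    · linear_combination (a2 - A2) * huv + u * h - u * hA
    · linear_combination (a3 - A3) * huv - v * h + v * hA
  · intro _ _; rfl

lemma Gf_param (w : ℕ) (s : Bool × Bool × Bool) (c1 c2 c3 a1 u v A2 A3 : ZMod (WW w))
    (huv : u * c2 + v * c3 = 1) (hA : c3 * A3 = c1 * a1 + c2 * A2) :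
    Gf w s c1 c2 c3 a1 = mean (WW w) (fun t => Th w s c1 c2 c3 a1 (A2 + c3 * t) (A3 + c2 * t)) := by
  unfold Gf mean
  rw [param_sum c2 c3 u v (c1 * a1) A2 A3 huv hA]

lemma unimod_or (w : ℕ) (c2 c3 : ZMod (WW w)) :
    (∃ u v, u * c2 + v * c3 = 1) ∨ ∃ i : PS w, crt w c2 i = 0 ∧ crt w c3 i = 0 := by
  by_cases h : ∃ i : PS w, crt w c2 i = 0 ∧ crt w c3 i = 0
  · exact Or.inr h
  left
  push Not at h
  have : ∀ i : PS w, ∃ u v : ZMod (i:ℕ), u * crt w c2 i + v * crt w c3 i = 1 := by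
    intro i
    by_cases h2 : crt w c2 i = 0
    · exact ⟨0, (crt w c3 i)⁻¹, by rw [zero_mul, zero_add, inv_mul_cancel₀ (h i h2)]⟩
    · exact ⟨(crt w c2 i)⁻¹, 0, by rw [zero_mul, add_zero, inv_mul_cancel₀ h2]⟩
  choose u v huv using this
  refine ⟨(crt w).symm u, (crt w).symm v, ?_⟩
  apply (crt w).injective
  rw [map_add, map_mul, map_mul, map_one, RingEquiv.apply_symm_apply, RingEquiv.apply_symm_apply]
  funext i
  exact huv i

lemma Gf_mem (w : ℕ) (s : Bool × Bool × Bool) (c1 c2 c3 a1 : ZMod (WW w)) :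
    0 ≤ Gf w s c1 c2 c3 a1 ∧ Gf w s c1 c2 c3 a1 ≤ 1 := by
  rcases unimod_or w c2 c3 with ⟨u, v, huv⟩ | ⟨i, hi2, hi3⟩
  · rw [Gf_param w s c1 c2 c3 a1 u v (- u * (c1 * a1)) (v * (c1 * a1)) huv
      (by linear_combination (c1 * a1) * huv)]
    exact mean_mem _ _ (fun r => (Th_mem w s _ _ _ _ _ _).1) (fun r => (Th_mem w s _ _ _ _ _ _).2)
  · have : Gf w s c1 c2 c3 a1 = 0 := by
      unfold Gf
      rw [div_eq_zero_iff]; left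
      refine Finset.sum_eq_zero fun a2 _ => Finset.sum_eq_zero fun a3 _ => ?_
      split_ifs with h
      · unfold Th
        refine Finset.prod_eq_zero (Finset.mem_univ i) ?_
        unfold loc
        rw [if_pos]
        have h2 := congrArg (fun x => crt w x i) h
        simp only [map_mul, map_add, Pi.mul_apply, Pi.add_apply, hi2, hi3, zero_mul, add_zero] at h2
        exact ⟨h2.symm, by rw [hi2, zero_mul]⟩
      · rfl
    rw [this]; simp

lemma gf_mem (w : ℕ) (s : Bool × Bool × Bool) (c1 c2 c3 : ZMod (WW w)) :
    0 ≤ gf w s c1 c2 c3 ∧ gf w s c1 c2 c3 ≤ 1 :=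
  mean_mem _ _ (fun r => (Gf_mem w s _ _ _ _).1) (fun r => (Gf_mem w s _ _ _ _).2)

/-- if some small prime divides `c2` and `c3` the density vanishes -/
lemma gf_zero (w : ℕ) (s : Bool × Bool × Bool) (c1 c2 c3 : ℕ) (p : ℕ) (hp : p.Prime) (hpw : p ≤ w)
    (h2 : p ∣ c2) (h3 : p ∣ c3) : gf w s c1 c2 c3 = 0 := by
  have hi : p ∈ PS w := by simp [PS]; exact ⟨by omega, hp⟩
  have h0 : ∀ a1, Gf w s c1 c2 c3 a1 = 0 := by
    intro a1
    unfold Gf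
    rw [div_eq_zero_iff]; left
    refine Finset.sum_eq_zero fun a2 _ => Finset.sum_eq_zero fun a3 _ => ?_
    split_ifs with h
    · unfold Th
      refine Finset.prod_eq_zero (Finset.mem_univ ⟨p, hi⟩) ?_
      have hi2 : crt w (c2 : ZMod (WW w)) ⟨p, hi⟩ = 0 := by
        rw [crt_nat]; exact (ZMod.natCast_eq_zero_iff _ _).2 h2
      have hi3 : crt w (c3 : ZMod (WW w)) ⟨p, hi⟩ = 0 := by
        rw [crt_nat]; exact (ZMod.natCast_eq_zero_iff _ _).2 h3
      unfold loc
      rw [if_pos]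
      have h2 := congrArg (fun x => crt w x ⟨p, hi⟩) h
      simp only [map_mul, map_add, Pi.mul_apply, Pi.add_apply, hi2, hi3, zero_mul, add_zero] at h2
      exact ⟨h2.symm, by rw [hi2, zero_mul]⟩
    · rfl
  unfold gf mean
  simp [h0]

/-! local count -/

lemma loc_L (p : ℕ) [Fact p.Prime] (s : Bool) (h : ZMod p → ℝ) :
    ∑ c, ∑ a, h (c * a) * wt p (pick s c a) = ((p:ℝ) - 1) * (∑ x, h x + h 0) := by
  have key : ∑ c, ∑ a, h (c * a) * wt p c = ((p:ℝ) - 1) * (∑ x, h x + h 0) := by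
    have hp0 : (p:ℝ) ≠ 0 := by exact_mod_cast (Fact.out : p.Prime).ne_zero
    rw [← Finset.add_sum_erase _ _ (Finset.mem_univ (0 : ZMod p))]
    have e1 : ∑ a : ZMod p, h (0 * a) * wt p 0 = ((p:ℝ) - 1) * h 0 := by
      simp only [zero_mul, Finset.sum_const, Finset.card_univ, ZMod.card, nsmul_eq_mul, wt, if_true]
      field_simp
    have e2 : ∀ c ∈ Finset.univ.erase (0 : ZMod p), ∑ a, h (c * a) * wt p c = ∑ x, h x := by
      intro c hc
      have hc0 : c ≠ 0 := Finset.ne_of_mem_erase hc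
      simp only [wt, if_neg hc0, mul_one]
      exact Fintype.sum_equiv (Equiv.mulLeft₀ c hc0) _ _ (fun x => rfl)
    rw [e1, Finset.sum_congr rfl e2, Finset.sum_const, Finset.card_erase_of_mem (Finset.mem_univ _),
      Finset.card_univ, ZMod.card, nsmul_eq_mul, Nat.cast_sub (Fact.out : p.Prime).one_lt.le]
    push_cast; ring
  cases s
  · exact key
  · rw [Finset.sum_comm]
    simp only [pick, cond_true]
    rw [← key]
    refine Finset.sum_congr rfl fun x _ => Finset.sum_congr rfl fun y _ => ?_
    rw [mul_comm y x]

lemma loc_count (p : ℕ) [Fact p.Prime] (s : Bool × Bool × Bool) :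
    ∑ c1, ∑ a1, ∑ c2, ∑ a2, ∑ c3, ∑ a3,
      (if c3 * a3 = c1 * a1 + c2 * a2 then loc p s c1 c2 c3 a1 a2 a3 else 0)
      = ((p:ℝ) - 1) ^ 4 * (p + 4) := by
  have st3 : ∀ c1 a1 c2 a2 : ZMod p, ∑ c3, ∑ a3,
      (if c3 * a3 = c1 * a1 + c2 * a2 then loc p s c1 c2 c3 a1 a2 a3 else 0)
      = (fun α => (fun β => if α = 0 ∧ β = 0 then (0:ℝ) else
          ((p:ℝ) - 1) * (1 + if α + β = 0 then 1 else 0)) (c2 * a2) * wt p (pick s.2.1 c2 a2))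
          (c1 * a1) * wt p (pick s.1 c1 a1) := by
    intro c1 a1 c2 a2
    simp only [loc]
    by_cases h : c1 * a1 = 0 ∧ c2 * a2 = 0
    · simp [h]
    · simp only [if_neg h]
      have := loc_L p s.2.2 (fun x => if x = c1 * a1 + c2 * a2 then
        wt p (pick s.1 c1 a1) * wt p (pick s.2.1 c2 a2) else 0)
      simp only [ite_mul, zero_mul] at this
      rw [this]
      rw [Finset.sum_ite_eq' Finset.univ]
      simp only [Finset.mem_univ, if_true]
      by_cases h2 : c1 * a1 + c2 * a2 = 0
      · simp [h2]; ring
      · have h3 : ¬ (0 = c1 * a1 + c2 * a2) := fun h => h2 h.symm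
        simp [h2, h3]; ring
  simp only [st3]
  have st2 : ∀ α : ZMod p, ∀ z : ℝ, ∑ c2, ∑ a2, ((if α = 0 ∧ c2 * a2 = 0 then (0:ℝ) else
          ((p:ℝ) - 1) * (1 + if α + c2 * a2 = 0 then 1 else 0)) * wt p (pick s.2.1 c2 a2)) * z
      = (((p:ℝ) - 1) ^ 2 * (if α = 0 then (p:ℝ) - 1 else p + 2)) * z := by
    intro α z
    simp only [← Finset.sum_mul]
    congr 1
    have := loc_L p s.2.1 (fun x => if α = 0 ∧ x = 0 then (0:ℝ) else
          ((p:ℝ) - 1) * (1 + if α + x = 0 then 1 else 0))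
    beta_reduce at this
    rw [this]
    by_cases h : α = 0
    · subst h
      have e : ∀ x : ZMod p, (if (0:ZMod p) = 0 ∧ x = 0 then (0:ℝ) else
          ((p:ℝ) - 1) * (1 + if 0 + x = 0 then 1 else 0)) = ((p:ℝ) - 1) * (1 - if x = 0 then 1 else 0) := by
        intro x; by_cases hx : x = 0 <;> simp [hx]
      rw [Finset.sum_congr rfl (fun x _ => e x), e 0, ← Finset.mul_sum, Finset.sum_sub_distrib]
      simp [ZMod.card]; ring
    · have e : ∀ x : ZMod p, (if α = 0 ∧ x = 0 then (0:ℝ) else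
          ((p:ℝ) - 1) * (1 + if α + x = 0 then 1 else 0)) = ((p:ℝ) - 1) * (1 + if x = -α then 1 else 0) := by
        intro x
        have : α + x = 0 ↔ x = -α := by rw [add_comm, add_eq_zero_iff_eq_neg]
        simp [h, this]
      have h' : (0 : ZMod p) ≠ -α := by intro h2; exact h (neg_eq_zero.1 h2.symm)
      rw [Finset.sum_congr rfl (fun x _ => e x), e 0, ← Finset.mul_sum, Finset.sum_add_distrib]
      rw [Finset.sum_ite_eq' Finset.univ]
      simp [ZMod.card, h, h']; ring
  simp only [st2]
  have := loc_L p s.1 (fun α => (((p:ℝ) - 1) ^ 2 * (if α = 0 then (p:ℝ) - 1 else p + 2)))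
  simp only at this
  rw [this]
  have e : ∀ x : ZMod p, (if x = 0 then (p:ℝ) - 1 else p + 2) = (p + 2) - 3 * (if x = 0 then 1 else 0) := by
    intro x; by_cases hx : x = 0 <;> simp [hx]; ring
  simp only [e, ← Finset.mul_sum, Finset.sum_sub_distrib]
  rw [Finset.sum_ite_eq' Finset.univ]
  simp [ZMod.card]; ring

noncomputable def kap (w : ℕ) : ℝ :=
  ∏ i : PS w, (1 - 1 / ((i:ℕ):ℝ)) ^ 4 * (1 + 4 / ((i:ℕ):ℝ))

lemma gf_mean (w : ℕ) (s : Bool × Bool × Bool) :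
    mean (WW w) (fun c1 => mean (WW w) (fun c2 => mean (WW w) (fun c3 => gf w s c1 c2 c3)))
      = kap w := by
  have hW : ((WW w : ℕ) : ℝ) ≠ 0 := by exact_mod_cast (WW_pos w).ne'
  have key : ∑ c1, ∑ a1, ∑ c2, ∑ a2, ∑ c3, ∑ a3,
      (if c3 * a3 = c1 * a1 + c2 * a2 then Th w s c1 c2 c3 a1 a2 a3 else 0)
      = ∏ i : PS w, (((i:ℕ):ℝ) - 1) ^ 4 * ((i:ℕ) + 4) := by
    have e0 : ∀ c1 a1 c2 a2 c3 a3 : ZMod (WW w),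
        (if c3 * a3 = c1 * a1 + c2 * a2 then Th w s c1 c2 c3 a1 a2 a3 else 0)
        = ∏ i : PS w, (if crt w c3 i * crt w a3 i = crt w c1 i * crt w a1 i + crt w c2 i * crt w a2 i
          then loc i s (crt w c1 i) (crt w c2 i) (crt w c3 i) (crt w a1 i) (crt w a2 i)
            (crt w a3 i) else 0) := by
      intro c1 a1 c2 a2 c3 a3
      by_cases h : c3 * a3 = c1 * a1 + c2 * a2
      · rw [if_pos h]
        unfold Th
        refine Finset.prod_congr rfl fun i _ => ?_
        rw [if_pos]
        have h2 := congrArg (fun x => crt w x i) h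
        simpa only [map_mul, map_add, Pi.mul_apply, Pi.add_apply] using h2
      · rw [if_neg h]
        have : ∃ i, crt w (c3 * a3) i ≠ crt w (c1 * a1 + c2 * a2) i := by
          by_contra hc
          push Not at hc
          exact h ((crt w).injective (funext hc))
        obtain ⟨i, hi⟩ := this
        symm
        refine Finset.prod_eq_zero (Finset.mem_univ i) ?_
        rw [if_neg]
        simpa only [map_mul, map_add, Pi.mul_apply, Pi.add_apply] using hi
    simp only [e0]
    simp only [fun (c1 a1 c2 a2 c3 : ZMod (WW w)) => crt_sum w (fun i y3 =>
      if crt w c3 i * y3 = crt w c1 i * crt w a1 i + crt w c2 i * crt w a2 i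
          then loc i s (crt w c1 i) (crt w c2 i) (crt w c3 i) (crt w a1 i) (crt w a2 i) y3 else 0)]
    simp only [fun (c1 a1 c2 a2 : ZMod (WW w)) => crt_sum w (fun i x3 => ∑ y3,
      if x3 * y3 = crt w c1 i * crt w a1 i + crt w c2 i * crt w a2 i
          then loc i s (crt w c1 i) (crt w c2 i) x3 (crt w a1 i) (crt w a2 i) y3 else 0)]
    simp only [fun (c1 a1 c2 : ZMod (WW w)) => crt_sum w (fun i y2 => ∑ x3, ∑ y3,
      if x3 * y3 = crt w c1 i * crt w a1 i + crt w c2 i * y2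
          then loc i s (crt w c1 i) (crt w c2 i) x3 (crt w a1 i) y2 y3 else 0)]
    simp only [fun (c1 a1 : ZMod (WW w)) => crt_sum w (fun i x2 => ∑ y2, ∑ x3, ∑ y3,
      if x3 * y3 = crt w c1 i * crt w a1 i + x2 * y2
          then loc i s (crt w c1 i) x2 x3 (crt w a1 i) y2 y3 else 0)]
    simp only [fun (c1 : ZMod (WW w)) => crt_sum w (fun i y1 => ∑ x2, ∑ y2, ∑ x3, ∑ y3,
      if x3 * y3 = crt w c1 i * y1 + x2 * y2
          then loc i s (crt w c1 i) x2 x3 y1 y2 y3 else 0)]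
    rw [crt_sum w (fun i x1 => ∑ y1, ∑ x2, ∑ y2, ∑ x3, ∑ y3,
      if x3 * y3 = x1 * y1 + x2 * y2 then loc i s x1 x2 x3 y1 y2 y3 else 0)]
    refine Finset.prod_congr rfl fun i _ => ?_
    exact loc_count i s
  have e1 : mean (WW w) (fun c1 => mean (WW w) (fun c2 => mean (WW w) (fun c3 => gf w s c1 c2 c3)))
      = (∑ c1, ∑ a1, ∑ c2, ∑ a2, ∑ c3, ∑ a3,
      (if c3 * a3 = c1 * a1 + c2 * a2 then Th w s c1 c2 c3 a1 a2 a3 else 0)) / (WW w : ℝ) ^ 5 := by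
    unfold gf mean Gf
    simp only [← Finset.sum_div]
    have num : ∑ c1, ∑ c2, ∑ c3, ∑ a1, ∑ a2, ∑ a3,
          (if c3 * a3 = c1 * a1 + c2 * a2 then Th w s c1 c2 c3 a1 a2 a3 else 0)
          = ∑ c1, ∑ a1, ∑ c2, ∑ a2, ∑ c3, ∑ a3,
          (if c3 * a3 = c1 * a1 + c2 * a2 then Th w s c1 c2 c3 a1 a2 a3 else 0) := by
      refine Finset.sum_congr rfl fun c1 _ => ?_
      have : ∀ c2 : ZMod (WW w), ∑ c3, ∑ a1, ∑ a2, ∑ a3,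
          (if c3 * a3 = c1 * a1 + c2 * a2 then Th w s c1 c2 c3 a1 a2 a3 else 0)
          = ∑ a1, ∑ a2, ∑ c3, ∑ a3,
          (if c3 * a3 = c1 * a1 + c2 * a2 then Th w s c1 c2 c3 a1 a2 a3 else 0) := by
        intro c2
        rw [Finset.sum_comm]
        refine Finset.sum_congr rfl fun a1 _ => ?_
        rw [Finset.sum_comm]
      simp only [this]
      rw [Finset.sum_comm]
    rw [num]
    generalize (∑ c1, ∑ a1, ∑ c2, ∑ a2, ∑ c3, ∑ a3,
          (if c3 * a3 = c1 * a1 + c2 * a2 then Th w s c1 c2 c3 a1 a2 a3 else 0)) = N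
    generalize ((WW w : ℕ) : ℝ) = Wr
    rw [div_div, div_div, div_div, div_div]
    congr 1
    ring
  rw [e1, key]
  unfold kap
  have : ((WW w : ℕ) : ℝ) ^ 5 = ∏ i : PS w, (((i:ℕ):ℝ)) ^ 5 := by
    unfold WW; push_cast; rw [Finset.prod_pow]
  rw [this, ← Finset.prod_div_distrib]
  refine Finset.prod_congr rfl fun i _ => ?_
  have : ((i:ℕ):ℝ) ≠ 0 := by exact_mod_cast (PS_prime i).ne_zero
  field_simp

end DP5

namespace DP5

def box (N : ℕ) : Finset (ℕ × ℕ × ℕ) :=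
  Finset.Icc 1 N ×ˢ Finset.Icc 1 N ×ˢ Finset.Icc 1 N

noncomputable def simplex (Y : ℝ) : Finset (ℕ × ℕ × ℕ) :=
  (box ⌊Y⌋₊).filter (fun c => (c.1 : ℝ) * c.2.1 * c.2.2 ≤ Y)

lemma sum_box (N : ℕ) (f : ℕ → ℕ → ℕ → ℝ) :
    ∑ c ∈ box N, f c.1 c.2.1 c.2.2 =
      ∑ c1 ∈ Finset.Icc 1 N, ∑ c2 ∈ Finset.Icc 1 N, ∑ c3 ∈ Finset.Icc 1 N, f c1 c2 c3 := by
  unfold box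
  rw [Finset.sum_product]
  refine Finset.sum_congr rfl fun c1 _ => ?_
  rw [Finset.sum_product]

lemma sum_simplex (Y : ℝ) (hY : 1 ≤ Y) (f : ℕ → ℕ → ℕ → ℝ) :
    ∑ c ∈ simplex Y, f c.1 c.2.1 c.2.2 =
      ∑ c1 ∈ Finset.Icc 1 ⌊Y⌋₊, ∑ c2 ∈ Finset.Icc 1 ⌊Y / c1⌋₊,
        ∑ c3 ∈ Finset.Icc 1 ⌊Y / c1 / c2⌋₊, f c1 c2 c3 := by
  unfold simplex
  rw [Finset.sum_filter, sum_box ⌊Y⌋₊ (fun a b c => if (a:ℝ) * b * c ≤ Y then f a b c else 0)]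
  refine Finset.sum_congr rfl fun c1 hc1 => ?_
  have h1 : (1:ℝ) ≤ c1 := by exact_mod_cast (Finset.mem_Icc.1 hc1).1
  have e3 : ∀ c2 ∈ Finset.Icc 1 ⌊Y⌋₊, ∑ c3 ∈ Finset.Icc 1 ⌊Y⌋₊,
      (if (c1:ℝ) * c2 * c3 ≤ Y then f c1 c2 c3 else 0)
      = ∑ c3 ∈ Finset.Icc 1 ⌊Y / c1 / c2⌋₊, f c1 c2 c3 := by
    intro c2 hc2
    have h2 : (1:ℝ) ≤ c2 := by exact_mod_cast (Finset.mem_Icc.1 hc2).1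
    rw [← Finset.sum_filter]
    refine Finset.sum_congr ?_ (fun _ _ => rfl)
    ext c3
    have hpos : 0 ≤ Y / c1 / c2 := by positivity
    simp only [Finset.mem_filter, Finset.mem_Icc, Nat.le_floor_iff hpos,
      Nat.le_floor_iff (by linarith : 0 ≤ Y)]
    have e : (c3:ℝ) ≤ Y / c1 / c2 ↔ (c1:ℝ) * c2 * c3 ≤ Y := by
      rw [div_div, le_div_iff₀ (by positivity), mul_comm]
    rw [e]
    constructor
    · rintro ⟨⟨a, b⟩, c⟩; exact ⟨a, c⟩
    · rintro ⟨a, c⟩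
      refine ⟨⟨a, ?_⟩, c⟩
      have : (1:ℝ) ≤ c1 * c2 := by nlinarith
      have : (0:ℝ) ≤ c3 := by positivity
      nlinarith
  rw [Finset.sum_congr rfl e3]
  symm
  apply Finset.sum_subset
  · intro c2 hc2
    have := Finset.mem_Icc.1 hc2
    refine Finset.mem_Icc.2 ⟨this.1, this.2.trans (Nat.floor_le_floor ?_)⟩
    rw [div_le_iff₀ (by linarith)]; nlinarith
  · intro c2 hc2 hn
    have h2 := Finset.mem_Icc.1 hc2
    have h2' : (1:ℝ) ≤ c2 := by exact_mod_cast h2.1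
    have : ⌊Y / c1 / c2⌋₊ = 0 := by
      rw [Nat.floor_eq_zero, div_lt_one (by linarith)]
      by_contra hc
      push Not at hc
      exact hn (Finset.mem_Icc.2 ⟨h2.1, Nat.le_floor hc⟩)
    rw [this]; simp

/-- error from dropping coprimality -/
lemma noncop_sum (w : ℕ) (hw : 1 ≤ w) (s : Bool × Bool × Bool) (N : ℕ) (C : Finset (ℕ × ℕ × ℕ))
    (hC : C ⊆ box N) :
    |∑ c ∈ C.filter (fun c => ¬ Nat.Coprime c.2.1 c.2.2),
      gf w s c.1 c.2.1 c.2.2 / (c.1 * c.2.1 * c.2.2)| ≤ (1 + Real.log N) ^ 3 / w := by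
  have hlog : 0 ≤ 1 + Real.log N := by
    have := Real.log_natCast_nonneg N; linarith
  rw [abs_of_nonneg (Finset.sum_nonneg fun c _ => div_nonneg (gf_mem _ _ _ _ _).1 (by positivity))]
  -- each bad triple has a prime factor p > w of both, or contributes zero
  set PP := (Finset.Ioc w N)
  have step1 : ∑ c ∈ C.filter (fun c => ¬ Nat.Coprime c.2.1 c.2.2),
      gf w s c.1 c.2.1 c.2.2 / (c.1 * c.2.1 * c.2.2) ≤
      ∑ c ∈ box N, ∑ p ∈ PP, if p ∣ c.2.1 ∧ p ∣ c.2.2 then 1 / ((c.1:ℝ) * c.2.1 * c.2.2) else 0 := by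
    have hnn : ∀ c : ℕ × ℕ × ℕ, 0 ≤ ∑ p ∈ PP, if p ∣ c.2.1 ∧ p ∣ c.2.2 then 1 / ((c.1:ℝ) * c.2.1 * c.2.2) else 0 := by
      intro c
      refine Finset.sum_nonneg fun p _ => ?_
      split_ifs <;> positivity
    calc _ ≤ ∑ c ∈ C.filter (fun c => ¬ Nat.Coprime c.2.1 c.2.2), ∑ p ∈ PP,
          if p ∣ c.2.1 ∧ p ∣ c.2.2 then 1 / ((c.1:ℝ) * c.2.1 * c.2.2) else 0 := by
          refine Finset.sum_le_sum fun c hc => ?_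
          obtain ⟨hc1, hc2⟩ := Finset.mem_filter.1 hc
          have hb := hC hc1
          simp only [box, Finset.mem_product, Finset.mem_Icc] at hb
          obtain ⟨p, hp, hp2, hp3⟩ := Nat.Prime.not_coprime_iff_dvd.1 hc2
          by_cases hpw : p ≤ w
          · rw [gf_zero w s c.1 c.2.1 c.2.2 p hp hpw hp2 hp3]
            simpa using hnn c
          · have hmem : p ∈ PP := Finset.mem_Ioc.2 ⟨by omega,
              (Nat.le_of_dvd (by omega) hp2).trans hb.2.1.2⟩
            refine le_trans ?_ (Finset.single_le_sum (f := fun p => if p ∣ c.2.1 ∧ p ∣ c.2.2 then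
              1 / ((c.1:ℝ) * c.2.1 * c.2.2) else 0) (fun q _ => ?_) hmem)
            · simp only [hp2, hp3, and_self, if_true]
              have := (gf_mem w s c.1 c.2.1 c.2.2).2
              gcongr
            · split_ifs <;> positivity
      _ ≤ _ := Finset.sum_le_sum_of_subset_of_nonneg
          ((Finset.filter_subset _ _).trans hC) (fun c _ _ => hnn c)
  refine step1.trans ?_
  rw [Finset.sum_comm]
  have mult : ∀ p ∈ PP, ∑ c ∈ Finset.Icc 1 N, (if p ∣ c then (1:ℝ) / c else 0) ≤
      (1 / p) * (1 + Real.log N) := by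
    intro p hp
    have hp0 : 1 ≤ p := by have := (Finset.mem_Ioc.1 hp).1; omega
    have hpr : (1:ℝ) ≤ p := by exact_mod_cast hp0
    calc _ = ∑ c ∈ (Finset.Icc 1 N).filter (p ∣ ·), (1:ℝ) / c := by rw [Finset.sum_filter]
      _ ≤ ∑ c ∈ (Finset.Icc 1 N).image (fun k => p * k), (1:ℝ) / c := by
        refine Finset.sum_le_sum_of_subset_of_nonneg ?_ (fun _ _ _ => by positivity)
        intro c hc
        obtain ⟨hc1, k, rfl⟩ := Finset.mem_filter.1 hc
        have := Finset.mem_Icc.1 hc1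
        refine Finset.mem_image.2 ⟨k, Finset.mem_Icc.2 ⟨?_, ?_⟩, rfl⟩
        · by_contra h; have : k = 0 := by omega
          subst this; simp at hc1
        · nlinarith
      _ = ∑ k ∈ Finset.Icc 1 N, (1:ℝ) / ((p * k : ℕ):ℝ) := by
        apply Finset.sum_image
        intro a _ b _ h
        exact Nat.eq_of_mul_eq_mul_left (by omega) h
      _ = (1 / p) * ∑ k ∈ Finset.Icc 1 N, (1:ℝ) / k := by
        rw [Finset.mul_sum]
        refine Finset.sum_congr rfl fun k _ => ?_
        push_cast
        rw [one_div_mul_one_div]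
      _ ≤ _ := by gcongr; exact harm_le N
  calc _ ≤ ∑ p ∈ PP, (1 / (p:ℝ)) ^ 2 * (1 + Real.log N) ^ 3 := by
        refine Finset.sum_le_sum fun p hp => ?_
        have hm := mult p hp
        rw [sum_box N (fun a b c => if p ∣ b ∧ p ∣ c then 1 / ((a:ℝ) * b * c) else 0)]
        have : ∀ a b c : ℕ, (if p ∣ b ∧ p ∣ c then 1 / ((a:ℝ) * b * c) else 0)
          = (1 / (a:ℝ)) * ((if p ∣ b then (1:ℝ) / b else 0) * (if p ∣ c then (1:ℝ) / c else 0)) := by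
          intro a b c
          by_cases h1 : p ∣ b <;> by_cases h2 : p ∣ c <;> simp [h1, h2]
          ring
        simp only [this, ← Finset.mul_sum, ← Finset.sum_mul]
        set M := ∑ c ∈ Finset.Icc 1 N, (if p ∣ c then (1:ℝ) / c else 0)
        have hM0 : 0 ≤ M := Finset.sum_nonneg fun c _ => by split_ifs <;> positivity
        have hh := harm_le N
        calc _ ≤ (1 + Real.log N) * ((1 / p * (1 + Real.log N)) * (1 / p * (1 + Real.log N))) := by
              gcongr
          _ = _ := by ring
    _ = (∑ p ∈ PP, (1 / (p:ℝ)) ^ 2) * (1 + Real.log N) ^ 3 := by rw [Finset.sum_mul]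
    _ ≤ (1 / w) * (1 + Real.log N) ^ 3 := by
        gcongr
        simp only [one_div, inv_pow]
        rcases le_or_gt w N with h | h
        · have h2 := sum_Ioc_inv_sq_le_sub (α := ℝ) (k := w) (n := N) (by omega) h
          have : (0:ℝ) ≤ (N:ℝ)⁻¹ := by positivity
          linarith
        · have : PP = ∅ := Finset.Ioc_eq_empty (by omega)
          rw [this]; simp
    _ = _ := by ring

lemma mean_mem' (W : ℕ) [NeZero W] (G : ZMod W → ℝ) (h : ∀ r, 0 ≤ G r ∧ G r ≤ 1) :
    0 ≤ mean W G ∧ mean W G ≤ 1 := mean_mem W G (fun r => (h r).1) (fun r => (h r).2)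

lemma log_sum0 (W : ℕ) [NeZero W] (G : ZMod W → ℝ) (h : ∀ r, 0 ≤ G r ∧ G r ≤ 1)
    (Z : ℝ) (hZ : 1 ≤ Z) :
    |∑ c ∈ Finset.Icc 1 ⌊Z⌋₊, (1:ℝ) / c * G (c : ZMod W) - mean W G * Real.log Z| ≤ 4 * W := by
  have := log_sum W G (fun r => (h r).1) (fun r => (h r).2) 0 Z hZ
  simpa using this

lemma abs_sum_sub_le {ι : Type*} (s : Finset ι) (f g e : ι → ℝ) (h : ∀ i ∈ s, |f i - g i| ≤ e i) :
    |∑ i ∈ s, f i - ∑ i ∈ s, g i| ≤ ∑ i ∈ s, e i := by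
  rw [← Finset.sum_sub_distrib]
  exact (Finset.abs_sum_le_sum_abs _ _).trans (Finset.sum_le_sum h)

lemma box_sum (w : ℕ) (s : Bool × Bool × Bool) (N : ℕ) (hN : 1 ≤ N) :
    |∑ c ∈ box N, gf w s c.1 c.2.1 c.2.2 / (c.1 * c.2.1 * c.2.2) - kap w * Real.log N ^ 3|
      ≤ 12 * WW w * (1 + Real.log N) ^ 2 := by
  have hl0 : 0 ≤ Real.log N := Real.log_natCast_nonneg N
  have hh := harm_le N
  have hN1 : (1:ℝ) ≤ N := by exact_mod_cast hN
  have hW : (0:ℝ) ≤ WW w := by positivity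
  set l := Real.log N
  have L0 : ∀ G : ZMod (WW w) → ℝ, (∀ r, 0 ≤ G r ∧ G r ≤ 1) →
      |∑ c ∈ Finset.Icc 1 N, (1:ℝ) / c * G (c : ZMod (WW w)) - mean (WW w) G * l| ≤ 4 * WW w := by
    intro G hG
    simpa using log_sum0 (WW w) G hG N hN1
  have m3 := fun c1 c2 => mean_mem' (WW w) (fun c3 => gf w s c1 c2 c3) (fun c3 => gf_mem w s c1 c2 c3)
  have m2 := fun c1 => mean_mem' (WW w) (fun c2 => mean (WW w) (fun c3 => gf w s c1 c2 c3)) (fun c2 => m3 c1 c2)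
  set g2 : ZMod (WW w) → ZMod (WW w) → ℝ := fun c1 c2 => mean (WW w) (fun c3 => gf w s c1 c2 c3)
  set g1 : ZMod (WW w) → ℝ := fun c1 => mean (WW w) (g2 c1)
  have hk : mean (WW w) g1 = kap w := gf_mean w s
  have a1 : ∀ c1 c2 : ℕ, |∑ c3 ∈ Finset.Icc 1 N, (1:ℝ) / c3 * gf w s c1 c2 c3 - g2 c1 c2 * l| ≤ 4 * WW w :=
    fun c1 c2 => L0 (fun c3 => gf w s c1 c2 c3) (fun c3 => gf_mem w s c1 c2 c3)
  have a2 : ∀ c1 : ℕ, |∑ c2 ∈ Finset.Icc 1 N, (1:ℝ) / c2 * (∑ c3 ∈ Finset.Icc 1 N, (1:ℝ) / c3 * gf w s c1 c2 c3)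
      - g1 c1 * l ^ 2| ≤ 8 * WW w * (1 + l) := by
    intro c1
    have h1 := abs_sum_sub_le (Finset.Icc 1 N) (fun c2 : ℕ => (1:ℝ) / c2 * (∑ c3 ∈ Finset.Icc 1 N, (1:ℝ) / c3 * gf w s c1 c2 c3))
      (fun c2 : ℕ => (1:ℝ) / c2 * (g2 c1 c2 * l)) (fun c2 : ℕ => (1:ℝ) / c2 * (4 * WW w)) (fun c2 _ => by
        rw [← mul_sub, abs_mul, abs_of_nonneg (by positivity : (0:ℝ) ≤ 1 / c2)]
        exact mul_le_mul_of_nonneg_left (a1 c1 c2) (by positivity))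
    have h2 := L0 (g2 c1) (m3 c1)
    have e : ∑ c2 ∈ Finset.Icc 1 N, (1:ℝ) / c2 * (g2 c1 c2 * l) = (∑ c2 ∈ Finset.Icc 1 N, (1:ℝ) / c2 * g2 c1 c2) * l := by
      rw [Finset.sum_mul]; refine Finset.sum_congr rfl fun _ _ => by ring
    rw [e, ← Finset.sum_mul] at h1
    have h3 : |(∑ c2 ∈ Finset.Icc 1 N, (1:ℝ) / c2 * g2 c1 c2) * l - g1 c1 * l ^ 2| ≤ 4 * WW w * l := by
      have : (∑ c2 ∈ Finset.Icc 1 N, (1:ℝ) / c2 * g2 c1 c2) * l - g1 c1 * l ^ 2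
        = ((∑ c2 ∈ Finset.Icc 1 N, (1:ℝ) / c2 * g2 c1 c2) - g1 c1 * l) * l := by ring
      rw [this, abs_mul, abs_of_nonneg hl0]
      exact mul_le_mul_of_nonneg_right h2 hl0
    have h4 : (∑ c ∈ Finset.Icc 1 N, (1:ℝ) / c) * (4 * WW w) ≤ (1 + l) * (4 * WW w) := by gcongr
    rw [abs_le] at *
    constructor <;> nlinarith
  have h1 := abs_sum_sub_le (Finset.Icc 1 N) (fun c1 : ℕ => (1:ℝ) / c1 * (∑ c2 ∈ Finset.Icc 1 N, (1:ℝ) / c2 * (∑ c3 ∈ Finset.Icc 1 N, (1:ℝ) / c3 * gf w s c1 c2 c3)))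
      (fun c1 : ℕ => (1:ℝ) / c1 * (g1 c1 * l ^ 2)) (fun c1 : ℕ => (1:ℝ) / c1 * (8 * WW w * (1 + l))) (fun c1 _ => by
        rw [← mul_sub, abs_mul, abs_of_nonneg (by positivity : (0:ℝ) ≤ 1 / c1)]
        exact mul_le_mul_of_nonneg_left (a2 c1) (by positivity))
  have h2 := L0 g1 m2
  have e : ∑ c1 ∈ Finset.Icc 1 N, (1:ℝ) / c1 * (g1 c1 * l ^ 2) = (∑ c1 ∈ Finset.Icc 1 N, (1:ℝ) / c1 * g1 c1) * l ^ 2 := by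
    rw [Finset.sum_mul]; refine Finset.sum_congr rfl fun _ _ => by ring
  rw [e, ← Finset.sum_mul] at h1
  have h3 : |(∑ c1 ∈ Finset.Icc 1 N, (1:ℝ) / c1 * g1 c1) * l ^ 2 - kap w * l ^ 3| ≤ 4 * WW w * l ^ 2 := by
    have : (∑ c1 ∈ Finset.Icc 1 N, (1:ℝ) / c1 * g1 c1) * l ^ 2 - kap w * l ^ 3
      = ((∑ c1 ∈ Finset.Icc 1 N, (1:ℝ) / c1 * g1 c1) - mean (WW w) g1 * l) * l ^ 2 := by rw [hk]; ring
    rw [this, abs_mul, abs_of_nonneg (by positivity : 0 ≤ l ^ 2)]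
    exact mul_le_mul_of_nonneg_right h2 (by positivity)
  have h4 : (∑ c ∈ Finset.Icc 1 N, (1:ℝ) / c) * (8 * WW w * (1 + l)) ≤ (1 + l) * (8 * WW w * (1 + l)) := by gcongr
  have e0 : ∑ c ∈ box N, gf w s c.1 c.2.1 c.2.2 / (c.1 * c.2.1 * c.2.2) =
      ∑ c1 ∈ Finset.Icc 1 N, (1:ℝ) / c1 * (∑ c2 ∈ Finset.Icc 1 N, (1:ℝ) / c2 * (∑ c3 ∈ Finset.Icc 1 N, (1:ℝ) / c3 * gf w s c1 c2 c3)) := by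
    rw [sum_box N (fun a b c => gf w s a b c / (a * b * c))]
    simp only [Finset.mul_sum]
    refine Finset.sum_congr rfl fun a _ => Finset.sum_congr rfl fun b _ => Finset.sum_congr rfl fun c _ => ?_
    rw [div_eq_mul_one_div, ← one_div_mul_one_div, ← one_div_mul_one_div]; ring
  rw [e0]
  rw [abs_le] at *
  constructor <;> nlinarith

lemma simplex_sum (w : ℕ) (s : Bool × Bool × Bool) (Y : ℝ) (hY : 1 ≤ Y) :
    |∑ c ∈ simplex Y, gf w s c.1 c.2.1 c.2.2 / (c.1 * c.2.1 * c.2.2) - kap w * (Real.log Y ^ 3 / 6)|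
      ≤ 12 * WW w * (1 + Real.log Y) ^ 2 := by
  have hW : (0:ℝ) ≤ WW w := by positivity
  have m3 := fun c1 c2 => mean_mem' (WW w) (fun c3 => gf w s c1 c2 c3) (fun c3 => gf_mem w s c1 c2 c3)
  have m2 := fun c1 => mean_mem' (WW w) (fun c2 => mean (WW w) (fun c3 => gf w s c1 c2 c3)) (fun c2 => m3 c1 c2)
  set g2 : ZMod (WW w) → ZMod (WW w) → ℝ := fun c1 c2 => mean (WW w) (fun c3 => gf w s c1 c2 c3)
  set g1 : ZMod (WW w) → ℝ := fun c1 => mean (WW w) (g2 c1)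
  have hk : mean (WW w) g1 = kap w := gf_mean w s
  have harmZ : ∀ Z : ℝ, 1 ≤ Z → ∑ c ∈ Finset.Icc 1 ⌊Z⌋₊, (1:ℝ) / c ≤ 1 + Real.log Z := by
    intro Z hZ
    refine (harm_le _).trans ?_
    have : Real.log (⌊Z⌋₊ : ℝ) ≤ Real.log Z := by
      apply Real.log_le_log
      · have : 1 ≤ ⌊Z⌋₊ := Nat.le_floor (by simpa using hZ)
        exact_mod_cast this
      · exact Nat.floor_le (by linarith)
    linarith
  have ge1 : ∀ Z : ℝ, 1 ≤ Z → ∀ c ∈ Finset.Icc 1 ⌊Z⌋₊, 1 ≤ Z / c ∧ (1:ℝ) ≤ c := by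
    intro Z hZ c hc
    have := Finset.mem_Icc.1 hc
    have h1 : (1:ℝ) ≤ c := by exact_mod_cast this.1
    refine ⟨?_, h1⟩
    rw [le_div_iff₀ (by linarith), one_mul]
    exact (Nat.le_floor_iff (by linarith)).1 this.2
  have a1 : ∀ (c1 c2 : ℕ) (Z : ℝ), 1 ≤ Z → |∑ c3 ∈ Finset.Icc 1 ⌊Z⌋₊, (1:ℝ) / c3 * gf w s c1 c2 c3 - g2 c1 c2 * Real.log Z| ≤ 4 * WW w :=
    fun c1 c2 Z hZ => log_sum0 (WW w) (fun c3 => gf w s c1 c2 c3) (fun c3 => gf_mem w s c1 c2 c3) Z hZ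
  have a2 : ∀ (c1 : ℕ) (Z : ℝ), 1 ≤ Z → |∑ c2 ∈ Finset.Icc 1 ⌊Z⌋₊, (1:ℝ) / c2 * (∑ c3 ∈ Finset.Icc 1 ⌊Z / c2⌋₊, (1:ℝ) / c3 * gf w s c1 c2 c3)
      - g1 c1 * (Real.log Z ^ 2 / 2)| ≤ 8 * WW w * (1 + Real.log Z) := by
    intro c1 Z hZ
    have h1 := abs_sum_sub_le (Finset.Icc 1 ⌊Z⌋₊) (fun c2 : ℕ => (1:ℝ) / c2 * (∑ c3 ∈ Finset.Icc 1 ⌊Z / c2⌋₊, (1:ℝ) / c3 * gf w s c1 c2 c3))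
      (fun c2 : ℕ => (1:ℝ) / c2 * (g2 c1 c2 * Real.log (Z / c2))) (fun c2 : ℕ => (1:ℝ) / c2 * (4 * WW w)) (fun c2 hc2 => by
        rw [← mul_sub, abs_mul, abs_of_nonneg (by positivity : (0:ℝ) ≤ 1 / c2)]
        exact mul_le_mul_of_nonneg_left (a1 c1 c2 (Z / c2) (ge1 Z hZ c2 hc2).1) (by positivity))
    have h2 := log_sum (WW w) (g2 c1) (fun r => (m3 c1 r).1) (fun r => (m3 c1 r).2) 1 Z hZ
    have e : ∑ c2 ∈ Finset.Icc 1 ⌊Z⌋₊, (1:ℝ) / c2 * (g2 c1 c2 * Real.log (Z / c2)) = ∑ c2 ∈ Finset.Icc 1 ⌊Z⌋₊, Real.log (Z / c2) ^ 1 / c2 * g2 c1 c2 := by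
      refine Finset.sum_congr rfl fun _ _ => by ring
    rw [e, ← Finset.sum_mul] at h1
    have h4 : (∑ c ∈ Finset.Icc 1 ⌊Z⌋₊, (1:ℝ) / c) * (4 * WW w) ≤ (1 + Real.log Z) * (4 * WW w) := by
      gcongr; exact harmZ Z hZ
    have e2 : mean (WW w) (g2 c1) * (Real.log Z ^ (1+1) / ((1:ℕ) + 1)) = g1 c1 * (Real.log Z ^ 2 / 2) := by
      norm_num [g1]
    rw [e2] at h2
    rw [abs_le] at *
    constructor <;> nlinarith
  have hl0 : 0 ≤ Real.log Y := Real.log_nonneg hY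
  have h1 := abs_sum_sub_le (Finset.Icc 1 ⌊Y⌋₊) (fun c1 : ℕ => (1:ℝ) / c1 * (∑ c2 ∈ Finset.Icc 1 ⌊Y / c1⌋₊, (1:ℝ) / c2 * (∑ c3 ∈ Finset.Icc 1 ⌊Y / c1 / c2⌋₊, (1:ℝ) / c3 * gf w s c1 c2 c3)))
      (fun c1 : ℕ => (1:ℝ) / c1 * (g1 c1 * (Real.log (Y / c1) ^ 2 / 2))) (fun c1 : ℕ => (1:ℝ) / c1 * (8 * WW w * (1 + Real.log Y))) (fun c1 hc1 => by
        have hg := ge1 Y hY c1 hc1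
        rw [← mul_sub, abs_mul, abs_of_nonneg (by positivity : (0:ℝ) ≤ 1 / c1)]
        refine mul_le_mul_of_nonneg_left ((a2 c1 _ hg.1).trans ?_) (by positivity)
        have : Real.log (Y / c1) ≤ Real.log Y := by
          apply Real.log_le_log (by linarith)
          rw [div_le_iff₀ (by linarith)]; nlinarith
        gcongr)
  have h2 := log_sum (WW w) g1 (fun r => (m2 r).1) (fun r => (m2 r).2) 2 Y hY
  have e : ∑ c1 ∈ Finset.Icc 1 ⌊Y⌋₊, (1:ℝ) / c1 * (g1 c1 * (Real.log (Y / c1) ^ 2 / 2)) = (∑ c1 ∈ Finset.Icc 1 ⌊Y⌋₊, Real.log (Y / c1) ^ 2 / c1 * g1 c1) / 2 := by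
    rw [Finset.sum_div]; refine Finset.sum_congr rfl fun _ _ => by ring
  rw [e, ← Finset.sum_mul] at h1
  have h4 : (∑ c ∈ Finset.Icc 1 ⌊Y⌋₊, (1:ℝ) / c) * (8 * WW w * (1 + Real.log Y)) ≤ (1 + Real.log Y) * (8 * WW w * (1 + Real.log Y)) := by
    gcongr; exact harmZ Y hY
  have e2 : mean (WW w) g1 * (Real.log Y ^ (2+1) / ((2:ℕ) + 1)) = 2 * (kap w * (Real.log Y ^ 3 / 6)) := by
    rw [hk]; push_cast; ring
  rw [e2] at h2
  have e0 : ∑ c ∈ simplex Y, gf w s c.1 c.2.1 c.2.2 / (c.1 * c.2.1 * c.2.2) =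
      ∑ c1 ∈ Finset.Icc 1 ⌊Y⌋₊, (1:ℝ) / c1 * (∑ c2 ∈ Finset.Icc 1 ⌊Y / c1⌋₊, (1:ℝ) / c2 * (∑ c3 ∈ Finset.Icc 1 ⌊Y / c1 / c2⌋₊, (1:ℝ) / c3 * gf w s c1 c2 c3)) := by
    rw [sum_simplex Y hY (fun a b c => gf w s a b c / (a * b * c))]
    simp only [Finset.mul_sum]
    refine Finset.sum_congr rfl fun a _ => Finset.sum_congr rfl fun b _ => Finset.sum_congr rfl fun c _ => ?_
    rw [div_eq_mul_one_div, ← one_div_mul_one_div, ← one_div_mul_one_div]; ring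
  rw [e0]
  have hq : (0:ℝ) ≤ WW w * (1 + Real.log Y) ^ 2 := by positivity
  rw [abs_le] at *
  constructor <;> nlinarith

end DP5

namespace DP5

/-- slice of the sector region -/
def SL (m a : ℝ) : Set ℝ := {b | 0 < b ∧ (a + b) * max a b ≤ m}

noncomputable def sg (m a : ℝ) : ℝ := sSup (SL m a)

lemma SL_le_sqrt {m a b : ℝ} (ha : 0 ≤ a) (hb : b ∈ SL m a) : b ≤ Real.sqrt m ∧ a ≤ Real.sqrt m := by
  obtain ⟨h0, h1⟩ := hb
  have h2 : b ≤ max a b := le_max_right _ _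
  have h3 : a ≤ max a b := le_max_left _ _
  constructor <;> apply Real.le_sqrt_of_sq_le <;> nlinarith

lemma SL_bdd {m a : ℝ} (ha : 0 ≤ a) : BddAbove (SL m a) :=
  ⟨Real.sqrt m, fun _ hb => (SL_le_sqrt ha hb).1⟩

lemma SL_down {m a a' b b' : ℝ} (ha : 0 ≤ a') (haa : a' ≤ a) (hb0 : 0 < b') (hbb : b' ≤ b)
    (hb : b ∈ SL m a) : b' ∈ SL m a' := by
  refine ⟨hb0, le_trans ?_ hb.2⟩
  have : max a' b' ≤ max a b := max_le_max haa hbb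
  have h0 : 0 < max a' b' := lt_max_of_lt_right hb0
  have h1 : 0 ≤ a + b := by linarith
  exact mul_le_mul (by linarith) this h0.le h1

lemma sg_nonneg (m a : ℝ) : 0 ≤ sg m a := Real.sSup_nonneg fun _ hb => hb.1.le

lemma le_sg {m a b : ℝ} (ha : 0 ≤ a) (hb : b ∈ SL m a) : b ≤ sg m a := le_csSup (SL_bdd ha) hb

lemma mem_of_lt_sg {m a b : ℝ} (ha : 0 ≤ a) (hb0 : 0 < b) (hb : b < sg m a) : b ∈ SL m a := by
  have hne : (SL m a).Nonempty := by
    by_contra h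
    rw [Set.not_nonempty_iff_eq_empty] at h
    unfold sg at hb; rw [h, Real.sSup_empty] at hb; linarith
  obtain ⟨c, hc, hbc⟩ := exists_lt_of_lt_csSup hne hb
  exact SL_down ha le_rfl hb0 hbc.le hc

lemma sg_anti {m a a' : ℝ} (ha : 0 ≤ a') (haa : a' ≤ a) : sg m a ≤ sg m a' := by
  apply Real.sSup_le _ (sg_nonneg _ _)
  intro b hb
  exact le_sg ha (SL_down ha haa hb.1 le_rfl hb)

lemma sg_le {m a : ℝ} (ha : 0 ≤ a) : sg m a ≤ Real.sqrt m :=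
  Real.sSup_le (fun _ hb => (SL_le_sqrt ha hb).1) (Real.sqrt_nonneg _)

lemma sg_zero {m a : ℝ} (ha0 : 0 ≤ a) (ha : Real.sqrt m < a) : sg m a = 0 := by
  have : SL m a = ∅ := by
    rw [Set.eq_empty_iff_forall_notMem]
    intro b hb
    have := (SL_le_sqrt ha0 hb).2
    linarith
  unfold sg; rw [this, Real.sSup_empty]

lemma vol_SL {m a : ℝ} (ha : 0 ≤ a) : volume (SL m a) = ENNReal.ofReal (sg m a) := by
  apply le_antisymm
  · calc volume (SL m a) ≤ volume (Set.Icc 0 (sg m a)) :=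
        measure_mono fun b hb => ⟨hb.1.le, le_sg ha hb⟩
      _ = _ := by simp
  · calc ENNReal.ofReal (sg m a) = volume (Set.Ioo 0 (sg m a)) := by simp
      _ ≤ _ := measure_mono fun b hb => mem_of_lt_sg ha hb.1 hb.2

/-- the sector region -/
def RS (m : ℝ) : Set (ℝ × ℝ) := {P | 0 < P.1 ∧ 0 < P.2 ∧ (P.1 + P.2) * max P.1 P.2 ≤ m}

noncomputable def AA : ℝ := (volume (RS 1)).toReal

lemma RS_meas (m : ℝ) : MeasurableSet (RS m) := by
  have h3 : MeasurableSet {P : ℝ × ℝ | (P.1 + P.2) * max P.1 P.2 ≤ m} :=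
    measurableSet_le (by fun_prop) measurable_const
  exact MeasurableSet.inter (measurableSet_lt measurable_const measurable_fst)
    (MeasurableSet.inter (measurableSet_lt measurable_const measurable_snd) h3)

lemma AA_nonneg : 0 ≤ AA := ENNReal.toReal_nonneg

lemma RS_sub (m : ℝ) : RS m ⊆ Set.Icc 0 (Real.sqrt m) ×ˢ Set.Icc 0 (Real.sqrt m) := by
  rintro ⟨a, b⟩ ⟨h1, h2, h3⟩
  have := SL_le_sqrt (m := m) (a := a) (b := b) h1.le ⟨h2, h3⟩
  exact ⟨⟨h1.le, this.2⟩, ⟨h2.le, this.1⟩⟩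

lemma RS_fin (m : ℝ) : volume (RS m) ≠ ⊤ := by
  apply ne_top_of_le_ne_top _ (measure_mono (RS_sub m))
  rw [Measure.volume_eq_prod, Measure.prod_prod]
  simp [ENNReal.mul_eq_top]

open scoped Pointwise in
lemma vol_RS (m : ℝ) (hm : 0 < m) : (volume (RS m)).toReal = m * AA := by
  have hs : 0 < Real.sqrt m := Real.sqrt_pos.2 hm
  have : RS m = (Real.sqrt m) • RS 1 := by
    ext ⟨a, b⟩
    rw [Set.mem_smul_set_iff_inv_smul_mem₀ hs.ne']
    simp only [RS, Set.mem_setOf_eq, Prod.smul_mk, smul_eq_mul]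
    have e : max ((Real.sqrt m)⁻¹ * a) ((Real.sqrt m)⁻¹ * b) = (Real.sqrt m)⁻¹ * max a b := by
      rw [mul_max_of_nonneg _ _ (by positivity)]
    rw [e, ← mul_add]
    have e2 : (Real.sqrt m)⁻¹ * (a + b) * ((Real.sqrt m)⁻¹ * max a b) = (a + b) * max a b / m := by
      have h : (Real.sqrt m)⁻¹ * (Real.sqrt m)⁻¹ = m⁻¹ := by
        rw [← mul_inv, Real.mul_self_sqrt hm.le]
      calc _ = ((Real.sqrt m)⁻¹ * (Real.sqrt m)⁻¹) * ((a + b) * max a b) := by ring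
        _ = _ := by rw [h]; ring
    rw [e2, div_le_one hm]
    have hi : 0 < (Real.sqrt m)⁻¹ := by positivity
    simp only [mul_pos_iff_of_pos_left hi]
  rw [this, Measure.addHaar_smul]
  simp only [Module.finrank_prod, Module.finrank_self]
  rw [ENNReal.toReal_mul, ENNReal.toReal_ofReal (by positivity)]
  have : |Real.sqrt m ^ (1+1)| = m := by
    rw [abs_of_nonneg (by positivity)]; exact Real.sq_sqrt hm.le
  rw [this, AA]

lemma int_sg (m L : ℝ) (hm : 0 < m) (hL : Real.sqrt m ≤ L) :
    ∫ a in (0:ℝ)..L, sg m a = m * AA := by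
  have hL0 : 0 ≤ L := (Real.sqrt_nonneg m).trans hL
  rw [← vol_RS m hm]
  rw [intervalIntegral.integral_of_le hL0]
  have anti : AntitoneOn (sg m) (Set.Ioc 0 L) := fun x hx y hy hxy => sg_anti hx.1.le hxy
  have hmeas : AEStronglyMeasurable (sg m) (volume.restrict (Set.Ioc 0 L)) :=
    (aemeasurable_restrict_of_antitoneOn measurableSet_Ioc anti).aestronglyMeasurable
  rw [integral_eq_lintegral_of_nonneg_ae (Filter.Eventually.of_forall fun a => sg_nonneg m a) hmeas]
  congr 1
  rw [Measure.volume_eq_prod, Measure.prod_apply (RS_meas m)]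
  have e : ∀ a : ℝ, volume (Prod.mk a ⁻¹' RS m) =
      (Set.Ioc 0 L).indicator (fun a => ENNReal.ofReal (sg m a)) a := by
    intro a
    by_cases ha : a ∈ Set.Ioc 0 L
    · rw [Set.indicator_of_mem ha, ← vol_SL ha.1.le]
      congr 1
      ext b
      simp only [RS, SL, Set.mem_preimage, Set.mem_setOf_eq]
      have := ha.1
      tauto
    · rw [Set.indicator_of_notMem ha]
      have : Prod.mk a ⁻¹' RS m = ∅ := by
        rw [Set.eq_empty_iff_forall_notMem]
        intro b hb
        apply ha
        refine ⟨hb.1, le_trans ?_ hL⟩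
        exact (RS_sub m hb).1.2
      rw [this]; simp
  simp_rw [e]
  rw [lintegral_indicator measurableSet_Ioc]

/-- sum of the slice function along multiples of `c` -/
lemma sum_sg (m : ℝ) (hm : 0 < m) (c : ℕ) (hc : 1 ≤ c) (N : ℕ) (hN : Real.sqrt m < c * (N + 1)) :
    |∑ n ∈ Finset.Icc 1 N, sg m (c * n) - m * AA / c| ≤ Real.sqrt m := by
  have hc0 : (1:ℝ) ≤ c := by exact_mod_cast hc
  have anti : ∀ s : Set ℝ, (∀ x ∈ s, 0 ≤ x) → AntitoneOn (fun x : ℝ => sg m (c * x)) s := by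
    intro s hs x hx y hy hxy
    have := hs x hx
    exact sg_anti (by positivity) (by gcongr)
  have hinteg : ∫ x in (0:ℝ)..((0:ℝ) + (N+1 : ℕ)), sg m (c * x) = m * AA / c := by
    rw [intervalIntegral.integral_comp_mul_left (fun x => sg m x) (by linarith : (c:ℝ) ≠ 0)]
    rw [mul_zero, int_sg m _ hm (by push_cast; rw [zero_add]; exact hN.le), smul_eq_mul]
    ring
  have h1 := AntitoneOn.sum_le_integral (f := fun x : ℝ => sg m (c * x)) (x₀ := 0) (a := N+1)
    (anti _ (fun x hx => hx.1))
  have h2 := AntitoneOn.integral_le_sum (f := fun x : ℝ => sg m (c * x)) (x₀ := 0) (a := N+1)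
    (anti _ (fun x hx => hx.1))
  rw [hinteg] at h1 h2
  have e : ∑ n ∈ Finset.Icc 1 N, sg m (c * n) = ∑ i ∈ Finset.range N, sg m (c * ((i + 1 : ℕ):ℝ)) := by
    rw [Finset.range_eq_Ico, Finset.sum_Ico_add' (fun n : ℕ => sg m (c * n)) 0 N 1]
    rfl
  have e1 : ∑ i ∈ Finset.range (N+1), sg m (c * (0 + ((i + 1 : ℕ):ℝ))) = ∑ n ∈ Finset.Icc 1 N, sg m (c * n) := by
    rw [Finset.sum_range_succ, e]
    have : sg m (c * (0 + ((N + 1 : ℕ):ℝ))) = 0 := by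
      apply sg_zero (by positivity); push_cast; rw [zero_add]; exact hN
    rw [this, add_zero]; simp
  have e2 : ∑ i ∈ Finset.range (N+1), sg m (c * (0 + (i:ℝ))) = sg m 0 + ∑ n ∈ Finset.Icc 1 N, sg m (c * n) := by
    rw [Finset.sum_range_succ', e]; simp [add_comm]
  rw [e1] at h1; rw [e2] at h2
  have h3 := sg_le (m := m) le_rfl
  have h4 := Real.sqrt_nonneg m
  rw [abs_le]; constructor <;> linarith

end DP5

namespace DP5

def Fn (a b : ℕ) : ℕ := (a + b) * max a b

lemma Fn_mono {a b b' : ℕ} (h : b ≤ b') : Fn a b ≤ Fn a b' := by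
  unfold Fn
  exact Nat.mul_le_mul (by omega) (by omega)

lemma le_Fn {a b : ℕ} (hb : 1 ≤ b) : b ≤ Fn a b := by
  unfold Fn
  calc b = b * 1 := by ring
    _ ≤ _ := Nat.mul_le_mul (by omega) (by omega)

lemma Fn_SL {m a b : ℕ} (hb : 1 ≤ b) : (b:ℝ) ∈ SL (m:ℝ) (a:ℝ) ↔ Fn a b ≤ m := by
  unfold SL Fn
  simp only [Set.mem_setOf_eq]
  constructor
  · rintro ⟨_, h⟩; exact_mod_cast h
  · intro h
    exact ⟨by exact_mod_cast hb, by exact_mod_cast h⟩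

/-- solution of the congruences -/
lemma exists_res (c2 c3 x : ℕ) (h2 : 1 ≤ c2) (h3 : 1 ≤ c3) (hc : Nat.Coprime c2 c3) :
    ∃ r, 1 ≤ r ∧ r ≤ c2 * c3 ∧ c2 ∣ r ∧ c3 ∣ x + r := by
  obtain ⟨k, hk2, hk3⟩ := Nat.chineseRemainder hc 0 (x * (c3 - 1))
  have q0 : 0 < c2 * c3 := by positivity
  have d2 : c2 ∣ k := (Nat.modEq_zero_iff_dvd).1 hk2
  have d3 : c3 ∣ x + k := by
    rw [← Nat.modEq_zero_iff_dvd]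
    calc x + k ≡ x + x * (c3 - 1) [MOD c3] := Nat.ModEq.add_left _ hk3
      _ = x * c3 := by
        obtain ⟨y, rfl⟩ : ∃ y, c3 = y + 1 := ⟨c3 - 1, by omega⟩
        simp; ring
      _ ≡ 0 [MOD c3] := by simp [Nat.ModEq]
  have hm := Nat.mod_add_div k (c2 * c3)
  have hlt := Nat.mod_lt k q0
  by_cases h0 : k % (c2 * c3) = 0
  · refine ⟨c2 * c3, q0, le_rfl, dvd_mul_right _ _, ?_⟩
    rw [h0, zero_add] at hm
    have : c3 ∣ x := by
      rw [← hm] at d3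
      exact (Nat.dvd_add_left ⟨c2 * (k / (c2 * c3)), by ring⟩).1 d3
    exact dvd_add this (dvd_mul_left _ _)
  · refine ⟨k % (c2 * c3), by omega, hlt.le, ?_, ?_⟩
    · rw [← hm] at d2
      exact (Nat.dvd_add_left ⟨c3 * (k / (c2 * c3)), by ring⟩).1 d2
    · rw [← hm, ← add_assoc] at d3
      exact (Nat.dvd_add_left ⟨c2 * (k / (c2 * c3)), by ring⟩).1 d3

lemma res_iff (c2 c3 x r : ℕ) (hc : Nat.Coprime c2 c3) (hr : r ≤ c2 * c3)
    (h2 : c2 ∣ r) (h3 : c3 ∣ x + r) (b : ℕ) (hb : 1 ≤ b) :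
    (c2 ∣ b ∧ c3 ∣ x + b) ↔ ∃ t, b = r + c2 * c3 * t := by
  constructor
  · rintro ⟨k2, k3⟩
    have e2 : ((c2:ℕ):ℤ) ∣ (b:ℤ) - r := dvd_sub (by exact_mod_cast k2) (by exact_mod_cast h2)
    have e3 : ((c3:ℕ):ℤ) ∣ (b:ℤ) - r := by
      have : (b:ℤ) - r = ((x + b : ℕ):ℤ) - ((x + r : ℕ):ℤ) := by push_cast; ring
      rw [this]
      exact dvd_sub (by exact_mod_cast k3) (by exact_mod_cast h3)
    have e := IsCoprime.mul_dvd (Nat.isCoprime_iff_coprime.2 hc) e2 e3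
    obtain ⟨t, ht⟩ := e
    have t0 : 0 ≤ t := by
      by_contra hneg
      have : t ≤ -1 := by omega
      have : (c2:ℤ) * c3 * t ≤ (c2:ℤ) * c3 * (-1) := by gcongr
      have : (r:ℤ) ≤ c2 * c3 := by exact_mod_cast hr
      have : (1:ℤ) ≤ b := by exact_mod_cast hb
      linarith
    obtain ⟨n, rfl⟩ := Int.eq_ofNat_of_zero_le t0
    refine ⟨n, ?_⟩
    have : (b:ℤ) = r + c2 * c3 * n := by linarith
    exact_mod_cast this
  · rintro ⟨t, rfl⟩
    refine ⟨dvd_add h2 ⟨c3 * t, by ring⟩, ?_⟩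
    rw [← add_assoc]
    exact dvd_add h3 ⟨c2 * t, by ring⟩

lemma inner_sum (w : ℕ) (s : Bool × Bool × Bool) (c1 c2 c3 a1 m : ℕ)
    (h2 : 1 ≤ c2) (h3 : 1 ≤ c3) (hc : Nat.Coprime c2 c3) :
    |∑ b ∈ (Finset.Icc 1 m).filter (fun b => Fn (c1 * a1) b ≤ m ∧ c2 ∣ b ∧ c3 ∣ c1 * a1 + b),
        Th w s c1 c2 c3 a1 ((b / c2 : ℕ) : ZMod (WW w)) (((c1 * a1 + b) / c3 : ℕ) : ZMod (WW w))
      - sg m ((c1 : ℝ) * a1) / (c2 * c3) * Gf w s c1 c2 c3 a1| ≤ WW w + 1 := by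
  obtain ⟨r, hr1, hrq, hr2, hr3⟩ := exists_res c2 c3 (c1 * a1) h2 h3 hc
  have q0 : 1 ≤ c2 * c3 := Nat.mul_pos h2 h3
  have hq0 : (0:ℝ) < (c2:ℝ) * c3 := by exact_mod_cast q0
  have hex : ∃ t, ¬ Fn (c1 * a1) (r + c2 * c3 * t) ≤ m := by
    refine ⟨m, ?_⟩
    have h := le_Fn (a := c1 * a1) (b := r + c2 * c3 * m) (by omega)
    have : m ≤ c2 * c3 * m := Nat.le_mul_of_pos_left m q0
    omega
  set N := Nat.find hex with hN
  have hlt : ∀ t, t < N → Fn (c1 * a1) (r + c2 * c3 * t) ≤ m := fun t ht => by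
    have := Nat.find_min hex ht; simpa using this
  have hge : ¬ Fn (c1 * a1) (r + c2 * c3 * N) ≤ m := Nat.find_spec hex
  have hiff : ∀ t, Fn (c1 * a1) (r + c2 * c3 * t) ≤ m ↔ t < N := by
    intro t
    refine ⟨fun h => ?_, hlt t⟩
    by_contra hn
    apply hge
    refine le_trans (Fn_mono ?_) h
    have : c2 * c3 * N ≤ c2 * c3 * t := Nat.mul_le_mul_left _ (by omega)
    omega
  obtain ⟨A2, hA2⟩ := hr2
  obtain ⟨A3, hA3⟩ := hr3
  have e1 : ∑ b ∈ (Finset.Icc 1 m).filter (fun b => Fn (c1 * a1) b ≤ m ∧ c2 ∣ b ∧ c3 ∣ c1 * a1 + b),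
        Th w s c1 c2 c3 a1 ((b / c2 : ℕ) : ZMod (WW w)) (((c1 * a1 + b) / c3 : ℕ) : ZMod (WW w))
      = ∑ t ∈ Finset.range N, Th w s c1 c2 c3 a1 ((A2 : ZMod (WW w)) + c3 * (t:ZMod (WW w)))
          ((A3 : ZMod (WW w)) + c2 * (t : ZMod (WW w))) := by
    symm
    apply Finset.sum_bij (fun t _ => r + c2 * c3 * t)
    · intro t ht
      have ht' := hlt t (Finset.mem_range.1 ht)
      have hb1 : 1 ≤ r + c2 * c3 * t := by omega
      rw [Finset.mem_filter, Finset.mem_Icc]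
      exact ⟨⟨hb1, (le_Fn hb1).trans ht'⟩, ht',
        (res_iff c2 c3 (c1 * a1) r hc hrq ⟨A2, hA2⟩ ⟨A3, hA3⟩ _ hb1).2 ⟨t, rfl⟩⟩
    · intro t _ t' _ h
      exact Nat.eq_of_mul_eq_mul_left q0 (by omega)
    · intro b hb
      rw [Finset.mem_filter, Finset.mem_Icc] at hb
      obtain ⟨t, rfl⟩ := (res_iff c2 c3 (c1 * a1) r hc hrq ⟨A2, hA2⟩ ⟨A3, hA3⟩ _ hb.1.1).1 hb.2.2
      exact ⟨t, Finset.mem_range.2 ((hiff t).1 hb.2.1), rfl⟩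
    · intro t _
      have f2 : (r + c2 * c3 * t) / c2 = A2 + c3 * t := by
        rw [hA2, show c2 * A2 + c2 * c3 * t = c2 * (A2 + c3 * t) by ring, Nat.mul_div_cancel_left _ h2]
      have f3 : (c1 * a1 + (r + c2 * c3 * t)) / c3 = A3 + c2 * t := by
        rw [← add_assoc, hA3, show c3 * A3 + c2 * c3 * t = c3 * (A3 + c2 * t) by ring,
          Nat.mul_div_cancel_left _ h3]
      rw [f2, f3]; push_cast; rfl
  rw [e1]
  have hbez := Nat.gcd_eq_gcd_ab c2 c3
  rw [Nat.Coprime.gcd_eq_one hc] at hbez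
  have huv : ((Nat.gcdA c2 c3 : ℤ) : ZMod (WW w)) * (c2 : ZMod (WW w)) +
      ((Nat.gcdB c2 c3 : ℤ) : ZMod (WW w)) * (c3 : ZMod (WW w)) = 1 := by
    have := congrArg (fun z : ℤ => (z : ZMod (WW w))) hbez
    push_cast at this
    rw [this]; ring
  have hA : (c3 : ZMod (WW w)) * (A3 : ZMod (WW w)) = c1 * a1 + c2 * (A2 : ZMod (WW w)) := by
    have : c3 * A3 = c1 * a1 + c2 * A2 := by rw [← hA3, ← hA2]
    exact_mod_cast congrArg (fun z : ℕ => (z : ZMod (WW w))) this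
  rw [Gf_param w s c1 c2 c3 a1 _ _ A2 A3 huv hA]
  set G : ZMod (WW w) → ℝ := fun t => Th w s c1 c2 c3 a1 ((A2 : ZMod (WW w)) + c3 * t)
          ((A3 : ZMod (WW w)) + c2 * t) with hG
  have G0 : ∀ t, 0 ≤ G t := fun t => (Th_mem w s _ _ _ _ _ _).1
  have G1 : ∀ t, G t ≤ 1 := fun t => (Th_mem w s _ _ _ _ _ _).2
  have hs := abs_sum_range_sub_mean (WW w) G G0 G1 N
  obtain ⟨M0, M1⟩ := mean_mem (WW w) G G0 G1
  have hNs : |(N:ℝ) - sg m ((c1 : ℝ) * a1) / (c2 * c3)| ≤ 1 := by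
    have ca : ((c1 * a1 : ℕ):ℝ) = (c1:ℝ) * a1 := by push_cast; ring
    have x0 : (0:ℝ) ≤ (c1:ℝ) * a1 := by positivity
    have hrq' : (r:ℝ) ≤ (c2:ℝ) * c3 := by exact_mod_cast hrq
    have hr1' : (1:ℝ) ≤ r := by exact_mod_cast hr1
    have hup : sg m ((c1 : ℝ) * a1) ≤ r + (c2:ℝ) * c3 * N := by
      by_contra hcon
      push Not at hcon
      apply hge
      rw [← Fn_SL (by omega), ca]
      push_cast
      exact mem_of_lt_sg x0 (by positivity) hcon
    have hlo : (c2:ℝ) * c3 * (N - 1) ≤ sg m ((c1 : ℝ) * a1) := by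
      rcases Nat.eq_zero_or_pos N with h | h
      · rw [h]; have := sg_nonneg m ((c1:ℝ) * a1); push_cast; nlinarith
      · have h5 := hlt (N-1) (by omega)
        rw [← Fn_SL (by omega), ca] at h5
        have h6 := le_sg x0 h5
        push_cast [Nat.cast_sub h] at h6
        linarith
    rw [abs_le]
    constructor
    · rw [neg_le_sub_iff_le_add, div_le_iff₀ hq0]; nlinarith
    · rw [sub_le_comm, le_div_iff₀ hq0]; nlinarith
  calc _ = |(∑ n ∈ Finset.range N, G n - N * mean (WW w) G) +
          (N - sg m ((c1 : ℝ) * a1) / (c2 * c3)) * mean (WW w) G| := by congr 1; ring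
    _ ≤ _ := abs_add_le _ _
    _ ≤ WW w + 1 * 1 := by
      rw [abs_mul, abs_of_nonneg M0]
      gcongr
    _ = _ := by ring

def Rg (m : ℕ) : Finset (ℕ × ℕ) :=
  (Finset.Icc 1 m ×ˢ Finset.Icc 1 m).filter (fun P => Fn P.1 P.2 ≤ m)

/-- the local sum attached to `c` -/
noncomputable def MS (w : ℕ) (s : Bool × Bool × Bool) (c1 c2 c3 m : ℕ) : ℝ :=
  ∑ P ∈ (Rg m).filter (fun P => c1 ∣ P.1 ∧ c2 ∣ P.2 ∧ c3 ∣ P.1 + P.2),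
    Th w s c1 c2 c3 ((P.1 / c1 : ℕ) : ZMod (WW w)) ((P.2 / c2 : ℕ) : ZMod (WW w))
      (((P.1 + P.2) / c3 : ℕ) : ZMod (WW w))

lemma ML (w : ℕ) (s : Bool × Bool × Bool) (c1 c2 c3 m : ℕ) (hm : 1 ≤ m)
    (h1 : 1 ≤ c1) (h2 : 1 ≤ c2) (h3 : 1 ≤ c3) (hc : Nat.Coprime c2 c3) :
    |MS w s c1 c2 c3 m - gf w s c1 c2 c3 / (c1 * c2 * c3) * (AA * m)|
      ≤ (WW w + 1) * Real.sqrt m * (1 / c1 + 1 / (c2 * c3)) := by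
  have hm0 : (0:ℝ) < m := by exact_mod_cast hm
  have hc1 : (0:ℝ) < c1 := by exact_mod_cast h1
  have hq1 : (1:ℝ) ≤ (c2:ℝ) * c3 := by exact_mod_cast Nat.mul_pos h2 h3
  have hq0 : (0:ℝ) < (c2:ℝ) * c3 := by linarith
  have sq0 : 0 ≤ Real.sqrt m := Real.sqrt_nonneg _
  set N := Nat.sqrt m / c1 with hN
  have hsq : ∀ a b, 1 ≤ b → Fn a b ≤ m → a ≤ Nat.sqrt m := by
    intro a b hb h
    rw [Nat.le_sqrt]
    refine le_trans ?_ h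
    unfold Fn
    exact Nat.mul_le_mul (by omega) (by omega)
  have hsm : Nat.sqrt m ≤ m := Nat.sqrt_le_self m
  have e1 : MS w s c1 c2 c3 m = ∑ a1 ∈ Finset.Icc 1 N,
      ∑ b ∈ (Finset.Icc 1 m).filter (fun b => Fn (c1 * a1) b ≤ m ∧ c2 ∣ b ∧ c3 ∣ c1 * a1 + b),
        Th w s c1 c2 c3 a1 ((b / c2 : ℕ) : ZMod (WW w)) (((c1 * a1 + b) / c3 : ℕ) : ZMod (WW w)) := by
    rw [Finset.sum_sigma']
    unfold MS
    symm
    apply Finset.sum_bij (fun (x : (_ : ℕ) × ℕ) _ => ((c1 * x.1, x.2) : ℕ × ℕ))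
    · rintro ⟨a1, b⟩ hx
      simp only [Finset.mem_sigma, Finset.mem_filter, Finset.mem_Icc] at hx
      obtain ⟨⟨ha1, haN⟩, ⟨hb1, hbm⟩, hF, hd2, hd3⟩ := hx
      simp only [Rg, Finset.mem_filter, Finset.mem_product, Finset.mem_Icc]
      have h5 := hsq _ _ hb1 hF
      exact ⟨⟨⟨⟨Nat.mul_pos h1 ha1, by omega⟩, hb1, hbm⟩, hF⟩, dvd_mul_right _ _, hd2, hd3⟩
    · rintro ⟨a1, b⟩ _ ⟨a1', b'⟩ _ h
      simp only [Prod.mk.injEq] at h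
      have := Nat.eq_of_mul_eq_mul_left h1 h.1
      simp [this, h.2]
    · rintro ⟨a, b⟩ hx
      simp only [Rg, Finset.mem_filter, Finset.mem_product, Finset.mem_Icc] at hx
      obtain ⟨⟨⟨⟨ha1, ham⟩, hb1, hbm⟩, hF⟩, ⟨a1, rfl⟩, hd2, hd3⟩ := hx
      refine ⟨⟨a1, b⟩, ?_, rfl⟩
      simp only [Finset.mem_sigma, Finset.mem_filter, Finset.mem_Icc]
      have h5 := hsq _ _ hb1 hF
      refine ⟨⟨Nat.pos_of_mul_pos_left ha1, ?_⟩, ⟨hb1, hbm⟩, hF, hd2, hd3⟩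
      rw [hN, Nat.le_div_iff_mul_le h1]; linarith
    · rintro ⟨a1, b⟩ _
      simp only [Nat.mul_div_cancel_left _ h1]
  have hNle : (N:ℝ) ≤ Real.sqrt m / c1 := by
    rw [le_div_iff₀ hc1]
    apply Real.le_sqrt_of_sq_le
    have : N * c1 ≤ Nat.sqrt m := Nat.div_mul_le_self _ _
    have h6 : (N * c1) ^ 2 ≤ m := by
      calc (N * c1) ^ 2 ≤ (Nat.sqrt m) ^ 2 := Nat.pow_le_pow_left this 2
        _ ≤ m := Nat.sqrt_le' m
    exact_mod_cast h6
  have hNgt : Real.sqrt m < c1 * (N + 1) := by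
    rw [Real.sqrt_lt' (by positivity)]
    have : Nat.sqrt m < c1 * (N + 1) := Nat.lt_mul_div_succ _ h1
    have h6 : m < (c1 * (N + 1)) ^ 2 := by
      rw [pow_two]; exact Nat.sqrt_lt.1 this
    exact_mod_cast h6
  have hsum := sum_sg m hm0 c1 h1 N hNgt
  -- step 1
  have s1 : |MS w s c1 c2 c3 m - ∑ a1 ∈ Finset.Icc 1 N,
      sg m ((c1 : ℝ) * a1) / (c2 * c3) * Gf w s c1 c2 c3 a1| ≤ (WW w + 1) * (Real.sqrt m / c1) := by
    rw [e1]
    refine (abs_sum_sub_le _ _ _ _ (fun a1 _ => inner_sum w s c1 c2 c3 a1 m h2 h3 hc)).trans ?_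
    rw [Finset.sum_const, Nat.card_Icc, nsmul_eq_mul, add_tsub_cancel_right, mul_comm]
    gcongr
  have gm := gf_mem w s c1 c2 c3
  have s2 : |∑ a1 ∈ Finset.Icc 1 N, sg m ((c1 : ℝ) * a1) / (c2 * c3) * Gf w s c1 c2 c3 a1
      - gf w s c1 c2 c3 * ∑ a1 ∈ Finset.Icc 1 N, sg m ((c1 : ℝ) * a1) / (c2 * c3)|
      ≤ WW w * (Real.sqrt m / (c2 * c3)) := by
    rcases Nat.eq_zero_or_pos N with h | h
    · rw [h]; simp; positivity
    · refine (periodic_antitone (WW w) (fun a1 => Gf w s c1 c2 c3 a1)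
        (fun r => (Gf_mem w s _ _ _ _).1) (fun r => (Gf_mem w s _ _ _ _).2)
        (fun n => sg m ((c1:ℝ) * n) / (c2 * c3)) N ?_ ?_ h).trans ?_
      · intro n _ _
        have : sg m ((c1:ℝ) * ((n+1 : ℕ):ℝ)) ≤ sg m ((c1:ℝ) * n) :=
          sg_anti (by positivity) (by push_cast; nlinarith)
        show _ / _ ≤ _ / _
        gcongr
      · intro n _ _
        exact div_nonneg (sg_nonneg _ _) hq0.le
      · have : sg m ((c1:ℝ) * ((1 : ℕ):ℝ)) ≤ Real.sqrt m := sg_le (by positivity)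
        show _ * (_ / _) ≤ _
        gcongr
  have s3 : |gf w s c1 c2 c3 * ∑ a1 ∈ Finset.Icc 1 N, sg m ((c1 : ℝ) * a1) / (c2 * c3)
      - gf w s c1 c2 c3 / (c1 * c2 * c3) * (AA * m)| ≤ Real.sqrt m / (c2 * c3) := by
    rw [← Finset.sum_div]
    have : gf w s c1 c2 c3 * ((∑ a1 ∈ Finset.Icc 1 N, sg m ((c1 : ℝ) * a1)) / (c2 * c3))
      - gf w s c1 c2 c3 / (c1 * c2 * c3) * (AA * m)
      = gf w s c1 c2 c3 * ((∑ a1 ∈ Finset.Icc 1 N, sg m ((c1 : ℝ) * a1) - m * AA / c1) / (c2 * c3)) := by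
      have : (c2:ℝ) ≠ 0 := by intro h; rw [h] at hq0; simp at hq0
      have : (c3:ℝ) ≠ 0 := by intro h; rw [h] at hq0; simp at hq0
      field_simp
    rw [this, abs_mul, abs_div, abs_of_nonneg gm.1, abs_of_pos hq0]
    calc _ ≤ 1 * (Real.sqrt m / (c2 * c3)) := by
          gcongr
          exact gm.2
      _ = _ := by ring
  have tri := abs_sub_le (MS w s c1 c2 c3 m) (∑ a1 ∈ Finset.Icc 1 N,
      sg m ((c1 : ℝ) * a1) / (c2 * c3) * Gf w s c1 c2 c3 a1) (gf w s c1 c2 c3 / (c1 * c2 * c3) * (AA * m))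
  have tri2 := abs_sub_le (∑ a1 ∈ Finset.Icc 1 N,
      sg m ((c1 : ℝ) * a1) / (c2 * c3) * Gf w s c1 c2 c3 a1)
      (gf w s c1 c2 c3 * ∑ a1 ∈ Finset.Icc 1 N, sg m ((c1 : ℝ) * a1) / (c2 * c3))
      (gf w s c1 c2 c3 / (c1 * c2 * c3) * (AA * m))
  calc _ ≤ (WW w + 1) * (Real.sqrt m / c1) + (WW w * (Real.sqrt m / (c2 * c3)) + Real.sqrt m / (c2 * c3)) := by
        linarith
    _ = _ := by ring

end DP5

namespace DP5

lemma mem_box {N : ℕ} {c : ℕ × ℕ × ℕ} : c ∈ box N ↔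
    (1 ≤ c.1 ∧ c.1 ≤ N) ∧ (1 ≤ c.2.1 ∧ c.2.1 ≤ N) ∧ (1 ≤ c.2.2 ∧ c.2.2 ≤ N) := by
  simp [box]

lemma inv_box (N : ℕ) (C : Finset (ℕ × ℕ × ℕ)) (hC : C ⊆ box N) :
    ∑ c ∈ C, (1:ℝ) / (c.1 * c.2.1 * c.2.2) ≤ (1 + Real.log N) ^ 3 := by
  have h1 : ∑ c ∈ C, (1:ℝ) / (c.1 * c.2.1 * c.2.2) ≤ ∑ c ∈ box N, (1:ℝ) / (c.1 * c.2.1 * c.2.2) :=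
    Finset.sum_le_sum_of_subset_of_nonneg hC (fun _ _ _ => by positivity)
  refine h1.trans ?_
  rw [sum_box N (fun c1 c2 c3 => (1:ℝ) / (c1 * c2 * c3))]
  have e : ∑ c1 ∈ Finset.Icc 1 N, ∑ c2 ∈ Finset.Icc 1 N, ∑ c3 ∈ Finset.Icc 1 N, (1:ℝ) / (c1 * c2 * c3)
      = (∑ c ∈ Finset.Icc 1 N, (1:ℝ) / c) ^ 3 := by
    rw [pow_succ, pow_two, Finset.sum_mul_sum, Finset.sum_mul]
    refine Finset.sum_congr rfl fun c1 _ => ?_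
    rw [Finset.sum_mul_sum]
    refine Finset.sum_congr rfl fun c2 _ => Finset.sum_congr rfl fun c3 _ => ?_
    rw [one_div_mul_one_div, one_div_mul_one_div]
  rw [e]
  exact pow_le_pow_left₀ (Finset.sum_nonneg fun _ _ => by positivity) (harm_le N) 3

lemma main_gen (w : ℕ) (hw : 1 ≤ w) (s : Bool × Bool × Bool) (m N : ℕ) (hm : 1 ≤ m)
    (C : Finset (ℕ × ℕ × ℕ)) (hC : C ⊆ box N) (L e Z : ℝ) (hz : 0 ≤ Z)
    (hZ : ∀ c ∈ C, (c.1 : ℝ) ≤ Z ∧ (c.2.1 * c.2.2 : ℝ) ≤ Z)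
    (hL : |∑ c ∈ C, gf w s c.1 c.2.1 c.2.2 / (c.1 * c.2.1 * c.2.2) - L| ≤ e) :
    |∑ c ∈ C.filter (fun c => Nat.Coprime c.2.1 c.2.2), MS w s c.1 c.2.1 c.2.2 m - L * (AA * m)|
      ≤ (AA * m) * (e + (1 + Real.log N) ^ 3 / w) +
        (WW w + 1) * Real.sqrt m * (2 * Z * (1 + Real.log N) ^ 3) := by
  have hA : 0 ≤ AA * m := mul_nonneg AA_nonneg (by positivity)
  have n1 := noncop_sum w hw s N C hC
  have sp := Finset.sum_filter_add_sum_filter_not C (fun c => Nat.Coprime c.2.1 c.2.2)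
    (fun c => gf w s c.1 c.2.1 c.2.2 / (c.1 * c.2.1 * c.2.2))
  have h1 : |∑ c ∈ C.filter (fun c => Nat.Coprime c.2.1 c.2.2), MS w s c.1 c.2.1 c.2.2 m
      - ∑ c ∈ C.filter (fun c => Nat.Coprime c.2.1 c.2.2),
        gf w s c.1 c.2.1 c.2.2 / (c.1 * c.2.1 * c.2.2) * (AA * m)|
      ≤ (WW w + 1) * Real.sqrt m * (2 * Z * (1 + Real.log N) ^ 3) := by
    refine (abs_sum_sub_le _ _ _ (fun c => (WW w + 1) * Real.sqrt m * (2 * Z * (1 / (c.1 * c.2.1 * c.2.2)))) ?_).trans ?_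
    · intro c hc
      rw [Finset.mem_filter] at hc
      obtain ⟨⟨b1, _⟩, ⟨b2, _⟩, ⟨b3, _⟩⟩ := mem_box.1 (hC hc.1)
      obtain ⟨z1, z2⟩ := hZ c hc.1
      refine (ML w s c.1 c.2.1 c.2.2 m hm b1 b2 b3 hc.2).trans ?_
      have k1 : (1:ℝ) ≤ c.1 := by exact_mod_cast b1
      have k2 : (1:ℝ) ≤ c.2.1 := by exact_mod_cast b2
      have k3 : (1:ℝ) ≤ c.2.2 := by exact_mod_cast b3
      gcongr
      have e1 : (1:ℝ) / c.1 + 1 / (c.2.1 * c.2.2) = (c.2.1 * c.2.2 + c.1) * (1 / (c.1 * c.2.1 * c.2.2)) := by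
        field_simp
      rw [e1]
      gcongr
      linarith
    · rw [← Finset.mul_sum, ← Finset.mul_sum]
      have hZ0 : ∑ c ∈ C.filter (fun c => Nat.Coprime c.2.1 c.2.2), (1:ℝ) / (c.1 * c.2.1 * c.2.2)
          ≤ (1 + Real.log N) ^ 3 := inv_box N _ ((Finset.filter_subset _ _).trans hC)
      gcongr
  rw [← Finset.sum_mul] at h1
  set S1 := ∑ c ∈ C.filter (fun c => Nat.Coprime c.2.1 c.2.2),
        gf w s c.1 c.2.1 c.2.2 / (c.1 * c.2.1 * c.2.2)
  set S2 := ∑ c ∈ C.filter (fun c => ¬ Nat.Coprime c.2.1 c.2.2),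
        gf w s c.1 c.2.1 c.2.2 / (c.1 * c.2.1 * c.2.2)
  rw [← sp] at hL
  have h2 : |S1 * (AA * m) - L * (AA * m)| ≤ (AA * m) * (e + (1 + Real.log N) ^ 3 / w) := by
    rw [← sub_mul, abs_mul, abs_of_nonneg hA, mul_comm]
    gcongr
    have : S1 - L = (S1 + S2 - L) - S2 := by ring
    rw [this]
    exact (abs_sub _ _).trans (add_le_add hL n1)
  have := abs_sub_le (∑ c ∈ C.filter (fun c => Nat.Coprime c.2.1 c.2.2), MS w s c.1 c.2.1 c.2.2 m)
    (S1 * (AA * m)) (L * (AA * m))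
  linarith

end DP5

namespace DP5

lemma count_res (S : Finset ℕ) (M q : ℕ) (hq : 1 ≤ q) (hS : ∀ v ∈ S, v ≤ M)
    (h : ∀ v ∈ S, ∀ v' ∈ S, (q:ℤ) ∣ (v:ℤ) - v') : S.card ≤ M / q + 1 := by
  have := Finset.card_le_card_of_injOn (s := S) (t := Finset.range (M / q + 1)) (fun v => v / q)
    (fun v hv => by
      simp only [Finset.coe_range, Set.mem_Iio]
      exact Nat.lt_succ_of_le (Nat.div_le_div_right (hS v hv)))
    (fun v hv v' hv' he => by
      have h1 := h v hv v' hv'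
      have h2 : v % q = v' % q := by
        have : v' ≡ v [MOD q] := (Nat.modEq_iff_dvd).2 h1
        exact this.symm
      simp only at he
      rw [← Nat.div_add_mod v q, ← Nat.div_add_mod v' q, he, h2])
  simpa using this

/-- the basic counting lemma -/
lemma lemU (T : Finset (ℕ × ℕ)) (t : ℕ → ℕ → ℕ) (M1 M n : ℕ) (hn : 1 ≤ n)
    (hT1 : ∀ P ∈ T, 1 ≤ P.1 ∧ P.1 ≤ M1 ∧ P.2 ≤ M)
    (hTc : ∀ P ∈ T, Nat.Coprime P.2 (t P.1 P.2))
    (hTt : ∀ u v v' c, (u, v) ∈ T → (u, v') ∈ T → c ∣ t u v → c ∣ t u v' → (c:ℤ) ∣ (v:ℤ) - v')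
    (C : Finset (ℕ × ℕ × ℕ)) (hC : ∀ c ∈ C, 1 ≤ c.1 ∧ 1 ≤ c.2.1 ∧ 1 ≤ c.2.2 ∧ c.2.1 * c.2.2 ≤ M) :
    ∑ P ∈ T, ((C.filter (fun c => n * c.1 ∣ P.1 ∧ c.2.1 ∣ P.2 ∧ c.2.2 ∣ t P.1 P.2)).card : ℝ)
      ≤ 2 * M1 * M / n * ∑ c ∈ C, (1:ℝ) / (c.1 * c.2.1 * c.2.2) := by
  have e : ∑ P ∈ T, ((C.filter (fun c => n * c.1 ∣ P.1 ∧ c.2.1 ∣ P.2 ∧ c.2.2 ∣ t P.1 P.2)).card : ℝ)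
      = ∑ c ∈ C, ((T.filter (fun P => n * c.1 ∣ P.1 ∧ c.2.1 ∣ P.2 ∧ c.2.2 ∣ t P.1 P.2)).card : ℝ) := by
    simp_rw [Finset.card_filter]
    push_cast
    rw [Finset.sum_comm]
  rw [e, Finset.mul_sum]
  refine Finset.sum_le_sum fun c hc => ?_
  obtain ⟨h1, h2, h3, h4⟩ := hC c hc
  set T' := T.filter (fun P => n * c.1 ∣ P.1 ∧ c.2.1 ∣ P.2 ∧ c.2.2 ∣ t P.1 P.2) with hT'
  have n0 : (0:ℝ) < n := by exact_mod_cast hn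
  have k1 : (0:ℝ) < c.1 := by exact_mod_cast h1
  have k2 : (0:ℝ) < c.2.1 := by exact_mod_cast h2
  have k3 : (0:ℝ) < c.2.2 := by exact_mod_cast h3
  by_cases hne : T'.Nonempty
  swap
  · rw [Finset.not_nonempty_iff_eq_empty] at hne
    rw [hne]; simp; positivity
  have hcop : Nat.Coprime c.2.1 c.2.2 := by
    obtain ⟨P, hP⟩ := hne
    rw [hT', Finset.mem_filter] at hP
    exact Nat.Coprime.of_dvd hP.2.2.1 hP.2.2.2 (hTc P hP.1)
  have hcard : T'.card ≤ (M1 / (n * c.1)) * (M / (c.2.1 * c.2.2) + 1) := by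
    have hm : ∀ P ∈ T', P.1 ∈ (Finset.Icc 1 (M1 / (n * c.1))).image (fun i => n * c.1 * i) := by
      intro P hP
      rw [hT', Finset.mem_filter] at hP
      obtain ⟨k, hk⟩ := hP.2.1
      obtain ⟨p1, p2, p3⟩ := hT1 P hP.1
      rw [Finset.mem_image]
      refine ⟨k, ?_, hk.symm⟩
      rw [Finset.mem_Icc]
      refine ⟨?_, ?_⟩
      · rcases Nat.eq_zero_or_pos k with h | h
        · rw [h] at hk; omega
        · exact h
      · rw [Nat.le_div_iff_mul_le (Nat.mul_pos hn h1)]; nlinarith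
    have := Finset.card_le_mul_card_image_of_maps_to hm (M / (c.2.1 * c.2.2) + 1) ?_
    · refine this.trans ?_
      rw [mul_comm]
      gcongr
      refine Finset.card_image_le.trans ?_
      simp
    · intro u _
      have hinj : (T'.filter (fun P => P.1 = u)).card = ((T'.filter (fun P => P.1 = u)).image Prod.snd).card := by
        rw [Finset.card_image_of_injOn]
        rintro ⟨a, b⟩ h ⟨a', b'⟩ h' hh
        simp only [Finset.coe_filter, Set.mem_setOf_eq] at h h'
        simp only at hh
        rw [Prod.mk.injEq]; exact ⟨h.2.trans h'.2.symm, hh⟩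
      rw [hinj]
      have hmem : ∀ v ∈ (T'.filter (fun P => P.1 = u)).image Prod.snd,
          (u, v) ∈ T ∧ c.2.1 ∣ v ∧ c.2.2 ∣ t u v := by
        intro v hv
        rw [Finset.mem_image] at hv
        obtain ⟨⟨a, b⟩, hP, hb⟩ := hv
        rw [Finset.mem_filter, hT', Finset.mem_filter] at hP
        obtain ⟨⟨hP1, _, hP2, hP3⟩, rfl⟩ := hP
        subst hb
        exact ⟨hP1, hP2, hP3⟩
      apply count_res _ _ _ (Nat.mul_pos h2 h3)
      · intro v hv; exact (hT1 _ (hmem v hv).1).2.2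
      · intro v hv v' hv'
        obtain ⟨m1, m2, m3⟩ := hmem v hv
        obtain ⟨m1', m2', m3'⟩ := hmem v' hv'
        push_cast
        apply IsCoprime.mul_dvd (Nat.isCoprime_iff_coprime.2 hcop)
        · exact dvd_sub (by exact_mod_cast m2) (by exact_mod_cast m2')
        · exact hTt u v v' _ m1 m1' m3 m3'
  have c1 : ((M1 / (n * c.1) : ℕ) : ℝ) ≤ M1 / (n * c.1) := by
    have := @Nat.cast_div_le ℝ _ _ _ M1 (n * c.1)
    push_cast at this; exact this
  have c2 : ((M / (c.2.1 * c.2.2) + 1 : ℕ) : ℝ) ≤ 2 * M / (c.2.1 * c.2.2) := by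
    have := @Nat.cast_div_le ℝ _ _ _ M (c.2.1 * c.2.2)
    push_cast at this ⊢
    have h5 : (1:ℝ) ≤ M / (c.2.1 * c.2.2) := by
      rw [le_div_iff₀ (by positivity), one_mul]; exact_mod_cast h4
    have : 2 * (M:ℝ) / (c.2.1 * c.2.2) = M / (c.2.1 * c.2.2) + M / (c.2.1 * c.2.2) := by ring
    linarith
  calc (T'.card : ℝ) ≤ ((M1 / (n * c.1) : ℕ) : ℝ) * ((M / (c.2.1 * c.2.2) + 1 : ℕ) : ℝ) := by
        exact_mod_cast hcard
    _ ≤ (M1 / (n * c.1)) * (2 * M / (c.2.1 * c.2.2)) := by gcongr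
    _ = _ := by field_simp

def tau (n : ℕ) : ℕ := n.divisors.card

/-- divisors below a bound -/
def sd (z n : ℕ) : Finset ℕ := (Finset.Icc 1 z).filter (fun d => d ∣ n)

lemma tau_le (n M : ℕ) (hn : 1 ≤ n) (hM : n ≤ M) : tau n ≤ 2 * (sd (Nat.sqrt M) n).card := by
  have key : n.divisors ⊆ sd (Nat.sqrt M) n ∪ (sd (Nat.sqrt M) n).image (fun d => n / d) := by
    intro d hd
    rw [Nat.mem_divisors] at hd
    obtain ⟨⟨e, he⟩, _⟩ := hd
    have hd0 : 0 < d := Nat.pos_of_ne_zero (by rintro rfl; omega)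
    have he0 : 0 < e := Nat.pos_of_ne_zero (by rintro rfl; omega)
    rw [Finset.mem_union, Finset.mem_image]
    rcases le_total d e with h | h
    · left
      simp only [sd, Finset.mem_filter, Finset.mem_Icc]
      refine ⟨⟨hd0, ?_⟩, ⟨e, he⟩⟩
      rw [Nat.le_sqrt]; nlinarith
    · right
      refine ⟨e, ?_, by rw [he]; exact Nat.mul_div_cancel _ he0⟩
      simp only [sd, Finset.mem_filter, Finset.mem_Icc]
      refine ⟨⟨he0, ?_⟩, ⟨d, by rw [he, mul_comm]⟩⟩
      rw [Nat.le_sqrt]; nlinarith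
  calc tau n ≤ _ := Finset.card_le_card key
    _ ≤ _ := Finset.card_union_le _ _
    _ ≤ (sd (Nat.sqrt M) n).card + (sd (Nat.sqrt M) n).card := Nat.add_le_add_left Finset.card_image_le _
    _ = _ := by ring

lemma tau_mul_le (m n : ℕ) : tau (m * n) ≤ tau m * tau n := by
  unfold tau
  rw [Nat.divisors_mul]
  exact Finset.card_mul_le

lemma box_filter_card (z : ℕ) (x y t : ℕ) :
    ((box z).filter (fun c => c.1 ∣ x ∧ c.2.1 ∣ y ∧ c.2.2 ∣ t)).card
      = (sd z x).card * ((sd z y).card * (sd z t).card) := by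
  rw [← Finset.card_product, ← Finset.card_product]
  congr 1
  ext ⟨a, b, c⟩
  simp only [box, sd, Finset.mem_filter, Finset.mem_product]
  tauto

lemma UBT (T : Finset (ℕ × ℕ)) (t : ℕ → ℕ → ℕ) (M1 M n : ℕ) (hn : 1 ≤ n) (hM : M1 ≤ M)
    (hT1 : ∀ P ∈ T, 1 ≤ P.1 ∧ P.1 ≤ M1 ∧ P.2 ≤ M)
    (hT2 : ∀ P ∈ T, n ∣ P.1 ∧ 1 ≤ P.2 ∧ 1 ≤ t P.1 P.2 ∧ t P.1 P.2 ≤ M)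
    (hTc : ∀ P ∈ T, Nat.Coprime P.2 (t P.1 P.2))
    (hTt : ∀ u v v' c, (u, v) ∈ T → (u, v') ∈ T → c ∣ t u v → c ∣ t u v' → (c:ℤ) ∣ (v:ℤ) - v') :
    ∑ P ∈ T, ((tau (P.1 / n) * tau P.2 * tau (t P.1 P.2) : ℕ) : ℝ)
      ≤ 16 * M1 * M / n * (1 + Real.log (Nat.sqrt M)) ^ 3 := by
  have hU := lemU T t M1 M n hn hT1 hTc hTt (box (Nat.sqrt M)) (by
    intro c hc
    obtain ⟨⟨b1, b1'⟩, ⟨b2, b2'⟩, ⟨b3, b3'⟩⟩ := mem_box.1 hc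
    refine ⟨b1, b2, b3, (Nat.mul_le_mul b2' b3').trans (Nat.sqrt_le M)⟩)
  have hI := inv_box (Nat.sqrt M) _ subset_rfl
  have hle : ∑ P ∈ T, ((tau (P.1 / n) * tau P.2 * tau (t P.1 P.2) : ℕ) : ℝ) ≤
      8 * ∑ P ∈ T, (((box (Nat.sqrt M)).filter
        (fun c => n * c.1 ∣ P.1 ∧ c.2.1 ∣ P.2 ∧ c.2.2 ∣ t P.1 P.2)).card : ℝ) := by
    rw [Finset.mul_sum]
    refine Finset.sum_le_sum fun P hP => ?_
    obtain ⟨p1, p2, p3⟩ := hT1 P hP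
    obtain ⟨⟨k, hk⟩, q2, q3, q4⟩ := hT2 P hP
    have hk' : P.1 / n = k := by rw [hk]; exact Nat.mul_div_cancel_left _ hn
    have hk0 : 1 ≤ k := Nat.pos_of_ne_zero (by rintro rfl; omega)
    have hkM : k ≤ M := by
      have : k ≤ n * k := Nat.le_mul_of_pos_left k hn
      omega
    have e : (box (Nat.sqrt M)).filter
        (fun c => n * c.1 ∣ P.1 ∧ c.2.1 ∣ P.2 ∧ c.2.2 ∣ t P.1 P.2) = (box (Nat.sqrt M)).filter
        (fun c => c.1 ∣ k ∧ c.2.1 ∣ P.2 ∧ c.2.2 ∣ t P.1 P.2) := by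
      congr 1
      funext c
      rw [hk, Nat.mul_dvd_mul_iff_left hn]
    rw [e, box_filter_card, hk']
    have t1 := tau_le k M hk0 hkM
    have t2 := tau_le P.2 M q2 p3
    have t3 := tau_le (t P.1 P.2) M q3 q4
    have : tau k * tau P.2 * tau (t P.1 P.2) ≤ (2 * (sd (Nat.sqrt M) k).card) *
      (2 * (sd (Nat.sqrt M) P.2).card) * (2 * (sd (Nat.sqrt M) (t P.1 P.2)).card) := by gcongr
    have h' : tau k * tau P.2 * tau (t P.1 P.2) ≤ 8 * ((sd (Nat.sqrt M) k).card * (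
      (sd (Nat.sqrt M) P.2).card * (sd (Nat.sqrt M) (t P.1 P.2)).card)) := by
      refine this.trans (le_of_eq (by ring))
    exact_mod_cast h'
  calc _ ≤ _ := hle
    _ ≤ 8 * (2 * M1 * M / n * ∑ c ∈ box (Nat.sqrt M), (1:ℝ) / (c.1 * c.2.1 * c.2.2)) := by gcongr
    _ ≤ 8 * (2 * M1 * M / n * (1 + Real.log (Nat.sqrt M)) ^ 3) := by gcongr
    _ = _ := by ring

end DP5

namespace DP5

def CR (m : ℕ) : Finset (ℕ × ℕ) := (Rg m).filter (fun P => Nat.Coprime P.1 P.2)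

def T3 (P : ℕ × ℕ) : ℝ := ((tau P.1 * tau P.2 * tau (P.1 + P.2) : ℕ) : ℝ)

lemma T3_nonneg (P : ℕ × ℕ) : 0 ≤ T3 P := by unfold T3; positivity

lemma mem_Rg {m : ℕ} {P : ℕ × ℕ} : P ∈ Rg m ↔ 1 ≤ P.1 ∧ 1 ≤ P.2 ∧ Fn P.1 P.2 ≤ m := by
  simp only [Rg, Finset.mem_filter, Finset.mem_product, Finset.mem_Icc]
  constructor
  · rintro ⟨⟨⟨a, _⟩, b, _⟩, c⟩; exact ⟨a, b, c⟩
  · rintro ⟨a, b, c⟩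
    have h1 := le_Fn (a := P.1) b
    have h2 : P.1 ≤ Fn P.1 P.2 := by
      unfold Fn
      calc P.1 = P.1 * 1 := by ring
        _ ≤ _ := Nat.mul_le_mul (by omega) (by omega)
    exact ⟨⟨⟨a, by omega⟩, b, by omega⟩, c⟩

lemma mem_CR {m : ℕ} {P : ℕ × ℕ} : P ∈ CR m ↔ 1 ≤ P.1 ∧ 1 ≤ P.2 ∧ Fn P.1 P.2 ≤ m ∧ Nat.Coprime P.1 P.2 := by
  rw [CR, Finset.mem_filter, mem_Rg]; tauto

lemma Rg_bd {m a b : ℕ} (h : Fn a b ≤ m) : a ≤ Nat.sqrt m ∧ b ≤ Nat.sqrt m ∧ a + b ≤ 2 * Nat.sqrt m := by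
  have h1 : max a b ≤ Nat.sqrt m := by
    rw [Nat.le_sqrt]
    refine le_trans ?_ h
    unfold Fn
    exact Nat.mul_le_mul (by omega) le_rfl
  omega

lemma Fn_comm (a b : ℕ) : Fn a b = Fn b a := by unfold Fn; rw [add_comm, max_comm]

lemma log_sqrt_le (m : ℕ) (hm : 1 ≤ m) : 1 + Real.log (Nat.sqrt (2 * Nat.sqrt m)) ≤ 1 + Real.log m := by
  have h1 : 1 ≤ Nat.sqrt m := by rw [Nat.le_sqrt]; omega
  have h2 : 1 ≤ Nat.sqrt (2 * Nat.sqrt m) := by rw [Nat.le_sqrt]; omega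
  have h3 : Nat.sqrt (2 * Nat.sqrt m) ≤ m := by
    have hh := Nat.sqrt_le m
    rcases Nat.lt_or_ge (Nat.sqrt m) 2 with h | h
    · have : Nat.sqrt m = 1 := by omega
      rw [this]
      have : Nat.sqrt (2 * 1) = 1 := by norm_num
      omega
    · have := Nat.sqrt_le_self (2 * Nat.sqrt m)
      nlinarith
  gcongr

lemma one_le_L (m : ℕ) : 1 ≤ 1 + Real.log m := by
  have := Real.log_natCast_nonneg m; linarith

lemma ub_a (m : ℕ) (hm : 1 ≤ m) (n M1 : ℕ) (hn : 1 ≤ n) (hM : M1 ≤ 2 * Nat.sqrt m)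
    (T : Finset (ℕ × ℕ)) (hT : T ⊆ CR m) (h : ∀ P ∈ T, P.1 ≤ M1 ∧ n ∣ P.1) :
    ∑ P ∈ T, ((tau (P.1 / n) * tau P.2 * tau (P.1 + P.2) : ℕ) : ℝ)
      ≤ 32 * M1 * Nat.sqrt m / n * (1 + Real.log m) ^ 3 := by
  have := UBT T (fun u v => u + v) M1 (2 * Nat.sqrt m) n hn hM ?_ ?_ ?_ ?_
  · refine this.trans ?_
    push_cast
    have hl := log_sqrt_le m hm
    have hl0 := one_le_L (Nat.sqrt (2 * Nat.sqrt m))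
    calc 16 * (M1:ℝ) * (2 * Nat.sqrt m) / n * (1 + Real.log (Nat.sqrt (2 * Nat.sqrt m))) ^ 3
        ≤ 16 * (M1:ℝ) * (2 * Nat.sqrt m) / n * (1 + Real.log m) ^ 3 := by gcongr
      _ = _ := by ring
  · intro P hP
    obtain ⟨p1, p2, p3, p4⟩ := mem_CR.1 (hT hP)
    have := Rg_bd p3
    exact ⟨p1, (h P hP).1, by omega⟩
  · intro P hP
    obtain ⟨p1, p2, p3, p4⟩ := mem_CR.1 (hT hP)
    have := Rg_bd p3
    exact ⟨(h P hP).2, p2, by omega, this.2.2⟩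
  · intro P hP
    obtain ⟨p1, p2, p3, p4⟩ := mem_CR.1 (hT hP)
    simpa using p4.symm
  · intro u v v' c _ _ h1 h2
    have : (v:ℤ) - v' = ((u + v : ℕ):ℤ) - ((u + v' : ℕ):ℤ) := by push_cast; ring
    rw [this]
    exact dvd_sub (by exact_mod_cast h1) (by exact_mod_cast h2)

lemma swap_CR {m : ℕ} {T : Finset (ℕ × ℕ)} (hT : T ⊆ CR m) : T.image Prod.swap ⊆ CR m := by
  intro P hP
  rw [Finset.mem_image] at hP
  obtain ⟨Q, hQ, rfl⟩ := hP
  obtain ⟨p1, p2, p3, p4⟩ := mem_CR.1 (hT hQ)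
  exact mem_CR.2 ⟨p2, p1, by rw [Fn_comm]; exact p3, p4.symm⟩

lemma ub_b (m : ℕ) (hm : 1 ≤ m) (n M1 : ℕ) (hn : 1 ≤ n) (hM : M1 ≤ 2 * Nat.sqrt m)
    (T : Finset (ℕ × ℕ)) (hT : T ⊆ CR m) (h : ∀ P ∈ T, P.2 ≤ M1 ∧ n ∣ P.2) :
    ∑ P ∈ T, ((tau P.1 * tau (P.2 / n) * tau (P.1 + P.2) : ℕ) : ℝ)
      ≤ 32 * M1 * Nat.sqrt m / n * (1 + Real.log m) ^ 3 := by
  have := ub_a m hm n M1 hn hM (T.image Prod.swap) (swap_CR hT) (by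
    intro P hP
    rw [Finset.mem_image] at hP
    obtain ⟨Q, hQ, rfl⟩ := hP
    exact h Q hQ)
  rw [Finset.sum_image (fun x _ y _ hxy => Prod.swap_injective hxy)] at this
  refine le_trans (le_of_eq ?_) this
  refine Finset.sum_congr rfl fun P _ => ?_
  simp only [Prod.fst_swap, Prod.snd_swap]
  rw [add_comm P.2 P.1]; congr 2; ring

lemma ub_c (m : ℕ) (hm : 1 ≤ m) (n : ℕ) (hn : 1 ≤ n)
    (T : Finset (ℕ × ℕ)) (hT : T ⊆ CR m) (h : ∀ P ∈ T, n ∣ P.1 + P.2) :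
    ∑ P ∈ T, ((tau P.1 * tau P.2 * tau ((P.1 + P.2) / n) : ℕ) : ℝ)
      ≤ 64 * Nat.sqrt m * Nat.sqrt m / n * (1 + Real.log m) ^ 3 := by
  have hinj : Set.InjOn (fun P : ℕ × ℕ => (P.1 + P.2, P.1)) T := by
    rintro ⟨a, b⟩ _ ⟨a', b'⟩ _ hh
    simp only [Prod.mk.injEq] at hh ⊢
    omega
  have := UBT (T.image (fun P => (P.1 + P.2, P.1))) (fun u v => u - v) (2 * Nat.sqrt m) (2 * Nat.sqrt m) n hn le_rfl ?_ ?_ ?_ ?_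
  · rw [Finset.sum_image hinj] at this
    have e : ∑ P ∈ T, ((tau P.1 * tau P.2 * tau ((P.1 + P.2) / n) : ℕ) : ℝ) =
      ∑ P ∈ T, ((tau ((P.1 + P.2) / n) * tau P.1 * tau (P.1 + P.2 - P.1) : ℕ) : ℝ) := by
      refine Finset.sum_congr rfl fun P _ => ?_
      rw [Nat.add_sub_cancel_left]; congr 1; ring
    rw [e]
    refine this.trans ?_
    push_cast
    have hl := log_sqrt_le m hm
    have hl0 := one_le_L (Nat.sqrt (2 * Nat.sqrt m))
    calc 16 * (2 * (Nat.sqrt m:ℝ)) * (2 * Nat.sqrt m) / n * (1 + Real.log (Nat.sqrt (2 * Nat.sqrt m))) ^ 3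
        ≤ 16 * (2 * (Nat.sqrt m:ℝ)) * (2 * Nat.sqrt m) / n * (1 + Real.log m) ^ 3 := by gcongr
      _ = _ := by ring
  · intro P hP
    rw [Finset.mem_image] at hP
    obtain ⟨Q, hQ, rfl⟩ := hP
    obtain ⟨p1, p2, p3, p4⟩ := mem_CR.1 (hT hQ)
    have := Rg_bd p3
    dsimp only
    omega
  · intro P hP
    rw [Finset.mem_image] at hP
    obtain ⟨Q, hQ, rfl⟩ := hP
    obtain ⟨p1, p2, p3, p4⟩ := mem_CR.1 (hT hQ)
    have := Rg_bd p3
    exact ⟨h Q hQ, by dsimp only; omega⟩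
  · intro P hP
    rw [Finset.mem_image] at hP
    obtain ⟨Q, hQ, rfl⟩ := hP
    obtain ⟨p1, p2, p3, p4⟩ := mem_CR.1 (hT hQ)
    dsimp only
    rwa [Nat.add_sub_cancel_left]
  · intro u v v' c m1 m2 h1 h2
    have hle : ∀ v, (u, v) ∈ T.image (fun P => (P.1 + P.2, P.1)) → v ≤ u := by
      intro v hv
      rw [Finset.mem_image] at hv
      obtain ⟨Q, hQ, hh⟩ := hv
      simp only [Prod.mk.injEq] at hh
      omega
    have l1 := hle v m1
    have l2 := hle v' m2
    have : (v:ℤ) - v' = ((u - v' : ℕ):ℤ) - ((u - v : ℕ):ℤ) := by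
      push_cast [Nat.cast_sub l1, Nat.cast_sub l2]; ring
    rw [this]
    exact dvd_sub (by exact_mod_cast h2) (by exact_mod_cast h1)

lemma sqrt_mul_le (m : ℕ) : (Nat.sqrt m : ℝ) * Nat.sqrt m ≤ m := by exact_mod_cast Nat.sqrt_le m

lemma UB0 (m : ℕ) (hm : 1 ≤ m) : ∑ P ∈ CR m, T3 P ≤ 32 * m * (1 + Real.log m) ^ 3 := by
  have := ub_a m hm 1 (Nat.sqrt m) le_rfl (by omega) (CR m) subset_rfl (fun P hP => by
    obtain ⟨p1, p2, p3, p4⟩ := mem_CR.1 hP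
    exact ⟨(Rg_bd p3).1, one_dvd _⟩)
  simp only [Nat.div_one] at this
  have h2 := sqrt_mul_le m
  have hL := one_le_L m
  calc _ ≤ _ := this
    _ = 32 * ((Nat.sqrt m : ℝ) * Nat.sqrt m) * (1 + Real.log m) ^ 3 := by push_cast; ring
    _ ≤ _ := by gcongr

lemma UBstrip (m w : ℕ) (hm : 1 ≤ m) (hw : 1 ≤ w) :
    ∑ P ∈ (CR m).filter (fun P => P.1 * w < Nat.sqrt m ∨ P.2 * w < Nat.sqrt m), T3 P
      ≤ 64 * m / w * (1 + Real.log m) ^ 3 := by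
  have hw0 : (0:ℝ) < w := by exact_mod_cast hw
  have hL := one_le_L m
  have hq : Nat.sqrt m / w ≤ Nat.sqrt m := Nat.div_le_self _ _
  have hb : 32 * ((Nat.sqrt m / w : ℕ):ℝ) * Nat.sqrt m / (1:ℕ) * (1 + Real.log m) ^ 3
      ≤ 32 * m / w * (1 + Real.log m) ^ 3 := by
    have h1 : ((Nat.sqrt m / w : ℕ):ℝ) ≤ Nat.sqrt m / w := Nat.cast_div_le
    have h2 := sqrt_mul_le m
    refine mul_le_mul_of_nonneg_right ?_ (by positivity)
    calc 32 * ((Nat.sqrt m / w : ℕ):ℝ) * Nat.sqrt m / (1:ℕ) = 32 * ((Nat.sqrt m / w : ℕ):ℝ) * Nat.sqrt m := by simp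
      _ ≤ 32 * (Nat.sqrt m / w : ℝ) * Nat.sqrt m := by gcongr
      _ = 32 * ((Nat.sqrt m : ℝ) * Nat.sqrt m) / w := by ring
      _ ≤ _ := by gcongr
  rw [Finset.filter_or]
  have hun : ∑ P ∈ (CR m).filter (fun P => P.1 * w < Nat.sqrt m) ∪ (CR m).filter (fun P => P.2 * w < Nat.sqrt m), T3 P
    ≤ ∑ P ∈ (CR m).filter (fun P => P.1 * w < Nat.sqrt m), T3 P + ∑ P ∈ (CR m).filter (fun P => P.2 * w < Nat.sqrt m), T3 P := by
    rw [← Finset.sum_union_inter]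
    have := Finset.sum_nonneg (fun P (_ : P ∈ (CR m).filter (fun P => P.1 * w < Nat.sqrt m) ∩ (CR m).filter (fun P => P.2 * w < Nat.sqrt m)) => T3_nonneg P)
    linarith
  have h1 := ub_a m hm 1 (Nat.sqrt m / w) le_rfl (by omega) ((CR m).filter (fun P => P.1 * w < Nat.sqrt m))
    (Finset.filter_subset _ _) (fun P hP => by
      rw [Finset.mem_filter] at hP
      exact ⟨(Nat.le_div_iff_mul_le hw).2 hP.2.le, one_dvd _⟩)
  have h2 := ub_b m hm 1 (Nat.sqrt m / w) le_rfl (by omega) ((CR m).filter (fun P => P.2 * w < Nat.sqrt m))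
    (Finset.filter_subset _ _) (fun P hP => by
      rw [Finset.mem_filter] at hP
      exact ⟨(Nat.le_div_iff_mul_le hw).2 hP.2.le, one_dvd _⟩)
  simp only [Nat.div_one] at h1 h2
  have h1' := h1.trans hb
  have h2' := h2.trans hb
  calc _ ≤ _ := hun
    _ ≤ 32 * m / w * (1 + Real.log m) ^ 3 + 32 * m / w * (1 + Real.log m) ^ 3 := add_le_add h1' h2'
    _ = _ := by ring

lemma sum_inv_sq (w N : ℕ) (hw : 1 ≤ w) (S : Finset ℕ) (hS : ∀ n ∈ S, w < n ∧ n ≤ N) :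
    ∑ n ∈ S, (1:ℝ) / (n * n) ≤ 1 / w := by
  have h1 : ∑ n ∈ S, (1:ℝ) / (n * n) ≤ ∑ n ∈ Finset.Ioc w (max w N), ((n:ℝ) ^ 2)⁻¹ := by
    have : ∑ n ∈ S, (1:ℝ) / (n * n) = ∑ n ∈ S, ((n:ℝ) ^ 2)⁻¹ :=
      Finset.sum_congr rfl fun n _ => by rw [pow_two, one_div]
    rw [this]
    apply Finset.sum_le_sum_of_subset_of_nonneg
    · intro n hn
      have := hS n hn
      rw [Finset.mem_Ioc]; omega
    · intros; positivity
  have h2 := sum_Ioc_inv_sq_le_sub (α := ℝ) (k := w) (n := max w N) (by omega) (le_max_left _ _)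
  have h3 : (0:ℝ) ≤ ((max w N : ℕ):ℝ)⁻¹ := by positivity
  rw [one_div]; linarith

end DP5

namespace DP5

lemma tau_div_le {p n : ℕ} (hp : p.Prime) (h : p ∣ n) : tau n ≤ 2 * tau (n / p) := by
  obtain ⟨k, rfl⟩ := h
  rw [Nat.mul_div_cancel_left _ hp.pos]
  refine (tau_mul_le p k).trans ?_
  have : tau p = 2 := by
    unfold tau; rw [Nat.Prime.divisors hp, Finset.card_pair hp.one_lt.ne]
  rw [this]

lemma ub2_aux (m w : ℕ) (hw : 1 ≤ w) (N : ℕ) (A : ℝ) (hA : 0 ≤ A)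
    (φ : ℕ → ℕ × ℕ → Prop) [∀ p P, Decidable (φ p P)]
    (h : ∀ p, p.Prime → ∑ P ∈ (CR m).filter (φ p), T3 P ≤ A / p) :
    ∑ P ∈ CR m, T3 P * ∑ p ∈ (Finset.Ioc w N).filter (fun p => p.Prime ∧ φ p P), (1:ℝ) / p ≤ A / w := by
  have e : ∑ P ∈ CR m, T3 P * ∑ p ∈ (Finset.Ioc w N).filter (fun p => p.Prime ∧ φ p P), (1:ℝ) / p
      = ∑ p ∈ (Finset.Ioc w N).filter Nat.Prime, (1:ℝ) / p * ∑ P ∈ (CR m).filter (φ p), T3 P := by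
    simp_rw [Finset.mul_sum, ← Finset.filter_filter, Finset.sum_filter (φ _)]
    have : ∀ P, ∑ p ∈ ((Finset.Ioc w N).filter Nat.Prime).filter (fun p => φ p P), T3 P * (1 / (p:ℝ))
      = ∑ p ∈ (Finset.Ioc w N).filter Nat.Prime, if φ p P then (1 / (p:ℝ)) * T3 P else 0 := by
      intro P
      rw [Finset.sum_filter]
      refine Finset.sum_congr rfl fun p _ => ?_
      split_ifs <;> ring
    simp_rw [this]
    rw [Finset.sum_comm]
  rw [e]
  calc _ ≤ ∑ p ∈ (Finset.Ioc w N).filter Nat.Prime, A * ((1:ℝ) / (p * p)) := by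
        refine Finset.sum_le_sum fun p hp => ?_
        rw [Finset.mem_filter] at hp
        have := h p hp.2
        calc (1:ℝ) / p * _ ≤ 1 / p * (A / p) := by gcongr
          _ = _ := by rw [div_mul_div_comm, one_mul, mul_one_div]
    _ = A * ∑ p ∈ (Finset.Ioc w N).filter Nat.Prime, ((1:ℝ) / (p * p)) := by rw [Finset.mul_sum]
    _ ≤ A * (1 / w) := by
        gcongr
        apply sum_inv_sq w N hw
        intro n hn
        rw [Finset.mem_filter, Finset.mem_Ioc] at hn
        exact hn.1
    _ = _ := by ring

lemma UB2 (m w N : ℕ) (hm : 1 ≤ m) (hw : 1 ≤ w) :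
    ∑ P ∈ CR m, T3 P * ∑ p ∈ (Finset.Ioc w N).filter
      (fun p => p.Prime ∧ p ∣ P.1 * P.2 * (P.1 + P.2)), (1:ℝ) / p
      ≤ 256 * m / w * (1 + Real.log m) ^ 3 := by
  have hL := one_le_L m
  have h2 := sqrt_mul_le m
  have ha := ub2_aux m w hw N (64 * m * (1 + Real.log m) ^ 3) (by positivity) (fun p P => p ∣ P.1) (by
    intro p hp
    have hp0 : (0:ℝ) < p := by exact_mod_cast hp.pos
    have := ub_a m hm p (Nat.sqrt m) hp.pos (by omega) ((CR m).filter (fun P => p ∣ P.1))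
      (Finset.filter_subset _ _) (fun P hP => by
        rw [Finset.mem_filter] at hP
        obtain ⟨p1, p2, p3, p4⟩ := mem_CR.1 hP.1
        exact ⟨(Rg_bd p3).1, hP.2⟩)
    calc _ ≤ ∑ P ∈ (CR m).filter (fun P => p ∣ P.1), 2 * ((tau (P.1 / p) * tau P.2 * tau (P.1 + P.2) : ℕ) : ℝ) := by
          refine Finset.sum_le_sum fun P hP => ?_
          rw [Finset.mem_filter] at hP
          unfold T3
          have := tau_div_le hp hP.2
          have : tau P.1 * tau P.2 * tau (P.1 + P.2) ≤ 2 * (tau (P.1 / p) * tau P.2 * tau (P.1 + P.2)) := by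
            calc _ ≤ 2 * tau (P.1 / p) * tau P.2 * tau (P.1 + P.2) := by gcongr
              _ = _ := by ring
          exact_mod_cast this
      _ ≤ 2 * (32 * Nat.sqrt m * Nat.sqrt m / p * (1 + Real.log m) ^ 3) := by
          rw [← Finset.mul_sum]; gcongr
      _ = 64 * (Nat.sqrt m * Nat.sqrt m) * (1 + Real.log m) ^ 3 / p := by ring
      _ ≤ _ := by gcongr)
  have hb := ub2_aux m w hw N (64 * m * (1 + Real.log m) ^ 3) (by positivity) (fun p P => p ∣ P.2) (by
    intro p hp
    have hp0 : (0:ℝ) < p := by exact_mod_cast hp.pos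
    have := ub_b m hm p (Nat.sqrt m) hp.pos (by omega) ((CR m).filter (fun P => p ∣ P.2))
      (Finset.filter_subset _ _) (fun P hP => by
        rw [Finset.mem_filter] at hP
        obtain ⟨p1, p2, p3, p4⟩ := mem_CR.1 hP.1
        exact ⟨(Rg_bd p3).2.1, hP.2⟩)
    calc _ ≤ ∑ P ∈ (CR m).filter (fun P => p ∣ P.2), 2 * ((tau P.1 * tau (P.2 / p) * tau (P.1 + P.2) : ℕ) : ℝ) := by
          refine Finset.sum_le_sum fun P hP => ?_
          rw [Finset.mem_filter] at hP
          unfold T3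
          have := tau_div_le hp hP.2
          have : tau P.1 * tau P.2 * tau (P.1 + P.2) ≤ 2 * (tau P.1 * tau (P.2 / p) * tau (P.1 + P.2)) := by
            calc _ ≤ tau P.1 * (2 * tau (P.2 / p)) * tau (P.1 + P.2) := by gcongr
              _ = _ := by ring
          exact_mod_cast this
      _ ≤ 2 * (32 * Nat.sqrt m * Nat.sqrt m / p * (1 + Real.log m) ^ 3) := by
          rw [← Finset.mul_sum]; gcongr
      _ = 64 * (Nat.sqrt m * Nat.sqrt m) * (1 + Real.log m) ^ 3 / p := by ring
      _ ≤ _ := by gcongr)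
  have hc := ub2_aux m w hw N (128 * m * (1 + Real.log m) ^ 3) (by positivity) (fun p P => p ∣ P.1 + P.2) (by
    intro p hp
    have hp0 : (0:ℝ) < p := by exact_mod_cast hp.pos
    have := ub_c m hm p hp.pos ((CR m).filter (fun P => p ∣ P.1 + P.2))
      (Finset.filter_subset _ _) (fun P hP => by
        rw [Finset.mem_filter] at hP
        exact hP.2)
    calc _ ≤ ∑ P ∈ (CR m).filter (fun P => p ∣ P.1 + P.2), 2 * ((tau P.1 * tau P.2 * tau ((P.1 + P.2) / p) : ℕ) : ℝ) := by
          refine Finset.sum_le_sum fun P hP => ?_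
          rw [Finset.mem_filter] at hP
          unfold T3
          have := tau_div_le hp hP.2
          have : tau P.1 * tau P.2 * tau (P.1 + P.2) ≤ 2 * (tau P.1 * tau P.2 * tau ((P.1 + P.2) / p)) := by
            calc _ ≤ tau P.1 * tau P.2 * (2 * tau ((P.1 + P.2) / p)) := by gcongr
              _ = _ := by ring
          exact_mod_cast this
      _ ≤ 2 * (64 * Nat.sqrt m * Nat.sqrt m / p * (1 + Real.log m) ^ 3) := by
          rw [← Finset.mul_sum]; gcongr
      _ = 128 * (Nat.sqrt m * Nat.sqrt m) * (1 + Real.log m) ^ 3 / p := by ring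
      _ ≤ _ := by gcongr)
  have key : ∀ P ∈ CR m, T3 P * ∑ p ∈ (Finset.Ioc w N).filter
      (fun p => p.Prime ∧ p ∣ P.1 * P.2 * (P.1 + P.2)), (1:ℝ) / p ≤
      T3 P * ∑ p ∈ (Finset.Ioc w N).filter (fun p => p.Prime ∧ p ∣ P.1), (1:ℝ) / p +
      T3 P * ∑ p ∈ (Finset.Ioc w N).filter (fun p => p.Prime ∧ p ∣ P.2), (1:ℝ) / p +
      T3 P * ∑ p ∈ (Finset.Ioc w N).filter (fun p => p.Prime ∧ p ∣ P.1 + P.2), (1:ℝ) / p := by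
    intro P _
    rw [← mul_add, ← mul_add]
    apply mul_le_mul_of_nonneg_left _ (T3_nonneg P)
    simp_rw [Finset.sum_filter]
    rw [← Finset.sum_add_distrib, ← Finset.sum_add_distrib]
    refine Finset.sum_le_sum fun p _ => ?_
    have h0 : (0:ℝ) ≤ 1 / p := by positivity
    by_cases h : p.Prime ∧ p ∣ P.1 * P.2 * (P.1 + P.2)
    · rw [if_pos h]
      obtain ⟨hp, hd⟩ := h
      rcases hp.dvd_mul.1 hd with hd | hd
      · rcases hp.dvd_mul.1 hd with hd | hd
        · rw [if_pos ⟨hp, hd⟩]; split_ifs <;> linarith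
        · rw [if_pos (⟨hp, hd⟩ : p.Prime ∧ p ∣ P.2)]; split_ifs <;> linarith
      · rw [if_pos (⟨hp, hd⟩ : p.Prime ∧ p ∣ P.1 + P.2)]; split_ifs <;> linarith
    · rw [if_neg h]; split_ifs <;> linarith
  calc _ ≤ _ := Finset.sum_le_sum key
    _ ≤ 64 * m * (1 + Real.log m) ^ 3 / w + 64 * m * (1 + Real.log m) ^ 3 / w + 128 * m * (1 + Real.log m) ^ 3 / w := by
      rw [Finset.sum_add_distrib, Finset.sum_add_distrib]
      exact add_le_add (add_le_add ha hb) hc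
    _ = _ := by ring

/-- moments of the divisor function -/
lemma tau_moment (k N : ℕ) : ∑ n ∈ Finset.Icc 1 N, (tau n : ℝ) ^ k / (n * n) ≤ 2 ^ (2 ^ k) := by
  induction k with
  | zero =>
    simp only [pow_zero, pow_one]
    rcases Nat.eq_zero_or_pos N with h | h
    · rw [h]; simp
    · have e : Finset.Icc 1 N = insert 1 (Finset.Ioc 1 N) := by
        ext x; simp; omega
      rw [e, Finset.sum_insert (by simp)]
      have := sum_inv_sq 1 N le_rfl (Finset.Ioc 1 N) (by simp)
      norm_num at this ⊢
      linarith
  | succ k ih =>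
    set S := ∑ n ∈ Finset.Icc 1 N, (tau n : ℝ) ^ k / (n * n) with hS
    have hle : ∑ n ∈ Finset.Icc 1 N, (tau n : ℝ) ^ (k+1) / (n * n) ≤ S * S := by
      have e1 : ∀ n ∈ Finset.Icc 1 N, (tau n : ℝ) ^ (k+1) / (n * n) ≤
          ∑ x ∈ Nat.divisorsAntidiagonal n, ((tau x.1 : ℝ) ^ k / (x.1 * x.1)) * ((tau x.2 : ℝ) ^ k / (x.2 * x.2)) := by
        intro n hn
        have hc : (tau n : ℝ) = ∑ x ∈ Nat.divisorsAntidiagonal n, (1:ℝ) := by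
          rw [Finset.sum_const, nsmul_eq_mul, mul_one]
          unfold tau
          rw [← Nat.map_div_right_divisors, Finset.card_map]
        rw [pow_succ]
        nth_rw 2 [hc]
        rw [Finset.mul_sum, Finset.sum_div]
        refine Finset.sum_le_sum fun x hx => ?_
        rw [Nat.mem_divisorsAntidiagonal] at hx
        have h5 : (tau n : ℝ) ≤ tau x.1 * tau x.2 := by
          rw [← hx.1]; exact_mod_cast tau_mul_le _ _
        have h6 : (n:ℝ) = x.1 * x.2 := by rw [← hx.1]; push_cast; ring
        rw [mul_one, div_mul_div_comm, ← mul_pow]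
        have h7 : (n:ℝ) * n = x.1 * x.1 * (x.2 * x.2) := by rw [h6]; ring
        rw [← h7]
        gcongr
      refine (Finset.sum_le_sum e1).trans ?_
      rw [hS, Finset.sum_mul_sum, ← Finset.sum_product']
      rw [Finset.sum_sigma']
      have inj : Set.InjOn (fun x : (_ : ℕ) × ℕ × ℕ => x.2)
          ((Finset.Icc 1 N).sigma (fun n => Nat.divisorsAntidiagonal n)) := by
        rintro ⟨n, x⟩ h ⟨n', x'⟩ h' hh
        simp only [Finset.coe_sigma, Set.mem_sigma_iff, Finset.mem_coe, Nat.mem_divisorsAntidiagonal] at h h' hh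
        subst hh
        obtain rfl : n = n' := by rw [← h.2.1, ← h'.2.1]
        rfl
      rw [← Finset.sum_image (g := fun x : (_ : ℕ) × ℕ × ℕ => x.2)
        (f := fun x : ℕ × ℕ => ((tau x.1 : ℝ) ^ k / (x.1 * x.1)) * ((tau x.2 : ℝ) ^ k / (x.2 * x.2))) inj]
      apply Finset.sum_le_sum_of_subset_of_nonneg
      · intro x hx
        rw [Finset.mem_image] at hx
        obtain ⟨⟨n, y⟩, hy, rfl⟩ := hx
        rw [Finset.mem_sigma, Nat.mem_divisorsAntidiagonal, Finset.mem_Icc] at hy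
        simp only at hy ⊢
        obtain ⟨⟨n1, n2⟩, h1, h2⟩ := hy
        rw [Finset.mem_product, Finset.mem_Icc, Finset.mem_Icc]
        have y1 : 0 < y.1 := Nat.pos_of_ne_zero (by intro h; rw [h] at h1; omega)
        have y2 : 0 < y.2 := Nat.pos_of_ne_zero (by intro h; rw [h] at h1; omega)
        refine ⟨⟨y1, ?_⟩, ⟨y2, ?_⟩⟩ <;> nlinarith
      · intros; positivity
    have hS0 : 0 ≤ S := Finset.sum_nonneg fun _ _ => by positivity
    calc _ ≤ _ := hle
      _ ≤ (2:ℝ) ^ (2^k) * 2 ^ (2^k) := by gcongr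
      _ = _ := by rw [← pow_add]; congr 1; ring

end DP5

namespace DP5

def smul2 (g : ℕ) (P : ℕ × ℕ) : ℕ × ℕ := (g * P.1, g * P.2)

lemma smul2_inj {g : ℕ} (hg : 1 ≤ g) : Function.Injective (smul2 g) := by
  rintro ⟨a, b⟩ ⟨a', b'⟩ h
  simp only [smul2, Prod.mk.injEq] at h ⊢
  exact ⟨Nat.eq_of_mul_eq_mul_left hg h.1, Nat.eq_of_mul_eq_mul_left hg h.2⟩

lemma T3_smul (g : ℕ) (P : ℕ × ℕ) : T3 (smul2 g P) ≤ (tau g : ℝ) ^ 3 * T3 P := by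
  unfold T3 smul2
  dsimp only
  rw [← mul_add]
  have h1 := tau_mul_le g P.1
  have h2 := tau_mul_le g P.2
  have h3 := tau_mul_le g (P.1 + P.2)
  have : tau (g * P.1) * tau (g * P.2) * tau (g * (P.1 + P.2)) ≤
      tau g ^ 3 * (tau P.1 * tau P.2 * tau (P.1 + P.2)) := by
    calc _ ≤ (tau g * tau P.1) * (tau g * tau P.2) * (tau g * tau (P.1 + P.2)) := by gcongr
      _ = _ := by ring
  exact_mod_cast this

lemma Fn_smul (g a b : ℕ) : Fn (g * a) (g * b) = g * g * Fn a b := by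
  unfold Fn
  have h : max (g * a) (g * b) = g * max a b := by
    rcases le_total a b with h | h
    · rw [max_eq_right h, max_eq_right (Nat.mul_le_mul_left g h)]
    · rw [max_eq_left h, max_eq_left (Nat.mul_le_mul_left g h)]
  rw [h]; ring

lemma sum_scaled (m g : ℕ) (hg : 1 ≤ g) (A : Finset (ℕ × ℕ)) (R' : ℕ → Finset (ℕ × ℕ))
    (hA : ∀ P ∈ A, ∃ Q ∈ R' (m / (g * g)), P = smul2 g Q) :
    ∑ P ∈ A, T3 P ≤ (tau g : ℝ) ^ 3 * ∑ Q ∈ R' (m / (g * g)), T3 Q := by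
  have h1 : ∑ P ∈ A, T3 P ≤ ∑ P ∈ (R' (m / (g * g))).image (smul2 g), T3 P := by
    apply Finset.sum_le_sum_of_subset_of_nonneg
    · intro P hP
      obtain ⟨Q, hQ, rfl⟩ := hA P hP
      exact Finset.mem_image_of_mem _ hQ
    · intro P _ _; exact T3_nonneg P
  rw [Finset.sum_image (fun x _ y _ h => smul2_inj hg h)] at h1
  refine h1.trans ?_
  rw [Finset.mul_sum]
  exact Finset.sum_le_sum fun Q _ => T3_smul g Q

lemma scaled_mem {m g a b : ℕ} (hg : 1 ≤ g) (h : Fn (g * a) (g * b) ≤ m) : Fn a b ≤ m / (g * g) := by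
  rw [Nat.le_div_iff_mul_le (Nat.mul_pos hg hg), mul_comm, ← Fn_smul]; exact h

lemma bound_scaled (f : ℕ → ℝ) (A : ℝ) (hA : 0 ≤ A) (hf : ∀ m, 1 ≤ m → f m ≤ A * m * (1 + Real.log m) ^ 3)
    (hf0 : f 0 ≤ 0) (m g : ℕ) (hg : 1 ≤ g) :
    f (m / (g * g)) ≤ A * m * (1 + Real.log m) ^ 3 / (g * g) := by
  have hL := one_le_L m
  rcases Nat.eq_zero_or_pos (m / (g * g)) with h | h
  · rw [h]; refine hf0.trans ?_; positivity
  · have hle : ((m / (g * g) : ℕ):ℝ) ≤ m / (g * g) := by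
      have := @Nat.cast_div_le ℝ _ _ _ m (g * g)
      push_cast at this; exact this
    have hlog : Real.log ((m / (g * g) : ℕ):ℝ) ≤ Real.log m := by
      apply Real.log_le_log (by exact_mod_cast h)
      exact_mod_cast Nat.div_le_self _ _
    have h0 := one_le_L (m / (g * g))
    calc _ ≤ _ := hf _ h
      _ ≤ A * (m / (g * g)) * (1 + Real.log m) ^ 3 := by gcongr
      _ = _ := by ring

lemma CR_zero : CR 0 = ∅ := by
  rw [Finset.eq_empty_iff_forall_notMem]
  intro P hP
  obtain ⟨p1, p2, p3, _⟩ := mem_CR.1 hP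
  have := le_Fn (a := P.1) p2
  omega

lemma Rg_zero : Rg 0 = ∅ := by
  rw [Finset.eq_empty_iff_forall_notMem]
  intro P hP
  obtain ⟨p1, p2, p3⟩ := mem_Rg.1 hP
  have := le_Fn (a := P.1) p2
  omega

lemma UBall (m : ℕ) (_hm : 1 ≤ m) : ∑ P ∈ Rg m, T3 P ≤ 8192 * m * (1 + Real.log m) ^ 3 := by
  have hL := one_le_L m
  have hmaps : ∀ P ∈ Rg m, Nat.gcd P.1 P.2 ∈ Finset.Icc 1 (Nat.sqrt m) := by
    intro P hP
    obtain ⟨p1, p2, p3⟩ := mem_Rg.1 hP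
    rw [Finset.mem_Icc]
    refine ⟨Nat.gcd_pos_of_pos_left _ p1, ?_⟩
    exact (Nat.gcd_le_left _ p1).trans (Rg_bd p3).1
  rw [← Finset.sum_fiberwise_of_maps_to hmaps]
  have key : ∀ g ∈ Finset.Icc 1 (Nat.sqrt m), ∑ P ∈ (Rg m).filter (fun P => Nat.gcd P.1 P.2 = g), T3 P
      ≤ (32 * m * (1 + Real.log m) ^ 3) * ((tau g : ℝ) ^ 3 / (g * g)) := by
    intro g hg
    rw [Finset.mem_Icc] at hg
    have h1 := sum_scaled m g hg.1 ((Rg m).filter (fun P => Nat.gcd P.1 P.2 = g)) CR (by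
      rintro ⟨a, b⟩ hP
      rw [Finset.mem_filter] at hP
      obtain ⟨⟨p1, p2, p3⟩, hgcd⟩ := And.imp_left mem_Rg.1 hP
      simp only at hgcd p1 p2 p3
      obtain ⟨a', ha⟩ : g ∣ a := hgcd ▸ Nat.gcd_dvd_left a b
      obtain ⟨b', hb⟩ : g ∣ b := hgcd ▸ Nat.gcd_dvd_right a b
      refine ⟨(a', b'), ?_, by simp [smul2, ha, hb]⟩
      rw [mem_CR]
      subst ha hb
      refine ⟨Nat.pos_of_mul_pos_left p1, Nat.pos_of_mul_pos_left p2, scaled_mem hg.1 p3, ?_⟩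
      rw [Nat.gcd_mul_left] at hgcd
      exact Nat.eq_of_mul_eq_mul_left hg.1 (by rw [hgcd, mul_one]))
    have h2 := bound_scaled (fun m => ∑ P ∈ CR m, T3 P) 32 (by norm_num) UB0 (by rw [CR_zero]; simp) m g hg.1
    calc _ ≤ _ := h1
      _ ≤ (tau g : ℝ) ^ 3 * (32 * m * (1 + Real.log m) ^ 3 / (g * g)) := by gcongr
      _ = _ := by ring
  calc _ ≤ _ := Finset.sum_le_sum key
    _ = (32 * m * (1 + Real.log m) ^ 3) * ∑ g ∈ Finset.Icc 1 (Nat.sqrt m), ((tau g : ℝ) ^ 3 / (g * g)) := by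
      rw [Finset.mul_sum]
    _ ≤ (32 * m * (1 + Real.log m) ^ 3) * 2 ^ (2 ^ 3) := by
      gcongr; exact tau_moment 3 _
    _ = _ := by norm_num; ring

open Classical in
lemma NP (m w : ℕ) (_hm : 1 ≤ m) (hw : 1 ≤ w) :
    ∑ P ∈ (Rg m).filter (fun P => ∃ p, p.Prime ∧ w < p ∧ p ∣ P.1 ∧ p ∣ P.2), T3 P
      ≤ 65536 * m / w * (1 + Real.log m) ^ 3 := by
  classical
  have hL := one_le_L m
  have h1 : ∑ P ∈ (Rg m).filter (fun P => ∃ p, p.Prime ∧ w < p ∧ p ∣ P.1 ∧ p ∣ P.2), T3 P ≤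
      ∑ P ∈ Rg m, ∑ p ∈ (Finset.Ioc w (Nat.sqrt m)).filter Nat.Prime,
        if p ∣ P.1 ∧ p ∣ P.2 then T3 P else 0 := by
    rw [Finset.sum_filter]
    refine Finset.sum_le_sum fun P hP => ?_
    have hnn : ∀ p ∈ (Finset.Ioc w (Nat.sqrt m)).filter Nat.Prime,
        0 ≤ if p ∣ P.1 ∧ p ∣ P.2 then T3 P else 0 := by
      intro p _; split_ifs; exacts [T3_nonneg P, le_rfl]
    split_ifs with h
    · obtain ⟨p, hp, hpw, hd⟩ := h
      obtain ⟨p1, p2, p3⟩ := mem_Rg.1 hP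
      have hmem : p ∈ (Finset.Ioc w (Nat.sqrt m)).filter Nat.Prime := by
        rw [Finset.mem_filter, Finset.mem_Ioc]
        exact ⟨⟨hpw, (Nat.le_of_dvd p1 hd.1).trans (Rg_bd p3).1⟩, hp⟩
      refine le_trans (le_of_eq ?_) (Finset.single_le_sum hnn hmem)
      rw [if_pos hd]
    · exact Finset.sum_nonneg hnn
  refine h1.trans ?_
  rw [Finset.sum_comm]
  have key : ∀ p ∈ (Finset.Ioc w (Nat.sqrt m)).filter Nat.Prime,
      ∑ P ∈ Rg m, (if p ∣ P.1 ∧ p ∣ P.2 then T3 P else 0) ≤ (65536 * m * (1 + Real.log m) ^ 3) * ((1:ℝ) / (p * p)) := by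
    intro p hp
    rw [Finset.mem_filter] at hp
    rw [← Finset.sum_filter]
    have h1 := sum_scaled m p hp.2.pos ((Rg m).filter (fun P => p ∣ P.1 ∧ p ∣ P.2)) Rg (by
      rintro ⟨a, b⟩ hP
      rw [Finset.mem_filter] at hP
      obtain ⟨⟨p1, p2, p3⟩, ⟨a', ha⟩, ⟨b', hb⟩⟩ := And.imp_left mem_Rg.1 hP
      simp only at ha hb p1 p2 p3
      refine ⟨(a', b'), ?_, by simp [smul2, ha, hb]⟩
      rw [mem_Rg]
      subst ha hb
      exact ⟨Nat.pos_of_mul_pos_left p1, Nat.pos_of_mul_pos_left p2, scaled_mem hp.2.pos p3⟩)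
    have h2 := bound_scaled (fun m => ∑ P ∈ Rg m, T3 P) 8192 (by norm_num) UBall (by rw [Rg_zero]; simp) m p hp.2.pos
    have h3 : tau p = 2 := by
      unfold tau; rw [Nat.Prime.divisors hp.2, Finset.card_pair hp.2.one_lt.ne]
    rw [h3] at h1
    calc _ ≤ _ := h1
      _ ≤ ((2:ℕ) : ℝ) ^ 3 * (8192 * m * (1 + Real.log m) ^ 3 / (p * p)) := by gcongr
      _ = _ := by push_cast; ring
  calc _ ≤ _ := Finset.sum_le_sum key
    _ = (65536 * m * (1 + Real.log m) ^ 3) * ∑ p ∈ (Finset.Ioc w (Nat.sqrt m)).filter Nat.Prime, ((1:ℝ) / (p * p)) := by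
      rw [Finset.mul_sum]
    _ ≤ (65536 * m * (1 + Real.log m) ^ 3) * (1 / w) := by
      gcongr
      apply sum_inv_sq w (Nat.sqrt m) hw
      intro n hn
      rw [Finset.mem_filter, Finset.mem_Ioc] at hn
      exact hn.1
    _ = _ := by ring

/-! windows of divisors -/

def TD (P : ℕ × ℕ) : Finset (ℕ × ℕ × ℕ) := P.1.divisors ×ˢ P.2.divisors ×ˢ (P.1 + P.2).divisors

def mid (z n : ℕ) : Finset ℕ := n.divisors.filter (fun d => z < d ∧ z < n / d)

def wd (z N n : ℕ) : Finset ℕ := (Finset.Ioc z N).filter (fun d => d ∣ n)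

lemma mid_le (z n M : ℕ) (hM : n ≤ M) : (mid z n).card ≤ 2 * (wd z (Nat.sqrt M) n).card := by
  have key : mid z n ⊆ wd z (Nat.sqrt M) n ∪ (wd z (Nat.sqrt M) n).image (fun d => n / d) := by
    intro d hd
    rw [mid, Finset.mem_filter, Nat.mem_divisors] at hd
    obtain ⟨⟨⟨e, he⟩, hn⟩, h1, h2⟩ := hd
    have hd0 : 0 < d := by omega
    have he0 : 0 < e := Nat.pos_of_ne_zero (by rintro rfl; omega)
    rw [he, Nat.mul_div_cancel_left _ hd0] at h2
    rw [Finset.mem_union, Finset.mem_image]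
    rcases le_total d e with h | h
    · left
      simp only [wd, Finset.mem_filter, Finset.mem_Ioc]
      refine ⟨⟨h1, ?_⟩, ⟨e, he⟩⟩
      rw [Nat.le_sqrt]; nlinarith
    · right
      refine ⟨e, ?_, by rw [he]; exact Nat.mul_div_cancel _ he0⟩
      simp only [wd, Finset.mem_filter, Finset.mem_Ioc]
      refine ⟨⟨h2, ?_⟩, ⟨d, by rw [he, mul_comm]⟩⟩
      rw [Nat.le_sqrt]; nlinarith
  calc (mid z n).card ≤ _ := Finset.card_le_card key
    _ ≤ _ := Finset.card_union_le _ _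
    _ ≤ (wd z (Nat.sqrt M) n).card + (wd z (Nat.sqrt M) n).card :=
        Nat.add_le_add_left Finset.card_image_le _
    _ = _ := by ring

lemma mid_zero (n : ℕ) : mid 0 n = n.divisors := by
  unfold mid
  rw [Finset.filter_true_of_mem]
  intro d hd
  have h1 := Nat.pos_of_mem_divisors hd
  exact ⟨h1, Nat.div_pos (Nat.divisor_le hd) h1⟩

lemma wd_sum (z N : ℕ) (hz : 1 ≤ z) (hN : z ≤ N) : ∑ c ∈ Finset.Ioc z N, (1:ℝ) / c ≤ 2 + Real.log (N / z) := by
  have hz0 : (0:ℝ) < z := by exact_mod_cast hz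
  apply harm_window z N hz0 (by exact_mod_cast hN)
  intro c hc
  rw [Finset.mem_Ioc] at hc
  exact ⟨by omega, by exact_mod_cast hc.1.le, by exact_mod_cast hc.2⟩

lemma lemU_CR (m : ℕ) (C : Finset (ℕ × ℕ × ℕ))
    (hC : ∀ c ∈ C, 1 ≤ c.1 ∧ 1 ≤ c.2.1 ∧ 1 ≤ c.2.2 ∧ c.2.1 * c.2.2 ≤ 2 * Nat.sqrt m) :
    ∑ P ∈ CR m, ((C.filter (fun c => c.1 ∣ P.1 ∧ c.2.1 ∣ P.2 ∧ c.2.2 ∣ P.1 + P.2)).card : ℝ)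
      ≤ 4 * m * ∑ c ∈ C, (1:ℝ) / (c.1 * c.2.1 * c.2.2) := by
  have := lemU (CR m) (fun u v => u + v) (Nat.sqrt m) (2 * Nat.sqrt m) 1 le_rfl ?_ ?_ ?_ C hC
  · simp only [one_mul] at this
    refine this.trans ?_
    have h2 := sqrt_mul_le m
    have h0 : 0 ≤ ∑ c ∈ C, (1:ℝ) / (c.1 * c.2.1 * c.2.2) := Finset.sum_nonneg fun _ _ => by positivity
    apply mul_le_mul_of_nonneg_right _ h0
    push_cast
    rw [div_one]; linarith
  · intro P hP
    obtain ⟨p1, p2, p3, p4⟩ := mem_CR.1 hP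
    have := Rg_bd p3
    omega
  · intro P hP
    obtain ⟨p1, p2, p3, p4⟩ := mem_CR.1 hP
    simpa using p4.symm
  · intro u v v' c _ _ h1 h2
    have : (v:ℤ) - v' = ((u + v : ℕ):ℤ) - ((u + v' : ℕ):ℤ) := by push_cast; ring
    rw [this]
    exact dvd_sub (by exact_mod_cast h1) (by exact_mod_cast h2)

lemma mid_prod (m z1 z2 z3 : ℕ) :
    ∑ P ∈ CR m, (((mid z1 P.1).card * (mid z2 P.2).card * (mid z3 (P.1 + P.2)).card : ℕ) : ℝ)
      ≤ 32 * m * ((∑ c ∈ Finset.Ioc z1 (Nat.sqrt (2 * Nat.sqrt m)), (1:ℝ) / c) *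
        ((∑ c ∈ Finset.Ioc z2 (Nat.sqrt (2 * Nat.sqrt m)), (1:ℝ) / c) *
        (∑ c ∈ Finset.Ioc z3 (Nat.sqrt (2 * Nat.sqrt m)), (1:ℝ) / c))) := by
  set N := Nat.sqrt (2 * Nat.sqrt m) with hN
  have hU := lemU_CR m (Finset.Ioc z1 N ×ˢ Finset.Ioc z2 N ×ˢ Finset.Ioc z3 N) (by
    intro c hc
    simp only [Finset.mem_product, Finset.mem_Ioc] at hc
    refine ⟨by omega, by omega, by omega, ?_⟩
    calc c.2.1 * c.2.2 ≤ N * N := Nat.mul_le_mul hc.2.1.2 hc.2.2.2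
      _ ≤ _ := Nat.sqrt_le _)
  have e : ∑ c ∈ Finset.Ioc z1 N ×ˢ Finset.Ioc z2 N ×ˢ Finset.Ioc z3 N, (1:ℝ) / (c.1 * c.2.1 * c.2.2) =
      ((∑ c ∈ Finset.Ioc z1 N, (1:ℝ) / c) * ((∑ c ∈ Finset.Ioc z2 N, (1:ℝ) / c) *
        (∑ c ∈ Finset.Ioc z3 N, (1:ℝ) / c))) := by
    rw [Finset.sum_mul_sum, Finset.sum_mul_sum, Finset.sum_product]
    refine Finset.sum_congr rfl fun c1 _ => ?_
    rw [Finset.sum_product]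
    refine Finset.sum_congr rfl fun c2 _ => ?_
    rw [Finset.mul_sum]
    refine Finset.sum_congr rfl fun c3 _ => ?_
    rw [one_div_mul_one_div, one_div_mul_one_div, mul_assoc]
  rw [e] at hU
  refine le_trans ?_ ((mul_le_mul_of_nonneg_left hU (by norm_num : (0:ℝ) ≤ 8)).trans (le_of_eq (by ring)))
  rw [Finset.mul_sum]
  refine Finset.sum_le_sum fun P hP => ?_
  obtain ⟨p1, p2, p3, p4⟩ := mem_CR.1 hP
  have hb := Rg_bd p3
  have t1 := mid_le z1 P.1 (2 * Nat.sqrt m) (by omega)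
  have t2 := mid_le z2 P.2 (2 * Nat.sqrt m) (by omega)
  have t3 := mid_le z3 (P.1 + P.2) (2 * Nat.sqrt m) (by omega)
  rw [← hN] at t1 t2 t3
  have ec : ((Finset.Ioc z1 N ×ˢ Finset.Ioc z2 N ×ˢ Finset.Ioc z3 N).filter
      (fun c => c.1 ∣ P.1 ∧ c.2.1 ∣ P.2 ∧ c.2.2 ∣ P.1 + P.2)).card
      = (wd z1 N P.1).card * ((wd z2 N P.2).card * (wd z3 N (P.1 + P.2)).card) := by
    rw [← Finset.card_product, ← Finset.card_product]
    congr 1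
    ext ⟨a, b, c⟩
    simp only [wd, Finset.mem_filter, Finset.mem_product]
    tauto
  rw [ec]
  have : (mid z1 P.1).card * (mid z2 P.2).card * (mid z3 (P.1 + P.2)).card ≤
    8 * ((wd z1 N P.1).card * ((wd z2 N P.2).card * (wd z3 N (P.1 + P.2)).card)) := by
    calc _ ≤ (2 * (wd z1 N P.1).card) * (2 * (wd z2 N P.2).card) * (2 * (wd z3 N (P.1 + P.2)).card) := by gcongr
      _ = _ := by ring
  exact_mod_cast this

end DP5

namespace DP5

noncomputable def phiW (w D : ℕ) : ℝ := ∏ i : PS w, if (i:ℕ) ∣ D then 1 - 1 / ((i:ℕ):ℝ) else 1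

lemma phiW_mem (w D : ℕ) : 0 ≤ phiW w D ∧ phiW w D ≤ 1 := by
  have h : ∀ i : PS w, 0 ≤ (if (i:ℕ) ∣ D then 1 - 1 / ((i:ℕ):ℝ) else 1) ∧
      (if (i:ℕ) ∣ D then 1 - 1 / ((i:ℕ):ℝ) else 1) ≤ 1 := by
    intro i
    have hp : (2:ℝ) ≤ (i:ℕ) := by exact_mod_cast (PS_prime i).two_le
    have h : (1:ℝ) / (i:ℕ) ≤ 1 := by rw [div_le_one (by linarith)]; linarith
    have h' : (0:ℝ) ≤ 1 / (i:ℕ) := by positivity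
    split_ifs <;> constructor <;> linarith
  exact ⟨Finset.prod_nonneg fun i _ => (h i).1, Finset.prod_le_one (fun i _ => (h i).1) (fun i _ => (h i).2)⟩

lemma TD_mem {P : ℕ × ℕ} {d : ℕ × ℕ × ℕ} (h1 : 1 ≤ P.1) (h2 : 1 ≤ P.2) :
    d ∈ TD P ↔ d.1 ∣ P.1 ∧ d.2.1 ∣ P.2 ∧ d.2.2 ∣ P.1 + P.2 := by
  simp only [TD, Finset.mem_product, Nat.mem_divisors]
  constructor
  · rintro ⟨⟨a, _⟩, ⟨b, _⟩, ⟨c, _⟩⟩; exact ⟨a, b, c⟩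
  · rintro ⟨a, b, c⟩; exact ⟨⟨a, by omega⟩, ⟨b, by omega⟩, ⟨c, by omega⟩⟩

def flip3 (s : Bool × Bool × Bool) (P : ℕ × ℕ) (d : ℕ × ℕ × ℕ) : ℕ × ℕ × ℕ :=
  (pick s.1 d.1 (P.1 / d.1), pick s.2.1 d.2.1 (P.2 / d.2.1), pick s.2.2 d.2.2 ((P.1 + P.2) / d.2.2))

lemma pick_dvd (s : Bool) {d n : ℕ} (h : d ∣ n) : pick s d (n / d) ∣ n := by
  cases s
  · exact h
  · exact Nat.div_dvd_of_dvd h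

lemma pick_pick (s : Bool) {d n : ℕ} (h : d ∣ n) (hn : 1 ≤ n) :
    pick s (pick s d (n / d)) (n / pick s d (n / d)) = d := by
  cases s
  · rfl
  · exact Nat.div_div_self h (by omega)

lemma flip3_mem (s : Bool × Bool × Bool) {P : ℕ × ℕ} {d : ℕ × ℕ × ℕ} (h1 : 1 ≤ P.1) (h2 : 1 ≤ P.2)
    (hd : d ∈ TD P) : flip3 s P d ∈ TD P := by
  rw [TD_mem h1 h2] at hd ⊢
  exact ⟨pick_dvd _ hd.1, pick_dvd _ hd.2.1, pick_dvd _ hd.2.2⟩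

lemma flip3_flip3 (s : Bool × Bool × Bool) {P : ℕ × ℕ} {d : ℕ × ℕ × ℕ} (h1 : 1 ≤ P.1) (h2 : 1 ≤ P.2)
    (hd : d ∈ TD P) : flip3 s P (flip3 s P d) = d := by
  rw [TD_mem (d := d) (P := P) h1 h2] at hd
  unfold flip3
  dsimp only
  rw [pick_pick _ hd.1 h1, pick_pick _ hd.2.1 h2, pick_pick _ hd.2.2 (by omega)]

noncomputable def ThP (w : ℕ) (s : Bool × Bool × Bool) (c : ℕ × ℕ × ℕ) (P : ℕ × ℕ) : ℝ :=
  Th w s c.1 c.2.1 c.2.2 ((P.1 / c.1 : ℕ) : ZMod (WW w)) ((P.2 / c.2.1 : ℕ) : ZMod (WW w))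
      (((P.1 + P.2) / c.2.2 : ℕ) : ZMod (WW w))

noncomputable def rsum (w : ℕ) (s : Bool × Bool × Bool) (C : Finset (ℕ × ℕ × ℕ)) (P : ℕ × ℕ) : ℝ :=
  ∑ c ∈ (C.filter (fun c => Nat.Coprime c.2.1 c.2.2)).filter
    (fun c => c.1 ∣ P.1 ∧ c.2.1 ∣ P.2 ∧ c.2.2 ∣ P.1 + P.2), ThP w s c P

lemma sum_MS (w : ℕ) (s : Bool × Bool × Bool) (C : Finset (ℕ × ℕ × ℕ)) (m : ℕ) :
    ∑ c ∈ C.filter (fun c => Nat.Coprime c.2.1 c.2.2), MS w s c.1 c.2.1 c.2.2 m =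
      ∑ P ∈ Rg m, rsum w s C P := by
  unfold MS rsum
  simp_rw [Finset.sum_filter (p := fun P : ℕ × ℕ => _ ∣ P.1 ∧ _ ∣ P.2 ∧ _ ∣ P.1 + P.2),
    Finset.sum_filter (p := fun c : ℕ × ℕ × ℕ => c.1 ∣ _ ∧ c.2.1 ∣ _ ∧ c.2.2 ∣ _)]
  rw [Finset.sum_comm]
  rfl

lemma wt_nat (p n : ℕ) : wt p (n : ZMod p) = if p ∣ n then 1 - 1 / (p:ℝ) else 1 := by
  unfold wt
  simp only [ZMod.natCast_eq_zero_iff]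

lemma pick_cast {R : Type} [NatCast R] (s : Bool) (c a : ℕ) :
    pick s (c : R) (a : R) = ((pick s c a : ℕ) : R) := by
  cases s <;> rfl

lemma ThP_eq (w : ℕ) (s : Bool × Bool × Bool) (c : ℕ × ℕ × ℕ) (P : ℕ × ℕ) (h1 : 1 ≤ P.1) (h2 : 1 ≤ P.2)
    (hP : Nat.Coprime P.1 P.2) (hc : c.1 ∣ P.1 ∧ c.2.1 ∣ P.2 ∧ c.2.2 ∣ P.1 + P.2) :
    ThP w s c P = phiW w ((flip3 s P c).1 * (flip3 s P c).2.1 * (flip3 s P c).2.2) := by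
  unfold ThP Th phiW
  refine Finset.prod_congr rfl fun i _ => ?_
  simp only [crt_nat]
  unfold loc
  have hp := PS_prime i
  have hc13 : Nat.Coprime P.1 (P.1 + P.2) := by simpa using hP
  have hc23 : Nat.Coprime P.2 (P.1 + P.2) := by simpa using hP.symm
  rw [if_neg]
  · simp only [pick_cast, wt_nat]
    have d1 : (flip3 s P c).1 ∣ P.1 := pick_dvd _ hc.1
    have d2 : (flip3 s P c).2.1 ∣ P.2 := pick_dvd _ hc.2.1
    have d3 : (flip3 s P c).2.2 ∣ P.1 + P.2 := pick_dvd _ hc.2.2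
    rw [show pick s.1 c.1 (P.1 / c.1) = (flip3 s P c).1 from rfl,
      show pick s.2.1 c.2.1 (P.2 / c.2.1) = (flip3 s P c).2.1 from rfl,
      show pick s.2.2 c.2.2 ((P.1 + P.2) / c.2.2) = (flip3 s P c).2.2 from rfl]
    generalize (flip3 s P c).1 = e1 at *
    generalize (flip3 s P c).2.1 = e2 at *
    generalize (flip3 s P c).2.2 = e3 at *
    have n12 : ¬ ((i:ℕ) ∣ e1 ∧ (i:ℕ) ∣ e2) := fun h =>
      Nat.not_coprime_of_dvd_of_dvd hp.one_lt (h.1.trans d1) (h.2.trans d2) hP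
    have n13 : ¬ ((i:ℕ) ∣ e1 ∧ (i:ℕ) ∣ e3) := fun h =>
      Nat.not_coprime_of_dvd_of_dvd hp.one_lt (h.1.trans d1) (h.2.trans d3) hc13
    have n23 : ¬ ((i:ℕ) ∣ e2 ∧ (i:ℕ) ∣ e3) := fun h =>
      Nat.not_coprime_of_dvd_of_dvd hp.one_lt (h.1.trans d2) (h.2.trans d3) hc23
    have e : (i:ℕ) ∣ e1 * e2 * e3 ↔ (i:ℕ) ∣ e1 ∨ (i:ℕ) ∣ e2 ∨ (i:ℕ) ∣ e3 := by
      rw [hp.dvd_mul, hp.dvd_mul, or_assoc]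
    simp only [e]
    by_cases k1 : (i:ℕ) ∣ e1 <;> by_cases k2 : (i:ℕ) ∣ e2 <;> by_cases k3 : (i:ℕ) ∣ e3 <;> simp_all
  · rw [← Nat.cast_mul, ← Nat.cast_mul, Nat.mul_div_cancel' hc.1, Nat.mul_div_cancel' hc.2.1,
      ZMod.natCast_eq_zero_iff, ZMod.natCast_eq_zero_iff]
    rintro ⟨k1, k2⟩
    exact Nat.not_coprime_of_dvd_of_dvd hp.one_lt k1 k2 hP

lemma rsum_eq (w : ℕ) (s : Bool × Bool × Bool) (C : Finset (ℕ × ℕ × ℕ)) (P : ℕ × ℕ) (h1 : 1 ≤ P.1) (h2 : 1 ≤ P.2)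
    (hP : Nat.Coprime P.1 P.2) :
    rsum w s C P = ∑ d ∈ (TD P).filter (fun d => flip3 s P d ∈ C), phiW w (d.1 * d.2.1 * d.2.2) := by
  unfold rsum
  have hc23 : Nat.Coprime P.2 (P.1 + P.2) := by simpa using hP.symm
  refine Finset.sum_nbij' (flip3 s P) (flip3 s P) ?_ ?_ ?_ ?_ ?_
  · intro c hc
    simp only [Finset.mem_filter] at hc ⊢
    have hc' := (TD_mem (d := c) (P := P) h1 h2).2 hc.2
    refine ⟨flip3_mem s h1 h2 hc', ?_⟩
    rw [flip3_flip3 s h1 h2 hc']; exact hc.1.1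
  · intro d hd
    simp only [Finset.mem_filter] at hd ⊢
    have := (TD_mem (P := P) h1 h2).1 (flip3_mem s h1 h2 hd.1)
    exact ⟨⟨hd.2, Nat.Coprime.coprime_dvd_left this.2.1 (Nat.Coprime.coprime_dvd_right this.2.2 hc23)⟩, this⟩
  · intro c hc
    simp only [Finset.mem_filter] at hc
    exact flip3_flip3 s h1 h2 ((TD_mem (d := c) (P := P) h1 h2).2 hc.2)
  · intro d hd
    simp only [Finset.mem_filter] at hd
    exact flip3_flip3 s h1 h2 hd.1
  · intro c hc
    simp only [Finset.mem_filter] at hc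
    exact ThP_eq w s c P h1 h2 hP hc.2

noncomputable def rho (w : ℕ) (X : ℝ) (P : ℕ × ℕ) : ℝ :=
  ∑ D ∈ (P.1 * P.2 * (P.1 + P.2)).divisors.filter (fun D : ℕ => (D:ℝ) ≤ X), phiW w D

lemma TD_pos {P : ℕ × ℕ} {d : ℕ × ℕ × ℕ} (hd : d ∈ TD P) : 1 ≤ d.1 ∧ 1 ≤ d.2.1 ∧ 1 ≤ d.2.2 := by
  simp only [TD, Finset.mem_product] at hd
  exact ⟨Nat.pos_of_mem_divisors hd.1, Nat.pos_of_mem_divisors hd.2.1, Nat.pos_of_mem_divisors hd.2.2⟩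

/-- divisors of abc versus triples of divisors -/
lemma divisors_TD (P : ℕ × ℕ) (h1 : 1 ≤ P.1) (h2 : 1 ≤ P.2) (hP : Nat.Coprime P.1 P.2)
    (p : ℕ → Prop) [DecidablePred p] (f : ℕ → ℝ) :
    ∑ D ∈ (P.1 * P.2 * (P.1 + P.2)).divisors.filter p, f D =
      ∑ d ∈ (TD P).filter (fun d => p (d.1 * d.2.1 * d.2.2)), f (d.1 * d.2.1 * d.2.2) := by
  symm
  have hc13 : Nat.Coprime P.1 (P.1 + P.2) := by simpa using hP
  have hc23 : Nat.Coprime P.2 (P.1 + P.2) := by simpa using hP.symm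
  have hcm : Nat.Coprime (P.1 * P.2) (P.1 + P.2) := Nat.Coprime.mul_left hc13 hc23
  refine Finset.sum_nbij' (fun d => d.1 * d.2.1 * d.2.2)
    (fun D => (Nat.gcd D P.1, Nat.gcd D P.2, Nat.gcd D (P.1 + P.2))) ?_ ?_ ?_ ?_ ?_
  · intro d hd
    simp only [Finset.mem_filter] at hd ⊢
    rw [TD_mem (d := d) (P := P) h1 h2] at hd
    refine ⟨Nat.mem_divisors.2 ⟨mul_dvd_mul (mul_dvd_mul hd.1.1 hd.1.2.1) hd.1.2.2, ?_⟩, hd.2⟩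
    have : 0 < P.1 * P.2 * (P.1 + P.2) := by positivity
    omega
  · intro D hD
    simp only [Finset.mem_filter, Nat.mem_divisors] at hD ⊢
    rw [TD_mem (P := P) h1 h2]
    refine ⟨⟨Nat.gcd_dvd_right _ _, Nat.gcd_dvd_right _ _, Nat.gcd_dvd_right _ _⟩, ?_⟩
    rw [← Nat.Coprime.gcd_mul D hP, ← Nat.Coprime.gcd_mul D hcm, Nat.gcd_eq_left hD.1.1]
    exact hD.2
  · rintro ⟨d1, d2, d3⟩ hd
    simp only [Finset.mem_filter] at hd
    rw [TD_mem (P := P) h1 h2] at hd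
    obtain ⟨⟨k1, k2, k3⟩, _⟩ := hd
    simp only at k1 k2 k3
    have key : ∀ {u v d e : ℕ}, d ∣ u → e ∣ v → Nat.Coprime u v → Nat.gcd (d * e) u = d := by
      intro u v d e hd he huv
      rw [Nat.gcd_comm, Nat.Coprime.gcd_mul_right_cancel_right d
        (Nat.Coprime.coprime_dvd_left he huv.symm)]
      exact Nat.gcd_eq_right hd
    simp only [Prod.mk.injEq]
    refine ⟨?_, ?_, ?_⟩
    · rw [mul_assoc]
      exact key k1 (mul_dvd_mul k2 k3) (Nat.Coprime.mul_right hP hc13)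
    · rw [show d1 * d2 * d3 = d2 * (d1 * d3) by ring]
      exact key k2 (mul_dvd_mul k1 k3) (Nat.Coprime.mul_right hP.symm hc23)
    · rw [mul_comm]
      exact key k3 (mul_dvd_mul k1 k2) hcm.symm
  · intro D hD
    simp only [Finset.mem_filter, Nat.mem_divisors] at hD
    simp only
    rw [← Nat.Coprime.gcd_mul D hP, ← Nat.Coprime.gcd_mul D hcm, Nat.gcd_eq_left hD.1.1]
  · intro d _; rfl

end DP5

namespace DP5

abbrev ttt : Bool × Bool × Bool := (true, true, true)

/-- triples with a middle divisor -/
def Eset (z : ℕ) (P : ℕ × ℕ) : Finset (ℕ × ℕ × ℕ) := (TD P).filter (fun d =>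
  (z < d.1 ∧ z < P.1 / d.1) ∨ (z < d.2.1 ∧ z < P.2 / d.2.1) ∨ (z < d.2.2 ∧ z < (P.1 + P.2) / d.2.2))

/-- triples with product in a window -/
noncomputable def Gset (Y1 Y2 : ℝ) (P : ℕ × ℕ) : Finset (ℕ × ℕ × ℕ) := (TD P).filter (fun e =>
  Y1 ≤ (e.1:ℝ) * e.2.1 * e.2.2 ∧ (e.1:ℝ) * e.2.1 * e.2.2 ≤ Y2)

noncomputable def rhow (w z : ℕ) (Y : ℝ) (P : ℕ × ℕ) : ℝ :=
  (∑ s : Bool × Bool × Bool, rsum w s (box z) P) - rsum w ttt (simplex Y) P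

lemma pick_pos (s : Bool) {d n : ℕ} (h : d ∣ n) (hn : 1 ≤ n) : 1 ≤ pick s d (n / d) :=
  Nat.pos_of_dvd_of_pos (pick_dvd s h) hn

lemma flip_box (z : ℕ) (s : Bool × Bool × Bool) {P : ℕ × ℕ} {d : ℕ × ℕ × ℕ} (h1 : 1 ≤ P.1) (h2 : 1 ≤ P.2)
    (hd : d ∈ TD P) : flip3 s P d ∈ box z ↔ (pick s.1 d.1 (P.1 / d.1) ≤ z ∧
      pick s.2.1 d.2.1 (P.2 / d.2.1) ≤ z ∧ pick s.2.2 d.2.2 ((P.1 + P.2) / d.2.2) ≤ z) := by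
  rw [mem_box]
  rw [TD_mem h1 h2] at hd
  have k1 := pick_pos s.1 hd.1 h1
  have k2 := pick_pos s.2.1 hd.2.1 h2
  have k3 := pick_pos s.2.2 hd.2.2 (by omega)
  simp only [flip3]
  tauto

lemma mem_simplex {Y : ℝ} {c : ℕ × ℕ × ℕ} (h1 : 1 ≤ c.1) (h2 : 1 ≤ c.2.1) (h3 : 1 ≤ c.2.2) :
    c ∈ simplex Y ↔ (c.1:ℝ) * c.2.1 * c.2.2 ≤ Y := by
  unfold simplex
  rw [Finset.mem_filter, mem_box]
  constructor
  · exact fun h => h.2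
  · intro h
    have g1 : (1:ℝ) ≤ c.1 := by exact_mod_cast h1
    have g2 : (1:ℝ) ≤ c.2.1 := by exact_mod_cast h2
    have g3 : (1:ℝ) ≤ c.2.2 := by exact_mod_cast h3
    have g12 : (1:ℝ) ≤ c.1 * c.2.1 := by nlinarith
    have a1 : (c.1:ℝ) ≤ c.1 * c.2.1 * c.2.2 := by nlinarith
    have a2 : (c.2.1:ℝ) ≤ c.1 * c.2.1 * c.2.2 := by nlinarith
    have a3 : (c.2.2:ℝ) ≤ c.1 * c.2.1 * c.2.2 := by nlinarith
    exact ⟨⟨⟨h1, Nat.le_floor (a1.trans h)⟩, ⟨h2, Nat.le_floor (a2.trans h)⟩, ⟨h3, Nat.le_floor (a3.trans h)⟩⟩, h⟩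

lemma count_flip (x1 y1 x2 y2 x3 y3 : Prop) [Decidable x1] [Decidable y1] [Decidable x2] [Decidable y2]
    [Decidable x3] [Decidable y3] (h1 : ¬ (x1 ∧ y1)) (h2 : ¬ (x2 ∧ y2)) (h3 : ¬ (x3 ∧ y3)) (r : ℝ)
    (q : Bool × Bool × Bool → Prop) [DecidablePred q]
    (hq : ∀ s, q s ↔ ((bif s.1 then y1 else x1) ∧ (bif s.2.1 then y2 else x2) ∧ (bif s.2.2 then y3 else x3))) :
    (∑ s, if q s then r else 0) = if (¬ x1 ∧ ¬ y1) ∨ (¬ x2 ∧ ¬ y2) ∨ (¬ x3 ∧ ¬ y3) then 0 else r := by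
  simp only [hq, Fintype.sum_prod_type, Fintype.sum_bool, cond_true, cond_false]
  by_cases a1 : x1 <;> by_cases b1 : y1 <;> by_cases a2 : x2 <;> by_cases b2 : y2 <;>
    by_cases a3 : x3 <;> by_cases b3 : y3 <;> simp_all

lemma sum_box_eq (w z : ℕ) (P : ℕ × ℕ) (h1 : 1 ≤ P.1) (h2 : 1 ≤ P.2) (hP : Nat.Coprime P.1 P.2)
    (hz1 : z * z < P.1) (hz2 : z * z < P.2) :
    ∑ d ∈ TD P, phiW w (d.1 * d.2.1 * d.2.2) - ∑ s : Bool × Bool × Bool, rsum w s (box z) P =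
      ∑ d ∈ Eset z P, phiW w (d.1 * d.2.1 * d.2.2) := by
  have e1 : ∑ s : Bool × Bool × Bool, rsum w s (box z) P = ∑ d ∈ TD P,
      if (z < d.1 ∧ z < P.1 / d.1) ∨ (z < d.2.1 ∧ z < P.2 / d.2.1) ∨
        (z < d.2.2 ∧ z < (P.1 + P.2) / d.2.2) then 0 else phiW w (d.1 * d.2.1 * d.2.2) := by
    simp_rw [rsum_eq w _ (box z) P h1 h2 hP, Finset.sum_filter]
    rw [Finset.sum_comm]
    refine Finset.sum_congr rfl fun d hd => ?_
    have hdd := (TD_mem h1 h2).1 hd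
    have key : ∀ {n k : ℕ}, z * z < n → k ∣ n → ¬ (k ≤ z ∧ n / k ≤ z) := by
      intro n k hn hk ⟨a, b⟩
      have := Nat.mul_div_cancel' hk
      have h := Nat.mul_le_mul a b
      omega
    have := count_flip (d.1 ≤ z) (P.1 / d.1 ≤ z) (d.2.1 ≤ z) (P.2 / d.2.1 ≤ z) (d.2.2 ≤ z)
      ((P.1 + P.2) / d.2.2 ≤ z) (key hz1 hdd.1) (key hz2 hdd.2.1) (key (by omega) hdd.2.2)
      (phiW w (d.1 * d.2.1 * d.2.2)) (fun s => flip3 s P d ∈ box z) (by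
        rintro ⟨s1, s2, s3⟩
        rw [flip_box z _ h1 h2 hd]
        cases s1 <;> cases s2 <;> cases s3 <;> simp [pick])
    simp only [not_le] at this
    exact this
  rw [e1, ← Finset.sum_sub_distrib, Eset, Finset.sum_filter]
  refine Finset.sum_congr rfl fun d _ => ?_
  split_ifs <;> simp

lemma rho_split (w : ℕ) (X : ℝ) (P : ℕ × ℕ) (h1 : 1 ≤ P.1) (h2 : 1 ≤ P.2) (hP : Nat.Coprime P.1 P.2) :
    rho w X P = ∑ d ∈ TD P, phiW w (d.1 * d.2.1 * d.2.2) -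
      ∑ d ∈ (TD P).filter (fun d => X < ((d.1 * d.2.1 * d.2.2 : ℕ):ℝ)), phiW w (d.1 * d.2.1 * d.2.2) := by
  unfold rho
  rw [divisors_TD P h1 h2 hP]
  rw [eq_sub_iff_add_eq, ← Finset.sum_filter_add_sum_filter_not (TD P) (fun d => ((d.1 * d.2.1 * d.2.2 : ℕ):ℝ) ≤ X)]
  simp only [not_le]

lemma cut_eq (w : ℕ) (X Y Y1 : ℝ) (hX : 0 < X) (P : ℕ × ℕ) (h1 : 1 ≤ P.1) (h2 : 1 ≤ P.2) (hP : Nat.Coprime P.1 P.2)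
    (hY : ((P.1 * P.2 * (P.1 + P.2) : ℕ):ℝ) ≤ X * Y) (hY1 : X * Y1 ≤ ((P.1 * P.2 * (P.1 + P.2) : ℕ):ℝ)) :
    |rsum w ttt (simplex Y) P -
      ∑ d ∈ (TD P).filter (fun d => X < ((d.1 * d.2.1 * d.2.2 : ℕ):ℝ)), phiW w (d.1 * d.2.1 * d.2.2)| ≤
      (Gset Y1 Y P).card := by
  have hinv : Set.InjOn (flip3 ttt P) (TD P) := by
    intro a ha b hb hab
    rw [← flip3_flip3 ttt h1 h2 ha, hab, flip3_flip3 ttt h1 h2 hb]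
  have prodeq : ∀ d ∈ TD P, (d.1 * d.2.1 * d.2.2) * ((flip3 ttt P d).1 * (flip3 ttt P d).2.1 * (flip3 ttt P d).2.2)
      = P.1 * P.2 * (P.1 + P.2) := by
    intro d hd
    rw [TD_mem h1 h2] at hd
    simp only [flip3, pick, cond_true]
    calc _ = (d.1 * (P.1 / d.1)) * (d.2.1 * (P.2 / d.2.1)) * (d.2.2 * ((P.1 + P.2) / d.2.2)) := by ring
      _ = _ := by rw [Nat.mul_div_cancel' hd.1, Nat.mul_div_cancel' hd.2.1, Nat.mul_div_cancel' hd.2.2]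
  rw [rsum_eq w ttt _ P h1 h2 hP, Finset.sum_filter, Finset.sum_filter, ← Finset.sum_sub_distrib]
  have hcard : ((Gset Y1 Y P).card : ℝ) = ((TD P).filter (fun d => flip3 ttt P d ∈ Gset Y1 Y P)).card := by
    norm_cast
    symm
    refine Finset.card_nbij' (flip3 ttt P) (flip3 ttt P) ?_ ?_ ?_ ?_
    · intro d hd; simp only [Finset.coe_filter, Set.mem_setOf_eq] at hd; exact hd.2
    · intro d hd
      have hd' : d ∈ TD P := (Finset.mem_filter.1 hd).1
      simp only [Finset.coe_filter, Set.mem_setOf_eq]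
      exact ⟨flip3_mem _ h1 h2 hd', by rw [flip3_flip3 _ h1 h2 hd']; exact hd⟩
    · intro d hd; simp only [Finset.coe_filter, Set.mem_setOf_eq] at hd; exact flip3_flip3 _ h1 h2 hd.1
    · intro d hd; exact flip3_flip3 _ h1 h2 (Finset.mem_filter.1 hd).1
  rw [hcard, Finset.card_filter]
  push_cast
  refine (Finset.abs_sum_le_sum_abs _ _).trans (Finset.sum_le_sum fun d hd => ?_)
  have hm := flip3_mem ttt h1 h2 hd
  obtain ⟨q1, q2, q3⟩ := TD_pos hm
  obtain ⟨r1, r2, r3⟩ := TD_pos hd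
  have hpr := prodeq d hd
  have hphi := phiW_mem w (d.1 * d.2.1 * d.2.2)
  have hs := mem_simplex (Y := Y) q1 q2 q3
  have hg : flip3 ttt P d ∈ Gset Y1 Y P ↔
      (Y1 ≤ ((flip3 ttt P d).1:ℝ) * (flip3 ttt P d).2.1 * (flip3 ttt P d).2.2 ∧
        ((flip3 ttt P d).1:ℝ) * (flip3 ttt P d).2.1 * (flip3 ttt P d).2.2 ≤ Y) := by
    unfold Gset; simp only [Finset.mem_filter, hm, true_and]
  simp only [hs, hg]
  have hDpos : (0:ℝ) < (d.1:ℝ) * d.2.1 * d.2.2 := by positivity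
  have hEpos : (0:ℝ) < ((flip3 ttt P d).1:ℝ) * (flip3 ttt P d).2.1 * (flip3 ttt P d).2.2 := by positivity
  have hpr' : ((d.1:ℝ) * d.2.1 * d.2.2) * (((flip3 ttt P d).1:ℝ) * (flip3 ttt P d).2.1 * (flip3 ttt P d).2.2)
      = ((P.1 * P.2 * (P.1 + P.2) : ℕ):ℝ) := by exact_mod_cast hpr
  rw [← hpr'] at hY hY1
  set D := (d.1:ℝ) * d.2.1 * d.2.2
  set E := ((flip3 ttt P d).1:ℝ) * (flip3 ttt P d).2.1 * (flip3 ttt P d).2.2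
  by_cases hDX : X < D
  · have : E ≤ Y := by
      by_contra h
      push Not at h
      nlinarith
    rw [if_pos this, if_pos hDX, sub_self, abs_zero]
    split_ifs <;> norm_num
  · rw [if_neg hDX, sub_zero]
    push Not at hDX
    have hge : Y1 ≤ E := by
      by_contra h
      push Not at h
      nlinarith
    by_cases hEY : E ≤ Y
    · rw [if_pos hEY, if_pos ⟨hge, hEY⟩, abs_of_nonneg hphi.1]; exact hphi.2
    · rw [if_neg hEY, abs_zero]; split_ifs <;> norm_num

lemma pointwise (w z : ℕ) (X Y Y1 : ℝ) (hX : 0 < X) (P : ℕ × ℕ) (h1 : 1 ≤ P.1) (h2 : 1 ≤ P.2) (hP : Nat.Coprime P.1 P.2)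
    (hY : ((P.1 * P.2 * (P.1 + P.2) : ℕ):ℝ) ≤ X * Y) (hY1 : X * Y1 ≤ ((P.1 * P.2 * (P.1 + P.2) : ℕ):ℝ))
    (hz1 : z * z < P.1) (hz2 : z * z < P.2) :
    |rho w X P - rhow w z Y P| ≤ (Eset z P).card + (Gset Y1 Y P).card := by
  have e1 := sum_box_eq w z P h1 h2 hP hz1 hz2
  have e2 := cut_eq w X Y Y1 hX P h1 h2 hP hY hY1
  have e3 : |∑ d ∈ Eset z P, phiW w (d.1 * d.2.1 * d.2.2)| ≤ (Eset z P).card := by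
    refine (Finset.abs_sum_le_sum_abs _ _).trans ?_
    rw [Finset.card_eq_sum_ones]; push_cast
    refine Finset.sum_le_sum fun d _ => ?_
    rw [abs_of_nonneg (phiW_mem _ _).1]; exact (phiW_mem _ _).2
  rw [rho_split w X P h1 h2 hP]
  unfold rhow
  rw [sub_sub_sub_comm, e1, sub_eq_add_neg, neg_sub]
  exact (abs_add_le _ _).trans (add_le_add e3 e2)

lemma T3_eq (P : ℕ × ℕ) : T3 P = (TD P).card := by
  unfold T3 TD tau
  rw [Finset.card_product, Finset.card_product]; push_cast; ring

lemma rsum_bd (w : ℕ) (s : Bool × Bool × Bool) (C : Finset (ℕ × ℕ × ℕ)) (P : ℕ × ℕ) (h1 : 1 ≤ P.1) (h2 : 1 ≤ P.2) :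
    0 ≤ rsum w s C P ∧ rsum w s C P ≤ T3 P := by
  unfold rsum
  refine ⟨Finset.sum_nonneg fun c _ => (Th_mem _ _ _ _ _ _ _ _).1, ?_⟩
  rw [T3_eq]
  calc _ ≤ ∑ c ∈ (C.filter (fun c => Nat.Coprime c.2.1 c.2.2)).filter
          (fun c => c.1 ∣ P.1 ∧ c.2.1 ∣ P.2 ∧ c.2.2 ∣ P.1 + P.2), (1:ℝ) :=
        Finset.sum_le_sum fun c _ => (Th_mem _ _ _ _ _ _ _ _).2
    _ = _ := by rw [Finset.sum_const, nsmul_eq_mul, mul_one]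
    _ ≤ _ := by
      norm_cast
      apply Finset.card_le_card
      intro c hc
      rw [Finset.mem_filter] at hc
      exact (TD_mem h1 h2).2 hc.2

lemma rhow_bd (w z : ℕ) (Y : ℝ) (P : ℕ × ℕ) (h1 : 1 ≤ P.1) (h2 : 1 ≤ P.2) : |rhow w z Y P| ≤ 8 * T3 P := by
  unfold rhow
  have a := fun s => rsum_bd w s (box z) P h1 h2
  have b := rsum_bd w ttt (simplex Y) P h1 h2
  have c1 : ∑ s : Bool × Bool × Bool, rsum w s (box z) P ≤ 8 * T3 P := by
    refine (Finset.sum_le_sum fun s _ => (a s).2).trans (le_of_eq ?_)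
    simp
  have c0 : 0 ≤ ∑ s : Bool × Bool × Bool, rsum w s (box z) P := Finset.sum_nonneg fun s _ => (a s).1
  have t := T3_nonneg P
  rw [abs_le]; constructor <;> linarith

lemma rho_bd (w : ℕ) (X : ℝ) (P : ℕ × ℕ) (h1 : 1 ≤ P.1) (h2 : 1 ≤ P.2) (hP : Nat.Coprime P.1 P.2) :
    0 ≤ rho w X P ∧ rho w X P ≤ T3 P := by
  have h0 : 0 ≤ rho w X P := Finset.sum_nonneg fun d _ => (phiW_mem _ _).1
  refine ⟨h0, ?_⟩
  rw [rho_split w X P h1 h2 hP, T3_eq]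
  have : ∑ d ∈ TD P, phiW w (d.1 * d.2.1 * d.2.2) ≤ (TD P).card := by
    rw [Finset.card_eq_sum_ones]; push_cast
    exact Finset.sum_le_sum fun d _ => (phiW_mem _ _).2
  have h2 : 0 ≤ ∑ d ∈ (TD P).filter (fun d => X < ((d.1 * d.2.1 * d.2.2 : ℕ):ℝ)), phiW w (d.1 * d.2.1 * d.2.2) :=
    Finset.sum_nonneg fun d _ => (phiW_mem _ _).1
  linarith

lemma rsum_zero (w : ℕ) (s : Bool × Bool × Bool) (C : Finset (ℕ × ℕ × ℕ)) (P : ℕ × ℕ) (p : ℕ) (hp : p.Prime)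
    (hpw : p ≤ w) (h1 : p ∣ P.1) (h2 : p ∣ P.2) : rsum w s C P = 0 := by
  unfold rsum
  refine Finset.sum_eq_zero fun c hc => ?_
  rw [Finset.mem_filter] at hc
  unfold ThP Th
  apply Finset.prod_eq_zero (Finset.mem_univ (⟨p, by simp [PS]; exact ⟨by omega, hp⟩⟩ : PS w))
  simp only [crt_nat]
  unfold loc
  rw [if_pos]
  rw [← Nat.cast_mul, ← Nat.cast_mul, Nat.mul_div_cancel' hc.2.1, Nat.mul_div_cancel' hc.2.2.1,
      ZMod.natCast_eq_zero_iff, ZMod.natCast_eq_zero_iff]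
  exact ⟨h1, h2⟩

lemma rhow_zero (w z : ℕ) (Y : ℝ) (P : ℕ × ℕ) (p : ℕ) (hp : p.Prime)
    (hpw : p ≤ w) (h1 : p ∣ P.1) (h2 : p ∣ P.2) : rhow w z Y P = 0 := by
  unfold rhow
  simp [rsum_zero w _ _ P p hp hpw h1 h2]

end DP5

namespace DP5

lemma sqsq_le (m : ℕ) (hm : 1 ≤ m) : Nat.sqrt (2 * Nat.sqrt m) ≤ m := by
  have h1 := Nat.sqrt_le (2 * Nat.sqrt m)
  have h2 := Nat.sqrt_le_self m
  by_contra h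
  push Not at h
  nlinarith

lemma harm0 (m N : ℕ) (hN : N ≤ m) : ∑ c ∈ Finset.Ioc 0 N, (1:ℝ) / c ≤ 1 + Real.log m := by
  have : Finset.Ioc 0 N = Finset.Icc 1 N := by ext; simp; omega
  rw [this]
  refine (harm_le N).trans ?_
  rcases Nat.eq_zero_or_pos N with h | h
  · subst h; simp; exact Real.log_natCast_nonneg m
  · have := Real.log_le_log (by exact_mod_cast h : (0:ℝ) < N) (by exact_mod_cast hN : (N:ℝ) ≤ m)
    linarith

lemma Ebound (m z : ℕ) (hm : 1 ≤ m) (hz : 1 ≤ z) (hzN : z ≤ Nat.sqrt (2 * Nat.sqrt m)) :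
    ∑ P ∈ CR m, ((Eset z P).card : ℝ) ≤
      96 * m * (1 + Real.log m) ^ 2 * (2 + Real.log ((Nat.sqrt (2 * Nat.sqrt m) : ℕ) / z)) := by
  have hh := harm0 m _ (sqsq_le m hm)
  have hw := wd_sum z _ hz hzN
  have a1 := mid_prod m z 0 0
  have a2 := mid_prod m 0 z 0
  have a3 := mid_prod m 0 0 z
  simp only [mid_zero] at a1 a2 a3
  set N := Nat.sqrt (2 * Nat.sqrt m)
  set S0 := ∑ c ∈ Finset.Ioc 0 N, (1:ℝ) / c
  set Sz := ∑ c ∈ Finset.Ioc z N, (1:ℝ) / c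
  have p0 : 0 ≤ S0 := Finset.sum_nonneg fun _ _ => by positivity
  have pz : 0 ≤ Sz := Finset.sum_nonneg fun _ _ => by positivity
  have hE : ∀ P ∈ CR m, ((Eset z P).card : ℝ) ≤
      (((mid z P.1).card * P.2.divisors.card * (P.1 + P.2).divisors.card : ℕ):ℝ) +
      ((P.1.divisors.card * (mid z P.2).card * (P.1 + P.2).divisors.card : ℕ):ℝ) +
      ((P.1.divisors.card * P.2.divisors.card * (mid z (P.1 + P.2)).card : ℕ):ℝ) := by
    intro P _
    norm_cast
    have sub : Eset z P ⊆ ((mid z P.1) ×ˢ P.2.divisors ×ˢ (P.1 + P.2).divisors ∪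
      P.1.divisors ×ˢ (mid z P.2) ×ˢ (P.1 + P.2).divisors) ∪
      P.1.divisors ×ˢ P.2.divisors ×ˢ (mid z (P.1 + P.2)) := by
      intro d hd
      simp only [Eset, TD, Finset.mem_filter, Finset.mem_product, Finset.mem_union, mid] at hd ⊢
      tauto
    refine (Finset.card_le_card sub).trans ?_
    refine (Finset.card_union_le _ _).trans ?_
    refine (Nat.add_le_add_right (Finset.card_union_le _ _) _).trans (le_of_eq ?_)
    simp only [Finset.card_product]
    ring
  refine (Finset.sum_le_sum hE).trans ?_
  rw [Finset.sum_add_distrib, Finset.sum_add_distrib]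
  have key : S0 * S0 * Sz ≤ (1 + Real.log m) ^ 2 * (2 + Real.log (N / z)) := by
    calc S0 * S0 * Sz ≤ (1 + Real.log m) * (1 + Real.log m) * (2 + Real.log (N / z)) := by
          gcongr
      _ = _ := by ring
  calc _ ≤ 96 * m * (S0 * S0 * Sz) := by linarith
    _ ≤ 96 * m * ((1 + Real.log m) ^ 2 * (2 + Real.log (N / z))) := by gcongr
    _ = _ := by ring

lemma Gbound (m : ℕ) (Y1 Y2 : ℝ) (hY1 : 0 < Y1) (hY : Y1 ≤ Y2) (hYm : Y2 ≤ Nat.sqrt m) :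
    ∑ P ∈ CR m, ((Gset Y1 Y2 P).card : ℝ) ≤
      4 * m * ((1 + Real.log m) ^ 2 * (2 + Real.log (Y2 / Y1))) := by
  classical
  set N := ⌊Y2⌋₊ with hN
  have hNm : N ≤ m := (Nat.floor_le_of_le hYm).trans (Nat.sqrt_le_self m)
  set C := (box N).filter (fun c => Y1 ≤ (c.1:ℝ) * c.2.1 * c.2.2 ∧ (c.1:ℝ) * c.2.1 * c.2.2 ≤ Y2) with hCdef
  have hU := lemU_CR m C (by
    intro c hc
    rw [hCdef, Finset.mem_filter, mem_box] at hc
    refine ⟨hc.1.1.1, hc.1.2.1.1, hc.1.2.2.1, ?_⟩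
    have g1 : (1:ℝ) ≤ c.1 := by exact_mod_cast hc.1.1.1
    have g2 : (0:ℝ) ≤ (c.2.1:ℝ) * c.2.2 := by positivity
    have : (c.2.1:ℝ) * c.2.2 ≤ 2 * Nat.sqrt m := by
      have h0 : (0:ℝ) ≤ Nat.sqrt m := by positivity
      nlinarith [hc.2.2]
    exact_mod_cast this)
  have hsum : ∑ c ∈ C, (1:ℝ) / (c.1 * c.2.1 * c.2.2) ≤ (1 + Real.log m) ^ 2 * (2 + Real.log (Y2 / Y1)) := by
    have hI : Finset.Icc 1 N = Finset.Ioc 0 N := by ext; simp; omega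
    have hh := harm0 m N hNm
    rw [← hI] at hh
    have hlog : 0 ≤ Real.log (Y2 / Y1) := Real.log_nonneg (by rw [le_div_iff₀ hY1]; linarith)
    rw [hCdef, Finset.sum_filter]
    rw [sum_box N (fun a b c => if Y1 ≤ (a:ℝ) * b * c ∧ (a:ℝ) * b * c ≤ Y2 then (1:ℝ) / (a * b * c) else 0)]
    have inner : ∀ a ∈ Finset.Icc 1 N, ∀ b ∈ Finset.Icc 1 N,
        ∑ c ∈ Finset.Icc 1 N, (if Y1 ≤ (a:ℝ) * b * c ∧ (a:ℝ) * b * c ≤ Y2 then (1:ℝ) / (a * b * c) else 0)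
        ≤ (1:ℝ) / a * (1 / b) * (2 + Real.log (Y2 / Y1)) := by
      intro a ha b hb
      rw [Finset.mem_Icc] at ha hb
      have ha0 : (0:ℝ) < a := by exact_mod_cast ha.1
      have hb0 : (0:ℝ) < b := by exact_mod_cast hb.1
      rw [← Finset.sum_filter]
      have hw := harm_window (Y1 / (a * b)) (Y2 / (a * b)) (by positivity) (by gcongr)
        ((Finset.Icc 1 N).filter (fun c : ℕ => Y1 ≤ (a:ℝ) * b * c ∧ (a:ℝ) * b * c ≤ Y2)) (by
          intro c hc
          rw [Finset.mem_filter, Finset.mem_Icc] at hc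
          refine ⟨hc.1.1, ?_, ?_⟩
          · rw [div_le_iff₀ (by positivity)]; linarith [hc.2.1]
          · rw [le_div_iff₀ (by positivity)]; linarith [hc.2.2])
      have e : Y2 / (a * b) / (Y1 / (a * b)) = Y2 / Y1 := by field_simp
      rw [e] at hw
      calc _ = (1:ℝ) / a * (1 / b) * ∑ c ∈ (Finset.Icc 1 N).filter (fun c : ℕ => Y1 ≤ (a:ℝ) * b * c ∧ (a:ℝ) * b * c ≤ Y2), (1:ℝ) / c := by
            rw [Finset.mul_sum]
            refine Finset.sum_congr rfl fun c _ => ?_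
            rw [one_div_mul_one_div, one_div_mul_one_div]
        _ ≤ _ := by gcongr
    calc _ ≤ ∑ a ∈ Finset.Icc 1 N, ∑ b ∈ Finset.Icc 1 N, (1:ℝ) / a * (1 / b) * (2 + Real.log (Y2 / Y1)) :=
          Finset.sum_le_sum fun a ha => Finset.sum_le_sum fun b hb => inner a ha b hb
      _ = (∑ a ∈ Finset.Icc 1 N, (1:ℝ) / a) * (∑ b ∈ Finset.Icc 1 N, (1:ℝ) / b) * (2 + Real.log (Y2 / Y1)) := by
          rw [Finset.sum_mul_sum, Finset.sum_mul]
          refine Finset.sum_congr rfl fun a _ => ?_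
          rw [Finset.sum_mul]
      _ ≤ (1 + Real.log m) * (1 + Real.log m) * (2 + Real.log (Y2 / Y1)) := by
          have : 0 ≤ ∑ b ∈ Finset.Icc 1 N, (1:ℝ) / b := Finset.sum_nonneg fun _ _ => by positivity
          gcongr
      _ = _ := by ring
  have hG : ∀ P ∈ CR m, ((Gset Y1 Y2 P).card : ℝ) ≤
      ((C.filter (fun c => c.1 ∣ P.1 ∧ c.2.1 ∣ P.2 ∧ c.2.2 ∣ P.1 + P.2)).card : ℝ) := by
    intro P hP
    obtain ⟨p1, p2, p3, p4⟩ := mem_CR.1 hP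
    norm_cast
    apply Finset.card_le_card
    intro d hd
    rw [Gset, Finset.mem_filter] at hd
    obtain ⟨q1, q2, q3⟩ := TD_pos hd.1
    have hs := (mem_simplex (Y := Y2) q1 q2 q3).2 hd.2.2
    rw [simplex, Finset.mem_filter] at hs
    rw [Finset.mem_filter, hCdef, Finset.mem_filter]
    exact ⟨⟨hs.1, hd.2⟩, (TD_mem p1 p2).1 hd.1⟩
  calc _ ≤ _ := Finset.sum_le_sum hG
    _ ≤ _ := hU
    _ ≤ _ := by gcongr

open Classical in
lemma CR_eq (m : ℕ) : CR m = (Rg m).filter (fun P => Nat.Coprime P.1 P.2) := by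
  ext P; rw [mem_CR, Finset.mem_filter, mem_Rg]; tauto

/-- product bound -/
lemma prod_le_sqrt {a b m : ℕ} (h : Fn a b ≤ m) : ((a * b * (a + b) : ℕ):ℝ) ≤ Real.sqrt m ^ 3 := by
  have hm0 : (0:ℝ) ≤ m := by positivity
  have hs := Real.sq_sqrt hm0
  have hs0 := Real.sqrt_nonneg (m:ℝ)
  have key : ((min a b : ℕ):ℝ) ≤ Real.sqrt m := by
    apply Real.le_sqrt_of_sq_le
    have : min a b ^ 2 ≤ m := by
      refine le_trans ?_ h
      unfold Fn
      rw [pow_two]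
      exact Nat.mul_le_mul (by omega) (by omega)
    exact_mod_cast this
  have e : a * b * (a + b) = min a b * Fn a b := by
    unfold Fn
    rw [← min_mul_max a b]; ring
  rw [e]
  push_cast
  have hF : (Fn a b : ℝ) ≤ m := by exact_mod_cast h
  have hF0 : (0:ℝ) ≤ Fn a b := by positivity
  calc ((min a b : ℝ)) * Fn a b ≤ Real.sqrt m * m := by
        push_cast at key
        gcongr
    _ = Real.sqrt m ^ 3 := by rw [pow_succ, hs]; ring

open Classical in
lemma diff_bound (m w z : ℕ) (X Y : ℝ) (hm : 1 ≤ m) (hw : 1 ≤ w) (hz : 1 ≤ z) (hX : 0 < X)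
    (hzS : z * z * w < Nat.sqrt m) (hXY : X * Y = Real.sqrt m ^ 3) (hYS : Y ≤ Nat.sqrt m) :
    |∑ P ∈ CR m, rho w X P - ∑ P ∈ Rg m, rhow w z Y P| ≤
      96 * m * (1 + Real.log m) ^ 2 * (2 + Real.log ((Nat.sqrt (2 * Nat.sqrt m) : ℕ) / z)) +
      4 * m * ((1 + Real.log m) ^ 2 * (2 + Real.log (4 * w ^ 3))) +
      524864 * (m / w * (1 + Real.log m) ^ 3) := by
  have hw0 : (1:ℝ) ≤ w := by exact_mod_cast hw
  have hzz : z ≤ z * z := Nat.le_mul_self z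
  have hzzw : z * z ≤ z * z * w := Nat.le_mul_of_pos_right _ hw
  have hzN : z ≤ Nat.sqrt (2 * Nat.sqrt m) := by rw [Nat.le_sqrt]; omega
  have hm1 : (1:ℝ) ≤ m := by exact_mod_cast hm
  have hH1 : 1 ≤ Real.sqrt m := Real.one_le_sqrt.2 hm1
  have hYpos : 0 < Y := by
    have : 0 < X * Y := by rw [hXY]; positivity
    exact (mul_pos_iff_of_pos_left hX).1 this
  have hE := Ebound m z hm hz hzN
  have hG := Gbound m (Y / (4 * w ^ 3)) Y (by positivity)
    (by apply div_le_self hYpos.le; nlinarith [pow_le_pow_left₀ zero_le_one hw0 3]) hYS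
  rw [show Y / (Y / (4 * (w:ℝ) ^ 3)) = 4 * w ^ 3 by field_simp] at hG
  have hS := UBstrip m w hm hw
  have hN := NP m w hm hw
  set S := Nat.sqrt m with hSdef
  have hSH : Real.sqrt m ≤ 2 * S := by
    have h1 : m < (S + 1) * (S + 1) := Nat.lt_succ_sqrt m
    have h2 : 1 ≤ S := by omega
    apply Real.sqrt_le_iff.2
    refine ⟨by positivity, ?_⟩
    have : m ≤ (2 * S) ^ 2 := by nlinarith
    exact_mod_cast this
  -- decompose
  have e1 : ∑ P ∈ Rg m, rhow w z Y P = ∑ P ∈ CR m, rhow w z Y P +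
      ∑ P ∈ (Rg m).filter (fun P => ¬ Nat.Coprime P.1 P.2), rhow w z Y P := by
    rw [CR_eq, Finset.sum_filter_add_sum_filter_not]
  rw [e1, ← sub_sub, ← Finset.sum_sub_distrib]
  have b1 : |∑ P ∈ (Rg m).filter (fun P => ¬ Nat.Coprime P.1 P.2), rhow w z Y P| ≤
      8 * (65536 * m / w * (1 + Real.log m) ^ 3) := by
    refine (Finset.abs_sum_le_sum_abs _ _).trans (le_trans ?_ (mul_le_mul_of_nonneg_left hN (by norm_num)))
    rw [Finset.mul_sum, Finset.sum_filter, Finset.sum_filter]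
    refine Finset.sum_le_sum fun P hP => ?_
    obtain ⟨p1, p2, p3⟩ := mem_Rg.1 hP
    have hT := T3_nonneg P
    by_cases hc : Nat.Coprime P.1 P.2
    · rw [if_neg (not_not.2 hc)]
      split_ifs <;> linarith
    · rw [if_pos hc]
      obtain ⟨p, hp, hd1, hd2⟩ := Nat.Prime.not_coprime_iff_dvd.1 hc
      by_cases hpw : p ≤ w
      · rw [rhow_zero w z Y P p hp hpw hd1 hd2, abs_zero]
        split_ifs <;> linarith
      · rw [if_pos ⟨p, hp, by omega, hd1, hd2⟩]
        exact rhow_bd w z Y P p1 p2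
  have b2 : |∑ P ∈ CR m, (rho w X P - rhow w z Y P)| ≤
      ∑ P ∈ CR m, ((Eset z P).card : ℝ) + ∑ P ∈ CR m, ((Gset (Y / (4 * w ^ 3)) Y P).card : ℝ) +
      9 * (64 * m / w * (1 + Real.log m) ^ 3) := by
    refine (Finset.abs_sum_le_sum_abs _ _).trans ?_
    refine le_trans ?_ (add_le_add_right (mul_le_mul_of_nonneg_left hS (by norm_num)) _)
    rw [← Finset.sum_add_distrib, Finset.mul_sum, Finset.sum_filter, ← Finset.sum_add_distrib]
    refine Finset.sum_le_sum fun P hP => ?_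
    obtain ⟨p1, p2, p3, p4⟩ := mem_CR.1 hP
    have hT := T3_nonneg P
    by_cases hst : P.1 * w < S ∨ P.2 * w < S
    · rw [if_pos hst]
      have r1 := rho_bd w X P p1 p2 p4
      have r2 := rhow_bd w z Y P p1 p2
      have r3 := abs_sub (rho w X P) (rhow w z Y P)
      rw [abs_of_nonneg r1.1] at r3
      have : (0:ℝ) ≤ (Eset z P).card + (Gset (Y / (4 * w ^ 3)) Y P).card := by positivity
      linarith
    · rw [if_neg hst, add_zero]
      push Not at hst
      refine pointwise w z X Y (Y / (4 * w ^ 3)) hX P p1 p2 p4 ?_ ?_ ?_ ?_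
      · rw [hXY]; exact prod_le_sqrt p3
      · rw [← mul_div_assoc, hXY, div_le_iff₀ (by positivity)]
        have q1 : (S:ℝ) ≤ P.1 * w := by exact_mod_cast hst.1
        have q2 : (S:ℝ) ≤ P.2 * w := by exact_mod_cast hst.2
        have q3 : (2:ℝ) * S ≤ (P.1 + P.2) * w := by linarith
        have hS0 : (0:ℝ) ≤ S := by positivity
        have : Real.sqrt m ^ 3 ≤ (2 * (S:ℝ)) ^ 3 := by gcongr
        have h4 : (S:ℝ) * S * (2 * S) ≤ (P.1 * w) * (P.2 * w) * ((P.1 + P.2) * w) := by gcongr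
        push_cast
        nlinarith
      · by_contra h; push Not at h
        have := Nat.mul_le_mul_right w h; omega
      · by_contra h; push Not at h
        have := Nat.mul_le_mul_right w h; omega
  refine (abs_sub _ _).trans ((add_le_add b2 b1).trans ?_)
  have e9 : 9 * (64 * m / w * (1 + Real.log m) ^ 3) + 8 * (65536 * m / w * (1 + Real.log m) ^ 3)
    = 524864 * (m / w * (1 + Real.log m) ^ 3) := by ring
  linarith

end DP5

namespace DP5

lemma kap_mem (w : ℕ) : 0 ≤ kap w ∧ kap w ≤ 1 := by
  have h : ∀ i : PS w, 0 ≤ (1 - 1 / ((i:ℕ):ℝ)) ^ 4 * (1 + 4 / ((i:ℕ):ℝ)) ∧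
      (1 - 1 / ((i:ℕ):ℝ)) ^ 4 * (1 + 4 / ((i:ℕ):ℝ)) ≤ 1 := by
    intro i
    have hp : (2:ℝ) ≤ (i:ℕ) := by exact_mod_cast (PS_prime i).two_le
    have h1 : (1:ℝ) / (i:ℕ) ≤ 1 / 2 := by
      rw [div_le_div_iff₀ (by linarith) (by norm_num)]; linarith
    have h' : (0:ℝ) ≤ 1 / (i:ℕ) := by positivity
    rw [show (4:ℝ) / (i:ℕ) = 4 * (1 / (i:ℕ)) by ring]
    generalize (1:ℝ) / (i:ℕ) = x at *
    refine ⟨by positivity, ?_⟩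
    have : 1 - (1 - x) ^ 4 * (1 + 4 * x) = x ^ 2 * (10 - 20 * x + 15 * x ^ 2 - 4 * x ^ 3) := by ring
    have h2 : 0 ≤ 10 - 20 * x + 15 * x ^ 2 - 4 * x ^ 3 := by
      nlinarith [sq_nonneg x, mul_nonneg h' (sq_nonneg x), mul_nonneg (sq_nonneg x) (sub_nonneg.2 h1)]
    nlinarith [mul_nonneg (sq_nonneg x) h2]
  exact ⟨Finset.prod_nonneg fun i _ => (h i).1, Finset.prod_le_one (fun i _ => (h i).1) (fun i _ => (h i).2)⟩

lemma rhow_sum (m w z : ℕ) (Y Z : ℝ) (hm : 1 ≤ m) (hw : 1 ≤ w) (hz : 1 ≤ z) (hzm : z ≤ m)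
    (hzZ : (z * z : ℝ) ≤ Z) (hY0 : 0 ≤ Y) (hYZ : Y ≤ Z) (hYm : Y ≤ m) :
    |∑ P ∈ Rg m, rhow w z Y P - kap w * (AA * m) * (8 * Real.log z ^ 3 - max 0 (Real.log Y) ^ 3 / 6)| ≤
      9 * ((AA * m) * (12 * WW w * (1 + Real.log m) ^ 2 + (1 + Real.log m) ^ 3 / w) +
        (WW w + 1) * Real.sqrt m * (2 * Z * (1 + Real.log m) ^ 3)) := by
  have hL := one_le_L m
  have hz1 : (1:ℝ) ≤ z := by exact_mod_cast hz
  have hZ0 : 0 ≤ Z := le_trans (by positivity) hzZ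
  have hAm : 0 ≤ AA * m := mul_nonneg AA_nonneg (by positivity)
  have hlz : Real.log z ≤ Real.log m := Real.log_le_log (by linarith) (by exact_mod_cast hzm)
  have hlz0 : 0 ≤ Real.log z := Real.log_nonneg hz1
  set E := ((AA * m) * (12 * WW w * (1 + Real.log m) ^ 2 + (1 + Real.log m) ^ 3 / w) +
        (WW w + 1) * Real.sqrt m * (2 * Z * (1 + Real.log m) ^ 3)) with hE
  have hbox : ∀ s, |∑ P ∈ Rg m, rsum w s (box z) P - kap w * Real.log z ^ 3 * (AA * m)| ≤ E := by
    intro s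
    have := main_gen w hw s m z hm (box z) (Finset.Subset.refl _) _ _ Z hZ0 (by
      intro c hc
      rw [mem_box] at hc
      have a1 : (c.1:ℝ) ≤ z := by exact_mod_cast hc.1.2
      have a2 : (c.2.1:ℝ) ≤ z := by exact_mod_cast hc.2.1.2
      have a3 : (c.2.2:ℝ) ≤ z := by exact_mod_cast hc.2.2.2
      refine ⟨by nlinarith, le_trans ?_ hzZ⟩
      gcongr) (box_sum w s z hz)
    rw [sum_MS] at this
    refine this.trans ?_
    rw [hE]
    gcongr
  have hsim : |∑ P ∈ Rg m, rsum w ttt (simplex Y) P - kap w * (max 0 (Real.log Y) ^ 3 / 6) * (AA * m)| ≤ E := by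
    have hE0 : 0 ≤ E := le_trans (abs_nonneg _) (hbox ttt)
    by_cases hY : 1 ≤ Y
    · rw [max_eq_right (Real.log_nonneg hY)]
      have hfl : 1 ≤ ⌊Y⌋₊ := Nat.le_floor (by exact_mod_cast hY)
      have hflY : ((⌊Y⌋₊:ℕ):ℝ) ≤ Y := Nat.floor_le (by linarith)
      have hlf : Real.log (⌊Y⌋₊:ℕ) ≤ Real.log m := Real.log_le_log (by exact_mod_cast hfl) (hflY.trans hYm)
      have hlf0 : 0 ≤ Real.log (⌊Y⌋₊:ℕ) := Real.log_natCast_nonneg _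
      have hly : Real.log Y ≤ Real.log m := Real.log_le_log (by linarith) hYm
      have hly0 : 0 ≤ Real.log Y := Real.log_nonneg hY
      have := main_gen w hw ttt m ⌊Y⌋₊ hm (simplex Y) (Finset.filter_subset _ _) _ _ Z hZ0 (by
        intro c hc
        rw [simplex, Finset.mem_filter, mem_box] at hc
        have a1 : (1:ℝ) ≤ c.1 := by exact_mod_cast hc.1.1.1
        have a2 : (1:ℝ) ≤ c.2.1 := by exact_mod_cast hc.1.2.1.1
        have a3 : (1:ℝ) ≤ c.2.2 := by exact_mod_cast hc.1.2.2.1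
        have a4 : (c.1:ℝ) ≤ Y := le_trans (by exact_mod_cast hc.1.1.2) hflY
        refine ⟨a4.trans hYZ, le_trans ?_ hYZ⟩
        have := hc.2
        have h0 : (0:ℝ) ≤ c.2.1 * c.2.2 := by positivity
        nlinarith) (simplex_sum w ttt Y hY)
      rw [sum_MS] at this
      refine this.trans ?_
      rw [hE]
      gcongr
    · push Not at hY
      have he : simplex Y = ∅ := by
        have : ⌊Y⌋₊ = 0 := Nat.floor_eq_zero.2 hY
        rw [simplex, this]; rfl
      have hr : ∀ P, rsum w ttt (simplex Y) P = 0 := by intro P; rw [he]; simp [rsum]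
      have hm0 : max 0 (Real.log Y) = 0 := max_eq_left (Real.log_nonpos hY0 hY.le)
      rw [hm0]
      simp only [hr]; simpa using hE0
  have hsp : ∑ P ∈ Rg m, rhow w z Y P = (∑ s : Bool × Bool × Bool, ∑ P ∈ Rg m, rsum w s (box z) P)
      - ∑ P ∈ Rg m, rsum w ttt (simplex Y) P := by
    unfold rhow
    rw [Finset.sum_sub_distrib, Finset.sum_comm]
  have h8 : |(∑ s : Bool × Bool × Bool, ∑ P ∈ Rg m, rsum w s (box z) P) - 8 * (kap w * Real.log z ^ 3 * (AA * m))|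
      ≤ 8 * E := by
    have e1 : 8 * (kap w * Real.log z ^ 3 * (AA * m)) = ∑ s : Bool × Bool × Bool, kap w * Real.log z ^ 3 * (AA * m) := by
      simp
    have e2 : 8 * E = ∑ s : Bool × Bool × Bool, E := by simp
    rw [e1, e2, ← Finset.sum_sub_distrib]
    exact (Finset.abs_sum_le_sum_abs _ _).trans (Finset.sum_le_sum fun s _ => hbox s)
  rw [hsp]
  have := (abs_sub _ _).trans (add_le_add h8 hsim)
  refine le_trans (le_of_eq ?_) (this.trans (le_of_eq (by ring)))
  congr 1; ring

noncomputable def Phi (l s : ℝ) : ℝ := (s / 2) ^ 3 - max 0 (3 * s / 2 - l) ^ 3 / 6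

/-- admissible parameters -/
structure Par (B : ℝ) (w : ℕ) : Prop where
  hw : 1 ≤ w
  lo : Real.exp (8 * w) ≤ Real.log B
  hi : Real.log B < Real.exp (8 * w + 8)

lemma Par.B_pos {B : ℝ} {w : ℕ} (h : Par B w) (hB : 3 ≤ B) : 0 < B := by linarith

lemma Par.l_ge {B : ℝ} {w : ℕ} (h : Par B w) : 1000 ≤ Real.log B := by
  have h1 : (1:ℝ) ≤ w := by exact_mod_cast h.hw
  have h2 : Real.exp 8 ≤ Real.exp (8 * w) := Real.exp_le_exp.2 (by linarith)
  have h3 : (2.7:ℝ) ^ 8 ≤ Real.exp 8 := by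
    rw [show (8:ℝ) = (8:ℕ) * 1 by norm_num, Real.exp_nat_mul]
    gcongr
    exact (by norm_num : (2.7:ℝ) ≤ 2.7182818283).trans Real.exp_one_gt_d9.le
  have h4 : (1000:ℝ) ≤ 2.7 ^ 8 := by norm_num
  linarith [h.lo]

lemma Par.loglog {B : ℝ} {w : ℕ} (h : Par B w) : Real.log (Real.log B) ≤ 16 * w := by
  have h1 : (1:ℝ) ≤ w := by exact_mod_cast h.hw
  have := Real.log_le_log (by linarith [h.l_ge]) h.hi.le
  rw [Real.log_exp] at this
  linarith

lemma Par.loglog' {B : ℝ} {w : ℕ} (h : Par B w) : 8 * w ≤ Real.log (Real.log B) := by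
  have := Real.log_le_log (Real.exp_pos _) h.lo
  rwa [Real.log_exp] at this

/-- a convenient lower bound for the logarithm -/
lemma Par.l_pow {B : ℝ} {w : ℕ} (h : Par B w) : (1024:ℝ) ^ w ≤ Real.log B := by
  refine le_trans ?_ h.lo
  rw [mul_comm, Real.exp_nat_mul]
  gcongr
  have h3 : (2.7:ℝ) ^ 8 ≤ Real.exp 8 := by
    rw [show (8:ℝ) = (8:ℕ) * 1 by norm_num, Real.exp_nat_mul]
    gcongr
    exact (by norm_num : (2.7:ℝ) ≤ 2.7182818283).trans Real.exp_one_gt_d9.le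
  have h4 : (1024:ℝ) ≤ 2.7 ^ 8 := by norm_num
  linarith

lemma w_le_two_pow (w : ℕ) : (w:ℝ) ≤ 2 ^ w := by exact_mod_cast Nat.lt_two_pow_self.le

/-- `W^2 w^4 <= l` -/
lemma Par.Wl {B : ℝ} {w : ℕ} (h : Par B w) : (WW w : ℝ) ^ 2 * w ^ 6 ≤ Real.log B := by
  refine le_trans ?_ h.l_pow
  have h1 : (WW w : ℝ) ≤ 4 ^ w := by exact_mod_cast WW_le w
  have h2 := w_le_two_pow w
  calc (WW w : ℝ) ^ 2 * w ^ 6 ≤ (4 ^ w) ^ 2 * (2 ^ w) ^ 6 := by gcongr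
    _ = (4 ^ 2 * 2 ^ 6) ^ w := by rw [mul_pow, ← pow_mul, ← pow_mul, ← pow_mul, ← pow_mul]; ring_nf
    _ = _ := by norm_num

lemma Par.Ww {B : ℝ} {w : ℕ} (h : Par B w) : (WW w : ℝ) * w ≤ Real.log B := by
  refine le_trans ?_ h.Wl
  have h1 : (1:ℝ) ≤ WW w := by exact_mod_cast WW_pos w
  have h2 : (1:ℝ) ≤ w := by exact_mod_cast h.hw
  calc (WW w : ℝ) * w = WW w ^ 1 * w ^ 1 := by ring
    _ ≤ _ := by gcongr <;> first | assumption | norm_num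

lemma Par.w6 {B : ℝ} {w : ℕ} (h : Par B w) : (w : ℝ) ^ 6 ≤ Real.log B := by
  refine le_trans ?_ h.Wl
  have h1 : (1:ℝ) ≤ WW w := by exact_mod_cast WW_pos w
  have : 0 ≤ (w:ℝ) ^ 6 := by positivity
  have h2 : (1:ℝ) ≤ (WW w : ℝ) ^ 2 := one_le_pow₀ h1
  nlinarith

lemma Par.w2 {B : ℝ} {w : ℕ} (h : Par B w) : (w : ℝ) ^ 2 ≤ Real.log B := by
  refine le_trans ?_ h.w6
  have h2 : (1:ℝ) ≤ w := by exact_mod_cast h.hw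
  gcongr <;> norm_num <;> assumption

end DP5

namespace DP5

lemma cube_diff {x y M d : ℝ} (hx : 0 ≤ x) (hy : 0 ≤ y) (hxM : x ≤ M) (hyM : y ≤ M) (hd : |x - y| ≤ d) :
    |x ^ 3 - y ^ 3| ≤ 3 * M ^ 2 * d := by
  have e : x ^ 3 - y ^ 3 = (x - y) * (x ^ 2 + x * y + y ^ 2) := by ring
  have hM : 0 ≤ M := hx.trans hxM
  have h1 : 0 ≤ x ^ 2 + x * y + y ^ 2 := by positivity
  have h2 : x ^ 2 + x * y + y ^ 2 ≤ 3 * M ^ 2 := by nlinarith [mul_le_mul hxM hyM hy hM, mul_le_mul hxM hxM hx hM, mul_le_mul hyM hyM hy hM]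
  rw [e, abs_mul, abs_of_nonneg h1]
  calc _ ≤ d * (3 * M ^ 2) := mul_le_mul hd h2 h1 (le_trans (abs_nonneg _) hd)
    _ = _ := by ring

/-- the numerical facts for the parameters -/
lemma par_facts {B : ℝ} {w m : ℕ} (hB : 0 < B) (hp : Par B w) (h1 : Real.log B ^ 40 ≤ m)
    (h2 : (m:ℝ) ≤ B / Real.log B ^ 20) :
    ∃ z : ℕ, 1 ≤ z ∧ (z:ℝ) ^ 2 ≤ Real.sqrt m / Real.log B ^ 10 ∧
      Real.sqrt m / Real.log B ^ 10 ≤ 4 * (z:ℝ) ^ 2 ∧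
      z * z * w < Nat.sqrt m ∧ Real.sqrt m ≤ 2 * (Nat.sqrt m : ℕ) ∧
      Real.sqrt m ^ 3 / (B / Real.log B) ≤ Real.sqrt m / Real.log B ^ 19 ∧ Real.log B ^ 20 ≤ Real.sqrt m := by
  have hl := hp.l_ge
  have hw1 : (1:ℝ) ≤ w := by exact_mod_cast hp.hw
  have hw2 := hp.w2
  set l := Real.log B
  have hl0 : 0 < l := by linarith
  have hH : l ^ 20 ≤ Real.sqrt m := by
    apply Real.le_sqrt_of_sq_le
    rw [← pow_mul]; exact h1
  have hHsq : Real.sqrt m ^ 2 = m := Real.sq_sqrt (by positivity)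
  set H := Real.sqrt m with hHdef
  have hHpos : 0 < H := lt_of_lt_of_le (by positivity) hH
  set x := Real.sqrt (H / l ^ 10) with hx
  have hx2 : x ^ 2 = H / l ^ 10 := Real.sq_sqrt (by positivity)
  have hl10 : (1:ℝ) ≤ l ^ 10 := one_le_pow₀ (by linarith)
  have hx1 : 1 ≤ x := by
    apply Real.one_le_sqrt.2
    rw [le_div_iff₀ (by positivity), one_mul]
    calc l ^ 10 ≤ l ^ 10 * l ^ 10 := by nlinarith
      _ = l ^ 20 := by ring
      _ ≤ H := hH
  have hz1 : 1 ≤ ⌊x⌋₊ := Nat.le_floor (by exact_mod_cast hx1)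
  have hzx : ((⌊x⌋₊:ℕ):ℝ) ≤ x := Nat.floor_le (by linarith)
  have hxz : x < (⌊x⌋₊:ℕ) + 1 := Nat.lt_floor_add_one x
  have hz1' : (1:ℝ) ≤ (⌊x⌋₊:ℕ) := by exact_mod_cast hz1
  have hzsq : ((⌊x⌋₊:ℕ):ℝ) ^ 2 ≤ H / l ^ 10 := by rw [← hx2]; gcongr
  have hSH : H ≤ 2 * (Nat.sqrt m : ℕ) := by
    have h1 : m < (Nat.sqrt m + 1) * (Nat.sqrt m + 1) := Nat.lt_succ_sqrt m
    have hm1 : (1:ℝ) ≤ m := by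
      rw [← hHsq]; exact one_le_pow₀ (le_trans (one_le_pow₀ (by linarith)) hH)
    have h2 : 1 ≤ Nat.sqrt m := by
      rw [Nat.le_sqrt]; simpa using (by exact_mod_cast hm1 : 1 ≤ m)
    apply Real.sqrt_le_iff.2
    refine ⟨by positivity, ?_⟩
    have : m ≤ (2 * Nat.sqrt m) ^ 2 := by nlinarith
    exact_mod_cast this
  refine ⟨⌊x⌋₊, hz1, hzsq, ?_, ?_, hSH, ?_, hH⟩
  · rw [← hx2]
    have : x ≤ 2 * (⌊x⌋₊:ℕ) := by linarith
    calc x ^ 2 ≤ (2 * ((⌊x⌋₊:ℕ):ℝ)) ^ 2 := by gcongr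
      _ = _ := by ring
  · have : ((⌊x⌋₊:ℕ):ℝ) * (⌊x⌋₊:ℕ) * w < (Nat.sqrt m : ℕ) := by
      have hwl : (w:ℝ) ≤ l := by nlinarith
      have a1 : ((⌊x⌋₊:ℕ):ℝ) * (⌊x⌋₊:ℕ) * w ≤ H / l ^ 10 * l := by
        rw [← pow_two]; gcongr
      have a2 : H / l ^ 10 * l ≤ H / 1000 := by
        rw [div_mul_eq_mul_div, div_le_div_iff₀ (by positivity) (by norm_num)]
        have : l * 1000 ≤ l ^ 10 := by
          calc l * 1000 ≤ l * l ^ 9 := by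
                gcongr
                calc (1000:ℝ) ≤ l := hl
                  _ ≤ l ^ 9 := le_self_pow₀ (by linarith) (by norm_num)
            _ = _ := by ring
        calc H * l * 1000 = H * (l * 1000) := by ring
          _ ≤ H * l ^ 10 := by gcongr
      linarith
    exact_mod_cast this
  · rw [div_div_eq_mul_div, div_le_div_iff₀ hB (by positivity)]
    rw [le_div_iff₀ (by positivity), ← hHsq] at h2
    calc H ^ 3 * l * l ^ 19 = H * (H ^ 2 * l ^ 20) := by ring
      _ ≤ H * B := by gcongr

set_option maxHeartbeats 1000000 in
lemma N3 {B : ℝ} {w m : ℕ} (hB : 0 < B) (hp : Par B w) (h1 : Real.log B ^ 40 ≤ m)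
    (h2 : (m:ℝ) ≤ B / Real.log B ^ 20) :
    |∑ P ∈ CR m, rho w (B / Real.log B) P - kap w * (AA * m) * Phi (Real.log B) (Real.log m)| ≤
      (5000000 + 3000 * AA) * (m * (Real.log B ^ 3 / w)) := by
  obtain ⟨z, hz1, hz2, hz3, hzS, hSH, hY1, hHl⟩ := par_facts hB hp h1 h2
  have hl := hp.l_ge
  have hw1 : (1:ℝ) ≤ w := by exact_mod_cast hp.hw
  have hw0 : (0:ℝ) < w := by linarith
  have hw2 := hp.w2
  have hw6 := hp.w6
  have hWw := hp.Ww
  have hW1 : (1:ℝ) ≤ WW w := by exact_mod_cast WW_pos w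
  have hll := hp.loglog
  have hA := AA_nonneg
  have hk := kap_mem w
  set l := Real.log B with hldef
  have hl0 : 0 < l := by linarith
  have hm0 : (0:ℝ) < m := lt_of_lt_of_le (by positivity) h1
  have hmN : 1 ≤ m := by exact_mod_cast hm0
  have hHsq : Real.sqrt m ^ 2 = m := Real.sq_sqrt (by positivity)
  have hlogm : Real.log m ≤ l := by
    apply Real.log_le_log hm0
    refine h2.trans (div_le_self hB.le (one_le_pow₀ (by linarith)))
  have hlogm0 : 0 ≤ Real.log m := Real.log_natCast_nonneg m
  have hlogH : Real.log (Real.sqrt m) = Real.log m / 2 := Real.log_sqrt (by positivity)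
  set H := Real.sqrt m with hHdef
  have hH1 : 1 ≤ H := le_trans (one_le_pow₀ (by linarith)) hHl
  have hH0 : 0 < H := by linarith
  set X := B / l with hX
  have hX0 : 0 < X := by positivity
  set Y := H ^ 3 / X with hY
  have hYpos : 0 < Y := by positivity
  have hll0 : 0 ≤ Real.log l := Real.log_nonneg (by linarith)
  have hYH10 : Y ≤ H / l ^ 10 := hY1.trans (div_le_div_of_nonneg_left hH0.le (by positivity) (pow_le_pow_right₀ (by linarith) (by norm_num)))
  have hl10 : 1000 ≤ l ^ 10 := hl.trans (le_self_pow₀ (by linarith) (by norm_num))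
  have hYS : Y ≤ (Nat.sqrt m : ℕ) := by
    have : H / l ^ 10 ≤ H / 1000 := by gcongr
    linarith
  have hSm : ((Nat.sqrt m : ℕ):ℝ) ≤ m := by exact_mod_cast Nat.sqrt_le_self m
  have hzz : z ≤ z * z := Nat.le_mul_self z
  have hzzw : z * z ≤ z * z * w := Nat.le_mul_of_pos_right _ hp.hw
  have hzm : z ≤ m := by have := Nat.sqrt_le_self m; omega
  have hz1' : (1:ℝ) ≤ z := by exact_mod_cast hz1
  have d1 := diff_bound m w z X Y hmN hp.hw hz1 hX0 hzS (by rw [hY]; field_simp; rfl) hYS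
  have d2 := rhow_sum m w z Y (H / l ^ 10) hmN hp.hw hz1 hzm (by rw [← pow_two]; exact hz2) hYpos.le hYH10
    (hYS.trans hSm)
  rw [← hHdef] at d2
  set L := 1 + Real.log m with hL
  have hL2 : L ≤ 2 * l := by linarith
  have hL0 : 0 ≤ L := by linarith
  set N := Nat.sqrt (2 * Nat.sqrt m) with hN
  -- useful: l^2 w^j <= l^3/w
  have hl2w : l ^ 2 * w ≤ l ^ 3 / w := by
    rw [le_div_iff₀ hw0]
    calc l ^ 2 * w * w = l ^ 2 * (w ^ 2) := by ring
      _ ≤ l ^ 2 * l := by gcongr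
      _ = l ^ 3 := by ring
  have hl2w3 : l ^ 2 * w ^ 3 ≤ l ^ 3 / w := by
    rw [le_div_iff₀ hw0]
    calc l ^ 2 * w ^ 3 * w = l ^ 2 * (w ^ 4) := by ring
      _ ≤ l ^ 2 * w ^ 6 := mul_le_mul_of_nonneg_left (pow_le_pow_right₀ hw1 (by norm_num)) (by positivity)
      _ ≤ l ^ 2 * l := by gcongr
      _ = l ^ 3 := by ring
  have hl2W : WW w * l ^ 2 ≤ l ^ 3 / w := by
    rw [le_div_iff₀ hw0]
    calc (WW w : ℝ) * l ^ 2 * w = l ^ 2 * (WW w * w) := by ring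
      _ ≤ l ^ 2 * l := by gcongr
      _ = l ^ 3 := by ring
  have hE0 : 0 ≤ l ^ 3 / w := by positivity
  set E := l ^ 3 / w with hE
  -- T1
  have hlogN : 2 + Real.log ((N:ℕ) / z) ≤ 165 * w := by
    have hNsq : ((N:ℕ):ℝ) ^ 2 ≤ 2 * H := by
      have a : N * N ≤ 2 * Nat.sqrt m := Nat.sqrt_le _
      have b : ((Nat.sqrt m : ℕ):ℝ) ≤ H := Real.nat_sqrt_le_real_sqrt
      have a' : ((N:ℕ):ℝ) * N ≤ 2 * (Nat.sqrt m : ℕ) := by exact_mod_cast a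
      rw [pow_two]; linarith
    have hNpos : 1 ≤ N := by rw [hN, Nat.le_sqrt]; omega
    have hNpos' : (1:ℝ) ≤ N := by exact_mod_cast hNpos
    have hq : ((N:ℕ):ℝ) / z ≤ 8 * l ^ 10 := by
      have sq : (((N:ℕ):ℝ) / z) ^ 2 ≤ 8 * l ^ 10 := by
        rw [div_pow, div_le_iff₀ (by positivity)]
        rw [div_le_iff₀ (by positivity)] at hz3
        linarith
      by_contra hcon
      push Not at hcon
      have t1 : 1 < ((N:ℕ):ℝ) / z := by linarith
      have t2 : 1 * (((N:ℕ):ℝ) / z) < ((N:ℕ):ℝ) / z * (((N:ℕ):ℝ) / z) := mul_lt_mul_of_pos_right t1 (by linarith)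
      rw [pow_two] at sq
      linarith
    have h3 := Real.log_le_log (by positivity) hq
    rw [Real.log_mul (by norm_num) (by positivity), Real.log_pow] at h3
    have h8 : Real.log 8 ≤ 3 := by
      rw [show (8:ℝ) = 2 ^ 3 by norm_num, Real.log_pow]
      have := Real.log_two_lt_d9
      push_cast; linarith
    push_cast at h3
    linarith
  have T1 : 96 * m * L ^ 2 * (2 + Real.log ((N:ℕ) / z)) ≤ 63360 * (m * E) := by
    calc 96 * m * L ^ 2 * (2 + Real.log ((N:ℕ) / z)) ≤ 96 * m * L ^ 2 * (165 * w) := by gcongr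
      _ ≤ 96 * m * (2 * l) ^ 2 * (165 * w) := by gcongr
      _ = 63360 * (m * (l ^ 2 * w)) := by ring
      _ ≤ _ := by gcongr
  have T2 : 4 * m * (L ^ 2 * (2 + Real.log (4 * w ^ 3))) ≤ 96 * (m * E) := by
    have a : 2 + Real.log (4 * w ^ 3) ≤ 6 * w ^ 3 := by
      have := Real.log_le_sub_one_of_pos (by positivity : (0:ℝ) < 4 * w ^ 3)
      have h3 : (1:ℝ) ≤ w ^ 3 := one_le_pow₀ hw1
      linarith
    calc 4 * m * (L ^ 2 * (2 + Real.log (4 * w ^ 3))) ≤ 4 * m * (L ^ 2 * (6 * w ^ 3)) := by gcongr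
      _ ≤ 4 * m * ((2 * l) ^ 2 * (6 * w ^ 3)) := by gcongr
      _ = 96 * (m * (l ^ 2 * w ^ 3)) := by ring
      _ ≤ _ := by gcongr
  have T3 : 524864 * (m / w * L ^ 3) ≤ 4198912 * (m * E) := by
    calc 524864 * (m / w * L ^ 3) ≤ 524864 * (m / w * (2 * l) ^ 3) := by gcongr
      _ = _ := by rw [hE]; ring
  have T4 : AA * m * (12 * WW w * L ^ 2 + L ^ 3 / w) ≤ 56 * (AA * (m * E)) := by
    have : 12 * WW w * L ^ 2 + L ^ 3 / w ≤ 56 * E := by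
      calc 12 * WW w * L ^ 2 + L ^ 3 / w ≤ 12 * WW w * (2 * l) ^ 2 + (2 * l) ^ 3 / w := by gcongr
        _ = 48 * (WW w * l ^ 2) + 8 * E := by rw [hE]; ring
        _ ≤ _ := by linarith
    calc AA * m * (12 * WW w * L ^ 2 + L ^ 3 / w) ≤ AA * m * (56 * E) := by gcongr
      _ = _ := by ring
  have T5 : (WW w + 1) * H * (2 * (H / l ^ 10) * L ^ 3) ≤ 16 * (m * E) := by
    have a : (WW w + 1) / l ^ 10 ≤ 1 / w := by
      rw [div_le_div_iff₀ (by positivity) hw0, one_mul]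
      have t2 : l ^ 2 ≤ l ^ 10 := pow_le_pow_right₀ (by linarith) (by norm_num)
      have t3 : 2 * l ≤ l ^ 2 := by rw [pow_two]; exact mul_le_mul_of_nonneg_right (by linarith) hl0.le
      have t4 : (w:ℝ) * 1 ≤ w * WW w := mul_le_mul_of_nonneg_left hW1 hw0.le
      have t5 : ((WW w:ℝ) + 1) * w = WW w * w + w := by ring
      rw [t5]; linarith
    calc (WW w + 1) * H * (2 * (H / l ^ 10) * L ^ 3) ≤ (WW w + 1) * H * (2 * (H / l ^ 10) * (2 * l) ^ 3) := by gcongr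
      _ = 16 * (H ^ 2 * ((WW w + 1) / l ^ 10 * l ^ 3)) := by ring
      _ ≤ 16 * (H ^ 2 * (1 / w * l ^ 3)) := by gcongr
      _ = 16 * (m * E) := by rw [hHsq, hE]; ring
  -- main term comparison
  have hlz : |Real.log z - Real.log m / 4| ≤ 82 * w := by
    have a1 := Real.log_le_log (by positivity) hz2
    have a2 := Real.log_le_log (by positivity) hz3
    rw [Real.log_div (by positivity) (by positivity), Real.log_pow, Real.log_pow, hlogH] at a1
    rw [Real.log_div (by positivity) (by positivity), Real.log_mul (by norm_num) (by positivity),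
      Real.log_pow, Real.log_pow, hlogH] at a2
    have h4 : Real.log 4 ≤ 2 := by
      rw [show (4:ℝ) = 2 ^ 2 by norm_num, Real.log_pow]
      have := Real.log_two_lt_d9
      push_cast; linarith
    push_cast at a1 a2
    rw [abs_le]; constructor <;> linarith
  have hlz0 : 0 ≤ Real.log z := Real.log_nonneg hz1'
  have hlzl : Real.log z ≤ l := (Real.log_le_log (by positivity) (by exact_mod_cast hzm)).trans hlogm
  have c1 := cube_diff hlz0 (by positivity : 0 ≤ Real.log m / 4) hlzl (by linarith) hlz
  have hlY : Real.log Y = 3 * Real.log m / 2 - l + Real.log l := by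
    rw [hY, hX, Real.log_div (by positivity) (by positivity), Real.log_pow, hlogH,
      Real.log_div (by positivity) (by positivity)]
    push_cast; ring
  have hlYl : Real.log Y ≤ l := (Real.log_le_log hYpos (hYS.trans hSm)).trans hlogm
  have c2 := cube_diff (le_max_left 0 (Real.log Y)) (le_max_left 0 (3 * Real.log m / 2 - l))
    (max_le hl0.le hlYl) (max_le hl0.le (by linarith)) (d := 16 * w) (by
      refine (abs_max_sub_max_le_max _ _ _ _).trans ?_
      rw [hlY, sub_self, abs_zero]
      rw [show 3 * Real.log m / 2 - l + Real.log l - (3 * Real.log m / 2 - l) = Real.log l by ring,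
        abs_of_nonneg hll0]
      exact max_le (by positivity) hll)
  have cm : |(8 * Real.log z ^ 3 - max 0 (Real.log Y) ^ 3 / 6) - Phi l (Real.log m)| ≤ 2000 * E := by
    have e : (8 * Real.log z ^ 3 - max 0 (Real.log Y) ^ 3 / 6) - Phi l (Real.log m) =
        8 * (Real.log z ^ 3 - (Real.log m / 4) ^ 3) -
        (max 0 (Real.log Y) ^ 3 - max 0 (3 * Real.log m / 2 - l) ^ 3) / 6 := by
      unfold Phi; ring
    rw [e]
    have c1' : 3 * l ^ 2 * (82 * w) ≤ 246 * E := by linarith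
    have c2' : 3 * l ^ 2 * (16 * w) ≤ 48 * E := by linarith
    have := abs_le.1 (c1.trans c1')
    have := abs_le.1 (c2.trans c2')
    rw [abs_le]; constructor <;> linarith
  have cm2 : |kap w * (AA * m) * (8 * Real.log z ^ 3 - max 0 (Real.log Y) ^ 3 / 6) -
      kap w * (AA * m) * Phi l (Real.log m)| ≤ 2000 * (AA * (m * E)) := by
    rw [← mul_sub, abs_mul, abs_of_nonneg (mul_nonneg hk.1 (mul_nonneg hA hm0.le))]
    calc _ ≤ 1 * (AA * m) * (2000 * E) := by gcongr; exact hk.2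
      _ = _ := by ring
  have p1 : 0 ≤ AA * (m * E) := by positivity
  have p2 : 0 ≤ m * E := by positivity
  have g1 := abs_le.1 d1
  have g2 := abs_le.1 d2
  have g3 := abs_le.1 cm2
  rw [abs_le]
  have : (5000000 + 3000 * AA) * (m * E) = 5000000 * (m * E) + 3000 * (AA * (m * E)) := by ring
  rw [this]
  constructor <;> linarith

end DP5

namespace DP5

lemma CR_succ_sum (f : ℕ × ℕ → ℝ) (m : ℕ) :
    ∑ P ∈ CR (m + 1), f P = ∑ P ∈ CR m, f P + ∑ P ∈ (CR (m + 1)).filter (fun P => Fn P.1 P.2 = m + 1), f P := by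
  rw [← Finset.sum_filter_add_sum_filter_not (CR (m + 1)) (fun P => Fn P.1 P.2 = m + 1), add_comm]
  congr 1
  apply Finset.sum_congr _ (fun _ _ => rfl)
  ext P
  simp only [Finset.mem_filter, mem_CR]
  constructor
  · rintro ⟨⟨a, b, c, d⟩, h⟩; exact ⟨a, b, by omega, d⟩
  · rintro ⟨a, b, c, d⟩; exact ⟨⟨a, b, by omega, d⟩, by omega⟩

lemma abel_CR (f : ℕ × ℕ → ℝ) (M : ℕ) :
    ∑ P ∈ CR M, f P / (Fn P.1 P.2 : ℕ) = (∑ P ∈ CR M, f P) / M +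
      ∑ m ∈ Finset.Ico 1 M, (∑ P ∈ CR m, f P) / (m * (m + 1)) := by
  induction M with
  | zero => simp [CR_zero]
  | succ M ih =>
    have h2 : ∑ P ∈ (CR (M + 1)).filter (fun P => Fn P.1 P.2 = M + 1), f P / (Fn P.1 P.2 : ℕ) =
        (∑ P ∈ (CR (M + 1)).filter (fun P => Fn P.1 P.2 = M + 1), f P) / ((M:ℝ) + 1) := by
      rw [Finset.sum_div]
      apply Finset.sum_congr rfl
      intro P hP
      rw [(Finset.mem_filter.1 hP).2]; push_cast; rfl
    rw [CR_succ_sum, ih, CR_succ_sum f, h2]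
    rcases Nat.eq_zero_or_pos M with h0 | h0
    · subst h0; simp [CR_zero]
    · rw [Finset.sum_Ico_succ_top h0]
      have : (0:ℝ) < M := by exact_mod_cast h0
      push_cast
      field_simp
      ring

lemma sum_inv_Ico (M0 M : ℕ) (h0 : 1 ≤ M0) (h : M0 ≤ M) :
    ∑ m ∈ Finset.Ico M0 M, (1:ℝ) / (m + 1) ≤ Real.log (M / M0) := by
  induction M, h using Nat.le_induction with
  | base =>
    simp only [Finset.Ico_self, Finset.sum_empty]
    have : (0:ℝ) < M0 := by exact_mod_cast h0
    rw [div_self this.ne']; simp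
  | succ M hM ih =>
    rw [Finset.sum_Ico_succ_top hM]
    have h1 : (0:ℝ) < M0 := by exact_mod_cast h0
    have h2 : (0:ℝ) < M := by exact_mod_cast (by omega : 0 < M)
    rw [Real.log_div h2.ne' h1.ne'] at ih
    rw [Real.log_div (by positivity) h1.ne']
    have h3 := Real.one_sub_inv_le_log_of_pos (by positivity : 0 < ((M:ℝ) + 1) / M)
    rw [Real.log_div (by positivity) h2.ne'] at h3
    have e : 1 - (((M:ℝ) + 1) / M)⁻¹ = 1 / (M + 1) := by field_simp; ring
    rw [e] at h3
    push_cast; linarith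

/-- Abel bound over `M0 < F ≤ M` -/
lemma abel_tail (f : ℕ × ℕ → ℝ) (hf : ∀ P, 0 ≤ f P) (A : ℝ) (M0 M : ℕ) (h0 : 1 ≤ M0) (h : M0 ≤ M)
    (hA : ∀ m ≤ M, ∑ P ∈ CR m, f P ≤ A * m) :
    ∑ P ∈ (CR M).filter (fun P => M0 < Fn P.1 P.2), f P / (Fn P.1 P.2 : ℕ) ≤ A * (1 + Real.log (M / M0)) := by
  have hM : (0:ℝ) < M := by exact_mod_cast (by omega : 0 < M)
  have hA0 : 0 ≤ A := by
    have h1 : 0 ≤ A * M := (Finset.sum_nonneg (fun P _ => hf P)).trans (hA M le_rfl)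
    exact nonneg_of_mul_nonneg_left h1 hM
  set g : ℕ × ℕ → ℝ := fun P => if M0 < Fn P.1 P.2 then f P else 0 with hg
  have hgf : ∀ m ≤ M, ∑ P ∈ CR m, g P ≤ A * m := by
    intro m hm
    refine le_trans (Finset.sum_le_sum (fun P _ => ?_)) (hA m hm)
    simp only [hg]; split_ifs; exacts [le_rfl, hf P]
  have e : ∑ P ∈ (CR M).filter (fun P => M0 < Fn P.1 P.2), f P / (Fn P.1 P.2 : ℕ) =
      ∑ P ∈ CR M, g P / (Fn P.1 P.2 : ℕ) := by
    rw [Finset.sum_filter]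
    apply Finset.sum_congr rfl
    intro P _
    simp only [hg]; split_ifs <;> simp
  rw [e, abel_CR, mul_add, mul_one]
  have h1 : (∑ P ∈ CR M, g P) / M ≤ A := by
    rw [div_le_iff₀ hM]; exact hgf M le_rfl
  have h2 : ∑ m ∈ Finset.Ico 1 M, (∑ P ∈ CR m, g P) / (m * (m + 1)) ≤
      ∑ m ∈ Finset.Ico M0 M, A * ((1:ℝ) / (m + 1)) := by
    rw [← Finset.sum_Ico_consecutive _ h0 h]
    have z : ∑ m ∈ Finset.Ico 1 M0, (∑ P ∈ CR m, g P) / ((m:ℝ) * (m + 1)) = 0 := by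
      apply Finset.sum_eq_zero
      intro m hm
      rw [Finset.mem_Ico] at hm
      rw [Finset.sum_eq_zero, zero_div]
      intro P hP
      rw [mem_CR] at hP
      simp only [hg]; rw [if_neg]; omega
    rw [z, zero_add]
    apply Finset.sum_le_sum
    intro m hm
    rw [Finset.mem_Ico] at hm
    have hm0 : (0:ℝ) < m := by exact_mod_cast (by omega : 0 < m)
    rw [div_le_iff₀ (by positivity)]
    calc _ ≤ A * m := hgf m hm.2.le
      _ = _ := by field_simp
  rw [← Finset.mul_sum] at h2
  have h3 := mul_le_mul_of_nonneg_left (sum_inv_Ico M0 M h0 h) hA0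
  linarith

lemma abel_all (f : ℕ × ℕ → ℝ) (hf : ∀ P, 0 ≤ f P) (A : ℝ) (M : ℕ) (h : 1 ≤ M)
    (hA : ∀ m ≤ M, ∑ P ∈ CR m, f P ≤ A * m) :
    ∑ P ∈ CR M, f P / (Fn P.1 P.2 : ℕ) ≤ A * (1 + Real.log M) := by
  have h1 := abel_tail f hf A 1 M le_rfl h hA
  have e : (CR M).filter (fun P => 1 < Fn P.1 P.2) = CR M := by
    apply Finset.filter_true_of_mem
    intro P hP
    rw [mem_CR] at hP
    obtain ⟨a, b, c, d⟩ := hP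
    have : P.2 ≤ max P.1 P.2 := le_max_right _ _
    unfold Fn
    have : 2 * 1 ≤ (P.1 + P.2) * max P.1 P.2 := Nat.mul_le_mul (by omega) (by omega)
    omega
  rw [e] at h1
  simpa using h1

/-- antiderivative of `Phi` -/
noncomputable def Psi (l s : ℝ) : ℝ := s ^ 4 / 32 - max 0 (3 * s / 2 - l) ^ 4 / 36

lemma Psi_step {l s t : ℝ} (h0 : 0 ≤ s) (hst : s ≤ t) (htl : t ≤ l) :
    |Psi l t - Psi l s - Phi l s * (t - s)| ≤ l ^ 2 * (t - s) ^ 2 := by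
  have hl : 0 ≤ l := by linarith
  set d := t - s with hd
  have hd0 : 0 ≤ d := by linarith
  have ht : t = s + d := by linarith
  have a1 : 0 ≤ t ^ 4 - s ^ 4 - 4 * s ^ 3 * d ∧ t ^ 4 - s ^ 4 - 4 * s ^ 3 * d ≤ 6 * l ^ 2 * d ^ 2 := by
    have e : t ^ 4 - s ^ 4 - 4 * s ^ 3 * d = d ^ 2 * (t ^ 2 + 2 * t * s + 3 * s ^ 2) := by rw [ht]; ring
    have ht0 : 0 ≤ t := by linarith
    have hsl : s ≤ l := by linarith
    rw [e]
    refine ⟨by positivity, ?_⟩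
    have b : t ^ 2 + 2 * t * s + 3 * s ^ 2 ≤ 6 * l ^ 2 := by
      have := mul_le_mul htl htl ht0 hl
      have := mul_le_mul htl hsl h0 hl
      have := mul_le_mul hsl hsl h0 hl
      nlinarith
    calc _ ≤ d ^ 2 * (6 * l ^ 2) := by gcongr
      _ = _ := by ring
  have a2 : 0 ≤ max 0 (3 * t / 2 - l) ^ 4 - max 0 (3 * s / 2 - l) ^ 4 - 4 * max 0 (3 * s / 2 - l) ^ 3 * (3 / 2 * d)
     ∧ max 0 (3 * t / 2 - l) ^ 4 - max 0 (3 * s / 2 - l) ^ 4 - 4 * max 0 (3 * s / 2 - l) ^ 3 * (3 / 2 * d) ≤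
      6 * (l / 2) ^ 2 * (3 / 2 * d) ^ 2 := by
    set y := 3 * t / 2 - l with hy
    set x := 3 * s / 2 - l with hx
    have hyx : y = x + 3 / 2 * d := by rw [hy, hx, hd]; ring
    have hyl : y ≤ l / 2 := by linarith
    set e := 3 / 2 * d with he
    have he0 : 0 ≤ e := by positivity
    rcases le_total x 0 with hx0 | hx0
    · rw [max_eq_left hx0]
      have : max 0 y ≤ e := max_le he0 (by linarith)
      have h2 : max 0 y ≤ l / 2 := max_le (by linarith) hyl
      have h3 : 0 ≤ max 0 y := le_max_left _ _
      constructor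
      · have : 0 ≤ max 0 y ^ 4 := by positivity
        simpa using this
      · calc max 0 y ^ 4 - 0 ^ 4 - 4 * 0 ^ 3 * e = max 0 y ^ 2 * max 0 y ^ 2 := by ring
          _ ≤ (l / 2) ^ 2 * e ^ 2 := by gcongr
          _ ≤ _ := by
            have : 0 ≤ (l / 2) ^ 2 * e ^ 2 := by positivity
            linarith
    · have hy0 : 0 ≤ y := by linarith
      rw [max_eq_right hx0, max_eq_right hy0]
      have e1 : y ^ 4 - x ^ 4 - 4 * x ^ 3 * e = e ^ 2 * (y ^ 2 + 2 * y * x + 3 * x ^ 2) := by rw [hyx]; ring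
      rw [e1]
      refine ⟨by positivity, ?_⟩
      have hxl : x ≤ l / 2 := by linarith
      have b : y ^ 2 + 2 * y * x + 3 * x ^ 2 ≤ 6 * (l / 2) ^ 2 := by
        have := mul_le_mul hyl hyl hy0 (by positivity)
        have := mul_le_mul hyl hxl hx0 (by positivity)
        have := mul_le_mul hxl hxl hx0 (by positivity)
        nlinarith
      calc _ ≤ e ^ 2 * (6 * (l / 2) ^ 2) := by gcongr
        _ = _ := by ring
  have e : Psi l t - Psi l s - Phi l s * d = (t ^ 4 - s ^ 4 - 4 * s ^ 3 * d) / 32 -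
      (max 0 (3 * t / 2 - l) ^ 4 - max 0 (3 * s / 2 - l) ^ 4 - 4 * max 0 (3 * s / 2 - l) ^ 3 * (3 / 2 * d)) / 36 := by
    unfold Psi Phi; ring
  rw [e, abs_le]
  have h3 : 6 * (l / 2) ^ 2 * (3 / 2 * d) ^ 2 = 27 / 8 * (l ^ 2 * d ^ 2) := by ring
  have h4 : 6 * l ^ 2 * d ^ 2 = 6 * (l ^ 2 * d ^ 2) := by ring
  have h5 : 0 ≤ l ^ 2 * d ^ 2 := by positivity
  constructor <;> linarith [a1.1, a1.2, a2.1, a2.2]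

lemma Phi_mem {l s : ℝ} (h0 : 0 ≤ s) (hs : s ≤ l) : 0 ≤ Phi l s ∧ Phi l s ≤ l ^ 3 := by
  have hl : 0 ≤ l := by linarith
  unfold Phi
  have h1 : max 0 (3 * s / 2 - l) ≤ s / 2 := max_le (by linarith) (by linarith)
  have h2 : 0 ≤ max 0 (3 * s / 2 - l) := le_max_left _ _
  have h3 : max 0 (3 * s / 2 - l) ^ 3 ≤ (s / 2) ^ 3 := by gcongr
  have h4 : 0 ≤ max 0 (3 * s / 2 - l) ^ 3 := by positivity
  have h5 : (s / 2) ^ 3 ≤ l ^ 3 := by gcongr; linarith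
  constructor <;> linarith

lemma Phi_sum (l : ℝ) (M : ℕ) (hM : 1 ≤ M) (hl : Real.log M ≤ l) :
    |∑ m ∈ Finset.Ico 1 M, Phi l (Real.log m) / ((m:ℝ) + 1) - Psi l (Real.log M)| ≤ 2 * l ^ 2 + l ^ 3 := by
  have hl0 : 0 ≤ l := (Real.log_natCast_nonneg M).trans hl
  have h0 : Psi l (Real.log (1:ℕ)) = 0 := by
    unfold Psi; simp [hl0]
  have h1 : Psi l (Real.log M) = ∑ m ∈ Finset.Ico 1 M, (Psi l (Real.log (m + 1 : ℕ)) - Psi l (Real.log m)) := by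
    rw [Finset.sum_Ico_sub (fun m : ℕ => Psi l (Real.log m)) hM, h0, sub_zero]
  rw [h1, ← Finset.sum_sub_distrib]
  refine (Finset.abs_sum_le_sum_abs _ _).trans ?_
  have h2 : ∀ m ∈ Finset.Ico 1 M, |Phi l (Real.log m) / ((m:ℝ) + 1) - (Psi l (Real.log (m + 1 : ℕ)) - Psi l (Real.log m))| ≤
      (2 * l ^ 2 + l ^ 3) * (1 / (m:ℝ) - 1 / ((m + 1 : ℕ):ℝ)) := by
    intro m hm
    rw [Finset.mem_Ico] at hm
    have hm1 : (1:ℝ) ≤ m := by exact_mod_cast hm.1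
    have hs0 := Real.log_natCast_nonneg m
    have hst : Real.log m ≤ Real.log (m + 1 : ℕ) := Real.log_le_log (by linarith) (by push_cast; linarith)
    have htl : Real.log (m + 1 : ℕ) ≤ l := (Real.log_le_log (by positivity) (by exact_mod_cast hm.2)).trans hl
    have a := Psi_step hs0 hst htl
    have hP := Phi_mem (l := l) hs0 (hst.trans htl)
    have d1 : Real.log (m + 1 : ℕ) - Real.log m ≤ 1 / m := by
      rw [← Real.log_div (by positivity) (by positivity)]
      have := Real.log_le_sub_one_of_pos (by positivity : 0 < ((m + 1 : ℕ):ℝ) / m)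
      refine this.trans (le_of_eq ?_)
      push_cast; field_simp; ring
    have d2 : 1 / ((m:ℝ) + 1) ≤ Real.log (m + 1 : ℕ) - Real.log m := by
      rw [← Real.log_div (by positivity) (by positivity)]
      have := Real.one_sub_inv_le_log_of_pos (by positivity : 0 < ((m + 1 : ℕ):ℝ) / m)
      refine le_trans (le_of_eq ?_) this
      push_cast; field_simp; ring
    set d := Real.log (m + 1 : ℕ) - Real.log m with hd
    have hd0 : 0 ≤ d := by linarith
    have b1 : d ^ 2 ≤ 2 * (1 / (m:ℝ) - 1 / ((m:ℝ) + 1)) := by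
      calc d ^ 2 ≤ (1 / (m:ℝ)) ^ 2 := by gcongr
        _ ≤ 2 * (1 / (m:ℝ) - 1 / ((m:ℝ) + 1)) := by
          have : 2 * (1 / (m:ℝ) - 1 / ((m:ℝ) + 1)) - (1 / (m:ℝ)) ^ 2 = (m - 1) / (m ^ 2 * (m + 1)) := by
            field_simp; ring
          have : 0 ≤ ((m:ℝ) - 1) / (m ^ 2 * (m + 1)) := div_nonneg (by linarith) (by positivity)
          linarith
    have b2 : Phi l (Real.log m) * (d - 1 / ((m:ℝ) + 1)) ≤ l ^ 3 * (1 / (m:ℝ) - 1 / ((m:ℝ) + 1)) :=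
      mul_le_mul hP.2 (by linarith) (by linarith) (by positivity)
    have b3 : 0 ≤ Phi l (Real.log m) * (d - 1 / ((m:ℝ) + 1)) := mul_nonneg hP.1 (by linarith)
    have b4 : l ^ 2 * d ^ 2 ≤ l ^ 2 * (2 * (1 / (m:ℝ) - 1 / ((m:ℝ) + 1))) := by gcongr
    have a' := abs_le.1 a
    have e : Phi l (Real.log m) / ((m:ℝ) + 1) - (Psi l (Real.log (m + 1 : ℕ)) - Psi l (Real.log m)) =
      - (Psi l (Real.log (m + 1 : ℕ)) - Psi l (Real.log m) - Phi l (Real.log m) * d) - Phi l (Real.log m) * (d - 1 / ((m:ℝ) + 1)) := by ring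
    have e2 : (2 * l ^ 2 + l ^ 3) * (1 / (m:ℝ) - 1 / ((m + 1 : ℕ):ℝ)) =
      l ^ 2 * (2 * (1 / (m:ℝ) - 1 / ((m:ℝ) + 1))) + l ^ 3 * (1 / (m:ℝ) - 1 / ((m:ℝ) + 1)) := by push_cast; ring
    rw [e, e2, abs_le]
    constructor <;> linarith [a'.1, a'.2]
  refine (Finset.sum_le_sum h2).trans ?_
  rw [← Finset.mul_sum]
  have h3 : ∑ m ∈ Finset.Ico 1 M, (1 / (m:ℝ) - 1 / ((m + 1 : ℕ):ℝ)) ≤ 1 := by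
    have := Finset.sum_Ico_sub (fun m : ℕ => -(1 / (m:ℝ))) hM
    simp only [neg_sub_neg] at this
    rw [this]
    have : 0 ≤ 1 / (M:ℝ) := by positivity
    simp
  calc _ ≤ (2 * l ^ 2 + l ^ 3) * 1 := by gcongr
    _ = _ := by ring

end DP5

namespace DP5

/-- the basic cutoff -/
noncomputable def MM (B : ℝ) : ℕ := ⌊B / Real.log B ^ 20⌋₊

lemma Par.big {B : ℝ} {w : ℕ} (hB : 0 < B) (hp : Par B w) : Real.log B ^ 61 ≤ B := by
  have hl := hp.l_ge
  have h1 := hp.loglog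
  have h2 := hp.l_pow
  have h3 : (1024:ℝ) * w ≤ 1024 ^ w := by
    have : 1024 * w ≤ 1024 ^ w := by
      have h := hp.hw
      clear h1 h2 hl hp hB
      induction w, h using Nat.le_induction with
      | base => norm_num
      | succ n hn ih => rw [pow_succ]; omega
    exact_mod_cast this
  have h4 : 61 * Real.log (Real.log B) ≤ Real.log B := by
    have : (0:ℝ) ≤ w := by positivity
    linarith
  have h5 : Real.log (Real.log B ^ 61) ≤ Real.log B := by rw [Real.log_pow]; exact_mod_cast h4
  exact (Real.log_le_log_iff (by positivity) hB).1 h5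

lemma MM_facts {B : ℝ} {w : ℕ} (hB : 0 < B) (hp : Par B w) :
    1 ≤ MM B ∧ (MM B : ℝ) ≤ B / Real.log B ^ 20 ∧ B / Real.log B ^ 20 ≤ 2 * MM B ∧
    Real.log (MM B) ≤ Real.log B ∧ Real.log B - 321 * w ≤ Real.log (MM B) := by
  have hl := hp.l_ge
  have hbig := hp.big hB
  have hw1 : (1:ℝ) ≤ w := by exact_mod_cast hp.hw
  have hll := hp.loglog
  set l := Real.log B with hldef
  have hl0 : 0 < l := by linarith
  have a1 : 1 ≤ B / l ^ 20 := by
    rw [le_div_iff₀ (by positivity), one_mul]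
    exact le_trans (pow_le_pow_right₀ (by linarith) (by norm_num)) hbig
  have h1 : 1 ≤ MM B := Nat.le_floor (by exact_mod_cast a1)
  have h1' : (1:ℝ) ≤ MM B := by exact_mod_cast h1
  have h2 : (MM B : ℝ) ≤ B / l ^ 20 := Nat.floor_le (by positivity)
  have h3 : B / l ^ 20 < MM B + 1 := Nat.lt_floor_add_one _
  have h4 : B / l ^ 20 ≤ 2 * MM B := by linarith
  refine ⟨h1, h2, h4, ?_, ?_⟩
  · apply Real.log_le_log (by linarith)
    exact h2.trans (div_le_self hB.le (one_le_pow₀ (by linarith)))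
  · have := Real.log_le_log (by positivity) h4
    rw [Real.log_div (by positivity) (by positivity), Real.log_mul (by norm_num) (by positivity),
      Real.log_pow, ← hldef] at this
    have := Real.log_two_lt_d9
    push_cast at *
    linarith

/-- trivial bound for all `m ≤ 8 B` -/
lemma UB0' {B : ℝ} {w m : ℕ} (hB : 0 < B) (hp : Par B w) (hm : (m:ℝ) ≤ 8 * B) :
    ∑ P ∈ CR m, T3 P ≤ 256 * Real.log B ^ 3 * m := by
  have hl := hp.l_ge
  rcases Nat.eq_zero_or_pos m with h0 | h0
  · subst h0; simp [CR_zero]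
  have h1 := UB0 m h0
  refine h1.trans ?_
  have hm0 : (0:ℝ) < m := by exact_mod_cast h0
  have h2 : Real.log m ≤ Real.log B + 3 := by
    have := Real.log_le_log hm0 hm
    rw [Real.log_mul (by norm_num) hB.ne'] at this
    have h8 : Real.log 8 ≤ 3 := by
      rw [show (8:ℝ) = 2 ^ 3 by norm_num, Real.log_pow]
      have := Real.log_two_lt_d9
      push_cast; linarith
    linarith
  have h3 := one_le_L m
  calc 32 * (m:ℝ) * (1 + Real.log m) ^ 3 ≤ 32 * m * (2 * Real.log B) ^ 3 := by gcongr; linarith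
    _ = _ := by ring

lemma CR_Good {m : ℕ} {P : ℕ × ℕ} (h : P ∈ CR m) : 1 ≤ P.1 ∧ 1 ≤ P.2 ∧ Nat.Coprime P.1 P.2 ∧ 1 ≤ Fn P.1 P.2 := by
  rw [mem_CR] at h
  exact ⟨h.1, h.2.1, h.2.2.2, h.2.1.trans (le_Fn h.2.1)⟩

lemma rho_sum_le {w m : ℕ} (X : ℝ) : 0 ≤ ∑ P ∈ CR m, rho w X P ∧
    ∑ P ∈ CR m, rho w X P ≤ ∑ P ∈ CR m, T3 P := by
  constructor
  · apply Finset.sum_nonneg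
    intro P hP
    obtain ⟨a, b, c, d⟩ := CR_Good hP
    exact (rho_bd w X P a b c).1
  · apply Finset.sum_le_sum
    intro P hP
    obtain ⟨a, b, c, d⟩ := CR_Good hP
    exact (rho_bd w X P a b c).2

lemma Psi_end {l s d : ℝ} (h0 : 0 ≤ s) (hs : s ≤ l) (hd : l - s ≤ d) :
    |Psi l s - 17 / 576 * l ^ 4| ≤ l ^ 3 * d := by
  have hl : 0 ≤ l := by linarith
  have hd0 : 0 ≤ d := by linarith
  have a1 : 0 ≤ l ^ 4 - s ^ 4 ∧ l ^ 4 - s ^ 4 ≤ 4 * (l ^ 3 * d) := by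
    have e : l ^ 4 - s ^ 4 = (l ^ 3 + l ^ 2 * s + l * s ^ 2 + s ^ 3) * (l - s) := by ring
    rw [e]
    refine ⟨mul_nonneg (by positivity) (by linarith), ?_⟩
    have : l ^ 3 + l ^ 2 * s + l * s ^ 2 + s ^ 3 ≤ 4 * l ^ 3 := by
      have h1 : l ^ 2 * s ≤ l ^ 2 * l := by gcongr
      have h2 : l * s ^ 2 ≤ l * l ^ 2 := by gcongr
      have h3 : s ^ 3 ≤ l ^ 3 := by gcongr
      nlinarith
    calc _ ≤ (4 * l ^ 3) * d := mul_le_mul this hd (by linarith) (by positivity)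
      _ = _ := by ring
  have a2 : 0 ≤ (l / 2) ^ 4 - max 0 (3 * s / 2 - l) ^ 4 ∧ (l / 2) ^ 4 - max 0 (3 * s / 2 - l) ^ 4 ≤ 4 * ((l / 2) ^ 3 * (3 / 2 * d)) := by
    set x := max 0 (3 * s / 2 - l) with hx
    have hx0 : 0 ≤ x := le_max_left _ _
    have hxl : x ≤ l / 2 := max_le (by linarith) (by linarith)
    have hxd : l / 2 - x ≤ 3 / 2 * d := by
      have : 3 * s / 2 - l ≤ x := le_max_right _ _
      linarith
    have e : (l / 2) ^ 4 - x ^ 4 = ((l / 2) ^ 3 + (l / 2) ^ 2 * x + (l / 2) * x ^ 2 + x ^ 3) * (l / 2 - x) := by ring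
    rw [e]
    refine ⟨mul_nonneg (by positivity) (by linarith), ?_⟩
    have : (l / 2) ^ 3 + (l / 2) ^ 2 * x + (l / 2) * x ^ 2 + x ^ 3 ≤ 4 * (l / 2) ^ 3 := by
      have h1 : (l / 2) ^ 2 * x ≤ (l / 2) ^ 2 * (l / 2) := by gcongr
      have h2 : (l / 2) * x ^ 2 ≤ (l / 2) * (l / 2) ^ 2 := by gcongr
      have h3 : x ^ 3 ≤ (l / 2) ^ 3 := by gcongr
      nlinarith
    calc _ ≤ (4 * (l / 2) ^ 3) * (3 / 2 * d) := mul_le_mul this hxd (by linarith) (by positivity)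
      _ = _ := by ring
  have e : Psi l s - 17 / 576 * l ^ 4 = -(l ^ 4 - s ^ 4) / 32 + ((l / 2) ^ 4 - max 0 (3 * s / 2 - l) ^ 4) / 36 := by
    unfold Psi; ring
  have h5 : 0 ≤ l ^ 3 * d := by positivity
  have h6 : 4 * ((l / 2) ^ 3 * (3 / 2 * d)) = 3 / 4 * (l ^ 3 * d) := by ring
  rw [e, abs_le]
  constructor <;> linarith [a1.1, a1.2, a2.1, a2.2]

set_option maxHeartbeats 1000000 in
lemma main_sum {B : ℝ} {w : ℕ} (hB : 0 < B) (hp : Par B w) :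
    |∑ P ∈ CR (MM B), rho w (B / Real.log B) P / (Fn P.1 P.2 : ℕ) - kap w * AA * (17 / 576 * Real.log B ^ 4)| ≤
      (20000000 + 20000 * AA) * (Real.log B ^ 4 / w) := by
  obtain ⟨hM1, hM2, hM3, hM4, hM5⟩ := MM_facts hB hp
  have hl := hp.l_ge
  have hw1 : (1:ℝ) ≤ w := by exact_mod_cast hp.hw
  have hw0 : (0:ℝ) < w := by linarith
  have hw2 := hp.w2
  have hA := AA_nonneg
  have hk := kap_mem w
  have hll := hp.loglog
  have hUB : ∀ m : ℕ, (m:ℝ) ≤ B → ∑ P ∈ CR m, rho w (B / Real.log B) P ≤ 256 * Real.log B ^ 3 * m :=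
    fun m hm => (rho_sum_le _).2.trans (UB0' hB hp (by linarith))
  have hN3 := fun (m : ℕ) => N3 (m := m) hB hp
  set l := Real.log B with hldef
  have hl0 : 0 < l := by linarith
  set M := MM B with hM
  set N : ℕ → ℝ := fun m => ∑ P ∈ CR m, rho w (B / l) P with hN
  have hN0 : ∀ m, 0 ≤ N m := fun m => (rho_sum_le _).1
  rw [abel_CR]
  have hMB : (M:ℝ) ≤ B := hM2.trans (div_le_self hB.le (one_le_pow₀ (by linarith)))
  have hMpos : (0:ℝ) < M := by exact_mod_cast hM1
  set E := l ^ 4 / w with hE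
  have hE0 : 0 ≤ E := by positivity
  have hl3w : l ^ 3 * w ≤ E := by
    rw [hE, le_div_iff₀ hw0]
    calc l ^ 3 * w * w = l ^ 3 * w ^ 2 := by ring
      _ ≤ l ^ 3 * l := by gcongr
      _ = l ^ 4 := by ring
  have hl3 : l ^ 3 ≤ E := le_trans (le_mul_of_one_le_right (by positivity) hw1) hl3w
  have hl2 : l ^ 2 ≤ l ^ 3 := pow_le_pow_right₀ (by linarith) (by norm_num)
  have t1 : N M / M ≤ 256 * E := by
    rw [div_le_iff₀ hMpos]
    refine (hUB M hMB).trans ?_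
    gcongr
  have t1' : 0 ≤ N M / M := div_nonneg (hN0 M) hMpos.le
  have t2 : |∑ m ∈ Finset.Ico 1 M, N m / (m * (m + 1)) -
      ∑ m ∈ Finset.Ico 1 M, kap w * AA * (Phi l (Real.log m) / ((m:ℝ) + 1))| ≤
      (11000000 + 8000 * AA) * E := by
    rw [← Finset.sum_sub_distrib]
    refine (Finset.abs_sum_le_sum_abs _ _).trans ?_
    set M0 := ⌊l ^ 40⌋₊ with hM0
    have hb : ∀ m ∈ Finset.Ico 1 M, |N m / (m * (m + 1)) - kap w * AA * (Phi l (Real.log m) / ((m:ℝ) + 1))| ≤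
        (5000000 + 3000 * AA) * (l ^ 3 / w) * (1 / ((m:ℝ) + 1)) +
          (if m ≤ M0 then (256 + AA) * l ^ 3 * (1 / (m:ℝ)) else 0) := by
      intro m hm
      rw [Finset.mem_Ico] at hm
      have hm0 : (0:ℝ) < m := by exact_mod_cast hm.1
      have hmM : (m:ℝ) ≤ M := by exact_mod_cast hm.2.le
      have e : N m / (m * (m + 1)) - kap w * AA * (Phi l (Real.log m) / ((m:ℝ) + 1)) =
          (N m - kap w * (AA * m) * Phi l (Real.log m)) * (1 / (m * ((m:ℝ) + 1))) := by field_simp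
      rw [e, abs_mul, abs_of_nonneg (by positivity : 0 ≤ 1 / (m * ((m:ℝ) + 1)))]
      by_cases hc : l ^ 40 ≤ m
      · have h := hN3 m hc (hmM.trans hM2)
        have q : 0 ≤ (if m ≤ M0 then (256 + AA) * l ^ 3 * (1 / (m:ℝ)) else 0) := by
          split_ifs <;> positivity
        calc _ ≤ (5000000 + 3000 * AA) * (m * (l ^ 3 / w)) * (1 / (m * ((m:ℝ) + 1))) := by gcongr
          _ = (5000000 + 3000 * AA) * (l ^ 3 / w) * (1 / ((m:ℝ) + 1)) := by field_simp
          _ ≤ _ := by linarith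
      · rw [if_pos (Nat.le_floor (not_le.1 hc).le)]
        have hlogm : Real.log m ≤ l := (Real.log_le_log hm0 hmM).trans hM4
        have hP := Phi_mem (Real.log_natCast_nonneg m) hlogm
        have b1 : |N m - kap w * (AA * m) * Phi l (Real.log m)| ≤ (256 + AA) * l ^ 3 * m := by
          have c1 := hUB m (hmM.trans hMB)
          have c2 := hN0 m
          have c3 : 0 ≤ kap w * (AA * m) * Phi l (Real.log m) := mul_nonneg (mul_nonneg hk.1 (by positivity)) hP.1
          have c4 : kap w * (AA * m) * Phi l (Real.log m) ≤ 1 * (AA * m) * l ^ 3 :=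
            mul_le_mul (mul_le_mul_of_nonneg_right hk.2 (by positivity)) hP.2 hP.1 (by positivity)
          have c5 : (256 + AA) * l ^ 3 * m = 256 * l ^ 3 * m + 1 * (AA * m) * l ^ 3 := by ring
          have c6 : 0 ≤ 256 * l ^ 3 * m := by positivity
          have c7 : 0 ≤ 1 * (AA * m) * l ^ 3 := by positivity
          rw [c5, abs_le]; constructor <;> linarith
        have q : 0 ≤ (5000000 + 3000 * AA) * (l ^ 3 / w) * (1 / ((m:ℝ) + 1)) := by positivity
        have q2 : (1 / (m * ((m:ℝ) + 1))) ≤ 1 / (m * m) := by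
          apply one_div_le_one_div_of_le (by positivity); gcongr; linarith
        calc _ ≤ (256 + AA) * l ^ 3 * m * (1 / (m * m)) := mul_le_mul b1 q2 (by positivity) (by positivity)
          _ = (256 + AA) * l ^ 3 * (1 / (m:ℝ)) := by field_simp
          _ ≤ _ := by linarith
    refine (Finset.sum_le_sum hb).trans ?_
    rw [Finset.sum_add_distrib, ← Finset.mul_sum, ← Finset.sum_filter, ← Finset.mul_sum]
    have s1 : ∑ m ∈ Finset.Ico 1 M, (1:ℝ) / (m + 1) ≤ l := by
      have := sum_inv_Ico 1 M le_rfl hM1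
      simp only [Nat.cast_one, div_one] at this
      linarith
    have s2 : ∑ m ∈ (Finset.Ico 1 M).filter (fun m => m ≤ M0), 1 / (m:ℝ) ≤ 641 * w := by
      calc _ ≤ ∑ m ∈ Finset.Icc 1 M0, (1:ℝ) / m := by
            apply Finset.sum_le_sum_of_subset_of_nonneg
            · intro m hm
              rw [Finset.mem_filter, Finset.mem_Ico] at hm
              rw [Finset.mem_Icc]; omega
            · intros; positivity
        _ ≤ 1 + Real.log M0 := harm_le M0
        _ ≤ 1 + Real.log (l ^ 40) := by
            have h40 : 1 ≤ l ^ 40 := one_le_pow₀ (by linarith)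
            have : 1 ≤ M0 := Nat.le_floor (by exact_mod_cast h40)
            have : (0:ℝ) < M0 := by exact_mod_cast this
            have := Real.log_le_log this (Nat.floor_le (by positivity : 0 ≤ l ^ 40))
            linarith
        _ ≤ 641 * w := by rw [Real.log_pow]; push_cast; linarith
    have u1 : (5000000 + 3000 * AA) * (l ^ 3 / w) * (∑ m ∈ Finset.Ico 1 M, (1:ℝ) / (m + 1)) ≤ (5000000 + 3000 * AA) * E := by
      calc _ ≤ (5000000 + 3000 * AA) * (l ^ 3 / w) * l := by gcongr
        _ = _ := by rw [hE]; ring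
    have u2 : (256 + AA) * l ^ 3 * (∑ m ∈ (Finset.Ico 1 M).filter (fun m => m ≤ M0), 1 / (m:ℝ)) ≤ (256 + AA) * 641 * E := by
      calc _ ≤ (256 + AA) * l ^ 3 * (641 * w) := by gcongr
        _ = (256 + AA) * 641 * (l ^ 3 * w) := by ring
        _ ≤ _ := by gcongr
    have p1 : 0 ≤ AA * E := by positivity
    calc _ ≤ _ := add_le_add u1 u2
      _ ≤ _ := by nlinarith
  rw [← Finset.mul_sum] at t2
  have t3 := Phi_sum l M hM1 hM4
  have t4 := Psi_end (Real.log_natCast_nonneg M) hM4 (d := 321 * w) (by linarith)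
  have hkA : kap w * AA ≤ AA := mul_le_of_le_one_left hA hk.2
  have hkA0 : 0 ≤ kap w * AA := mul_nonneg hk.1 hA
  have t5 : |kap w * AA * ∑ m ∈ Finset.Ico 1 M, Phi l (Real.log m) / ((m:ℝ) + 1) - kap w * AA * (17 / 576 * l ^ 4)| ≤ AA * (324 * E) := by
    rw [← mul_sub, abs_mul, abs_of_nonneg hkA0]
    apply mul_le_mul hkA _ (abs_nonneg _) hA
    have b := abs_sub_le (∑ m ∈ Finset.Ico 1 M, Phi l (Real.log m) / ((m:ℝ) + 1)) (Psi l (Real.log M)) (17 / 576 * l ^ 4)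
    have e : l ^ 3 * (321 * w) = 321 * (l ^ 3 * w) := by ring
    linarith
  have p1 : 0 ≤ AA * E := by positivity
  have g2 := abs_le.1 t2
  have g5 := abs_le.1 t5
  have e1 : (20000000 + 20000 * AA) * E = 20000000 * E + 20000 * (AA * E) := by ring
  have e2 : (11000000 + 8000 * AA) * E = 11000000 * E + 8000 * (AA * E) := by ring
  have e3 : AA * (324 * E) = 324 * (AA * E) := by ring
  rw [e2] at g2
  rw [e3] at g5
  rw [e1, abs_le]
  constructor <;> linarith [g2.1, g2.2, g5.1, g5.2]

end DP5

namespace DP5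

/-- the divisors in the top range -/
noncomputable def DX (X Y : ℝ) (P : ℕ × ℕ) : Finset ℕ :=
  (P.1 * P.2 * (P.1 + P.2)).divisors.filter (fun D : ℕ => X < (D:ℝ) ∧ (D:ℝ) ≤ Y)

lemma card_divisors_T3 {m : ℕ} {P : ℕ × ℕ} (hP : P ∈ CR m) (p : ℕ → Prop) [DecidablePred p] :
    (((P.1 * P.2 * (P.1 + P.2)).divisors.filter p).card : ℝ) ≤ T3 P := by
  obtain ⟨h1, h2, h3, _⟩ := CR_Good hP
  have := divisors_TD P h1 h2 h3 p (fun _ => 1)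
  simp only [Finset.sum_const, nsmul_eq_mul, mul_one] at this
  rw [this, T3_eq]
  exact_mod_cast Finset.card_filter_le _ _

lemma DX_le_G {m : ℕ} {P : ℕ × ℕ} (hP : P ∈ CR m) (X Y Y1 Y2 : ℝ) (hX : 0 < X)
    (h2 : ((P.1 * P.2 * (P.1 + P.2) : ℕ) : ℝ) ≤ Y2 * X) (h1 : Y1 * Y ≤ ((P.1 * P.2 * (P.1 + P.2) : ℕ) : ℝ))
    (hY1 : 0 ≤ Y1) :
    (DX X Y P).card ≤ (Gset Y1 Y2 P).card := by
  obtain ⟨p1, p2, p3, _⟩ := CR_Good hP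
  have e := divisors_TD P p1 p2 p3 (fun E : ℕ => Y1 ≤ (E:ℝ) ∧ (E:ℝ) ≤ Y2) (fun _ => 1)
  simp only [Finset.sum_const, nsmul_eq_mul, mul_one] at e
  have e' : (((P.1 * P.2 * (P.1 + P.2)).divisors.filter (fun E : ℕ => Y1 ≤ (E:ℝ) ∧ (E:ℝ) ≤ Y2)).card) =
      (Gset Y1 Y2 P).card := by
    have := (by exact_mod_cast e :
      ((P.1 * P.2 * (P.1 + P.2)).divisors.filter (fun E : ℕ => Y1 ≤ (E:ℝ) ∧ (E:ℝ) ≤ Y2)).card = _)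
    rw [this]; unfold Gset; push_cast; rfl
  rw [← e']
  have hn0 : P.1 * P.2 * (P.1 + P.2) ≠ 0 := by positivity
  set n := P.1 * P.2 * (P.1 + P.2) with hn
  unfold DX
  rw [← hn]
  refine Finset.card_le_card_of_injOn (fun D => n / D) ?_ ?_
  · intro D hD
    simp only [Finset.coe_filter, Set.mem_setOf_eq, Nat.mem_divisors] at hD ⊢
    obtain ⟨⟨hd, _⟩, hx, hy⟩ := hD
    have hD0 : (0:ℝ) < D := hX.trans hx
    refine ⟨⟨Nat.div_dvd_of_dvd hd, hn0⟩, ?_⟩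
    rw [Nat.cast_div hd hD0.ne']
    constructor
    · rw [le_div_iff₀ hD0]
      exact le_trans (by gcongr) h1
    · rw [div_le_iff₀ hD0]
      refine h2.trans ?_
      have : 0 ≤ Y2 := by
        have : (0:ℝ) ≤ Y2 * X := le_trans (by positivity) h2
        exact nonneg_of_mul_nonneg_left this hX
      gcongr
  · intro D hD D' hD' h
    simp only [Finset.coe_filter, Set.mem_setOf_eq, Nat.mem_divisors] at hD hD'
    simp only at h
    rw [← Nat.div_div_self hD.1.1 hn0, h, Nat.div_div_self hD'.1.1 hn0]

lemma NX {B : ℝ} {w : ℕ} (hB : 0 < B) (hp : Par B w) (m : ℕ) (hm : m ≤ MM B) :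
    ∑ P ∈ CR m, ((DX (B / Real.log B) (2 * B) P).card : ℝ) ≤ 2000 * (Real.log B ^ 3 / w) * m := by
  obtain ⟨hM1, hM2, hM3, hM4, hM5⟩ := MM_facts hB hp
  have hl := hp.l_ge
  have hw1 : (1:ℝ) ≤ w := by exact_mod_cast hp.hw
  have hw0 : (0:ℝ) < w := by linarith
  have hw2 := hp.w2
  have hll := hp.loglog
  rcases Nat.eq_zero_or_pos m with h0 | hm1
  · subst h0; simp [CR_zero]
  have hm0 : (0:ℝ) < m := by exact_mod_cast hm1
  have hmM : (m:ℝ) ≤ MM B := by exact_mod_cast hm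
  have hS := UBstrip m w hm1 hp.hw
  have hlogm : Real.log m ≤ Real.log B := (Real.log_le_log hm0 hmM).trans hM4
  set l := Real.log B with hldef
  have hl0 : 0 < l := by linarith
  set X := B / l with hX
  have hX0 : 0 < X := by positivity
  set H := Real.sqrt m with hH
  have hHsq : H ^ 2 = m := Real.sq_sqrt (by positivity)
  have hH0 : 0 < H := Real.sqrt_pos.2 hm0
  set S := Nat.sqrt m with hSdef
  have hSH : H ≤ 2 * S := by
    have h1 : m < (S + 1) * (S + 1) := Nat.lt_succ_sqrt m
    have h2 : 1 ≤ S := by rw [hSdef, Nat.le_sqrt]; omega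
    apply Real.sqrt_le_iff.2
    refine ⟨by positivity, ?_⟩
    have : m ≤ (2 * S) ^ 2 := by nlinarith
    exact_mod_cast this
  have hY2 : H ^ 3 / X ≤ S := by
    have h19 : 2 ≤ l ^ 19 := by
      calc (2:ℝ) ≤ l := by linarith
        _ ≤ l ^ 19 := le_self_pow₀ (by linarith) (by norm_num)
    have a : H ^ 3 / X ≤ H / 2 := by
      rw [hX, div_div_eq_mul_div, div_le_div_iff₀ hB (by norm_num)]
      have : (m:ℝ) * l ^ 20 ≤ B := by rw [← le_div_iff₀ (by positivity)]; exact hmM.trans hM2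
      calc H ^ 3 * l * 2 = H * (H ^ 2 * (l * 2)) := by ring
        _ ≤ H * (H ^ 2 * (l * l ^ 19)) := by gcongr
        _ = H * (m * l ^ 20) := by rw [hHsq]; ring
        _ ≤ H * B := by gcongr
    linarith
  have hY12 : H ^ 3 / (8 * w ^ 3 * B) ≤ H ^ 3 / X := by
    apply div_le_div_of_nonneg_left (by positivity) hX0
    have h3 : (1:ℝ) ≤ w ^ 3 := one_le_pow₀ hw1
    have : X ≤ B := div_le_self hB.le (by linarith)
    nlinarith
  have hG := Gbound m (H ^ 3 / (8 * w ^ 3 * B)) (H ^ 3 / X) (by positivity) hY12 hY2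
  have er : H ^ 3 / X / (H ^ 3 / (8 * w ^ 3 * B)) = 8 * w ^ 3 * l := by rw [hX]; field_simp
  rw [er] at hG
  have hlog : 2 + Real.log (8 * w ^ 3 * l) ≤ 24 * w := by
    rw [Real.log_mul (by positivity) (by positivity), Real.log_mul (by norm_num) (by positivity), Real.log_pow]
    have h8 : Real.log 8 ≤ 3 := by
      rw [show (8:ℝ) = 2 ^ 3 by norm_num, Real.log_pow]
      have := Real.log_two_lt_d9
      push_cast; linarith
    have := Real.log_le_sub_one_of_pos hw0
    push_cast; linarith
  have hmain : ∑ P ∈ CR m, ((DX X (2 * B) P).card : ℝ) ≤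
      ∑ P ∈ CR m, ((Gset (H ^ 3 / (8 * w ^ 3 * B)) (H ^ 3 / X) P).card : ℝ) +
      ∑ P ∈ (CR m).filter (fun P => P.1 * w < S ∨ P.2 * w < S), T3 P := by
    rw [Finset.sum_filter, ← Finset.sum_add_distrib]
    refine Finset.sum_le_sum fun P hP => ?_
    have hT := T3_nonneg P
    by_cases hst : P.1 * w < S ∨ P.2 * w < S
    · rw [if_pos hst]
      have := card_divisors_T3 hP (fun D : ℕ => X < (D:ℝ) ∧ (D:ℝ) ≤ 2 * B)
      have h2 : (0:ℝ) ≤ (Gset (H ^ 3 / (8 * w ^ 3 * B)) (H ^ 3 / X) P).card := by positivity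
      unfold DX; linarith
    · rw [if_neg hst, add_zero]
      push Not at hst
      obtain ⟨q1, q2, q3, q4⟩ := mem_CR.1 hP
      have := DX_le_G hP X (2 * B) (H ^ 3 / (8 * w ^ 3 * B)) (H ^ 3 / X) hX0 (by
        rw [div_mul_cancel₀ _ hX0.ne']
        have := prod_le_sqrt q3
        exact_mod_cast this) (by
        have a1 : H / (2 * w) ≤ P.1 := by
          rw [div_le_iff₀ (by positivity)]
          have : (S:ℝ) ≤ P.1 * w := by exact_mod_cast hst.1
          linarith
        have a2 : H / (2 * w) ≤ P.2 := by
          rw [div_le_iff₀ (by positivity)]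
          have : (S:ℝ) ≤ P.2 * w := by exact_mod_cast hst.2
          linarith
        push_cast
        calc H ^ 3 / (8 * w ^ 3 * B) * (2 * B) = H / (2 * w) * (H / (2 * w)) * (H / (2 * w) + H / (2 * w)) := by
              field_simp; ring
          _ ≤ P.1 * P.2 * (P.1 + P.2) := by gcongr) (by positivity)
      exact_mod_cast this
  refine hmain.trans ((add_le_add hG hS).trans ?_)
  have hL : 1 + Real.log m ≤ 2 * l := by linarith
  have hL1 := one_le_L m
  have hl2w : l ^ 2 * w ≤ l ^ 3 / w := by
    rw [le_div_iff₀ hw0]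
    calc l ^ 2 * w * w = l ^ 2 * (w ^ 2) := by ring
      _ ≤ l ^ 2 * l := by gcongr
      _ = l ^ 3 := by ring
  have u1 : 4 * m * ((1 + Real.log m) ^ 2 * (2 + Real.log (8 * w ^ 3 * l))) ≤ 384 * (m * (l ^ 3 / w)) := by
    calc _ ≤ 4 * m * ((1 + Real.log m) ^ 2 * (24 * w)) := by gcongr
      _ ≤ 4 * m * ((2 * l) ^ 2 * (24 * w)) := by gcongr
      _ = 384 * (m * (l ^ 2 * w)) := by ring
      _ ≤ _ := by gcongr
  have u2 : 64 * m / w * (1 + Real.log m) ^ 3 ≤ 512 * (m * (l ^ 3 / w)) := by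
    calc _ ≤ 64 * m / w * (2 * l) ^ 3 := by gcongr
      _ = _ := by ring
  have p : 0 ≤ m * (l ^ 3 / w) := by positivity
  calc _ ≤ _ := add_le_add u1 u2
    _ ≤ 2000 * (m * (l ^ 3 / w)) := by linarith
    _ = _ := by ring

end DP5

namespace DP5

/-- indicator of being prime to the small primes of `D`, on residues -/
noncomputable def Ind (w D : ℕ) (r : ZMod (WW w)) : ℝ :=
  ∏ i : PS w, if (i:ℕ) ∣ D ∧ crt w r i = 0 then 0 else 1

lemma Ind_mem (w D : ℕ) (r : ZMod (WW w)) : 0 ≤ Ind w D r ∧ Ind w D r ≤ 1 := by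
  unfold Ind
  constructor
  · apply Finset.prod_nonneg; intro i _; split_ifs <;> norm_num
  · apply Finset.prod_le_one
    · intro i _; split_ifs <;> norm_num
    · intro i _; split_ifs <;> norm_num

lemma Ind_mean (w D : ℕ) : mean (WW w) (Ind w D) = phiW w D := by
  unfold mean Ind phiW
  rw [crt_sum w (fun i y => if (i:ℕ) ∣ D ∧ y = 0 then (0:ℝ) else 1)]
  have hW : ((WW w : ℕ):ℝ) = ∏ i : PS w, ((i:ℕ):ℝ) := by unfold WW; push_cast; rfl
  rw [hW, ← Finset.prod_div_distrib]
  refine Finset.prod_congr rfl fun i _ => ?_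
  have hp : (0:ℝ) < (i:ℕ) := by exact_mod_cast (PS_prime i).pos
  by_cases h : (i:ℕ) ∣ D
  · simp only [h, true_and, if_true]
    have : ∑ y : ZMod (i:ℕ), (if y = 0 then (0:ℝ) else 1) = (i:ℕ) - 1 := by
      have h1 : ∀ y : ZMod (i:ℕ), (if y = 0 then (0:ℝ) else 1) = 1 - (if y = 0 then (1:ℝ) else 0) := by
        intro y; split_ifs <;> norm_num
      simp only [h1, Finset.sum_sub_distrib]
      simp [ZMod.card]
    rw [this]; field_simp
  · simp [h, ZMod.card, hp.ne']

/-- prime to the small primes of `D` -/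
def cop (w D : ℕ) (z : ℤ) : Prop := ∀ p ∈ PS w, p ∣ D → ¬ (p:ℤ) ∣ z

lemma Ind_int (w D : ℕ) (z : ℤ) [Decidable (cop w D z)] :
    Ind w D (z : ZMod (WW w)) = if cop w D z then 1 else 0 := by
  have hc : ∀ i : PS w, crt w (z : ZMod (WW w)) i = (z : ZMod (i:ℕ)) := by
    intro i; rw [map_intCast]; rfl
  unfold Ind
  split_ifs with h
  · apply Finset.prod_eq_one
    intro i _
    rw [if_neg]
    rintro ⟨h1, h2⟩
    rw [hc, ZMod.intCast_zmod_eq_zero_iff_dvd] at h2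
    exact h i i.2 h1 h2
  · unfold cop at h
    push Not at h
    obtain ⟨p, hp, h1, h2⟩ := h
    apply Finset.prod_eq_zero (Finset.mem_univ ⟨p, hp⟩)
    rw [if_pos]
    refine ⟨h1, ?_⟩
    rw [hc, ZMod.intCast_zmod_eq_zero_iff_dvd]
    exact h2

lemma sum_Icc_range (f : ℤ → ℝ) (lo hi : ℤ) :
    ∑ z ∈ Finset.Icc lo hi, f z = ∑ k ∈ Finset.range (Finset.Icc lo hi).card, f (lo + k) := by
  symm
  refine Finset.sum_nbij' (fun k => lo + (k:ℤ)) (fun z => (z - lo).toNat) ?_ ?_ ?_ ?_ ?_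
  · intro k hk
    rw [Finset.mem_range, Int.card_Icc] at hk
    rw [Finset.mem_Icc]; omega
  · intro z hz
    rw [Finset.mem_Icc] at hz
    rw [Finset.mem_range, Int.card_Icc]; omega
  · intro k _; simp
  · intro z hz
    rw [Finset.mem_Icc] at hz
    omega
  · intros; rfl

open Classical in
lemma cop_count (w D : ℕ) (lo hi : ℤ) :
    |(((Finset.Icc lo hi).filter (cop w D)).card : ℝ) - (Finset.Icc lo hi).card * phiW w D| ≤ WW w := by
  have h := abs_sum_range_sub_mean (WW w) (fun r => Ind w D (r + (lo : ZMod (WW w))))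
    (fun r => (Ind_mem w D _).1) (fun r => (Ind_mem w D _).2) (Finset.Icc lo hi).card
  rw [mean_shift (WW w) (Ind w D), Ind_mean] at h
  have e : (((Finset.Icc lo hi).filter (cop w D)).card : ℝ) =
      ∑ n ∈ Finset.range (Finset.Icc lo hi).card, Ind w D ((n : ZMod (WW w)) + (lo : ZMod (WW w))) := by
    rw [Finset.card_filter]
    push_cast
    rw [sum_Icc_range]
    apply Finset.sum_congr rfl
    intro n _
    rw [← Ind_int]
    push_cast; rw [add_comm]
  rw [e]; exact h

/-- integers `z` with `|z c + t| ≤ y` -/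
noncomputable def Lam (c : ℕ) (t : ℤ) (y : ℝ) : Finset ℤ := Finset.Icc ⌈(-y - t) / c⌉ ⌊(y - t) / c⌋

lemma mem_Lam {c : ℕ} (hc : 1 ≤ c) {t : ℤ} {y : ℝ} {z : ℤ} : z ∈ Lam c t y ↔ |((z * c + t : ℤ) : ℝ)| ≤ y := by
  have hc0 : (0:ℝ) < c := by exact_mod_cast hc
  unfold Lam
  rw [Finset.mem_Icc, Int.ceil_le, Int.le_floor, div_le_iff₀ hc0, le_div_iff₀ hc0, abs_le]
  push_cast
  constructor
  · rintro ⟨a, b⟩; constructor <;> linarith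
  · rintro ⟨a, b⟩; constructor <;> linarith

lemma Lam_card {c : ℕ} (hc : 1 ≤ c) (t : ℤ) {y : ℝ} (hy : 0 ≤ y) :
    2 * y / c - 1 ≤ (Lam c t y).card ∧ ((Lam c t y).card : ℝ) ≤ 2 * y / c + 1 := by
  have hc0 : (0:ℝ) < c := by exact_mod_cast hc
  unfold Lam
  rw [Int.card_Icc]
  set A := (-y - t) / (c:ℝ) with hA
  set Bb := (y - t) / (c:ℝ) with hB
  have e : 2 * y / c = Bb - A := by rw [hA, hB]; ring
  have a1 := Int.le_ceil A
  have a2 := Int.ceil_lt_add_one A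
  have b1 := Int.floor_le Bb
  have b2 := Int.lt_floor_add_one Bb
  have hn : 0 ≤ 2 * y / c := by positivity
  rw [e] at hn ⊢
  set n := ⌊Bb⌋ + 1 - ⌈A⌉ with hnn
  have hnr : (n:ℝ) = ⌊Bb⌋ + 1 - ⌈A⌉ := by rw [hnn]; push_cast; ring
  have e2 : ((n.toNat : ℕ):ℝ) = max (n:ℝ) 0 := by
    have : ((n.toNat : ℕ):ℤ) = max n 0 := Int.toNat_eq_max n
    have h2 : (((n.toNat : ℕ):ℤ):ℝ) = ((max n 0 : ℤ):ℝ) := by rw [this]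
    push_cast at h2; exact h2
  rw [e2]
  constructor
  · exact le_trans (by linarith) (le_max_left _ _)
  · exact max_le (by linarith) (by linarith)

open Classical in
lemma Lam_upper (w D : ℕ) {c : ℕ} (hc : 1 ≤ c) (t : ℤ) {y : ℝ} (hy : 0 ≤ y) :
    (((Lam c t y).filter (cop w D)).card : ℝ) ≤ phiW w D * (2 * y / c) + (1 + WW w) := by
  have h1 := cop_count w D ⌈(-y - t) / c⌉ ⌊(y - t) / c⌋
  have h2 := (Lam_card hc t hy).2
  have h3 := phiW_mem w D
  have h1' := (abs_le.1 h1).2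
  unfold Lam at h2 ⊢
  nlinarith

open Classical in
lemma Lam_lower (w D : ℕ) (hD : D ≠ 0) {c : ℕ} (hc : 1 ≤ c) (t : ℤ) {y : ℝ} (hy : 0 ≤ y) :
    phiW w D * (2 * y / c) - (1 + WW w) - ∑ p ∈ D.primeFactors.filter (fun p => w < p), (2 * y / (c * p) + 1) ≤
    (((Lam c t y).filter (fun z => Int.gcd z D = 1)).card : ℝ) := by
  have h1 := cop_count w D ⌈(-y - t) / c⌉ ⌊(y - t) / c⌋
  have h2 := (Lam_card hc t hy).1
  have h3 := phiW_mem w D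
  have h1' := (abs_le.1 h1).1
  have h4 : phiW w D * (2 * y / c) - (1 + WW w) ≤ (((Lam c t y).filter (cop w D)).card : ℝ) := by
    unfold Lam at h2 ⊢
    nlinarith
  have hsub : (Lam c t y).filter (cop w D) ⊆ (Lam c t y).filter (fun z => Int.gcd z D = 1) ∪
      (D.primeFactors.filter (fun p => w < p)).biUnion (fun p => (Lam c t y).filter (fun z => (p:ℤ) ∣ z)) := by
    intro z hz
    rw [Finset.mem_filter] at hz
    rw [Finset.mem_union, Finset.mem_filter, Finset.mem_biUnion]
    by_cases hg : Int.gcd z D = 1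
    · left; exact ⟨hz.1, hg⟩
    · right
      obtain ⟨p, hp, hpd⟩ := Nat.exists_prime_and_dvd hg
      have d1 : (p:ℤ) ∣ z := (Int.natCast_dvd_natCast.2 hpd).trans (Int.gcd_dvd_left ..)
      have d2 : p ∣ D := by
        have : (p:ℤ) ∣ D := (Int.natCast_dvd_natCast.2 hpd).trans (Int.gcd_dvd_right ..)
        exact Int.natCast_dvd_natCast.1 this
      refine ⟨p, ?_, ?_⟩
      · rw [Finset.mem_filter, Nat.mem_primeFactors]
        refine ⟨⟨hp, d2, hD⟩, ?_⟩
        by_contra hpw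
        refine hz.2 p ?_ d2 d1
        unfold PS; rw [Finset.mem_filter, Finset.mem_range]; exact ⟨by omega, hp⟩
      · rw [Finset.mem_filter]; exact ⟨hz.1, d1⟩
  have h5 : (((Lam c t y).filter (cop w D)).card : ℝ) ≤ ((Lam c t y).filter (fun z => Int.gcd z D = 1)).card +
      ∑ p ∈ D.primeFactors.filter (fun p => w < p), (((Lam c t y).filter (fun z => (p:ℤ) ∣ z)).card : ℝ) := by
    have := (Finset.card_le_card hsub).trans ((Finset.card_union_le _ _).trans
      (Nat.add_le_add_left Finset.card_biUnion_le _))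
    exact_mod_cast this
  have h6 : ∑ p ∈ D.primeFactors.filter (fun p => w < p), (((Lam c t y).filter (fun z => (p:ℤ) ∣ z)).card : ℝ) ≤
      ∑ p ∈ D.primeFactors.filter (fun p => w < p), (2 * y / (c * p) + 1) := by
    apply Finset.sum_le_sum
    intro p hp
    rw [Finset.mem_filter, Nat.mem_primeFactors] at hp
    have hp1 : 1 ≤ p := hp.1.1.pos
    have hcp : 1 ≤ c * p := Nat.mul_pos hc hp1
    have h7 := (Lam_card hcp t hy).2
    have h8 : ((Lam c t y).filter (fun z => (p:ℤ) ∣ z)).card ≤ (Lam (c * p) t y).card := by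
      apply Finset.card_le_card_of_injOn (fun z : ℤ => z / (p:ℤ))
      · intro z hz
        simp only [Finset.coe_filter, Set.mem_setOf_eq] at hz
        rw [Finset.mem_coe, mem_Lam hcp]
        rw [mem_Lam hc] at hz
        have e : z / (p:ℤ) * (c * p : ℕ) + t = z * c + t := by
          obtain ⟨k, hk⟩ := hz.2
          rw [hk, Int.mul_ediv_cancel_left _ (by exact_mod_cast hp.1.1.ne_zero)]
          push_cast; ring
        rw [e]; exact hz.1
      · intro z hz z' hz' h
        simp only [Finset.coe_filter, Set.mem_setOf_eq] at hz hz'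
        simp only at h
        rw [← Int.ediv_mul_cancel hz.2, ← Int.ediv_mul_cancel hz'.2, h]
    push_cast at h7
    have h8' : (((Lam c t y).filter (fun z => (p:ℤ) ∣ z)).card : ℝ) ≤ (Lam (c * p) t y).card := by exact_mod_cast h8
    linarith
  linarith

end DP5

namespace DP5

/-- primitive and off the lines -/
def good (x y : ℤ) : Prop := Int.gcd x y = 1 ∧ x ≠ 0 ∧ y ≠ 0 ∧ x + y ≠ 0

def FF (x y : ℤ) : ℤ := max |x * y| (max |x * (x + y)| |y * (x + y)|)

/-- symmetrised height condition -/
def HS (x y u v : ℤ) (B : ℝ) : Prop :=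
  ((|x * v| : ℤ) : ℝ) ≤ B ∧ ((|y * u| : ℤ) : ℝ) ≤ B ∧ ((|x * (u + v)| : ℤ) : ℝ) ≤ B ∧
  ((|y * (u + v)| : ℤ) : ℝ) ≤ B ∧ ((|(x + y) * u| : ℤ) : ℝ) ≤ B ∧ ((|(x + y) * v| : ℤ) : ℝ) ≤ B

/-- the partners of `P` with given determinant -/
def qs (P : ℕ × ℕ) (D : ℕ) (B : ℝ) : Set (ℤ × ℤ) :=
  {Q | (P.1:ℤ) * Q.2 - P.2 * Q.1 = D ∧ good Q.1 Q.2 ∧ HS P.1 P.2 Q.1 Q.2 B}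

def qs' (P : ℕ × ℕ) (D : ℕ) (B : ℝ) : Set (ℤ × ℤ) :=
  {Q | Q ∈ qs P D B ∧ FF P.1 P.2 < FF Q.1 Q.2}

def gmap (P : ℕ × ℕ) (D : ℕ) (r s z : ℤ) : ℤ × ℤ := (z * P.1 - D * s, z * P.2 + D * r)

lemma FF_nat (a b : ℕ) : FF a b = (Fn a b : ℕ) := by
  unfold FF Fn
  have e1 : |(a:ℤ) * b| = a * b := abs_of_nonneg (by positivity)
  have e2 : |(a:ℤ) * (a + b)| = a * (a + b) := abs_of_nonneg (by positivity)
  have e3 : |(b:ℤ) * (a + b)| = b * (a + b) := abs_of_nonneg (by positivity)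
  rw [e1, e2, e3]
  push_cast
  have h0 : (0:ℤ) ≤ a := by positivity
  have h1 : (0:ℤ) ≤ b := by positivity
  rcases le_total (a:ℤ) b with h | h
  · rw [max_eq_right (mul_le_mul_of_nonneg_right h (by positivity)), max_eq_right h, max_eq_right]
    · ring
    · nlinarith
  · rw [max_eq_left (mul_le_mul_of_nonneg_right h (by positivity)), max_eq_left h, max_eq_right]
    · ring
    · nlinarith

lemma qs_sub (w : ℕ) {P : ℕ × ℕ} (h1 : 1 ≤ P.1) (h2 : 1 ≤ P.2) (D : ℕ) (B : ℝ) (r s : ℤ)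
    (hrs : r * P.1 + s * P.2 = 1) {Q : ℤ × ℤ} (hQ : Q ∈ qs P D B) :
    ∃ z, gmap P D r s z = Q ∧ z ∈ Lam (P.1 + P.2) (D * (r - s)) (B / (max P.1 P.2 : ℕ)) ∧ cop w D z := by
  obtain ⟨hd, hg, hh⟩ := hQ
  refine ⟨r * Q.1 + s * Q.2, ?_, ?_, ?_⟩
  · unfold gmap
    ext
    · simp only; rw [← hd]; linear_combination Q.1 * hrs
    · simp only; rw [← hd]; linear_combination Q.2 * hrs
  · rw [mem_Lam (by omega)]
    have hmu : (0:ℝ) < (max P.1 P.2 : ℕ) := by exact_mod_cast (by omega : 0 < max P.1 P.2)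
    rw [le_div_iff₀ hmu]
    have e : (r * Q.1 + s * Q.2) * ((P.1 + P.2 : ℕ):ℤ) + D * (r - s) = Q.1 + Q.2 := by
      push_cast; rw [← hd]; linear_combination (Q.1 + Q.2) * hrs
    rw [e]
    obtain ⟨-, -, h3, h4, -, -⟩ := hh
    rcases le_total P.1 P.2 with h | h
    · rw [max_eq_right h]
      rw [abs_mul] at h4; push_cast at h4
      rw [abs_of_nonneg (by positivity : (0:ℝ) ≤ P.2)] at h4
      push_cast; linarith
    · rw [max_eq_left h]
      rw [abs_mul] at h3; push_cast at h3
      rw [abs_of_nonneg (by positivity : (0:ℝ) ≤ P.1)] at h3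
      push_cast; linarith
  · intro p hp hpD hpz
    have hpp : p.Prime := (Finset.mem_filter.1 hp).2
    have hpD' : (p:ℤ) ∣ D := by exact_mod_cast hpD
    have d1 : (p:ℤ) ∣ Q.1 := by
      have : Q.1 = (r * Q.1 + s * Q.2) * P.1 - D * s := by rw [← hd]; linear_combination -Q.1 * hrs
      rw [this]; exact dvd_sub (hpz.mul_right _) (hpD'.mul_right _)
    have d2 : (p:ℤ) ∣ Q.2 := by
      have : Q.2 = (r * Q.1 + s * Q.2) * P.2 + D * r := by rw [← hd]; linear_combination -Q.2 * hrs
      rw [this]; exact dvd_add (hpz.mul_right _) (hpD'.mul_right _)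
    have := Int.dvd_coe_gcd d1 d2
    rw [hg.1] at this
    exact hpp.one_lt.ne' (by exact_mod_cast Int.eq_one_of_dvd_one (by positivity) this)

lemma bez {P : ℕ × ℕ} (hP : Nat.Coprime P.1 P.2) : ∃ r s : ℤ, r * P.1 + s * P.2 = 1 := by
  obtain ⟨r, s, h⟩ := Nat.isCoprime_iff_coprime.2 hP
  exact ⟨r, s, h⟩

lemma len_eq (P : ℕ × ℕ) (B : ℝ) :
    2 * (B / (max P.1 P.2 : ℕ)) / ((P.1 + P.2 : ℕ):ℝ) = 2 * B / (Fn P.1 P.2 : ℕ) := by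
  unfold Fn
  rw [Nat.cast_mul ((P.1 + P.2)), mul_comm ((P.1 + P.2 : ℕ):ℝ), ← div_div, mul_div_assoc]; ring

lemma qs_upper (w : ℕ) {P : ℕ × ℕ} (h1 : 1 ≤ P.1) (h2 : 1 ≤ P.2) (hP : Nat.Coprime P.1 P.2)
    (D : ℕ) {B : ℝ} (hB : 0 ≤ B) :
    (qs P D B).Finite ∧ ((qs P D B).ncard : ℝ) ≤ 2 * B / (Fn P.1 P.2 : ℕ) + 1 ∧
    ((qs P D B).ncard : ℝ) ≤ phiW w D * (2 * B / (Fn P.1 P.2 : ℕ)) + (1 + WW w) := by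
  classical
  obtain ⟨r, s, hrs⟩ := bez hP
  set L := Lam (P.1 + P.2) (D * (r - s)) (B / (max P.1 P.2 : ℕ)) with hL
  have hsub : qs P D B ⊆ (((L.filter (cop w D)).image (gmap P D r s) : Finset (ℤ × ℤ)) : Set (ℤ × ℤ)) := by
    intro Q hQ
    obtain ⟨z, a, b, c⟩ := qs_sub w h1 h2 D B r s hrs hQ
    rw [Finset.mem_coe, Finset.mem_image]
    exact ⟨z, Finset.mem_filter.2 ⟨b, c⟩, a⟩
  have hc : (qs P D B).ncard ≤ (L.filter (cop w D)).card := by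
    have := Set.ncard_le_ncard hsub (Finset.finite_toSet _)
    rw [Set.ncard_coe_finset] at this
    exact this.trans Finset.card_image_le
  have hc' : ((qs P D B).ncard : ℝ) ≤ (L.filter (cop w D)).card := by exact_mod_cast hc
  have hy : 0 ≤ B / (max P.1 P.2 : ℕ) := by positivity
  refine ⟨(Finset.finite_toSet _).subset hsub, ?_, ?_⟩
  · have h3 := (Lam_card (by omega : 1 ≤ P.1 + P.2) (D * (r - s)) hy).2
    rw [len_eq] at h3
    have : ((L.filter (cop w D)).card : ℝ) ≤ L.card := by exact_mod_cast Finset.card_filter_le _ _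
    linarith
  · have h3 := Lam_upper w D (by omega : 1 ≤ P.1 + P.2) (D * (r - s)) hy
    rw [len_eq] at h3
    linarith

lemma gmap_mem {P : ℕ × ℕ} (h1 : 1 ≤ P.1) (h2 : 1 ≤ P.2) (D : ℕ) {B : ℝ} (r s : ℤ)
    (hrs : r * P.1 + s * P.2 = 1) {z : ℤ}
    (hz : z ∈ Lam (P.1 + P.2) (D * (r - s)) ((B - D) / (max P.1 P.2 : ℕ))) (hg : Int.gcd z D = 1)
    (ha : z * P.1 - D * s ≠ 0) (hb : z * P.2 + D * r ≠ 0)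
    (hc : z ∉ Lam (P.1 + P.2) (D * (r - s)) (2 * (P.1 + P.2 : ℕ))) :
    gmap P D r s z ∈ qs' P D B := by
  have hmu : (0:ℝ) < (max P.1 P.2 : ℕ) := by exact_mod_cast (by omega : 0 < max P.1 P.2)
  rw [mem_Lam (by omega)] at hz hc
  rw [le_div_iff₀ hmu] at hz
  set u := z * P.1 - D * s with hu
  set v := z * P.2 + D * r with hv
  have hn : z * ((P.1 + P.2 : ℕ):ℤ) + D * (r - s) = u + v := by rw [hu, hv]; push_cast; ring
  rw [hn] at hz hc
  have hd : (P.1:ℤ) * v - P.2 * u = D := by rw [hu, hv]; linear_combination (D:ℤ) * hrs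
  have hn' : 2 * ((P.1:ℤ) + P.2) < |u + v| := by
    push Not at hc; exact_mod_cast hc
  have hD0 : (0:ℤ) ≤ D := by positivity
  have hA : (0:ℤ) < P.1 := by exact_mod_cast h1
  have hBb : (0:ℤ) < P.2 := by exact_mod_cast h2
  have hzI : ((|u + v| * (max (P.1:ℤ) P.2) + D : ℤ) : ℝ) ≤ B := by
    push_cast at hz ⊢; linarith
  unfold gmap
  rw [← hu, ← hv]
  obtain ⟨a, ha'⟩ : ∃ a : ℤ, a = P.1 := ⟨_, rfl⟩
  obtain ⟨b, hb'⟩ : ∃ b : ℤ, b = P.2 := ⟨_, rfl⟩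
  have hmA : a ≤ max (P.1:ℤ) P.2 := by rw [ha']; exact le_max_left _ _
  have hmB : b ≤ max (P.1:ℤ) P.2 := by rw [hb']; exact le_max_right _ _
  have hmM : max (P.1:ℤ) P.2 ≤ a + b := max_le (by omega) (by omega)
  refine ⟨⟨hd, ⟨?_, ha, hb, ?_⟩, ?_⟩, ?_⟩
  · rw [← Int.isCoprime_iff_gcd_eq_one] at hg ⊢
    obtain ⟨α, β, h⟩ := hg
    refine ⟨α * r - β * P.2, α * s + β * P.1, ?_⟩
    have ez : z = r * u + s * v := by rw [hu, hv]; linear_combination -z * hrs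
    simp only
    rw [← h]; rw [← hd] ; linear_combination (-α) * ez
  · intro h0; simp only at h0; rw [h0] at hn'; simp at hn'; omega
  · simp only
    rw [← ha', ← hb'] at hd ⊢
    rw [← ha'] at hA
    rw [← hb'] at hBb
    set μ := max (P.1:ℤ) P.2
    have k : ∀ X : ℤ, |X| ≤ |u + v| * μ + D → ((|X| : ℤ) : ℝ) ≤ B := by
      intro X hX
      exact le_trans (by exact_mod_cast hX) hzI
    have n0 := abs_nonneg (u + v)
    have ka : |a * (u + v)| ≤ |u + v| * μ := by
      rw [abs_mul, abs_of_pos hA, mul_comm]; exact mul_le_mul_of_nonneg_left hmA n0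
    have kb : |b * (u + v)| ≤ |u + v| * μ := by
      rw [abs_mul, abs_of_pos hBb, mul_comm]; exact mul_le_mul_of_nonneg_left hmB n0
    have ku : |(a + b) * u| ≤ |u + v| * μ + D := by
      have e : (a + b) * u = a * (u + v) - D := by rw [← hd]; ring
      rw [e]
      have := abs_sub (a * (u + v)) (D:ℤ)
      rw [abs_of_nonneg hD0] at this; linarith
    have kv : |(a + b) * v| ≤ |u + v| * μ + D := by
      have e : (a + b) * v = b * (u + v) + D := by rw [← hd]; ring
      rw [e]
      have := abs_add_le (b * (u + v)) (D:ℤ)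
      rw [abs_of_nonneg hD0] at this; linarith
    refine ⟨k _ ?_, k _ ?_, k _ (by linarith), k _ (by linarith), k _ ku, k _ kv⟩
    · refine le_trans ?_ kv
      rw [abs_mul, abs_mul, abs_of_pos hA, abs_of_pos (by omega : 0 < a + b)]
      exact mul_le_mul_of_nonneg_right (by omega) (abs_nonneg _)
    · refine le_trans ?_ ku
      rw [abs_mul, abs_mul, abs_of_pos hBb, abs_of_pos (by omega : 0 < a + b)]
      exact mul_le_mul_of_nonneg_right (by omega) (abs_nonneg _)
  · simp only
    rw [FF_nat]
    have e1 : ((Fn P.1 P.2 : ℕ):ℤ) ≤ (a + b) * (a + b) := by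
      unfold Fn; push_cast
      rw [← ha', ← hb'] at hmM ⊢
      exact mul_le_mul_of_nonneg_left hmM (by omega)
    have e2 : |u * (u + v)| ≤ FF u v := by unfold FF; exact le_trans (le_max_left _ _) (le_max_right _ _)
    have e3 : |v * (u + v)| ≤ FF u v := by unfold FF; exact le_trans (le_max_right _ _) (le_max_right _ _)
    rw [abs_mul] at e2 e3
    have e4 : |u + v| ≤ |u| + |v| := abs_add_le u v
    have e5 : |u + v| * |u + v| ≤ 2 * FF u v := by
      calc |u + v| * |u + v| ≤ (|u| + |v|) * |u + v| := mul_le_mul_of_nonneg_right e4 (abs_nonneg _)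
        _ = |u| * |u + v| + |v| * |u + v| := by ring
        _ ≤ _ := by linarith
    rw [← ha', ← hb'] at hn'
    have e6 : (2 * (a + b)) * (2 * (a + b)) < |u + v| * |u + v| := by
      have : 0 ≤ 2 * (a + b) := by omega
      nlinarith
    nlinarith [mul_self_nonneg (a + b)]

lemma qs_lower (w : ℕ) {P : ℕ × ℕ} (h1 : 1 ≤ P.1) (h2 : 1 ≤ P.2) (hP : Nat.Coprime P.1 P.2)
    (D : ℕ) (hD : D ≠ 0) {B : ℝ} (hB : (D:ℝ) ≤ B) :
    phiW w D * (2 * (B - D) / (Fn P.1 P.2 : ℕ)) - (8 + WW w) -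
      ∑ p ∈ D.primeFactors.filter (fun p => w < p), (2 * B / ((Fn P.1 P.2 : ℕ) * p) + 1) ≤
      ((qs' P D B).ncard : ℝ) := by
  classical
  obtain ⟨r, s, hrs⟩ := bez hP
  have hB0 : 0 ≤ B := le_trans (by positivity) hB
  have hfin := (qs_upper w h1 h2 hP D hB0).1
  have hy : 0 ≤ (B - D) / (max P.1 P.2 : ℕ) := div_nonneg (by linarith) (by positivity)
  have h3 := Lam_lower w D hD (by omega : 1 ≤ P.1 + P.2) (D * (r - s)) hy
  set L := Lam (P.1 + P.2) (D * (r - s)) ((B - D) / (max P.1 P.2 : ℕ)) with hL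
  set G := L.filter (fun z => Int.gcd z D = 1) with hG
  set b1 := G.filter (fun z => z * P.1 - D * s = 0)
  set b2 := G.filter (fun z => z * P.2 + D * r = 0)
  set b3 := Lam (P.1 + P.2) (D * (r - s)) (2 * (P.1 + P.2 : ℕ)) with hb3
  have hPa : (P.1:ℤ) ≠ 0 := by exact_mod_cast (by omega : P.1 ≠ 0)
  have hPb : (P.2:ℤ) ≠ 0 := by exact_mod_cast (by omega : P.2 ≠ 0)
  have c1 : b1.card ≤ 1 := by
    rw [Finset.card_le_one]
    intro x hx y hy
    have hx := (Finset.mem_filter.1 hx).2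
    have hy := (Finset.mem_filter.1 hy).2
    exact mul_right_cancel₀ hPa (by linarith)
  have c2 : b2.card ≤ 1 := by
    rw [Finset.card_le_one]
    intro x hx y hy
    have hx := (Finset.mem_filter.1 hx).2
    have hy := (Finset.mem_filter.1 hy).2
    exact mul_right_cancel₀ hPb (by linarith)
  have c3 : (b3.card : ℝ) ≤ 5 := by
    have := (Lam_card (by omega : 1 ≤ P.1 + P.2) (D * (r - s)) (by positivity : (0:ℝ) ≤ 2 * (P.1 + P.2 : ℕ))).2
    refine this.trans (le_of_eq ?_)
    have : ((P.1 + P.2 : ℕ):ℝ) ≠ 0 := by exact_mod_cast (by omega : P.1 + P.2 ≠ 0)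
    field_simp; norm_num
  have hsub : (((G \ (b1 ∪ b2 ∪ b3)).image (gmap P D r s) : Finset (ℤ × ℤ)) : Set (ℤ × ℤ)) ⊆ qs' P D B := by
    intro Q hQ
    rw [Finset.mem_coe, Finset.mem_image] at hQ
    obtain ⟨z, hz, rfl⟩ := hQ
    rw [Finset.mem_sdiff, Finset.mem_union, Finset.mem_union] at hz
    obtain ⟨hz1, hz2⟩ := hz
    push Not at hz2
    have hz1' := Finset.mem_filter.1 hz1
    exact gmap_mem h1 h2 D r s hrs hz1'.1 hz1'.2 (fun h => hz2.1.1 (Finset.mem_filter.2 ⟨hz1, h⟩))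
      (fun h => hz2.1.2 (Finset.mem_filter.2 ⟨hz1, h⟩)) hz2.2
  have hinj : Function.Injective (gmap P D r s) := by
    intro x y h
    unfold gmap at h
    have := (Prod.mk.inj h).1
    exact mul_right_cancel₀ hPa (by linarith)
  have hn := Set.ncard_le_ncard hsub (hfin.subset (fun Q hQ => hQ.1))
  rw [Set.ncard_coe_finset, Finset.card_image_of_injective _ hinj] at hn
  have h5 : G.card ≤ (qs' P D B).ncard + (1 + 1 + b3.card) := by
    have a := Finset.le_card_sdiff (b1 ∪ b2 ∪ b3) G
    have b := Finset.card_union_le (b1 ∪ b2) b3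
    have c := Finset.card_union_le b1 b2
    omega
  have h5' : (G.card : ℝ) ≤ (qs' P D B).ncard + (1 + 1 + b3.card) := by exact_mod_cast h5
  rw [len_eq] at h3
  have h6 : ∑ p ∈ D.primeFactors.filter (fun p => w < p), (2 * ((B - D) / (max P.1 P.2 : ℕ)) / (((P.1 + P.2 : ℕ):ℝ) * p) + 1) ≤
      ∑ p ∈ D.primeFactors.filter (fun p => w < p), (2 * B / ((Fn P.1 P.2 : ℕ) * p) + 1) := by
    apply Finset.sum_le_sum
    intro p _
    rw [← div_div, len_eq, div_div]
    gcongr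
    have : (0:ℝ) ≤ D := by positivity
    linarith
  linarith

end DP5

namespace DP5

/-- the error unit -/
noncomputable def EE (B : ℝ) (w : ℕ) : ℝ := Real.log B ^ 4 / w

lemma EE_facts {B : ℝ} {w : ℕ} (hp : Par B w) :
    (1:ℝ) ≤ w ∧ (w:ℝ) ≤ Real.log B ∧ Real.log B ^ 3 ≤ EE B w ∧ Real.log B ^ 3 * w ≤ EE B w ∧ 1 ≤ EE B w ∧
    Real.log B ^ 4 / Real.log B ≤ EE B w ∧ EE B w ≤ Real.log B ^ 4 := by
  have hl := hp.l_ge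
  have hw : (1:ℝ) ≤ w := by exact_mod_cast hp.hw
  have h2 := hp.w2
  have hwl : (w:ℝ) ≤ Real.log B := by nlinarith
  have e : Real.log B ^ 4 / Real.log B = Real.log B ^ 3 := by field_simp
  have h3 : Real.log B ^ 3 * w ≤ EE B w := by
    unfold EE
    rw [le_div_iff₀ (by linarith)]
    have : 0 ≤ Real.log B ^ 3 := by positivity
    nlinarith
  have h4 : Real.log B ^ 3 ≤ EE B w := by
    have : 0 ≤ Real.log B ^ 3 := by positivity
    nlinarith
  refine ⟨hw, hwl, h4, h3, ?_, by rw [e]; exact h4, ?_⟩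
  · have : 1 ≤ Real.log B ^ 3 := one_le_pow₀ (by linarith)
    linarith
  · unfold EE
    exact div_le_self (by positivity) hw

lemma T3_tail {B : ℝ} {w : ℕ} (hB : 0 < B) (hp : Par B w) (M : ℕ) (hM : (M:ℝ) ≤ 3 * B) (hMM : MM B ≤ M) :
    ∑ P ∈ (CR M).filter (fun P => MM B < Fn P.1 P.2), T3 P / (Fn P.1 P.2 : ℕ) ≤ 90000 * EE B w := by
  obtain ⟨hM1, hM2, hM3, hM4, hM5⟩ := MM_facts hB hp
  obtain ⟨hw, hwl, h3, h4, h5, h6, h7⟩ := EE_facts hp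
  have hl := hp.l_ge
  have h := abel_tail T3 T3_nonneg (256 * Real.log B ^ 3) (MM B) M hM1 hMM
    (fun m hm => UB0' hB hp (by
      have : (m:ℝ) ≤ M := by exact_mod_cast hm
      linarith))
  refine h.trans ?_
  have hM0 : (0:ℝ) < MM B := by exact_mod_cast hM1
  have hq : (M:ℝ) / MM B ≤ Real.log B ^ 21 := by
    rw [div_le_iff₀ hM0]
    rw [div_le_iff₀ (by positivity)] at hM3
    have : 0 ≤ (MM B : ℝ) * Real.log B ^ 20 := by positivity
    calc (M:ℝ) ≤ 3 * B := hM
      _ ≤ 3 * (2 * MM B * Real.log B ^ 20) := by linarith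
      _ = 6 * (MM B * Real.log B ^ 20) := by ring
      _ ≤ Real.log B * (MM B * Real.log B ^ 20) := by
          apply mul_le_mul_of_nonneg_right _ this; linarith
      _ = _ := by ring
  have hMp : (0:ℝ) < M := by exact_mod_cast (by omega : 0 < M)
  have hlog : Real.log ((M:ℝ) / MM B) ≤ 336 * w := by
    have := Real.log_le_log (by positivity) hq
    rw [Real.log_pow] at this
    have := hp.loglog
    push_cast at *
    linarith
  have h8 : 0 ≤ 256 * Real.log B ^ 3 := by positivity
  calc 256 * Real.log B ^ 3 * (1 + Real.log ((M:ℝ) / MM B)) ≤ 256 * Real.log B ^ 3 * (337 * w) := by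
        apply mul_le_mul_of_nonneg_left _ h8; linarith
    _ = 86272 * (Real.log B ^ 3 * w) := by ring
    _ ≤ _ := by nlinarith

lemma CR_filter {M M0 : ℕ} (h : M0 ≤ M) : (CR M).filter (fun P => ¬ M0 < Fn P.1 P.2) = CR M0 := by
  ext P
  rw [Finset.mem_filter, mem_CR, mem_CR]
  constructor
  · rintro ⟨⟨a, b, c, d⟩, e⟩; exact ⟨a, b, by omega, d⟩
  · rintro ⟨a, b, c, d⟩; exact ⟨⟨a, b, by omega, d⟩, by omega⟩

/-- divisors up to `X` -/
noncomputable def D1 (X : ℝ) (P : ℕ × ℕ) : Finset ℕ :=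
  (P.1 * P.2 * (P.1 + P.2)).divisors.filter (fun D : ℕ => (D:ℝ) ≤ X)

lemma qs_big {m : ℕ} {P : ℕ × ℕ} (hP : P ∈ CR m) (D : ℕ) {B : ℝ} (hB : 0 ≤ B) (hm : (m:ℝ) ≤ B) :
    ((qs P D B).ncard : ℝ) ≤ 3 * B / (Fn P.1 P.2 : ℕ) := by
  obtain ⟨a, b, c, d⟩ := CR_Good hP
  have h := (qs_upper 1 a b c D hB).2.1
  have hF : (0:ℝ) < (Fn P.1 P.2 : ℕ) := by exact_mod_cast d
  have : (1:ℝ) ≤ B / (Fn P.1 P.2 : ℕ) := by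
    rw [le_div_iff₀ hF]
    have : ((Fn P.1 P.2 : ℕ):ℝ) ≤ m := by exact_mod_cast ((mem_CR).1 hP).2.2.1
    linarith
  have e : 3 * B / (Fn P.1 P.2 : ℕ) = 2 * B / (Fn P.1 P.2 : ℕ) + B / (Fn P.1 P.2 : ℕ) := by ring
  rw [e]; linarith

lemma main_sum_S {B : ℝ} {w : ℕ} (hB : 0 < B) (hp : Par B w) :
    0 ≤ ∑ P ∈ CR (MM B), rho w (B / Real.log B) P / (Fn P.1 P.2 : ℕ) ∧
    1 / Real.log B * ∑ P ∈ CR (MM B), rho w (B / Real.log B) P / (Fn P.1 P.2 : ℕ) ≤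
     (20000000 + 20001 * AA) * EE B w := by
  have h := (abs_le.1 (main_sum hB hp)).2
  obtain ⟨hw, hwl, h3, h4, h5, h6, h7⟩ := EE_facts hp
  have hl := hp.l_ge
  have hA := AA_nonneg
  have hk := kap_mem w
  constructor
  · apply Finset.sum_nonneg
    intro P hP
    obtain ⟨a, b, c, d⟩ := CR_Good hP
    have := (rho_bd w (B / Real.log B) P a b c).1
    positivity
  · rw [one_div, inv_mul_le_iff₀ (by linarith)]
    have e1 : kap w * AA * (17 / 576 * Real.log B ^ 4) ≤ AA * Real.log B ^ 4 := by
      have : kap w * AA ≤ AA := by nlinarith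
      have h9 : 0 ≤ Real.log B ^ 4 := by positivity
      nlinarith [mul_le_mul_of_nonneg_right this h9, mul_nonneg hA h9, mul_nonneg (mul_nonneg hk.1 hA) h9]
    have e2 : Real.log B ^ 4 ≤ Real.log B * EE B w := by
      have : Real.log B ^ 4 = Real.log B * Real.log B ^ 3 := by ring
      rw [this]; exact mul_le_mul_of_nonneg_left h3 (by linarith)
    have e3 : Real.log B ^ 4 / w ≤ Real.log B * EE B w := by
      change EE B w ≤ _
      nlinarith
    have e4 := mul_le_mul_of_nonneg_left e3 (by positivity : 0 ≤ 20000000 + 20000 * AA)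
    have e5 := mul_le_mul_of_nonneg_left e2 hA
    nlinarith

lemma upper1 {B : ℝ} {w : ℕ} (hB : 0 < B) (hp : Par B w) :
    ∑ P ∈ CR ⌊B * (1 + 1 / Real.log B)⌋₊, ∑ D ∈ D1 (B / Real.log B) P,
      ((qs P D (B * (1 + 1 / Real.log B))).ncard : ℝ) ≤
    2 * B * (kap w * AA * (17 / 576 * Real.log B ^ 4)) + (100000000 + 100000 * AA) * (B * EE B w) := by
  obtain ⟨hM1, hM2, hM3, hM4, hM5⟩ := MM_facts hB hp
  obtain ⟨hw, hwl, h3, h4, h5, h6, h7⟩ := EE_facts hp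
  have hl := hp.l_ge
  have hA := AA_nonneg
  set B' := B * (1 + 1 / Real.log B) with hB'
  have hil : 1 / Real.log B ≤ 1 := by rw [div_le_one (by linarith)]; linarith
  have hil0 : 0 < 1 / Real.log B := by positivity
  have hB'1 : B ≤ B' := by rw [hB']; nlinarith
  have hB'2 : B' ≤ 2 * B := by rw [hB']; nlinarith
  have hfl : (⌊B'⌋₊ : ℝ) ≤ B' := Nat.floor_le (by linarith)
  have hMMB : (MM B : ℝ) ≤ B := hM2.trans (div_le_self hB.le (one_le_pow₀ (by linarith)))
  have hMM : MM B ≤ ⌊B'⌋₊ := Nat.le_floor (by linarith)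
  rw [← Finset.sum_filter_add_sum_filter_not _ (fun P : ℕ × ℕ => MM B < Fn P.1 P.2), CR_filter hMM]
  have t1 : ∑ P ∈ (CR ⌊B'⌋₊).filter (fun P => MM B < Fn P.1 P.2), ∑ D ∈ D1 (B / Real.log B) P,
      ((qs P D B').ncard : ℝ) ≤ 6 * B * (90000 * EE B w) := by
    refine le_trans ?_ (mul_le_mul_of_nonneg_left (T3_tail hB hp ⌊B'⌋₊ (by linarith) hMM) (by positivity))
    rw [Finset.mul_sum]
    apply Finset.sum_le_sum
    intro P hP
    have hP' := (Finset.mem_filter.1 hP).1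
    have hF : (0:ℝ) < (Fn P.1 P.2 : ℕ) := by exact_mod_cast (CR_Good hP').2.2.2
    have h1 : ∑ D ∈ D1 (B / Real.log B) P, ((qs P D B').ncard : ℝ) ≤
        ∑ D ∈ D1 (B / Real.log B) P, 6 * B / (Fn P.1 P.2 : ℕ) := by
      apply Finset.sum_le_sum
      intro D _
      refine (qs_big hP' D (by linarith) hfl).trans ?_
      exact div_le_div_of_nonneg_right (by linarith) hF.le
    refine h1.trans ?_
    rw [Finset.sum_const, nsmul_eq_mul]
    have h2 := card_divisors_T3 hP' (fun D : ℕ => (D:ℝ) ≤ B / Real.log B)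
    have h8 : 0 ≤ 6 * B / (Fn P.1 P.2 : ℕ) := by positivity
    calc ((D1 (B / Real.log B) P).card : ℝ) * (6 * B / (Fn P.1 P.2 : ℕ)) ≤ T3 P * (6 * B / (Fn P.1 P.2 : ℕ)) :=
          mul_le_mul_of_nonneg_right h2 h8
      _ = _ := by ring
  have t2 : ∑ P ∈ CR (MM B), ∑ D ∈ D1 (B / Real.log B) P, ((qs P D B').ncard : ℝ) ≤
      2 * B' * (∑ P ∈ CR (MM B), rho w (B / Real.log B) P / (Fn P.1 P.2 : ℕ)) +
        (1 + WW w) * ∑ P ∈ CR (MM B), T3 P := by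
    rw [Finset.mul_sum, Finset.mul_sum, ← Finset.sum_add_distrib]
    apply Finset.sum_le_sum
    intro P hP
    obtain ⟨a, b, c, d⟩ := CR_Good hP
    have h1 : ∑ D ∈ D1 (B / Real.log B) P, ((qs P D B').ncard : ℝ) ≤
        ∑ D ∈ D1 (B / Real.log B) P, (phiW w D * (2 * B' / (Fn P.1 P.2 : ℕ)) + (1 + WW w)) := by
      apply Finset.sum_le_sum
      intro D _
      exact (qs_upper w a b c D (by linarith)).2.2
    refine h1.trans ?_
    rw [Finset.sum_add_distrib, ← Finset.sum_mul, Finset.sum_const, nsmul_eq_mul]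
    have h2 := card_divisors_T3 hP (fun D : ℕ => (D:ℝ) ≤ B / Real.log B)
    have h8 : (0:ℝ) ≤ 1 + WW w := by positivity
    have e : ∑ D ∈ D1 (B / Real.log B) P, phiW w D = rho w (B / Real.log B) P := rfl
    rw [e]
    have := mul_le_mul_of_nonneg_right h2 h8
    have e2 : rho w (B / Real.log B) P * (2 * B' / (Fn P.1 P.2 : ℕ)) =
      2 * B' * (rho w (B / Real.log B) P / (Fn P.1 P.2 : ℕ)) := by ring
    rw [e2]
    unfold D1
    linarith
  have t3 : (1 + (WW w:ℝ)) * ∑ P ∈ CR (MM B), T3 P ≤ B * EE B w := by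
    have hW : (WW w : ℝ) ≤ Real.log B := by
      have := hp.Ww
      have h0 : (0:ℝ) ≤ WW w := by positivity
      nlinarith
    have h1 := UB0' (m := MM B) hB hp (by linarith)
    have h0 : 0 ≤ ∑ P ∈ CR (MM B), T3 P := Finset.sum_nonneg fun P _ => T3_nonneg P
    rw [le_div_iff₀ (by positivity)] at hM2
    calc (1 + (WW w:ℝ)) * ∑ P ∈ CR (MM B), T3 P ≤ (2 * Real.log B) * (256 * Real.log B ^ 3 * MM B) :=
          mul_le_mul (by linarith) h1 h0 (by linarith)
      _ = 512 * (MM B * Real.log B ^ 4) := by ring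
      _ ≤ Real.log B * (MM B * Real.log B ^ 4) := by
          apply mul_le_mul_of_nonneg_right (by linarith) (by positivity)
      _ = MM B * Real.log B ^ 5 := by ring
      _ ≤ MM B * Real.log B ^ 20 := by
          apply mul_le_mul_of_nonneg_left _ (by positivity)
          exact pow_le_pow_right₀ (by linarith) (by norm_num)
      _ ≤ B := hM2
      _ ≤ B * EE B w := by nlinarith
  have t4 := (abs_le.1 (main_sum hB hp)).2
  have t5 := (main_sum_S hB hp).2
  set S := ∑ P ∈ CR (MM B), rho w (B / Real.log B) P / (Fn P.1 P.2 : ℕ)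
  have t6 : 2 * B' * S = 2 * B * S + 2 * B * (1 / Real.log B * S) := by rw [hB']; ring
  have t7 := mul_le_mul_of_nonneg_left t5 (by positivity : 0 ≤ 2 * B)
  have t8 : 2 * B * S ≤ 2 * B * (kap w * AA * (17 / 576 * Real.log B ^ 4) + (20000000 + 20000 * AA) * EE B w) := by
    apply mul_le_mul_of_nonneg_left _ (by positivity)
    unfold EE; linarith
  have hBE : 0 ≤ B * EE B w := by positivity
  have hABE : 0 ≤ AA * (B * EE B w) := by positivity
  nlinarith

lemma upper2 {B : ℝ} {w : ℕ} (hB : 0 < B) (hp : Par B w) :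
    ∑ P ∈ CR ⌊3 * B⌋₊, ∑ D ∈ DX (B / Real.log B) (2 * B) P,
      ((qs P D (3 * B)).ncard : ℝ) ≤ 1000000 * (B * EE B w) := by
  obtain ⟨hM1, hM2, hM3, hM4, hM5⟩ := MM_facts hB hp
  obtain ⟨hw, hwl, h3, h4, h5, h6, h7⟩ := EE_facts hp
  have hl := hp.l_ge
  have hfl : (⌊3 * B⌋₊ : ℝ) ≤ 3 * B := Nat.floor_le (by linarith)
  have hMMB : (MM B : ℝ) ≤ B := hM2.trans (div_le_self hB.le (one_le_pow₀ (by linarith)))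
  have hMM : MM B ≤ ⌊3 * B⌋₊ := Nat.le_floor (by linarith)
  have h0 : ∀ P ∈ CR ⌊3 * B⌋₊, ∑ D ∈ DX (B / Real.log B) (2 * B) P, ((qs P D (3 * B)).ncard : ℝ) ≤
      9 * B * (((DX (B / Real.log B) (2 * B) P).card : ℝ) / (Fn P.1 P.2 : ℕ)) := by
    intro P hP
    have h1 : ∑ D ∈ DX (B / Real.log B) (2 * B) P, ((qs P D (3 * B)).ncard : ℝ) ≤
        ∑ D ∈ DX (B / Real.log B) (2 * B) P, 3 * (3 * B) / (Fn P.1 P.2 : ℕ) := by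
      apply Finset.sum_le_sum
      intro D _
      exact qs_big hP D (by linarith) hfl
    refine h1.trans (le_of_eq ?_)
    rw [Finset.sum_const, nsmul_eq_mul]; ring
  refine (Finset.sum_le_sum h0).trans ?_
  rw [← Finset.mul_sum, ← Finset.sum_filter_add_sum_filter_not _ (fun P : ℕ × ℕ => MM B < Fn P.1 P.2), CR_filter hMM]
  have t1 : ∑ P ∈ (CR ⌊3 * B⌋₊).filter (fun P => MM B < Fn P.1 P.2),
      ((DX (B / Real.log B) (2 * B) P).card : ℝ) / (Fn P.1 P.2 : ℕ) ≤ 90000 * EE B w := by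
    refine le_trans ?_ (T3_tail hB hp ⌊3 * B⌋₊ hfl hMM)
    apply Finset.sum_le_sum
    intro P hP
    have hP' := (Finset.mem_filter.1 hP).1
    gcongr
    exact card_divisors_T3 hP' _
  have t2 := abel_all (fun P => ((DX (B / Real.log B) (2 * B) P).card : ℝ)) (fun P => by positivity)
    (2000 * (Real.log B ^ 3 / w)) (MM B) hM1 (NX hB hp)
  have t3 : 2000 * (Real.log B ^ 3 / w) * (1 + Real.log (MM B)) ≤ 4000 * EE B w := by
    calc 2000 * (Real.log B ^ 3 / w) * (1 + Real.log (MM B)) ≤ 2000 * (Real.log B ^ 3 / w) * (2 * Real.log B) := by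
          apply mul_le_mul_of_nonneg_left (by linarith) (by positivity)
      _ = _ := by unfold EE; ring
  have t4 := add_le_add t1 (t2.trans t3)
  have := mul_le_mul_of_nonneg_left t4 (by positivity : 0 ≤ 9 * B)
  have hBE : 0 ≤ B * EE B w := by positivity
  nlinarith

lemma omega_le {D : ℕ} (hD : D ≠ 0) : (D.primeFactors.card : ℝ) ≤ 2 * Real.log D := by
  have h1 : 2 ^ D.primeFactors.card ≤ D := by
    refine le_trans ?_ (Nat.le_of_dvd (Nat.pos_of_ne_zero hD) (Nat.prod_primeFactors_dvd D))
    exact Finset.pow_card_le_prod _ _ _ (fun p hp => (Nat.prime_of_mem_primeFactors hp).two_le)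
  have h2 : ((2:ℝ) ^ D.primeFactors.card) ≤ D := by exact_mod_cast h1
  have h3 := Real.log_le_log (by positivity) h2
  rw [Real.log_pow] at h3
  have h4 := Real.log_two_gt_d9
  have : (0:ℝ) ≤ D.primeFactors.card := by positivity
  nlinarith

lemma lower {B : ℝ} {w : ℕ} (hB : 0 < B) (hp : Par B w) :
    2 * B * (kap w * AA * (17 / 576 * Real.log B ^ 4)) - (100000000 + 100000 * AA) * (B * EE B w) ≤
    ∑ P ∈ CR (MM B), ∑ D ∈ D1 (B / Real.log B) P, ((qs' P D B).ncard : ℝ) := by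
  obtain ⟨hM1, hM2, hM3, hM4, hM5⟩ := MM_facts hB hp
  obtain ⟨hw, hwl, h3, h4, h5, h6, h7⟩ := EE_facts hp
  have hl := hp.l_ge
  have hA := AA_nonneg
  have hMMB : (MM B : ℝ) ≤ B := hM2.trans (div_le_self hB.le (one_le_pow₀ (by linarith)))
  set X := B / Real.log B with hX
  have hXB : X ≤ B := div_le_self hB.le (by linarith)
  set N := ⌊X⌋₊
  set R : ℕ × ℕ → ℝ := fun P => ∑ p ∈ (Finset.Ioc w N).filter
      (fun p => p.Prime ∧ p ∣ P.1 * P.2 * (P.1 + P.2)), (1:ℝ) / p with hR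
  have hR0 : ∀ P, 0 ≤ R P := fun P => Finset.sum_nonneg fun p _ => by positivity
  have key : 2 * B * (1 - 1 / Real.log B) * (∑ P ∈ CR (MM B), rho w X P / (Fn P.1 P.2 : ℕ)) -
      (8 + WW w + 2 * Real.log B) * (∑ P ∈ CR (MM B), T3 P) -
      2 * B * (∑ P ∈ CR (MM B), T3 P * R P / (Fn P.1 P.2 : ℕ)) ≤
      ∑ P ∈ CR (MM B), ∑ D ∈ D1 X P, ((qs' P D B).ncard : ℝ) := by
    rw [Finset.mul_sum, Finset.mul_sum, Finset.mul_sum, ← Finset.sum_sub_distrib, ← Finset.sum_sub_distrib]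
    apply Finset.sum_le_sum
    intro P hP
    obtain ⟨a, b, c, d⟩ := CR_Good hP
    have hF : (0:ℝ) < (Fn P.1 P.2 : ℕ) := by exact_mod_cast d
    have h1 : ∑ D ∈ D1 X P, (phiW w D * (2 * B * (1 - 1 / Real.log B) / (Fn P.1 P.2 : ℕ)) -
        ((8 + WW w + 2 * Real.log B) + 2 * B * R P / (Fn P.1 P.2 : ℕ))) ≤
        ∑ D ∈ D1 X P, ((qs' P D B).ncard : ℝ) := by
      apply Finset.sum_le_sum
      intro D hD
      unfold D1 at hD
      rw [Finset.mem_filter, Nat.mem_divisors] at hD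
      obtain ⟨⟨hDd, hn0⟩, hDX⟩ := hD
      have hD0 : D ≠ 0 := by rintro rfl; exact hn0 (zero_dvd_iff.1 hDd)
      have h := qs_lower w a b c D hD0 (hDX.trans hXB)
      refine le_trans ?_ h
      have e1 : phiW w D * (2 * B * (1 - 1 / Real.log B) / (Fn P.1 P.2 : ℕ)) ≤
          phiW w D * (2 * (B - D) / (Fn P.1 P.2 : ℕ)) := by
        apply mul_le_mul_of_nonneg_left _ (phiW_mem w D).1
        apply div_le_div_of_nonneg_right _ hF.le
        have : B * (1 - 1 / Real.log B) = B - X := by rw [hX]; ring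
        linarith
      have e2 : ∑ p ∈ D.primeFactors.filter (fun p => w < p), (2 * B / ((Fn P.1 P.2 : ℕ) * p) + 1) ≤
          2 * Real.log B + 2 * B * R P / (Fn P.1 P.2 : ℕ) := by
        rw [Finset.sum_add_distrib, add_comm]
        apply add_le_add
        · rw [Finset.sum_const, nsmul_eq_mul, mul_one]
          have e3 : ((D.primeFactors.filter (fun p => w < p)).card : ℝ) ≤ D.primeFactors.card := by
            exact_mod_cast Finset.card_filter_le _ _
          have e4 := omega_le hD0
          have e5 : Real.log D ≤ Real.log B := Real.log_le_log
            (by exact_mod_cast Nat.pos_of_ne_zero hD0) (hDX.trans hXB)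
          linarith
        · have e6 : 2 * B * R P / (Fn P.1 P.2 : ℕ) = ∑ p ∈ (Finset.Ioc w N).filter
              (fun p => p.Prime ∧ p ∣ P.1 * P.2 * (P.1 + P.2)), 2 * B / ((Fn P.1 P.2 : ℕ) * p) := by
            rw [hR]; simp only
            rw [mul_div_assoc, Finset.sum_div, Finset.mul_sum]
            apply Finset.sum_congr rfl
            intro p _
            rw [div_div, mul_one_div]; congr 1; ring
          rw [e6]
          apply Finset.sum_le_sum_of_subset_of_nonneg
          · intro p hp'
            rw [Finset.mem_filter] at hp' ⊢
            obtain ⟨hp1, hp2⟩ := hp'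
            have hpd := Nat.dvd_of_mem_primeFactors hp1
            refine ⟨Finset.mem_Ioc.2 ⟨hp2, ?_⟩, Nat.prime_of_mem_primeFactors hp1, hpd.trans hDd⟩
            exact (Nat.le_of_dvd (Nat.pos_of_ne_zero hD0) hpd).trans (Nat.le_floor hDX)
          · intro p _ _; positivity
      linarith
    refine le_trans ?_ h1
    rw [Finset.sum_sub_distrib, ← Finset.sum_mul, Finset.sum_const, nsmul_eq_mul]
    have h2 := card_divisors_T3 hP (fun D : ℕ => (D:ℝ) ≤ X)
    have e : ∑ D ∈ D1 X P, phiW w D = rho w X P := rfl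
    rw [e]
    have h8 : 0 ≤ (8 + (WW w:ℝ) + 2 * Real.log B) + 2 * B * R P / (Fn P.1 P.2 : ℕ) := by
      have := hR0 P
      positivity
    have h9 := mul_le_mul_of_nonneg_right h2 h8
    have e2 : rho w X P * (2 * B * (1 - 1 / Real.log B) / (Fn P.1 P.2 : ℕ)) =
      2 * B * (1 - 1 / Real.log B) * (rho w X P / (Fn P.1 P.2 : ℕ)) := by ring
    have e3 : T3 P * ((8 + (WW w:ℝ) + 2 * Real.log B) + 2 * B * R P / (Fn P.1 P.2 : ℕ)) =
      (8 + (WW w:ℝ) + 2 * Real.log B) * T3 P + 2 * B * (T3 P * R P / (Fn P.1 P.2 : ℕ)) := by ring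
    rw [e2]; rw [e3] at h9
    unfold D1
    linarith
  refine le_trans ?_ key
  have t3 : (8 + (WW w:ℝ) + 2 * Real.log B) * ∑ P ∈ CR (MM B), T3 P ≤ 2 * (B * EE B w) := by
    have hW : (WW w : ℝ) ≤ Real.log B := by
      have := hp.Ww
      have h0 : (0:ℝ) ≤ WW w := by positivity
      nlinarith
    have h1 := UB0' (m := MM B) hB hp (by linarith)
    have h0 : 0 ≤ ∑ P ∈ CR (MM B), T3 P := Finset.sum_nonneg fun P _ => T3_nonneg P
    rw [le_div_iff₀ (by positivity)] at hM2
    calc (8 + (WW w:ℝ) + 2 * Real.log B) * ∑ P ∈ CR (MM B), T3 P ≤ (4 * Real.log B) * (256 * Real.log B ^ 3 * MM B) :=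
          mul_le_mul (by linarith) h1 h0 (by linarith)
      _ = 1024 * (MM B * Real.log B ^ 4) := by ring
      _ ≤ (2 * Real.log B) * (MM B * Real.log B ^ 4) := by
          apply mul_le_mul_of_nonneg_right (by linarith) (by positivity)
      _ = 2 * (MM B * Real.log B ^ 5) := by ring
      _ ≤ 2 * (MM B * Real.log B ^ 20) := by
          apply mul_le_mul_of_nonneg_left _ (by positivity)
          apply mul_le_mul_of_nonneg_left _ (by positivity)
          exact pow_le_pow_right₀ (by linarith) (by norm_num)
      _ ≤ 2 * B := by linarith
      _ ≤ 2 * (B * EE B w) := by nlinarith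
  have t9 : ∑ P ∈ CR (MM B), T3 P * R P / (Fn P.1 P.2 : ℕ) ≤ 4096 * EE B w := by
    have h := abel_all (fun P => T3 P * R P) (fun P => mul_nonneg (T3_nonneg P) (hR0 P))
      (2048 * (Real.log B ^ 3 / w)) (MM B) hM1 (by
        intro m hm
        rcases Nat.eq_zero_or_pos m with h0 | h0
        · subst h0; simp [CR_zero]
        · refine (UB2 m w N h0 hp.hw).trans ?_
          have hm0 : (0:ℝ) < m := by exact_mod_cast h0
          have hlm : Real.log m ≤ Real.log B := by
            apply Real.log_le_log hm0
            have : (m:ℝ) ≤ MM B := by exact_mod_cast hm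
            linarith
          have h1 := one_le_L m
          have h2 : (1 + Real.log m) ^ 3 ≤ (2 * Real.log B) ^ 3 :=
            pow_le_pow_left₀ (by linarith) (by linarith) 3
          calc 256 * m / w * (1 + Real.log m) ^ 3 ≤ 256 * m / w * (2 * Real.log B) ^ 3 :=
                mul_le_mul_of_nonneg_left h2 (by positivity)
            _ = _ := by ring)
    refine h.trans ?_
    calc 2048 * (Real.log B ^ 3 / w) * (1 + Real.log (MM B)) ≤ 2048 * (Real.log B ^ 3 / w) * (2 * Real.log B) := by
          apply mul_le_mul_of_nonneg_left (by linarith) (by positivity)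
      _ = _ := by unfold EE; ring
  have t4 := (abs_le.1 (main_sum hB hp)).1
  have t5 := (main_sum_S hB hp).2
  rw [← hX] at t4 t5
  set S := ∑ P ∈ CR (MM B), rho w X P / (Fn P.1 P.2 : ℕ)
  have t6 : 2 * B * (1 - 1 / Real.log B) * S = 2 * B * S - 2 * B * (1 / Real.log B * S) := by ring
  have t7 := mul_le_mul_of_nonneg_left t5 (by positivity : 0 ≤ 2 * B)
  have t8 : 2 * B * (kap w * AA * (17 / 576 * Real.log B ^ 4) - (20000000 + 20000 * AA) * EE B w) ≤ 2 * B * S := by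
    apply mul_le_mul_of_nonneg_left _ (by positivity)
    unfold EE; linarith
  have t10 := mul_le_mul_of_nonneg_left t9 (by positivity : 0 ≤ 2 * B)
  have hBE : 0 ≤ B * EE B w := by positivity
  have hABE : 0 ≤ AA * (B * EE B w) := by positivity
  nlinarith

end DP5

namespace DP5

abbrev Q4 := (ℤ × ℤ) × (ℤ × ℤ)

def dd (R : Q4) : ℤ := R.1.1 * R.2.2 - R.1.2 * R.2.1

/-- pairs of good vectors with positive determinant dividing the product -/
def M4 (R : Q4) : Prop :=
  good R.1.1 R.1.2 ∧ good R.2.1 R.2.2 ∧ 0 < dd R ∧ dd R ∣ R.1.1 * R.1.2 * (R.1.1 + R.1.2)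

def H4 (R : Q4) (B : ℝ) : Prop := HS R.1.1 R.1.2 R.2.1 R.2.2 B

/-- the unsymmetrised height condition -/
def H0 (R : Q4) (B : ℝ) : Prop :=
  ((|R.1.1 * R.2.2| : ℤ) : ℝ) ≤ B ∧ ((|R.1.2 * R.2.1| : ℤ) : ℝ) ≤ B ∧
  ((|R.1.1 * (R.2.1 + R.2.2)| : ℤ) : ℝ) ≤ B ∧ ((|R.1.2 * (R.2.1 + R.2.2)| : ℤ) : ℝ) ≤ B

def F1 (R : Q4) : ℤ := FF R.1.1 R.1.2
def F2 (R : Q4) : ℤ := FF R.2.1 R.2.2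

def gm (i : Fin 6) (P : ℤ × ℤ) : ℤ × ℤ :=
  match i with
  | 0 => (P.1, P.2)
  | 1 => (-P.1, -P.2)
  | 2 => (P.1, -P.1 - P.2)
  | 3 => (-P.1, P.1 + P.2)
  | 4 => (-P.1 - P.2, P.2)
  | 5 => (P.1 + P.2, -P.2)

def gm2 (i : Fin 6) (P : ℤ × ℤ) : ℤ × ℤ :=
  match i with
  | 0 => (P.1, P.2)
  | 1 => (-P.1, -P.2)
  | 2 => (-P.1, P.1 + P.2)
  | 3 => (P.1, -P.1 - P.2)
  | 4 => (P.1 + P.2, -P.2)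
  | 5 => (-P.1 - P.2, P.2)

def act (i : Fin 6) (R : Q4) : Q4 := (gm i R.1, gm2 i R.2)

def sw (R : Q4) : Q4 := (R.2, (-R.1.1, -R.1.2))

lemma gm_gm (i : Fin 6) (P : ℤ × ℤ) : gm i (gm i P) = P := by
  fin_cases i <;> ext <;> simp [gm] 

lemma gm2_gm2 (i : Fin 6) (P : ℤ × ℤ) : gm2 i (gm2 i P) = P := by
  fin_cases i <;> ext <;> simp [gm2] 

lemma act_act (i : Fin 6) (R : Q4) : act i (act i R) = R := by
  simp [act, gm_gm, gm2_gm2]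

lemma act_bij (i : Fin 6) : Function.Bijective (act i) :=
  Function.Involutive.bijective (act_act i)

lemma sw_bij : Function.Bijective sw := by
  constructor
  · rintro ⟨⟨a, b⟩, ⟨c, d⟩⟩ ⟨⟨a', b'⟩, ⟨c', d'⟩⟩ h
    simp only [sw, Prod.mk.injEq] at h ⊢
    omega
  · rintro ⟨⟨a, b⟩, ⟨c, d⟩⟩
    exact ⟨((-c, -d), (a, b)), by simp [sw]⟩

lemma good_gm (i : Fin 6) {P : ℤ × ℤ} (h : good P.1 P.2) : good (gm i P).1 (gm i P).2 := by
  obtain ⟨hg, h1, h2, h3⟩ := h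
  obtain ⟨r, s, h⟩ := Int.isCoprime_iff_gcd_eq_one.2 hg
  unfold good
  rw [← Int.isCoprime_iff_gcd_eq_one]
  fin_cases i
  · exact ⟨⟨r, s, h⟩, h1, h2, h3⟩
  · exact ⟨⟨-r, -s, by simp only [gm]; linear_combination h⟩, by simp only [gm]; omega⟩
  · exact ⟨⟨r - s, -s, by simp only [gm]; linear_combination h⟩, by simp only [gm]; omega⟩
  · exact ⟨⟨s - r, s, by simp only [gm]; linear_combination h⟩, by simp only [gm]; omega⟩
  · exact ⟨⟨-r, s - r, by simp only [gm]; linear_combination h⟩, by simp only [gm]; omega⟩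
  · exact ⟨⟨r, r - s, by simp only [gm]; linear_combination h⟩, by simp only [gm]; omega⟩

lemma good_gm2 (i : Fin 6) {P : ℤ × ℤ} (h : good P.1 P.2) : good (gm2 i P).1 (gm2 i P).2 := by
  obtain ⟨hg, h1, h2, h3⟩ := h
  obtain ⟨r, s, h⟩ := Int.isCoprime_iff_gcd_eq_one.2 hg
  unfold good
  rw [← Int.isCoprime_iff_gcd_eq_one]
  fin_cases i
  · exact ⟨⟨r, s, h⟩, h1, h2, h3⟩
  · exact ⟨⟨-r, -s, by simp only [gm2]; linear_combination h⟩, by simp only [gm2]; omega⟩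
  · exact ⟨⟨s - r, s, by simp only [gm2]; linear_combination h⟩, by simp only [gm2]; omega⟩
  · exact ⟨⟨r - s, -s, by simp only [gm2]; linear_combination h⟩, by simp only [gm2]; omega⟩
  · exact ⟨⟨r, r - s, by simp only [gm2]; linear_combination h⟩, by simp only [gm2]; omega⟩
  · exact ⟨⟨-r, s - r, by simp only [gm2]; linear_combination h⟩, by simp only [gm2]; omega⟩

lemma dd_act (i : Fin 6) (R : Q4) : dd (act i R) = dd R := by
  fin_cases i <;> simp [act, dd, gm, gm2] <;> ring

lemma dd_sw (R : Q4) : dd (sw R) = dd R := by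
  simp [sw, dd]; ring

lemma M4_act (i : Fin 6) {R : Q4} (h : M4 R) : M4 (act i R) := by
  obtain ⟨h1, h2, h3, h4⟩ := h
  refine ⟨good_gm i h1, good_gm2 i h2, by rw [dd_act]; exact h3, ?_⟩
  rw [dd_act]
  fin_cases i
  · simpa [act, gm] using h4
  all_goals
    first
    | (have e : ∀ z : ℤ, z = R.1.1 * R.1.2 * (R.1.1 + R.1.2) → dd R ∣ z := by rintro z rfl; exact h4
       apply e; simp [act, gm]; ring; done)
    | (have e : ∀ z : ℤ, z = -(R.1.1 * R.1.2 * (R.1.1 + R.1.2)) → dd R ∣ z := by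
        rintro z rfl; exact (dvd_neg.2 h4)
       apply e; simp [act, gm]; ring; done)

lemma M4_sw {R : Q4} (h : M4 R) : M4 (sw R) := by
  obtain ⟨h1, h2, h3, h4⟩ := h
  refine ⟨h2, ?_, by rw [dd_sw]; exact h3, ?_⟩
  · have := good_gm 1 h1
    exact this
  · rw [dd_sw]
    obtain ⟨r, s, h⟩ := Int.isCoprime_iff_gcd_eq_one.2 h1.1
    simp only [sw]
    obtain ⟨⟨x, y⟩, ⟨u, v⟩⟩ := R
    simp only [dd] at *
    set l := r * u + s * v with hl
    have e1 : u ≡ l * x [ZMOD (x * v - y * u)] := by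
      apply Int.ModEq.symm
      rw [Int.modEq_iff_dvd]
      exact ⟨-s, by rw [hl]; linear_combination -u * h⟩
    have e2 : v ≡ l * y [ZMOD (x * v - y * u)] := by
      apply Int.ModEq.symm
      rw [Int.modEq_iff_dvd]
      exact ⟨r, by rw [hl]; linear_combination -v * h⟩
    have e3 := (e1.mul e2).mul (e1.add e2)
    rw [← Int.modEq_zero_iff_dvd]
    refine e3.trans ?_
    rw [Int.modEq_zero_iff_dvd]
    have : l * x * (l * y) * (l * x + l * y) = l ^ 3 * (x * y * (x + y)) := by ring
    rw [this]
    exact h4.mul_left _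

lemma abs_sums (x y : ℤ) : |-x - y| = |x + y| ∧ |-x + -y| = |x + y| ∧ |x + (-x - y)| = |y| ∧
    |-x + (x + y)| = |y| ∧ |-x - y + y| = |x| ∧ |x + y + -y| = |x| := by
  refine ⟨?_, ?_, ?_, ?_, ?_, ?_⟩
  · rw [← abs_neg]; congr 1; ring
  · rw [← abs_neg]; congr 1; ring
  · rw [← abs_neg]; congr 1; ring
  · congr 1; ring
  · rw [← abs_neg]; congr 1; ring
  · congr 1; ring

lemma H4_act (i : Fin 6) {R : Q4} {B : ℝ} (h : H4 R B) : H4 (act i R) B := by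
  unfold H4 HS at *
  obtain ⟨h1, h2, h3, h4, h5, h6⟩ := h
  obtain ⟨⟨x, y⟩, ⟨u, v⟩⟩ := R
  simp only [abs_mul] at *
  obtain ⟨n1, n2, n3, n4, n5, n6⟩ := abs_sums x y
  obtain ⟨m1, m2, m3, m4, m5, m6⟩ := abs_sums u v
  fin_cases i <;> simp only [act, gm, gm2, abs_neg, n1, n2, n3, n4, n5, n6, m1, m2, m3, m4, m5, m6] <;>
  refine ⟨?_, ?_, ?_, ?_, ?_, ?_⟩ <;> assumption

lemma H4_sw {R : Q4} {B : ℝ} (h : H4 R B) : H4 (sw R) B := by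
  unfold H4 HS at *
  obtain ⟨h1, h2, h3, h4, h5, h6⟩ := h
  obtain ⟨⟨x, y⟩, ⟨u, v⟩⟩ := R
  simp only [abs_mul] at *
  have n1 : |-x + -y| = |x + y| := by rw [← abs_neg]; congr 1; ring
  simp only [sw, n1, abs_neg]
  simp only [mul_comm |u|, mul_comm |v|, mul_comm |u + v|]
  tauto

lemma FF_gm (i : Fin 6) (P : ℤ × ℤ) : FF (gm i P).1 (gm i P).2 = FF P.1 P.2 := by
  obtain ⟨x, y⟩ := P
  unfold FF
  simp only [abs_mul]
  obtain ⟨n1, n2, n3, n4, n5, n6⟩ := abs_sums x y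
  fin_cases i <;> simp only [gm, abs_neg, n1, n2, n3, n4, n5, n6] <;>
  simp only [max_comm, max_left_comm, mul_comm]

lemma FF_gm2 (i : Fin 6) (P : ℤ × ℤ) : FF (gm2 i P).1 (gm2 i P).2 = FF P.1 P.2 := by
  obtain ⟨x, y⟩ := P
  unfold FF
  simp only [abs_mul]
  obtain ⟨n1, n2, n3, n4, n5, n6⟩ := abs_sums x y
  fin_cases i <;> simp only [gm2, abs_neg, n1, n2, n3, n4, n5, n6] <;>
  simp only [max_comm, max_left_comm, mul_comm]

lemma F1_act (i : Fin 6) (R : Q4) : F1 (act i R) = F1 R := FF_gm i R.1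
lemma F2_act (i : Fin 6) (R : Q4) : F2 (act i R) = F2 R := FF_gm2 i R.2
lemma F1_sw (R : Q4) : F1 (sw R) = F2 R := rfl
lemma F2_sw (R : Q4) : F2 (sw R) = F1 R := FF_gm 1 R.1

lemma FF_le (x y : ℤ) (T : ℝ) (h : T < FF x y) : T < |x| * |y| ∨ T < |x| * |x + y| ∨ T < |y| * |x + y| := by
  unfold FF at h
  push_cast at h
  rw [lt_max_iff, lt_max_iff, abs_mul, abs_mul, abs_mul] at h
  push_cast
  exact h

lemma F1_le {R : Q4} {B : ℝ} (hB : 0 ≤ B) (h : H4 R B) (hF : F1 R ≤ F2 R) : (F1 R : ℝ) ≤ B := by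
  by_contra hc
  push Not at hc
  have hc2 : B < F2 R := hc.trans_le (by exact_mod_cast hF)
  obtain ⟨⟨x, y⟩, ⟨u, v⟩⟩ := R
  obtain ⟨h1, h2, h3, h4, h5, h6⟩ := h
  have k1 := FF_le _ _ _ hc
  have k2 := FF_le _ _ _ hc2
  simp only [abs_mul] at h1 h2 h3 h4 h5 h6 k1 k2
  push_cast at h1 h2 h3 h4 h5 h6 k1 k2
  have ax := abs_nonneg (x:ℝ)
  have ay := abs_nonneg (y:ℝ)
  have az := abs_nonneg ((x:ℝ) + y)
  have au := abs_nonneg (u:ℝ)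
  have av := abs_nonneg (v:ℝ)
  have aw := abs_nonneg ((u:ℝ) + v)
  generalize |(x:ℝ)| = a at *
  generalize |(y:ℝ)| = b at *
  generalize |(x:ℝ) + y| = c at *
  generalize |(u:ℝ)| = d at *
  generalize |(v:ℝ)| = e at *
  generalize |(u:ℝ) + v| = f at *
  have key : ∀ s t p q : ℝ, B < s → B < t → 0 ≤ p → 0 ≤ q → p ≤ B → q ≤ B → s * t = p * q → False := by
    intro s t p q hs ht hp hq hp' hq' he
    have i1 : B * B < s * t := mul_lt_mul'' hs ht hB hB
    have i2 : p * q ≤ B * B := mul_le_mul hp' hq' hq hB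
    linarith
  have n1 : 0 ≤ a * e := by positivity
  have n2 : 0 ≤ b * d := by positivity
  have n3 : 0 ≤ a * f := by positivity
  have n4 : 0 ≤ b * f := by positivity
  have n5 : 0 ≤ c * d := by positivity
  have n6 : 0 ≤ c * e := by positivity
  rcases k1 with k1 | k1 | k1 <;> rcases k2 with k2 | k2 | k2
  · exact key _ _ _ _ k1 k2 n1 n2 h1 h2 (by ring)
  · exact key _ _ _ _ k1 k2 n2 n3 h2 h3 (by ring)
  · exact key _ _ _ _ k1 k2 n1 n4 h1 h4 (by ring)
  · exact key _ _ _ _ k1 k2 n1 n5 h1 h5 (by ring)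
  · exact key _ _ _ _ k1 k2 n3 n5 h3 h5 (by ring)
  · exact key _ _ _ _ k1 k2 n3 n6 h3 h6 (by ring)
  · exact key _ _ _ _ k1 k2 n2 n6 h2 h6 (by ring)
  · exact key _ _ _ _ k1 k2 n4 n5 h4 h5 (by ring)
  · exact key _ _ _ _ k1 k2 n4 n6 h4 h6 (by ring)

/-- the twelve symmetries -/
def ph (k : Fin 6 × Bool) (R : Q4) : Q4 := act k.1 (if k.2 then sw R else R)

lemma ph_bij (k : Fin 6 × Bool) : Function.Bijective (ph k) := by
  obtain ⟨i, b⟩ := k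
  cases b
  · exact act_bij i
  · exact (act_bij i).comp sw_bij

lemma M4_ph (k : Fin 6 × Bool) {R : Q4} (h : M4 R) : M4 (ph k R) := by
  obtain ⟨i, b⟩ := k
  cases b
  · exact M4_act i h
  · exact M4_act i (M4_sw h)

lemma H4_ph (k : Fin 6 × Bool) {R : Q4} {B : ℝ} (h : H4 R B) : H4 (ph k R) B := by
  obtain ⟨i, b⟩ := k
  cases b
  · exact H4_act i h
  · exact H4_act i (H4_sw h)

lemma dd_ph (k : Fin 6 × Bool) (R : Q4) : dd (ph k R) = dd R := by
  obtain ⟨i, b⟩ := k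
  cases b
  · exact dd_act i R
  · exact (dd_act i (sw R)).trans (dd_sw R)

/-- inverse directions: `sw` has order four -/
lemma M4_sw_inv {R : Q4} (h : M4 (sw R)) : M4 R := by
  have := M4_sw (M4_sw (M4_sw h))
  have e : sw (sw (sw (sw R))) = R := by simp [sw]
  rwa [e] at this

lemma H4_sw_inv {R : Q4} {B : ℝ} (h : H4 (sw R) B) : H4 R B := by
  have := H4_sw (H4_sw (H4_sw h))
  have e : sw (sw (sw (sw R))) = R := by simp [sw]
  rwa [e] at this

lemma ph_inv (k : Fin 6 × Bool) {R : Q4} {B : ℝ} (h : M4 (ph k R)) (h' : H4 (ph k R) B) : M4 R ∧ H4 R B := by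
  obtain ⟨i, b⟩ := k
  have e1 := M4_act i h
  have e2 := H4_act i h'
  cases b
  · rw [ph, act_act] at e1 e2
    exact ⟨e1, e2⟩
  · rw [ph, act_act] at e1 e2
    exact ⟨M4_sw_inv e1, H4_sw_inv e2⟩

lemma sector {x y : ℤ} (h : good x y) : ∃ i, 0 < (gm i (x, y)).1 ∧ 0 < (gm i (x, y)).2 := by
  obtain ⟨_, h1, h2, h3⟩ := h
  rcases lt_or_gt_of_ne h1 with a | a <;> rcases lt_or_gt_of_ne h2 with b | b
  · exact ⟨1, by simp only [gm]; omega⟩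
  · rcases lt_or_gt_of_ne h3 with c | c
    · exact ⟨4, by simp only [gm]; omega⟩
    · exact ⟨3, by simp only [gm]; omega⟩
  · rcases lt_or_gt_of_ne h3 with c | c
    · exact ⟨2, by simp only [gm]; omega⟩
    · exact ⟨5, by simp only [gm]; omega⟩
  · exact ⟨0, by simp only [gm]; omega⟩

lemma sector_unique {P : ℤ × ℤ} {i j : Fin 6} (h : 0 < (gm i P).1 ∧ 0 < (gm i P).2)
    (h' : 0 < (gm j P).1 ∧ 0 < (gm j P).2) : i = j := by
  fin_cases i <;> fin_cases j <;> simp only [gm] at h h' <;> first | rfl | (exfalso; omega)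

lemma ph_exists {R : Q4} (h : M4 R) : ∃ k, 0 < (ph k R).1.1 ∧ 0 < (ph k R).1.2 ∧ F1 (ph k R) ≤ F2 (ph k R) := by
  rcases le_total (F1 R) (F2 R) with hF | hF
  · obtain ⟨i, hi⟩ := sector h.1
    refine ⟨(i, false), hi.1, hi.2, ?_⟩
    change F1 (act i R) ≤ F2 (act i R)
    rwa [F1_act, F2_act]
  · obtain ⟨i, hi⟩ := sector (M4_sw h).1
    refine ⟨(i, true), hi.1, hi.2, ?_⟩
    change F1 (act i (sw R)) ≤ F2 (act i (sw R))
    rwa [F1_act, F2_act, F1_sw, F2_sw]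

lemma ph_unique {R : Q4} {k k' : Fin 6 × Bool}
    (h : 0 < (ph k R).1.1 ∧ 0 < (ph k R).1.2 ∧ F1 (ph k R) < F2 (ph k R))
    (h' : 0 < (ph k' R).1.1 ∧ 0 < (ph k' R).1.2 ∧ F1 (ph k' R) < F2 (ph k' R)) : k = k' := by
  obtain ⟨i, b⟩ := k
  obtain ⟨j, b'⟩ := k'
  obtain ⟨h1, h2, h3⟩ := h
  obtain ⟨g1, g2, g3⟩ := h'
  simp only [ph, F1_act, F2_act] at h3 g3
  have hb : b = b' := by
    cases b <;> cases b' <;> simp [F1_sw, F2_sw] at h3 g3 ⊢ <;> omega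
  subst hb
  have : i = j := sector_unique (P := (if b then sw R else R).1) ⟨h1, h2⟩ ⟨g1, g2⟩
  rw [this]

end DP5

namespace DP5

lemma ncard_bU {ι α : Type*} (t : Finset ι) (s : ι → Set α) (hs : ∀ i ∈ t, (s i).Finite)
    (hd : ∀ i ∈ t, ∀ j ∈ t, i ≠ j → Disjoint (s i) (s j)) :
    (⋃ i ∈ t, s i).ncard = ∑ i ∈ t, (s i).ncard := by
  have h := (t.finite_toSet).ncard_biUnion (s := s) (fun i hi => hs i hi)
    (fun i hi j hj hij => hd i hi j hj hij)
  rw [finsum_mem_coe_finset] at h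
  exact h

def MH (B : ℝ) : Set Q4 := {R | M4 R ∧ H0 R B}

def emb (P : ℕ × ℕ) (Q : ℤ × ℤ) : Q4 := (((P.1 : ℤ), (P.2 : ℤ)), Q)

lemma emb_inj (P : ℕ × ℕ) : Function.Injective (emb P) := by
  intro a b h
  exact (Prod.mk.inj h).2

def SS (m : ℕ) (Ds : ℕ × ℕ → Finset ℕ) (B : ℝ) : Set Q4 :=
  ⋃ P ∈ CR m, ⋃ D ∈ Ds P, emb P '' qs P D B

def SS' (m : ℕ) (Ds : ℕ × ℕ → Finset ℕ) (B : ℝ) : Set Q4 :=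
  ⋃ P ∈ CR m, ⋃ D ∈ Ds P, emb P '' qs' P D B

lemma SS_count (m : ℕ) (Ds : ℕ × ℕ → Finset ℕ) {B : ℝ} (hB : 0 ≤ B) :
    (SS m Ds B).Finite ∧ ((SS m Ds B).ncard : ℝ) ≤ ∑ P ∈ CR m, ∑ D ∈ Ds P, ((qs P D B).ncard : ℝ) := by
  constructor
  · apply Set.Finite.biUnion (Finset.finite_toSet _)
    intro P hP
    apply Set.Finite.biUnion (Finset.finite_toSet _)
    intro D _
    obtain ⟨a, b, c, d⟩ := CR_Good hP
    exact ((qs_upper 1 a b c D hB).1).image _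
  · have h : (SS m Ds B).ncard ≤ ∑ P ∈ CR m, ∑ D ∈ Ds P, (qs P D B).ncard := by
      refine (Finset.set_ncard_biUnion_le _ _).trans ?_
      apply Finset.sum_le_sum
      intro P hP
      refine (Finset.set_ncard_biUnion_le _ _).trans ?_
      apply Finset.sum_le_sum
      intro D _
      rw [Set.ncard_image_of_injective _ (emb_inj P)]
    exact_mod_cast h

lemma emb_dd {P : ℕ × ℕ} {D : ℕ} {B : ℝ} {Q : ℤ × ℤ} (h : Q ∈ qs P D B) : dd (emb P Q) = D := h.1

lemma SS'_count (m : ℕ) (Ds : ℕ × ℕ → Finset ℕ) {B : ℝ} (hB : 0 ≤ B) :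
    (SS' m Ds B).Finite ∧ ((SS' m Ds B).ncard : ℝ) = ∑ P ∈ CR m, ∑ D ∈ Ds P, ((qs' P D B).ncard : ℝ) := by
  have f1 : ∀ P ∈ CR m, ∀ D ∈ Ds P, (emb P '' qs' P D B).Finite := by
    intro P hP D _
    obtain ⟨a, b, c, d⟩ := CR_Good hP
    exact ((qs_upper 1 a b c D hB).1.subset (fun Q hQ => hQ.1)).image _
  have f2 : ∀ P ∈ CR m, (⋃ D ∈ Ds P, emb P '' qs' P D B).Finite := by
    intro P hP
    apply Set.Finite.biUnion (Finset.finite_toSet _)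
    exact f1 P hP
  constructor
  · apply Set.Finite.biUnion (Finset.finite_toSet _)
    exact f2
  · have h : (SS' m Ds B).ncard = ∑ P ∈ CR m, ∑ D ∈ Ds P, (qs' P D B).ncard := by
      unfold SS'
      rw [ncard_bU _ _ f2]
      · apply Finset.sum_congr rfl
        intro P hP
        rw [ncard_bU _ _ (f1 P hP)]
        · apply Finset.sum_congr rfl
          intro D _
          rw [Set.ncard_image_of_injective _ (emb_inj P)]
        · intro D _ D' _ hne
          rw [Set.disjoint_left]
          rintro _ ⟨Q, hQ, rfl⟩ ⟨Q', hQ', he⟩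
          have e1 := emb_dd hQ.1
          have e2 := emb_dd hQ'.1
          rw [he, e1] at e2
          exact hne (by exact_mod_cast e2)
      · intro P _ P' _ hne
        rw [Set.disjoint_left]
        intro R hR hR'
        simp only [Set.mem_iUnion] at hR hR'
        obtain ⟨D, _, Q, _, rfl⟩ := hR
        obtain ⟨D', _, Q', _, he⟩ := hR'
        have := congrArg Prod.fst he
        simp only [emb, Prod.mk.injEq] at this
        exact hne (Prod.ext (by exact_mod_cast this.1.symm) (by exact_mod_cast this.2.symm))
    exact_mod_cast h

lemma mem_SS {R : Q4} {Ds : ℕ × ℕ → Finset ℕ} {B : ℝ} (hB : 0 ≤ B) (h : M4 R) (hH : H4 R B)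
    (h1 : 0 < R.1.1) (h2 : 0 < R.1.2) (hF : F1 R ≤ F2 R)
    (hD : (dd R).toNat ∈ Ds (R.1.1.toNat, R.1.2.toNat)) : R ∈ SS ⌊B⌋₊ Ds B := by
  have hF' := F1_le hB hH hF
  obtain ⟨⟨x, y⟩, Q⟩ := R
  simp only at h1 h2
  lift x to ℕ using h1.le
  lift y to ℕ using h2.le
  simp only [Int.toNat_natCast] at hD
  unfold SS
  simp only [Set.mem_iUnion]
  refine ⟨(x, y), ?_, (dd ((((x:ℤ), (y:ℤ)), Q) : Q4)).toNat, hD, Q, ⟨?_, h.2.1, hH⟩, rfl⟩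
  · rw [mem_CR]
    refine ⟨by exact_mod_cast h1, by exact_mod_cast h2, ?_, ?_⟩
    · apply Nat.le_floor
      unfold F1 at hF'
      simp only at hF'
      rw [FF_nat] at hF'
      exact_mod_cast hF'
    · have := h.1.1
      simpa [Int.gcd_natCast_natCast] using this
  · rw [Int.toNat_of_nonneg h.2.2.1.le]
    rfl

lemma H0_dd {R : Q4} {B : ℝ} (h : H0 R B) : (dd R : ℝ) ≤ 2 * B := by
  obtain ⟨h1, h2, _, _⟩ := h
  unfold dd
  push_cast at *
  have := neg_abs_le ((R.1.2:ℝ) * R.2.1)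
  have := le_abs_self ((R.1.1:ℝ) * R.2.2)
  linarith

lemma H0_H4 {R : Q4} {B B' : ℝ} (h : H0 R B) (hM : M4 R) (hB : B + dd R ≤ B') : H4 R B' := by
  obtain ⟨h1, h2, h3, h4⟩ := h
  have hd : (0:ℝ) < dd R := by exact_mod_cast hM.2.2.1
  have e5 : (R.1.1 + R.1.2) * R.2.1 = R.1.1 * (R.2.1 + R.2.2) - dd R := by unfold dd; ring
  have e6 : (R.1.1 + R.1.2) * R.2.2 = R.1.2 * (R.2.1 + R.2.2) + dd R := by unfold dd; ring
  refine ⟨by linarith, by linarith, by linarith, by linarith, ?_, ?_⟩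
  · rw [e5]
    push_cast at *
    have := abs_sub ((R.1.1:ℝ) * (R.2.1 + R.2.2)) (dd R)
    rw [abs_of_pos hd] at this
    linarith
  · rw [e6]
    push_cast at *
    have := abs_add_le ((R.1.2:ℝ) * (R.2.1 + R.2.2)) (dd R)
    rw [abs_of_pos hd] at this
    linarith

lemma M4_divisors {R : Q4} (h : M4 R) (h1 : 0 < R.1.1) (h2 : 0 < R.1.2) :
    (dd R).toNat ∈ (R.1.1.toNat * R.1.2.toNat * (R.1.1.toNat + R.1.2.toNat)).divisors := by
  rw [Nat.mem_divisors]
  constructor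
  · have := h.2.2.2
    rw [← Int.natCast_dvd_natCast]
    push_cast
    rw [Int.toNat_of_nonneg h.2.2.1.le, Int.toNat_of_nonneg h1.le, Int.toNat_of_nonneg h2.le]
    exact this
  · have : 0 < R.1.1.toNat := by omega
    have : 0 < R.1.2.toNat := by omega
    positivity

lemma upper_count {B X : ℝ} (hB : 0 ≤ B) (hX : 0 ≤ X) :
    (MH B).Finite ∧ ((MH B).ncard : ℝ) ≤ 12 * (
      ∑ P ∈ CR ⌊B + X⌋₊, ∑ D ∈ D1 X P, ((qs P D (B + X)).ncard : ℝ) +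
      ∑ P ∈ CR ⌊3 * B⌋₊, ∑ D ∈ DX X (2 * B) P, ((qs P D (3 * B)).ncard : ℝ)) := by
  set S1 := SS ⌊B + X⌋₊ (D1 X) (B + X)
  set S2 := SS ⌊3 * B⌋₊ (DX X (2 * B)) (3 * B)
  obtain ⟨f1, c1⟩ := SS_count ⌊B + X⌋₊ (D1 X) (by linarith : 0 ≤ B + X)
  obtain ⟨f2, c2⟩ := SS_count ⌊3 * B⌋₊ (DX X (2 * B)) (by linarith : 0 ≤ 3 * B)
  have hsub : MH B ⊆ ⋃ k, ph k ⁻¹' (S1 ∪ S2) := by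
    rintro R ⟨hM, hH⟩
    obtain ⟨k, k1, k2, k3⟩ := ph_exists hM
    rw [Set.mem_iUnion]
    refine ⟨k, ?_⟩
    have hMk := M4_ph k hM
    have hdiv := M4_divisors hMk k1 k2
    have hpos : 0 ≤ dd (ph k R) := hMk.2.2.1.le
    have hcast : (((dd (ph k R)).toNat : ℕ) : ℝ) = dd R := by
      have : (((dd (ph k R)).toNat : ℤ) : ℝ) = dd (ph k R) := by rw [Int.toNat_of_nonneg hpos]
      rw [dd_ph] at this ⊢
      exact_mod_cast this
    have h2B := H0_dd hH
    rcases le_or_gt (dd R : ℝ) X with hd | hd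
    · left
      apply mem_SS (by linarith) hMk (H4_ph k (H0_H4 hH hM (by linarith))) k1 k2 k3
      unfold D1
      rw [Finset.mem_filter]
      exact ⟨hdiv, by rw [hcast]; exact hd⟩
    · right
      apply mem_SS (by linarith) hMk (H4_ph k (H0_H4 hH hM (by linarith))) k1 k2 k3
      unfold DX
      rw [Finset.mem_filter]
      exact ⟨hdiv, by rw [hcast]; exact ⟨hd, h2B⟩⟩
  have hfk : ∀ k, (ph k ⁻¹' (S1 ∪ S2)).Finite := fun k =>
    (f1.union f2).preimage (ph_bij k).injective.injOn
  have hf : (⋃ k, ph k ⁻¹' (S1 ∪ S2)).Finite := Set.finite_iUnion hfk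
  refine ⟨hf.subset hsub, ?_⟩
  have hc : ∀ k, (ph k ⁻¹' (S1 ∪ S2)).ncard = (S1 ∪ S2).ncard := by
    intro k
    unfold Set.ncard
    rw [Set.encard_preimage_of_bijective (ph_bij k)]
  have h1 : (MH B).ncard ≤ 12 * (S1.ncard + S2.ncard) := by
    refine (Set.ncard_le_ncard hsub hf).trans ?_
    refine (Set.ncard_iUnion_le_of_fintype _).trans ?_
    simp only [hc]
    rw [Finset.sum_const, Finset.card_univ, Fintype.card_prod, Fintype.card_fin, Fintype.card_bool, smul_eq_mul]
    have := Set.ncard_union_le S1 S2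
    omega
  have h2 : ((MH B).ncard : ℝ) ≤ 12 * (S1.ncard + S2.ncard) := by exact_mod_cast h1
  linarith

lemma H4_H0 {R : Q4} {B : ℝ} (h : H4 R B) : H0 R B := ⟨h.1, h.2.1, h.2.2.1, h.2.2.2.1⟩

lemma SS'_mem {m : ℕ} {X B : ℝ} {R : Q4} (h : R ∈ SS' m (D1 X) B) :
    M4 R ∧ H4 R B ∧ 0 < R.1.1 ∧ 0 < R.1.2 ∧ F1 R < F2 R := by
  unfold SS' at h
  simp only [Set.mem_iUnion] at h
  obtain ⟨P, hP, D, hD, Q, ⟨hQ, hF⟩, rfl⟩ := h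
  obtain ⟨a, b, c, d⟩ := CR_Good hP
  obtain ⟨q1, q2, q3⟩ := hQ
  have hdd : dd (emb P Q) = D := q1
  unfold D1 at hD
  rw [Finset.mem_filter, Nat.mem_divisors] at hD
  have hD0 : 0 < D := Nat.pos_of_ne_zero (by rintro rfl; exact hD.1.2 (zero_dvd_iff.1 hD.1.1))
  have a' : (0:ℤ) < P.1 := by exact_mod_cast a
  have b' : (0:ℤ) < P.2 := by exact_mod_cast b
  refine ⟨⟨⟨?_, a'.ne', b'.ne', by simp only [emb]; omega⟩, q2, by rw [hdd]; exact_mod_cast hD0, ?_⟩, q3, a', b', hF⟩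
  · simpa [emb, Int.gcd_natCast_natCast] using c
  · rw [hdd]
    simp only [emb]
    exact_mod_cast hD.1.1

lemma lower_count {B X : ℝ} (hB : 0 ≤ B) (hX : 0 ≤ X) (m : ℕ) :
    12 * ∑ P ∈ CR m, ∑ D ∈ D1 X P, ((qs' P D B).ncard : ℝ) ≤ ((MH B).ncard : ℝ) := by
  obtain ⟨f1, c1⟩ := SS'_count m (D1 X) hB
  set S := SS' m (D1 X) B
  have hc : ∀ k, (ph k ⁻¹' S).ncard = S.ncard := by
    intro k
    unfold Set.ncard
    rw [Set.encard_preimage_of_bijective (ph_bij k)]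
  have hsub : (⋃ k ∈ (Finset.univ : Finset (Fin 6 × Bool)), ph k ⁻¹' S) ⊆ MH B := by
    intro R hR
    simp only [Set.mem_iUnion] at hR
    obtain ⟨k, _, hR⟩ := hR
    obtain ⟨a, b, c, d, e⟩ := SS'_mem hR
    obtain ⟨a', b'⟩ := ph_inv k a b
    exact ⟨a', H4_H0 b'⟩
  have h1 := Set.ncard_le_ncard hsub (upper_count hB hX).1
  rw [ncard_bU] at h1
  · simp only [hc] at h1
    rw [Finset.sum_const, Finset.card_univ, Fintype.card_prod, Fintype.card_fin, Fintype.card_bool, smul_eq_mul] at h1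
    rw [← c1]
    exact_mod_cast h1
  · intro k _
    exact f1.preimage (ph_bij k).injective.injOn
  · intro k _ k' _ hne
    rw [Set.disjoint_left]
    intro R hR hR'
    exact hne (ph_unique (SS'_mem hR).2.2 (SS'_mem hR').2.2)

lemma MH_main {B : ℝ} {w : ℕ} (hB : 0 < B) (hp : Par B w) :
    |((MH B).ncard : ℝ) - 24 * B * (kap w * AA * (17 / 576 * Real.log B ^ 4))| ≤
      12 * (101000000 + 100000 * AA) * (B * EE B w) := by
  have hl := hp.l_ge
  have hX : 0 ≤ B / Real.log B := by positivity
  have h1 := (upper_count hB.le hX).2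
  have h2 := lower_count hB.le hX (MM B)
  have e : B + B / Real.log B = B * (1 + 1 / Real.log B) := by ring
  rw [e] at h1
  have h3 := upper1 hB hp
  have h4 := upper2 hB hp
  have h5 := lower hB hp
  have h6 := (EE_facts hp).2.2.2.2.1
  have : 0 ≤ B * EE B w := by positivity
  rw [abs_le]
  constructor <;> linarith

end DP5

namespace DP5

lemma c_iff {a b c : ℤ} (hg : ∀ p : ℕ, p.Prime → (p:ℤ) ∣ a → (p:ℤ) ∣ b → (p:ℤ) ∣ c → False)
    (ha : a ≠ 0) (hb : b ≠ 0) (hc : c ≠ 0) :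
    (∀ p : ℕ, p.Prime → padicValInt p c ≤ max (padicValInt p a) (padicValInt p b)) ↔ c ∣ a * b := by
  have ha' := Int.natAbs_ne_zero.2 ha
  have hb' := Int.natAbs_ne_zero.2 hb
  have hc' := Int.natAbs_ne_zero.2 hc
  rw [← Int.natAbs_dvd_natAbs, Int.natAbs_mul, ← Nat.factorization_prime_le_iff_dvd hc' (mul_ne_zero ha' hb')]
  apply forall_congr'
  intro p
  apply forall_congr'
  intro hp
  rw [Nat.factorization_mul ha' hb', Finsupp.add_apply, Nat.factorization_def _ hp, Nat.factorization_def _ hp,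
    Nat.factorization_def _ hp]
  unfold padicValInt
  have key : padicValNat p a.natAbs = 0 ∨ padicValNat p b.natAbs = 0 ∨ padicValNat p c.natAbs = 0 := by
    by_contra hh
    push Not at hh
    obtain ⟨h1, h2, h3⟩ := hh
    exact hg p hp (Int.natCast_dvd.2 (dvd_of_one_le_padicValNat (by omega)))
      (Int.natCast_dvd.2 (dvd_of_one_le_padicValNat (by omega)))
      (Int.natCast_dvd.2 (dvd_of_one_le_padicValNat (by omega)))
  rcases key with k | k | k <;> rw [k] <;> simp

/-- the parametrisation -/
def Rel (X : ℤ × ℤ × ℤ) (R : Q4) : Prop :=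
  ∃ e f : ℤ, 0 < e ∧ f ≠ 0 ∧ IsCoprime e f ∧ X.1 = e * R.1.1 ∧ X.2.1 = -(e * R.1.2) ∧
    X.1 - X.2.2 = f * R.2.1 ∧ X.2.1 - X.2.2 = -(f * R.2.2)

lemma Rel_left {X : ℤ × ℤ × ℤ} {R R' : Q4} (h : Rel X R) (h' : Rel X R') (g : M4 R) (g' : M4 R') : R = R' := by
  obtain ⟨x1, x2, x3⟩ := X
  obtain ⟨⟨x, y⟩, ⟨u, v⟩⟩ := R
  obtain ⟨⟨x', y'⟩, ⟨u', v'⟩⟩ := R'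
  obtain ⟨e, f, he, hf, hc, r1, r2, r3, r4⟩ := h
  obtain ⟨e', f', he', hf', hc', r1', r2', r3', r4'⟩ := h'
  obtain ⟨⟨g1, g2, g3, g4⟩, ⟨k1, k2, k3, k4⟩, g5, g6⟩ := g
  obtain ⟨⟨g1', g2', g3', g4'⟩, ⟨k1', k2', k3', k4'⟩, g5', g6'⟩ := g'
  simp only [dd] at *
  have a1 : Int.gcd x1 x2 = e.natAbs := by rw [r1, r2, Int.gcd_neg, Int.gcd_mul_left, g1, mul_one]
  have a2 : Int.gcd x1 x2 = e'.natAbs := by rw [r1', r2', Int.gcd_neg, Int.gcd_mul_left, g1', mul_one]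
  have a3 : e = e' := by omega
  subst a3
  have b1 : x = x' := mul_left_cancel₀ he.ne' (r1.symm.trans r1')
  have b2 : y = y' := mul_left_cancel₀ he.ne' (neg_injective (r2.symm.trans r2'))
  subst b1 b2
  have c1 : Int.gcd (x1 - x3) (x2 - x3) = f.natAbs := by rw [r3, r4, Int.gcd_neg, Int.gcd_mul_left, k1, mul_one]
  have c2 : Int.gcd (x1 - x3) (x2 - x3) = f'.natAbs := by rw [r3', r4', Int.gcd_neg, Int.gcd_mul_left, k1', mul_one]
  have d1 : f * (x * v - y * u) = x3 * (x + y) := by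
    linear_combination x * r4 + y * r3 - x * r2 - y * r1
  have d2 : f' * (x * v' - y * u') = x3 * (x + y) := by
    linear_combination x * r4' + y * r3' - x * r2 - y * r1
  have : f = f' := by
    rcases Int.natAbs_eq_natAbs_iff.1 (c1.symm.trans c2) with h | h
    · exact h
    · exfalso
      have : f' * ((x * v' - y * u') + (x * v - y * u)) = 0 := by
        linear_combination d2 - d1 + (x * v - y * u) * h
      rcases mul_eq_zero.1 this with h | h
      · exact hf' h
      · omega
  subst this
  have b1 : u = u' := mul_left_cancel₀ hf (r3.symm.trans r3')
  have b2 : v = v' := mul_left_cancel₀ hf (neg_injective (r4.symm.trans r4'))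
  subst b1 b2
  rfl

lemma Rel_right {X X' : ℤ × ℤ × ℤ} {R : Q4} (h : Rel X R) (h' : Rel X' R) (g : M4 R) : X = X' := by
  obtain ⟨x1, x2, x3⟩ := X
  obtain ⟨x1', x2', x3'⟩ := X'
  obtain ⟨⟨x, y⟩, ⟨u, v⟩⟩ := R
  obtain ⟨e, f, he, hf, hc, r1, r2, r3, r4⟩ := h
  obtain ⟨e', f', he', hf', hc', r1', r2', r3', r4'⟩ := h'
  obtain ⟨⟨g1, g2, g3, g4⟩, ⟨k1, k2, k3, k4⟩, g5, g6⟩ := g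
  simp only [dd] at *
  have a1 : e * (x + y) = f * (u + v) := by linear_combination -r1 + r2 + r3 - r4
  have a2 : e' * (x + y) = f' * (u + v) := by linear_combination -r1' + r2' + r3' - r4'
  have a3 : e * f' = e' * f := by
    apply mul_right_cancel₀ (mul_ne_zero g4 k4)
    linear_combination (f' * (u + v)) * a1 - f * (u + v) * a2
  have b1 : e ∣ e' := hc.dvd_of_dvd_mul_right (Dvd.intro _ a3)
  have b2 : e' ∣ e := hc'.dvd_of_dvd_mul_right (Dvd.intro _ a3.symm)
  have b3 : e = e' := Int.dvd_antisymm he.le he'.le b1 b2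
  subst b3
  have b4 : f' = f := mul_left_cancel₀ he.ne' a3
  subst b4
  have c1 : x1 = x1' := r1.trans r1'.symm
  have c2 : x2 = x2' := r2.trans r2'.symm
  have c3 : x3 = x3' := by linarith
  rw [c1, c2, c3]

lemma Rel_exR {R : Q4} (g : M4 R) : ∃ X, Rel X R := by
  obtain ⟨⟨x, y⟩, ⟨u, v⟩⟩ := R
  obtain ⟨⟨g1, g2, g3, g4⟩, ⟨k1, k2, k3, k4⟩, g5, g6⟩ := g
  simp only at *
  have hgp : 0 < Int.gcd (u + v) (x + y) := Int.gcd_pos_of_ne_zero_left _ k4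
  obtain ⟨e0, he0⟩ := Int.gcd_dvd_left (u + v) (x + y)
  obtain ⟨f0, hf0⟩ := Int.gcd_dvd_right (u + v) (x + y)
  have hc : IsCoprime e0 f0 := by
    have hb := Int.gcd_eq_gcd_ab (u + v) (x + y)
    have h0 : ((Int.gcd (u + v) (x + y) : ℕ) : ℤ) ≠ 0 := by exact_mod_cast hgp.ne'
    generalize Int.gcdA (u + v) (x + y) = r at hb
    generalize Int.gcdB (u + v) (x + y) = s at hb
    refine ⟨r, s, mul_left_cancel₀ h0 ?_⟩
    linear_combination -hb - r * he0 - s * hf0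
  set t : ℤ := (Int.gcd (u + v) (x + y) : ℤ) with ht
  have ht0 : 0 < t := by rw [ht]; exact_mod_cast hgp
  have hr : e0 * (x + y) = f0 * (u + v) := by rw [he0, hf0]; ring
  have he : e0 ≠ 0 := by rintro rfl; apply k4; rw [he0]; ring
  have hf : f0 ≠ 0 := by rintro rfl; apply g4; rw [hf0]; ring
  rcases lt_or_gt_of_ne he with h | h
  · refine ⟨(-e0 * x, -(-e0 * y), -e0 * x - -f0 * u), -e0, -f0, by omega, by omega, hc.neg_neg, rfl, rfl, ?_, ?_⟩
    · simp only; ring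
    · simp only; linear_combination hr
  · refine ⟨(e0 * x, -(e0 * y), e0 * x - f0 * u), e0, f0, h, hf, hc, rfl, rfl, ?_, ?_⟩
    · simp only; ring
    · simp only; linear_combination -hr

lemma Rel_iff {X : ℤ × ℤ × ℤ} {R : Q4} (h : Rel X R) (h1 : Int.gcd R.1.1 R.1.2 = 1) (h2 : Int.gcd R.2.1 R.2.2 = 1)
    (hd : 0 < dd R) (B : ℝ) : X ∈ dP5Set B ↔ R ∈ MH B := by
  obtain ⟨x1, x2, x3⟩ := X
  obtain ⟨⟨x, y⟩, ⟨u, v⟩⟩ := R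
  obtain ⟨e, f, he, hf, hc, r1, r2, r3, r4⟩ := h
  simp only [dd] at *
  have a1 : e * (x + y) = f * (u + v) := by linear_combination -r1 + r2 + r3 - r4
  have d1 : f * (x * v - y * u) = x3 * (x + y) := by
    linear_combination x * r4 + y * r3 - x * r2 - y * r1
  have d2 : e * (x * v - y * u) = x3 * (u + v) := by
    linear_combination (u + v) * r3 - (u + v) * r1 - u * a1
  have cxy : IsCoprime x y := Int.isCoprime_iff_gcd_eq_one.2 h1
  have cuv : IsCoprime u v := Int.isCoprime_iff_gcd_eq_one.2 h2
  have hx3 : x3 ≠ 0 := by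
    rintro rfl
    have : e * (x * v - y * u) = 0 := by rw [d2]; ring
    rcases mul_eq_zero.1 this with h | h <;> omega
  have e12 : x1 - x2 = e * (x + y) := by linear_combination r1 - r2
  have G1 : Int.gcd x1 x2 = e.natAbs := by rw [r1, r2, Int.gcd_neg, Int.gcd_mul_left, h1, mul_one]
  have G2 : Int.gcd (x1 - x2) (x1 - x3) = f.natAbs := by
    rw [e12, a1, r3, Int.gcd_mul_left]
    have : Int.gcd (u + v) u = 1 := by
      rw [← Int.isCoprime_iff_gcd_eq_one]
      obtain ⟨r, s, hrs⟩ := cuv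
      exact ⟨s, r - s, by linear_combination hrs⟩
    rw [this, mul_one]
  -- primes dividing everything
  have hpr : ∀ p : ℕ, p.Prime → (p:ℤ) ∣ x1 → (p:ℤ) ∣ x2 → (p:ℤ) ∣ x3 → False := by
    intro p hp q1 q2 q3
    have i1 : (p:ℤ) ∣ e := by
      have := Int.dvd_coe_gcd q1 q2
      rw [G1] at this
      exact (Int.dvd_natAbs.1 this)
    have i2 : (p:ℤ) ∣ f := by
      have := Int.dvd_coe_gcd (dvd_sub q1 q2) (dvd_sub q1 q3)
      rw [G2] at this
      exact (Int.dvd_natAbs.1 this)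
    have := hc.isUnit_of_dvd' i1 i2
    exact (Nat.prime_iff_prime_int.1 hp).not_unit this
  have hgcd : Int.gcd x1 (Int.gcd x2 x3) = 1 := by
    by_contra hne
    obtain ⟨p, hp, hpd⟩ := Nat.exists_prime_and_dvd hne
    have hpd' : (p:ℤ) ∣ (Int.gcd x1 (Int.gcd x2 x3) : ℤ) := by exact_mod_cast hpd
    have i1 := hpd'.trans (Int.gcd_dvd_left _ _)
    have i2 := hpd'.trans (Int.gcd_dvd_right _ _)
    exact hpr p hp i1 (i2.trans (Int.gcd_dvd_left _ _)) (i2.trans (Int.gcd_dvd_right _ _))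
  have cx3e : IsCoprime x3 e := by
    obtain ⟨s, t, hst⟩ := hc
    obtain ⟨r, q, huv⟩ := cuv
    exact ⟨t * (q - r), s + t * (r * x + q * y),
      by linear_combination hst + t * r * (r3 - r1) - t * q * (r4 - r2) + t * f * huv⟩
  have cx3f : IsCoprime x3 f := by
    obtain ⟨s, t, hst⟩ := hc
    obtain ⟨r, q, hxy⟩ := cxy
    exact ⟨s * (r - q), t + s * (r * u + q * v),
      by linear_combination hst - s * r * (r3 - r1) + s * q * (r4 - r2) + s * e * hxy⟩
  have dml : ∀ a b c : ℤ, IsCoprime a b → (a ∣ b * c ↔ a ∣ c) := fun a b c h =>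
    ⟨fun k => h.dvd_of_dvd_mul_left k, fun k => k.mul_left _⟩
  have hb : x1 * x2 * x3 * (x1 - x2) * (x1 - x3) * (x2 - x3) ≠ 0 ↔ (x ≠ 0 ∧ y ≠ 0 ∧ x + y ≠ 0) ∧ (u ≠ 0 ∧ v ≠ 0 ∧ u + v ≠ 0) := by
    have huv : u + v = 0 ↔ x + y = 0 := by
      constructor
      · intro h; rw [h, mul_zero] at a1; exact (mul_eq_zero.1 a1).resolve_left he.ne'
      · intro h; rw [h, mul_zero] at a1; exact (mul_eq_zero.1 a1.symm).resolve_left hf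
    rw [e12, r3, r4, r1, r2]
    simp only [ne_eq, mul_eq_zero, neg_eq_zero, he.ne', hf, hx3, false_or, huv]
    tauto
  have hdiv : x + y ≠ 0 → (x3 ∣ x1 * x2 ↔ x * v - y * u ∣ x * y * (x + y)) := by
    intro hxy
    have s1 : x * v - y * u ∣ x * y * (x + y) ↔ x3 ∣ f * (x * y) := by
      rw [← mul_dvd_mul_iff_left hf, d1]
      have : f * (x * y * (x + y)) = f * (x * y) * (x + y) := by ring
      rw [this, mul_dvd_mul_iff_right hxy]
    rw [s1, dml _ _ _ cx3f, r1, r2]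
    have : e * x * -(e * y) = -((e * e) * (x * y)) := by ring
    rw [this, dvd_neg, dml _ _ _ (cx3e.mul_right cx3e)]
  have hH : ((max |x1 * (x2 - x3)| (max |x2 * (x1 - x3)| (max |x1 * (x1 - x2)| |x2 * (x1 - x2)|)) : ℤ) : ℝ) ≤
      B * (Int.gcd x1 x2 : ℝ) * (Int.gcd (x1 - x2) (x1 - x3) : ℝ) ↔ H0 ((x, y), (u, v)) B := by
    have n1 : |x1 * (x2 - x3)| = (e * |f|) * |x * v| := by
      rw [r1, r4, ← abs_of_pos he, ← abs_mul, ← abs_mul, ← abs_neg, abs_of_pos he]; congr 1; ring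
    have n2 : |x2 * (x1 - x3)| = (e * |f|) * |y * u| := by
      rw [r2, r3, ← abs_of_pos he, ← abs_mul, ← abs_mul, ← abs_neg, abs_of_pos he]; congr 1; ring
    have n3 : |x1 * (x1 - x2)| = (e * |f|) * |x * (u + v)| := by
      rw [e12, a1, r1, ← abs_of_pos he, ← abs_mul, ← abs_mul, abs_of_pos he]; congr 1; ring
    have n4 : |x2 * (x1 - x2)| = (e * |f|) * |y * (u + v)| := by
      rw [e12, a1, r2, ← abs_of_pos he, ← abs_mul, ← abs_mul, ← abs_neg, abs_of_pos he]; congr 1; ring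
    have hG : B * (Int.gcd x1 x2 : ℝ) * (Int.gcd (x1 - x2) (x1 - x3) : ℝ) = ((e * |f| : ℤ) : ℝ) * B := by
      rw [G1, G2]
      have q1 : ((e.natAbs : ℕ) : ℝ) = e := by rw [Nat.cast_natAbs, abs_of_pos he]
      have q2 : ((f.natAbs : ℕ) : ℝ) = ((|f| : ℤ) : ℝ) := Nat.cast_natAbs f
      rw [q1, q2]; push_cast; ring
    have hpos : (0:ℝ) < ((e * |f| : ℤ) : ℝ) := by
      exact_mod_cast mul_pos he (abs_pos.2 hf)
    rw [n1, n2, n3, n4, hG, Int.cast_max, Int.cast_max, Int.cast_max, max_le_iff, max_le_iff, max_le_iff]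
    rw [Int.cast_mul (e * |f|), Int.cast_mul (e * |f|), Int.cast_mul (e * |f|), Int.cast_mul (e * |f|)]
    rw [mul_le_mul_iff_right₀ hpos, mul_le_mul_iff_right₀ hpos, mul_le_mul_iff_right₀ hpos, mul_le_mul_iff_right₀ hpos]
    rfl
  unfold dP5Set MH M4 good
  simp only [Set.mem_setOf_eq]
  rw [hH, hb]
  constructor
  · rintro ⟨_, ⟨t1, t2⟩, t3, t4⟩
    refine ⟨⟨⟨h1, t1⟩, ⟨h2, t2⟩, hd, ?_⟩, t4⟩
    rw [c_iff hpr (by rw [r1]; exact mul_ne_zero he.ne' t1.1)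
      (by rw [r2]; exact neg_ne_zero.2 (mul_ne_zero he.ne' t1.2.1)) hx3] at t3
    exact (hdiv t1.2.2).1 t3
  · rintro ⟨⟨⟨_, t1⟩, ⟨_, t2⟩, _, t3⟩, t4⟩
    refine ⟨hgcd, ⟨t1, t2⟩, ?_, t4⟩
    rw [c_iff hpr (by rw [r1]; exact mul_ne_zero he.ne' t1.1)
      (by rw [r2]; exact neg_ne_zero.2 (mul_ne_zero he.ne' t1.2.1)) hx3]
    exact (hdiv t1.2.2).2 t3

lemma Rel_exX {X : ℤ × ℤ × ℤ} {B : ℝ} (h : X ∈ dP5Set B) : ∃ R, R ∈ MH B ∧ Rel X R := by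
  obtain ⟨x1, x2, x3⟩ := X
  have hX := h
  obtain ⟨h1, h2, -, -⟩ := h
  simp only at h1 h2
  simp only [ne_eq, mul_eq_zero, not_or] at h2
  obtain ⟨⟨⟨⟨⟨a1, a2⟩, a3⟩, a4⟩, a5⟩, a6⟩ := h2
  have key : ∀ a b : ℤ, a ≠ 0 → ∃ e r s : ℤ, 0 < e ∧ a = e * r ∧ b = e * s ∧ IsCoprime r s := by
    intro a b ha
    have hgp : 0 < Int.gcd a b := Int.gcd_pos_of_ne_zero_left _ ha
    obtain ⟨r, hr⟩ := Int.gcd_dvd_left a b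
    obtain ⟨s, hs⟩ := Int.gcd_dvd_right a b
    refine ⟨Int.gcd a b, r, s, by exact_mod_cast hgp, hr, hs, ?_⟩
    have hb := Int.gcd_eq_gcd_ab a b
    have h0 : ((Int.gcd a b : ℕ) : ℤ) ≠ 0 := by exact_mod_cast hgp.ne'
    generalize Int.gcdA a b = p at hb
    generalize Int.gcdB a b = q at hb
    refine ⟨p, q, mul_left_cancel₀ h0 ?_⟩
    linear_combination -hb - p * hr - q * hs
  obtain ⟨e, x, y, he, r1, r2, cxy⟩ := key x1 (-x2) a1
  obtain ⟨f, u, v, hf, r3, r4, cuv⟩ := key (x1 - x3) (-(x2 - x3)) a5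
  have hc : IsCoprime e f := by
    rw [Int.isCoprime_iff_gcd_eq_one]
    by_contra hne
    obtain ⟨p, hp, hpd⟩ := Nat.exists_prime_and_dvd hne
    have hpd' : (p:ℤ) ∣ (Int.gcd e f : ℤ) := by exact_mod_cast hpd
    have i1 := hpd'.trans (Int.gcd_dvd_left _ _)
    have i2 := hpd'.trans (Int.gcd_dvd_right _ _)
    have j1 : (p:ℤ) ∣ x1 := by rw [r1]; exact i1.mul_right _
    have j2 : (p:ℤ) ∣ x2 := by rw [← dvd_neg, r2]; exact i1.mul_right _
    have j3 : (p:ℤ) ∣ x3 := by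
      have : (p:ℤ) ∣ x1 - x3 := by rw [r3]; exact i2.mul_right _
      have := dvd_sub j1 this
      simpa using this
    have := Int.dvd_coe_gcd j1 (Int.dvd_coe_gcd j2 j3)
    rw [h1] at this
    exact (Nat.prime_iff_prime_int.1 hp).not_unit (isUnit_of_dvd_one (by exact_mod_cast this))
  have hD : e * f * (x * v - y * u) = x3 * (x1 - x2) := by
    linear_combination (-(x2 - x3)) * (-r1) + f * v * 0 - e * x * r4 + e * y * r3 + (x1 - x3) * r2
  have hD0 : x * v - y * u ≠ 0 := by
    intro h0
    rw [h0, mul_zero] at hD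
    rcases mul_eq_zero.1 hD.symm with h | h
    · exact a3 h
    · exact a4 h
  have gxy : Int.gcd x y = 1 := Int.isCoprime_iff_gcd_eq_one.1 cxy
  rcases lt_or_gt_of_ne hD0 with hlt | hgt
  · have hR : Rel (x1, x2, x3) ((x, y), (-u, -v)) := by
      refine ⟨e, -f, he, by omega, hc.neg_right, r1, by simp only; linear_combination -r2, ?_, ?_⟩
      · simp only; linear_combination r3
      · simp only; linear_combination -r4
    refine ⟨_, (Rel_iff hR gxy ?_ ?_ B).1 hX, hR⟩
    · exact Int.isCoprime_iff_gcd_eq_one.1 cuv.neg_neg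
    · simp only [dd]; linarith
  · have hR : Rel (x1, x2, x3) ((x, y), (u, v)) := by
      refine ⟨e, f, he, by omega, hc, r1, by simp only; linear_combination -r2, ?_, ?_⟩
      · simp only; linear_combination r3
      · simp only; linear_combination -r4
    refine ⟨_, (Rel_iff hR gxy ?_ ?_ B).1 hX, hR⟩
    · exact Int.isCoprime_iff_gcd_eq_one.1 cuv
    · simp only [dd]; linarith

lemma card_eq (B : ℝ) : Nat.card (dP5Set B) = (MH B).ncard := by
  have h0 : Nat.card (dP5Set B) = (dP5Set B).ncard := rfl
  rw [h0]
  choose! φ hφ using fun (X : ℤ × ℤ × ℤ) (h : X ∈ dP5Set B) => Rel_exX h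
  refine Set.ncard_congr (fun X _ => φ X) (fun X h => (hφ X h).1) ?_ ?_
  · intro X X' h h' he
    have e1 := (hφ X h).2
    have e2 := (hφ X' h').2
    rw [← he] at e2
    exact Rel_right e1 e2 (hφ X h).1.1
  · intro R hR
    obtain ⟨X, hX⟩ := Rel_exR hR.1
    have hXS : X ∈ dP5Set B := (Rel_iff hX hR.1.1.1 hR.1.2.1.1 hR.1.2.2.1 B).2 hR
    exact ⟨X, hXS, Rel_left (hφ X hXS).2 hX (hφ X hXS).1.1 hR.1⟩

end DP5

namespace DP5

/-! ### The archimedean volume -/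

lemma vol_lin (a b c d : ℝ) (h : |a * d - b * c| = 1) (s : Set (ℝ × ℝ)) :
    volume {y : ℝ × ℝ | (a * y.1 + b * y.2, c * y.1 + d * y.2) ∈ s} = volume s := by
  set L := Matrix.toLin (Module.Basis.finTwoProd ℝ) (Module.Basis.finTwoProd ℝ) !![a, b; c, d] with hL
  have hd : LinearMap.det L = a * d - b * c := by
    rw [hL, LinearMap.det_toLin, Matrix.det_fin_two_of]
  have hd0 : LinearMap.det L ≠ 0 := by
    rw [hd]; intro h0; rw [h0] at h; norm_num at h
  have e : {y : ℝ × ℝ | (a * y.1 + b * y.2, c * y.1 + d * y.2) ∈ s} = L ⁻¹' s := by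
    ext y
    simp only [Set.mem_setOf_eq, Set.mem_preimage, hL, Matrix.toLin_finTwoProd_apply]
  rw [e, Measure.addHaar_preimage_linearMap _ hd0, hd, abs_inv, h]
  simp

lemma vol_line (a b : ℝ) (h : ¬ (a = 0 ∧ b = 0)) :
    volume {y : ℝ × ℝ | a * y.1 + b * y.2 = 0} = 0 := by
  set L : (ℝ × ℝ) →ₗ[ℝ] ℝ := a • LinearMap.fst ℝ ℝ ℝ + b • LinearMap.snd ℝ ℝ ℝ with hL
  have e : {y : ℝ × ℝ | a * y.1 + b * y.2 = 0} = (LinearMap.ker L : Set (ℝ × ℝ)) := by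
    ext y
    simp [hL]
  rw [e]
  apply Measure.addHaar_submodule
  intro ht
  apply h
  have h1 : ((1:ℝ), (0:ℝ)) ∈ LinearMap.ker L := by rw [ht]; trivial
  have h2 : ((0:ℝ), (1:ℝ)) ∈ LinearMap.ker L := by rw [ht]; trivial
  simp [hL] at h1 h2
  exact ⟨h1, h2⟩

/-- coefficients of the six sectors -/
def sc : Fin 6 → (ℝ × ℝ) × (ℝ × ℝ) :=
  ![((1,0),(0,-1)), ((-1,0),(0,1)), ((1,-1),(0,1)), ((-1,1),(0,-1)), ((1,0),(-1,1)), ((-1,0),(1,-1))]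

def sect (i : Fin 6) : Set (ℝ × ℝ) :=
  {y : ℝ × ℝ | ((sc i).1.1 * y.1 + (sc i).1.2 * y.2, (sc i).2.1 * y.1 + (sc i).2.2 * y.2) ∈ RS 1}

lemma sect_vol (i : Fin 6) : volume (sect i) = volume (RS 1) := by
  apply vol_lin
  fin_cases i <;> simp [sc]

lemma sect_meas (i : Fin 6) : MeasurableSet (sect i) := by
  have : Measurable fun y : ℝ × ℝ => ((sc i).1.1 * y.1 + (sc i).1.2 * y.2, (sc i).2.1 * y.1 + (sc i).2.2 * y.2) := by
    fun_prop
  exact this (RS_meas 1)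

lemma sect_disj : Pairwise (Function.onFun Disjoint sect) := by
  intro i j hij
  rw [Function.onFun, Set.disjoint_left]
  intro y h1 h2
  obtain ⟨a1, b1, -⟩ := h1
  obtain ⟨a2, b2, -⟩ := h2
  revert hij
  fin_cases i <;> fin_cases j <;> simp [sc] at a1 b1 a2 b2 ⊢ <;> linarith

def GG : Set (ℝ × ℝ) := {y : ℝ × ℝ |
      max |y.1 * y.2| (max |y.1 * (y.1 - y.2)| |y.2 * (y.1 - y.2)|) ≤ 1}

lemma pos_iff {a b : ℝ} (ha : 0 < a) (hb : 0 < b) :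
    (a + b) * max a b ≤ 1 ↔ a * b ≤ 1 ∧ a * (a + b) ≤ 1 ∧ b * (a + b) ≤ 1 := by
  rw [mul_max_of_nonneg _ _ (by positivity), max_le_iff]
  constructor
  · rintro ⟨h1, h2⟩
    refine ⟨by nlinarith, by linarith, by linarith⟩
  · rintro ⟨-, h1, h2⟩
    exact ⟨by linarith, by linarith⟩

lemma sect_iff (i : Fin 6) (y : ℝ × ℝ) : y ∈ sect i ↔
    (0 < (sc i).1.1 * y.1 + (sc i).1.2 * y.2 ∧ 0 < (sc i).2.1 * y.1 + (sc i).2.2 * y.2) ∧ y ∈ GG := by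
  have key : ∀ a b : ℝ, 0 < a → 0 < b → ((max |y.1 * y.2| (max |y.1 * (y.1 - y.2)| |y.2 * (y.1 - y.2)|) ≤ 1) ↔
      (a * b ≤ 1 ∧ a * (a + b) ≤ 1 ∧ b * (a + b) ≤ 1)) → 
      ((0 < a ∧ 0 < b ∧ (a + b) * max a b ≤ 1) ↔ (0 < a ∧ 0 < b) ∧ y ∈ GG) := by
    intro a b ha hb h
    rw [pos_iff ha hb, ← h]
    simp [ha, hb, GG]
  set a := (sc i).1.1 * y.1 + (sc i).1.2 * y.2 with hA
  set b := (sc i).2.1 * y.1 + (sc i).2.2 * y.2 with hB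
  change (0 < a ∧ 0 < b ∧ (a + b) * max a b ≤ 1) ↔ _
  by_cases ha : 0 < a
  swap
  · simp [ha]
  by_cases hb : 0 < b
  swap
  · simp [hb]
  apply key a b ha hb
  have hab := mul_pos ha hb
  have h1 := mul_pos ha (add_pos ha hb)
  have h2 := mul_pos hb (add_pos ha hb)
  simp only [max_le_iff]
  have e1 : ∀ {u v : ℝ}, 0 < v → (u = v ∨ u = -v) → |u| = v := by
    intro u v hv h
    rcases h with rfl | rfl
    · exact abs_of_pos hv
    · rw [abs_neg, abs_of_pos hv]
  fin_cases i <;> simp [sc] at hA hB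
  · rw [e1 hab (Or.inr (by rw [hA, hB]; ring)), e1 h1 (Or.inl (by rw [hA, hB]; ring)), e1 h2 (Or.inr (by rw [hA, hB]; ring))]
  · rw [e1 hab (Or.inr (by rw [hA, hB]; ring)), e1 h1 (Or.inl (by rw [hA, hB]; ring)), e1 h2 (Or.inr (by rw [hA, hB]; ring))]
  · rw [e1 (u := y.1 * y.2) h2 (Or.inl (by rw [hA, hB]; ring)), e1 h1 (Or.inl (by rw [hA, hB]; ring)), e1 hab (Or.inl (by rw [hA, hB]; ring))]
    tauto
  · rw [e1 (u := y.1 * y.2) h2 (Or.inl (by rw [hA, hB]; ring)), e1 h1 (Or.inl (by rw [hA, hB]; ring)), e1 hab (Or.inl (by rw [hA, hB]; ring))]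
    tauto
  · rw [e1 (u := y.1 * y.2) h1 (Or.inl (by rw [hA, hB]; ring)), e1 hab (Or.inr (by rw [hA, hB]; ring)), e1 h2 (Or.inr (by rw [hA, hB]; ring))]
    tauto
  · rw [e1 (u := y.1 * y.2) h1 (Or.inl (by rw [hA, hB]; ring)), e1 hab (Or.inr (by rw [hA, hB]; ring)), e1 h2 (Or.inr (by rw [hA, hB]; ring))]
    tauto

lemma vol_GG : (volume GG).toReal = 6 * AA := by
  set N : Set (ℝ × ℝ) := ({y : ℝ × ℝ | 1 * y.1 + 0 * y.2 = 0} ∪ {y : ℝ × ℝ | 0 * y.1 + 1 * y.2 = 0}) ∪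
    {y : ℝ × ℝ | 1 * y.1 + (-1) * y.2 = 0} with hN
  have hN0 : volume N = 0 := by
    rw [hN]
    refine measure_union_null (measure_union_null ?_ ?_) ?_ <;> apply vol_line <;> norm_num
  have hs1 : (⋃ i, sect i) ⊆ GG := by
    intro y hy
    obtain ⟨i, hi⟩ := Set.mem_iUnion.1 hy
    exact ((sect_iff i y).1 hi).2
  have hs2 : GG ⊆ (⋃ i, sect i) ∪ N := by
    intro y hy
    by_cases hn : y ∈ N
    · exact Or.inr hn
    left
    simp only [hN, Set.mem_union, Set.mem_setOf_eq, not_or] at hn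
    obtain ⟨⟨n1, n2⟩, n3⟩ := hn
    have n1' : y.1 ≠ 0 := fun h => n1 (by linarith)
    have n2' : y.2 ≠ 0 := fun h => n2 (by linarith)
    have n3' : y.1 ≠ y.2 := fun h => n3 (by linarith)
    have fin : ∀ i, 0 < (sc i).1.1 * y.1 + (sc i).1.2 * y.2 → 0 < (sc i).2.1 * y.1 + (sc i).2.2 * y.2 →
        y ∈ ⋃ i, sect i := fun i h1 h2 => Set.mem_iUnion.2 ⟨i, (sect_iff i y).2 ⟨⟨h1, h2⟩, hy⟩⟩
    rcases lt_or_gt_of_ne n1' with h1 | h1 <;> rcases lt_or_gt_of_ne n2' with h2 | h2 <;>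
      rcases lt_or_gt_of_ne n3' with h3 | h3
    · exact fin 3 (by simp [sc]; linarith) (by simp [sc]; linarith)
    · exact fin 5 (by simp [sc]; linarith) (by simp [sc]; linarith)
    · exact fin 1 (by simp [sc]; linarith) (by simp [sc]; linarith)
    · exact fin 1 (by simp [sc]; linarith) (by simp [sc]; linarith)
    · exact fin 0 (by simp [sc]; linarith) (by simp [sc]; linarith)
    · exact fin 0 (by simp [sc]; linarith) (by simp [sc]; linarith)
    · exact fin 4 (by simp [sc]; linarith) (by simp [sc]; linarith)
    · exact fin 2 (by simp [sc]; linarith) (by simp [sc]; linarith)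
  have e : volume GG = volume (⋃ i, sect i) := by
    apply le_antisymm
    · calc volume GG ≤ volume ((⋃ i, sect i) ∪ N) := measure_mono hs2
        _ ≤ volume (⋃ i, sect i) + volume N := measure_union_le _ _
        _ = _ := by rw [hN0, add_zero]
    · exact measure_mono hs1
  rw [e, measure_iUnion sect_disj sect_meas, tsum_fintype]
  simp only [sect_vol, Finset.sum_const, Finset.card_univ, Fintype.card_fin, AA, nsmul_eq_mul, ENNReal.toReal_mul]
  simp

/-! ### The Euler product -/

noncomputable def ef (n : ℕ) : ℝ := (1 - 1 / (n:ℝ)) ^ 4 * (1 + 4 / (n:ℝ))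

lemma ef_mem {n : ℕ} (hn : n.Prime) : 0 ≤ ef n ∧ ef n ≤ 1 ∧ 1 - 10 * ((n:ℝ) ^ 2)⁻¹ ≤ ef n := by
  have hp : (2:ℝ) ≤ n := by exact_mod_cast hn.two_le
  have h1 : (1:ℝ) / n ≤ 1 / 2 := by
    rw [div_le_div_iff₀ (by linarith) (by norm_num)]; linarith
  have h' : (0:ℝ) ≤ 1 / n := by positivity
  rw [ef, show (4:ℝ) / n = 4 * (1 / n) by ring, show ((n:ℝ)^2)⁻¹ = (1 / n) ^ 2 by rw [div_pow, one_pow, one_div]]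
  generalize (1:ℝ) / n = x at *
  refine ⟨by positivity, ?_, ?_⟩
  · have : 1 - (1 - x) ^ 4 * (1 + 4 * x) = x ^ 2 * (10 - 20 * x + 15 * x ^ 2 - 4 * x ^ 3) := by ring
    have h2 : 0 ≤ 10 - 20 * x + 15 * x ^ 2 - 4 * x ^ 3 := by
      nlinarith [sq_nonneg x, mul_nonneg h' (sq_nonneg x), mul_nonneg (sq_nonneg x) (sub_nonneg.2 h1)]
    nlinarith [mul_nonneg (sq_nonneg x) h2]
  · have : (1 - x) ^ 4 * (1 + 4 * x) - (1 - 10 * x ^ 2) = x ^ 3 * (20 - 15 * x + 4 * x ^ 2) := by ring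
    have h2 : 0 ≤ x ^ 3 * (20 - 15 * x + 4 * x ^ 2) := mul_nonneg (by positivity) (by nlinarith)
    linarith

lemma mult_ef : Multipliable (fun p : Nat.Primes => ef (p : ℕ)) := by
  have h : Summable fun p : Nat.Primes => ef (p:ℕ) - 1 := by
    have hs : Summable fun n : ℕ => ((n:ℝ) ^ 2)⁻¹ := Real.summable_nat_pow_inv.2 (by norm_num)
    have hs' : Summable fun p : Nat.Primes => 10 * (((p:ℕ):ℝ) ^ 2)⁻¹ :=
      (hs.mul_left 10).comp_injective (i := fun p : Nat.Primes => (p:ℕ)) Subtype.val_injective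
    refine hs'.of_norm_bounded fun p => ?_
    obtain ⟨h0, h1, h2⟩ := ef_mem p.2
    rw [Real.norm_eq_abs, abs_le]
    constructor
    · linarith
    · have : (0:ℝ) ≤ 10 * (((p:ℕ):ℝ) ^ 2)⁻¹ := by positivity
      linarith
  have := Real.multipliable_one_add_of_summable h
  simpa using this

lemma prod_ge {T : Finset ℕ} (hT : ∀ n ∈ T, n.Prime) :
    0 ≤ ∏ n ∈ T, ef n ∧ ∏ n ∈ T, ef n ≤ 1 ∧ 1 - 10 * ∑ n ∈ T, ((n:ℝ) ^ 2)⁻¹ ≤ ∏ n ∈ T, ef n := by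
  classical
  induction T using Finset.induction_on with
  | empty => simp
  | insert a s ha ih =>
    obtain ⟨i1, i2, i3⟩ := ih fun n hn => hT n (Finset.mem_insert_of_mem hn)
    obtain ⟨h0, h1, h2⟩ := ef_mem (hT a (Finset.mem_insert_self _ _))
    rw [Finset.prod_insert ha, Finset.sum_insert ha]
    generalize ef a = u at *
    generalize ∏ n ∈ s, ef n = v at *
    generalize ((a:ℝ) ^ 2)⁻¹ = c at *
    generalize ∑ n ∈ s, ((n:ℝ) ^ 2)⁻¹ = d at *
    refine ⟨mul_nonneg h0 i1, mul_le_one₀ h1 i1 i2, ?_⟩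
    have hh := mul_nonneg (sub_nonneg.2 h1) (sub_nonneg.2 i2)
    have : u * v = (1 - u) * (1 - v) + u + v - 1 := by ring
    rw [mul_add]
    linarith

lemma kap_eq (w : ℕ) : kap w = ∏ n ∈ PS w, ef n := by
  exact Finset.prod_coe_sort (PS w) ef

lemma kap_conv (w : ℕ) (hw : 1 ≤ w) :
    |kap w - ∏' p : Nat.Primes, ef (p : ℕ)| ≤ 20 / w := by
  classical
  have hw0 : (0:ℝ) < w := by exact_mod_cast hw
  have ht := mult_ef.hasProd
  rw [HasProd] at ht
  simp only [SummationFilter.unconditional_filter] at ht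
  set T0 : Finset Nat.Primes := Finset.subtype Nat.Prime (PS w) with hT0
  have ev : ∀ᶠ T : Finset Nat.Primes in Filter.atTop,
      ∏ p ∈ T, ef (p:ℕ) ∈ Set.Icc (kap w - 20 / w) (kap w) := by
    filter_upwards [Filter.eventually_ge_atTop T0] with T hT
    set T' : Finset ℕ := T.map ⟨fun p : Nat.Primes => (p:ℕ), Subtype.val_injective⟩ with hT'
    have e1 : ∏ p ∈ T, ef (p:ℕ) = ∏ n ∈ T', ef n := by
      rw [hT', Finset.prod_map]; rfl
    have hsub : PS w ⊆ T' := by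
      intro n hn
      have hnp : n.Prime := (Finset.mem_filter.1 hn).2
      rw [hT', Finset.mem_map]
      exact ⟨⟨n, hnp⟩, hT (Finset.mem_subtype.2 hn), rfl⟩
    have hpr : ∀ n ∈ T' \ PS w, n.Prime := by
      intro n hn
      obtain ⟨p, -, rfl⟩ := Finset.mem_map.1 (Finset.mem_sdiff.1 hn).1
      exact p.2
    obtain ⟨i1, i2, i3⟩ := prod_ge hpr
    rw [e1, ← Finset.prod_sdiff hsub, ← kap_eq]
    obtain ⟨k0, k1⟩ := kap_mem w
    have hsum : ∑ n ∈ T' \ PS w, ((n:ℝ) ^ 2)⁻¹ ≤ 2 / w := by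
      have hss : T' \ PS w ⊆ Finset.Ioo w (T'.sup id + 1) := by
        intro n hn
        have hp := hpr n hn
        obtain ⟨h1, h2⟩ := Finset.mem_sdiff.1 hn
        rw [Finset.mem_Ioo]
        constructor
        · by_contra hlt
          exact h2 (Finset.mem_filter.2 ⟨Finset.mem_range.2 (by omega), hp⟩)
        · have := Finset.le_sup (f := id) h1
          simp only [id] at this
          exact Nat.lt_succ_of_le this
      calc _ ≤ ∑ n ∈ Finset.Ioo w (T'.sup id + 1), ((n:ℝ) ^ 2)⁻¹ :=
            Finset.sum_le_sum_of_subset_of_nonneg hss fun _ _ _ => by positivity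
        _ ≤ 2 / (w + 1) := sum_Ioo_inv_sq_le _ _
        _ ≤ 2 / w := by
            apply div_le_div_of_nonneg_left <;> linarith
    have h20 : (20:ℝ) / w = 10 * (2 / w) := by ring
    have h2w : (0:ℝ) ≤ 2 / w := by positivity
    constructor
    · rw [h20]; nlinarith
    · nlinarith
  have := isClosed_Icc.mem_of_tendsto ht ev
  rw [abs_le]
  obtain ⟨h1, h2⟩ := this
  have : (0:ℝ) ≤ 20 / w := by positivity
  constructor <;> linarith

end DP5

namespace DP5

lemma const_eq : dP5Const = (17 / 576) * (12 * AA) * ∏' p : Nat.Primes, ef (p : ℕ) := by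
  have h : dP5Const = (17 / 576) * (2 * (volume GG).toReal) * ∏' p : Nat.Primes, ef (p : ℕ) := rfl
  rw [h, vol_GG]; ring

lemma Par_exists {B : ℝ} (h : Real.exp 8 ≤ Real.log B) : ∃ w, Par B w := by
  have hpos : 0 < Real.log B := lt_of_lt_of_le (Real.exp_pos _) h
  have h8 : 8 ≤ Real.log (Real.log B) := by
    rw [Real.le_log_iff_exp_le hpos]; exact h
  refine ⟨⌊Real.log (Real.log B) / 8⌋₊, ?_, ?_, ?_⟩
  · rw [Nat.one_le_floor_iff]; linarith
  · rw [← Real.le_log_iff_exp_le hpos]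
    have := Nat.floor_le (show 0 ≤ Real.log (Real.log B) / 8 by linarith)
    linarith
  · rw [← Real.log_lt_iff_lt_exp hpos]
    have := Nat.lt_floor_add_one (Real.log (Real.log B) / 8)
    linarith

lemma MH_mono {B B' : ℝ} (h : B ≤ B') : MH B ⊆ MH B' := by
  rintro R ⟨h1, a, b, c, d⟩
  exact ⟨h1, a.trans h, b.trans h, c.trans h, d.trans h⟩

lemma large {B : ℝ} {w : ℕ} (hB : 3 ≤ B) (hp : Par B w) (hl : 0 < Real.log (Real.log B)) :
    |(Nat.card (dP5Set B) : ℝ) / 2 - dP5Const * B * (Real.log B) ^ 4| ≤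
      16 * (6 * (101000000 + 100000 * AA) + 240 * AA) * (B * (Real.log B) ^ 4 / Real.log (Real.log B)) := by
  have hB0 : 0 < B := by linarith
  have hm := MH_main hB0 hp
  have hk := kap_conv w hp.hw
  have hA := AA_nonneg
  have hw0 : (0:ℝ) < w := by exact_mod_cast hp.hw
  have hll := hp.loglog
  rw [card_eq, const_eq]
  rw [EE] at hm
  set κ := ∏' p : Nat.Primes, ef (p : ℕ)
  set L := Real.log B
  set n : ℝ := ((MH B).ncard : ℝ)
  set X := B * L ^ 4 with hX
  have hX0 : 0 ≤ X := by positivity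
  have e : n / 2 - (17 / 576) * (12 * AA) * κ * B * L ^ 4 =
      (n - 24 * B * (kap w * AA * (17 / 576 * L ^ 4))) / 2 + (17 / 48 * (AA * X)) * (kap w - κ) := by
    rw [hX]; ring
  rw [e]
  have h1 : |(n - 24 * B * (kap w * AA * (17 / 576 * L ^ 4))) / 2| ≤
      6 * (101000000 + 100000 * AA) * (X / w) := by
    rw [abs_div, abs_of_pos (show (0:ℝ) < 2 by norm_num)]
    have : B * (L ^ 4 / w) = X / w := by rw [hX]; ring
    rw [this] at hm
    linarith
  have h2 : |(17 / 48 * (AA * X)) * (kap w - κ)| ≤ 240 * AA * (X / w) := by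
    rw [abs_mul, abs_of_nonneg (by positivity)]
    calc _ ≤ 17 / 48 * (AA * X) * (20 / w) := by gcongr
      _ = (17 * 20 / 48) * (AA * (X / w)) := by ring
      _ ≤ 240 * (AA * (X / w)) := by gcongr; norm_num
      _ = _ := by ring
  have h3 : X / w ≤ 16 * (X / Real.log L) := by
    rw [← mul_div_assoc, div_le_div_iff₀ hw0 hl]
    nlinarith
  calc _ ≤ _ := abs_add_le _ _
    _ ≤ (6 * (101000000 + 100000 * AA) + 240 * AA) * (X / w) := by linarith
    _ ≤ (6 * (101000000 + 100000 * AA) + 240 * AA) * (16 * (X / Real.log L)) := by gcongr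
    _ = _ := by ring

lemma small {B : ℝ} (hB : 3 ≤ B) (h : Real.log B < Real.exp 8) (hl1 : 1 < Real.log B) :
    |(Nat.card (dP5Set B) : ℝ) / 2 - dP5Const * B * (Real.log B) ^ 4| ≤
      (8 * ((MH (Real.exp (Real.exp 8))).ncard : ℝ) + 8 * |dP5Const|) *
        (B * (Real.log B) ^ 4 / Real.log (Real.log B)) := by
  have hB0 : 0 < B := by linarith
  have hl : 0 < Real.log (Real.log B) := Real.log_pos hl1
  have hl8 : Real.log (Real.log B) ≤ 8 := by
    rw [Real.log_le_iff_le_exp (by linarith)]; exact h.le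
  have hBB : B ≤ Real.exp (Real.exp 8) := by
    rw [← Real.log_le_iff_le_exp hB0]; exact h.le
  have hc : ((MH B).ncard : ℝ) ≤ ((MH (Real.exp (Real.exp 8))).ncard : ℝ) := by
    exact_mod_cast Set.ncard_le_ncard (MH_mono hBB) (upper_count (Real.exp_pos _).le le_rfl).1
  rw [card_eq]
  set L := Real.log B
  set X := B * L ^ 4 with hX
  have hX1 : 1 ≤ X := by
    have : 1 ≤ L ^ 4 := one_le_pow₀ hl1.le
    nlinarith
  set Y := X / Real.log L with hY
  have hXY : X ≤ 8 * Y := by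
    rw [hY, ← mul_div_assoc, le_div_iff₀ hl]
    nlinarith
  set N := ((MH (Real.exp (Real.exp 8))).ncard : ℝ)
  have hn : (0:ℝ) ≤ ((MH B).ncard : ℝ) := by positivity
  have hN : 0 ≤ N := by positivity
  calc _ ≤ |((MH B).ncard : ℝ) / 2| + |dP5Const * B * L ^ 4| := abs_sub _ _
    _ = ((MH B).ncard : ℝ) / 2 + |dP5Const| * X := by
        rw [abs_of_nonneg (by positivity), mul_assoc, abs_mul, abs_of_nonneg (by linarith : 0 ≤ B * L ^ 4)]
    _ ≤ N * X + |dP5Const| * X := by nlinarith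
    _ ≤ N * (8 * Y) + |dP5Const| * (8 * Y) := by gcongr
    _ = _ := by ring

lemma final : ∃ C : ℝ, ∀ B : ℝ, 3 ≤ B →
      |(Nat.card (dP5Set B) : ℝ) / 2 - dP5Const * B * (Real.log B) ^ 4| ≤
        C * (B * (Real.log B) ^ 4 / Real.log (Real.log B)) := by
  refine ⟨16 * (6 * (101000000 + 100000 * AA) + 240 * AA) +
    (8 * ((MH (Real.exp (Real.exp 8))).ncard : ℝ) + 8 * |dP5Const|), fun B hB => ?_⟩
  have hB0 : 0 < B := by linarith
  have hl1 : 1 < Real.log B := by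
    rw [Real.lt_log_iff_exp_lt hB0]
    have := Real.exp_one_lt_d9
    linarith
  have hl : 0 < Real.log (Real.log B) := Real.log_pos hl1
  have hA := AA_nonneg
  have hY : 0 ≤ B * (Real.log B) ^ 4 / Real.log (Real.log B) := by positivity
  rw [add_mul]
  rcases le_or_gt (Real.exp 8) (Real.log B) with h | h
  · obtain ⟨w, hp⟩ := Par_exists h
    have := large hB hp hl
    have h2 : 0 ≤ (8 * ((MH (Real.exp (Real.exp 8))).ncard : ℝ) + 8 * |dP5Const|) *
        (B * (Real.log B) ^ 4 / Real.log (Real.log B)) := by positivity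
    linarith
  · have := small hB h hl1
    have h2 : 0 ≤ 16 * (6 * (101000000 + 100000 * AA) + 240 * AA) *
        (B * (Real.log B) ^ 4 / Real.log (Real.log B)) := by positivity
    linarith

end DP5

/-- Main theorem for `K = ℚ`: the number of integral points of bounded log-anticanonical
height satisfies `½|S(B)| = c B (log B)⁴ + O(B (log B)⁴ / log log B)`, and the Euler
product in the constant converges. -/
theorem main_theorem_over_Q :
    Multipliable (fun p : Nat.Primes =>
      (1 - 1 / ((p : ℕ) : ℝ)) ^ 4 * (1 + 4 / ((p : ℕ) : ℝ))) ∧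
    ∃ C : ℝ, ∀ B : ℝ, 3 ≤ B →
      |(Nat.card (dP5Set B) : ℝ) / 2 - dP5Const * B * (Real.log B) ^ 4| ≤
        C * (B * (Real.log B) ^ 4 / Real.log (Real.log B)) :=
  ⟨DP5.mult_ef, DP5.final⟩
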